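/- Let {u_n} ⊆ ℤ be a linear recurrence sequence, p a prime, k ∈ ℕ₀, and a, b ∈ ℚ. Then the set T = {n ∈ ℕ₀ : u_n = b + a·p^{km} for some m ∈ ℕ₀} is a finite union of arithmetic progressions together with a finite union of p-arithmetic sequences. -/

import Mathlib

/-- An integer linear recurrence sequence: `u` satisfies a homogeneous linear
recurrence `u_{n+m} + c_{m-1}u_{n+m-1} + ... + c₀u_n = 0` for some fixed `m ≥ 1`. -/
def IsLinRecSeq (u : ℕ → ℤ) : Prop :=
  ∃ (m : ℕ), 1 ≤ m ∧ ∃ c : ℕ → ℤ,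
    ∀ n : ℕ, u (n + m) + ∑ i ∈ Finset.range m, c i * u (n + i) = 0

/-- An arithmetic progression of natural numbers `{m·j + ℓ : j ∈ ℕ₀}`
(a singleton when `m = 0`). -/
def IsAPNat (S : Set ℕ) : Prop :=
  ∃ m ℓ : ℕ, S = {n : ℕ | ∃ j : ℕ, n = m * j + ℓ}

/-- A `p`-arithmetic sequence of natural numbers. -/
def IsPArithSeqNat (p : ℕ) (S : Set ℕ) : Prop :=
  ∃ (c d : ℚ) (k' : ℕ), S = {n : ℕ | ∃ j : ℕ, (n : ℚ) = c * (p : ℚ) ^ (k' * j) + d}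

open Finset MvPolynomial Filter Topology
open Equiv (Perm swap)
open Finsupp (erase_add_single erase_ne prod_fintype single single_apply single_eq_same)
open Fintype (card_coe card_perm card_pos_iff mem_piFinset piFinset sum_prod_type)
open Function (Injective comp_def ne_iff update update_of_ne)
open Int (castRingHom one_le_abs units_eq_one_or)
open LinearMap (comp_apply funLeft funLeft_apply proj)
open Matrix (adjugate_mul charpoly_map det det_apply det_eq_zero_of_row_eq_zero det_mul det_one det_pow det_smul diagonal dotProduct_mulVec eval_charpoly map_apply mulVec mulVec_diagonal mulVec_mulVec mulVec_smul mul_adjugate mul_nonsing_inv nonsing_inv_mul of of_apply one_mulVec smul_mulVec sub_mulVec updateRow_ne updateRow_self vecMul vecMulLinear vecMul_one vecMul_vecMul zero_vecMul)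
open Module (Basis End finrank)
open Real (exp exp_add exp_le_exp exp_log exp_nat_mul exp_neg exp_pos exp_sum log log_exp log_le_log log_mul log_nonneg log_pos log_pow rpow_add rpow_le_rpow_of_exponent_le rpow_pos_of_pos rpow_sum_of_pos)
open RingHom (mapMatrix mapMatrix_apply map_det)
open Submodule (mem_span_singleton_self span span_le subset_span)
set_option linter.all false
namespace Sub
notation "Sq" r:max K:max => Matrix (Fin r) (Fin r) K
notation "MvP" => MvPolynomial
noncomputable section

section R1
variable {σ R : Type*} [CommRing R]

/-- degree bound -/
def DegLe (d : σ → ℕ) (F : MvP σ R) : Prop := ∀ m, coeff m F ≠ 0 → ∀ h, m h ≤ d h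

/-- weight of an exponent -/
def wt (w : σ → ℝ) (m : σ →₀ ℕ) : ℝ := m.sum fun h a => (a : ℝ) * w h

/-- index lower bound -/
def IndGe (w : σ → ℝ) (t : ℝ) (F : MvP σ R) : Prop := ∀ m, coeff m F ≠ 0 → t ≤ wt w m

lemma wt_add (w : σ → ℝ) (m n : σ →₀ ℕ) : wt w (m + n) = wt w m + wt w n := by
  classical
  unfold wt
  rw [Finsupp.sum_add_index']
  · simp
  · intros; push_cast; ring

@[simp] lemma wt_zero (w : σ → ℝ) : wt w 0 = 0 := by simp [wt]

lemma wt_single (w : σ → ℝ) (h : σ) (a : ℕ) : wt w (single h a) = a * w h := by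
  simp [wt]

lemma wt_nonneg {w : σ → ℝ} (hw : ∀ h, 0 ≤ w h) (m : σ →₀ ℕ) : 0 ≤ wt w m :=
  sum_nonneg fun _ _ => mul_nonneg (Nat.cast_nonneg _) (hw _)

lemma coeff_mul_ne {F G : MvP σ R} {m} (h : coeff m (F * G) ≠ 0) :
    ∃ a b, a + b = m ∧ coeff a F ≠ 0 ∧ coeff b G ≠ 0 := by
  classical
  rw [coeff_mul] at h
  obtain ⟨x, hx, hne⟩ := exists_ne_zero_of_sum_ne_zero h
  exact ⟨x.1, x.2, by simpa using hx, left_ne_zero_of_mul hne, right_ne_zero_of_mul hne⟩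

lemma DegLe.mul {d e : σ → ℕ} {F G : MvP σ R} (hF : DegLe d F) (hG : DegLe e G) :
    DegLe (d + e) (F * G) := by
  intro m hm h
  obtain ⟨a, b, rfl, ha, hb⟩ := coeff_mul_ne hm
  exact add_le_add (hF a ha h) (hG b hb h)

lemma DegLe.mono {d e : σ → ℕ} {F : MvP σ R} (hF : DegLe d F) (hde : ∀ h, d h ≤ e h) :
    DegLe e F := fun m hm h => (hF m hm h).trans (hde h)

lemma DegLe.sum {ι : Type*} {d : σ → ℕ} (s : Finset ι) {F : ι → MvP σ R}
    (hF : ∀ i ∈ s, DegLe d (F i)) : DegLe d (∑ i ∈ s, F i) := by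
  intro m hm
  rw [coeff_sum] at hm
  obtain ⟨i, hi, hne⟩ := exists_ne_zero_of_sum_ne_zero hm
  exact hF i hi m hne

lemma DegLe.one {d : σ → ℕ} : DegLe d (1 : MvP σ R) := by
  classical
  intro m hm h
  rw [coeff_one] at hm
  have : m = 0 := by
    by_contra hc
    exact hm (if_neg (fun h => hc h.symm))
  simp [this]

lemma DegLe.prod {ι : Type*} {d : ι → σ → ℕ} (s : Finset ι) {F : ι → MvP σ R}
    (hF : ∀ i ∈ s, DegLe (d i) (F i)) : DegLe (∑ i ∈ s, d i) (∏ i ∈ s, F i) := by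
  classical
  induction s using Finset.induction_on with
  | empty => simpa using DegLe.one
  | insert a s ha ih =>
    rw [sum_insert ha, prod_insert ha]
    exact (hF a (mem_insert_self _ _)).mul (ih fun i hi => hF i (mem_insert_of_mem hi))

lemma IndGe.mul {w : σ → ℝ} {s t : ℝ} {F G : MvP σ R} (hF : IndGe w s F)
    (hG : IndGe w t G) : IndGe w (s + t) (F * G) := by
  intro m hm
  obtain ⟨a, b, rfl, ha, hb⟩ := coeff_mul_ne hm
  rw [wt_add]
  exact add_le_add (hF a ha) (hG b hb)

lemma IndGe.mono {w : σ → ℝ} {s t : ℝ} {F : MvP σ R} (hF : IndGe w s F) (h : t ≤ s) :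
    IndGe w t F := fun m hm => h.trans (hF m hm)

lemma IndGe.sum {ι : Type*} {w : σ → ℝ} {t : ℝ} (s : Finset ι) {F : ι → MvP σ R}
    (hF : ∀ i ∈ s, IndGe w t (F i)) : IndGe w t (∑ i ∈ s, F i) := by
  intro m hm
  rw [coeff_sum] at hm
  obtain ⟨i, hi, hne⟩ := exists_ne_zero_of_sum_ne_zero hm
  exact hF i hi m hne

lemma IndGe.zero {w : σ → ℝ} (hw : ∀ h, 0 ≤ w h) {F : MvP σ R} : IndGe w 0 F :=
  fun m _ => wt_nonneg hw m

lemma IndGe.prod {ι : Type*} {w : σ → ℝ} (hw : ∀ h, 0 ≤ w h) {t : ι → ℝ} (s : Finset ι)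
    {F : ι → MvP σ R}
    (hF : ∀ i ∈ s, IndGe w (t i) (F i)) : IndGe w (∑ i ∈ s, t i) (∏ i ∈ s, F i) := by
  classical
  induction s using Finset.induction_on with
  | empty => simpa using IndGe.zero hw
  | insert a s ha ih =>
    rw [sum_insert ha, prod_insert ha]
    exact (hF a (mem_insert_self _ _)).mul (ih fun i hi => hF i (mem_insert_of_mem hi))

/-- multi-binomial coefficient -/
def mbin (m μ : σ →₀ ℕ) : ℕ := μ.prod fun h a => (m h).choose a

lemma mbin_eq_prod {m μ : σ →₀ ℕ} {s : Finset σ} (hs : μ.support ⊆ s) :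
    mbin m μ = ∏ h ∈ s, (m h).choose (μ h) :=
  Finsupp.prod_of_support_subset _ hs _ (by simp)

/-- Hasse derivative -/
def hd (μ : σ →₀ ℕ) (F : MvP σ R) : MvP σ R :=
  ∑ m ∈ F.support, monomial (m - μ) ((mbin m μ : R) * coeff m F)

lemma mbin_eq_zero {m μ : σ →₀ ℕ} (h : ¬ μ ≤ m) : mbin m μ = 0 := by
  classical
  rw [Finsupp.le_def] at h
  push Not at h
  obtain ⟨i, hi⟩ := h
  unfold mbin
  refine prod_eq_zero (i := i) ?_ (Nat.choose_eq_zero_of_lt hi)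
  simp; omega

lemma coeff_hd (μ n : σ →₀ ℕ) (F : MvP σ R) :
    coeff n (hd μ F) = (mbin (n + μ) μ : R) * coeff (n + μ) F := by
  classical
  unfold hd
  rw [coeff_sum]
  rw [sum_eq_single (n + μ)]
  · rw [coeff_monomial, if_pos (by simp)]
  · intro m hm hne
    rw [coeff_monomial]
    split_ifs with h
    · by_cases hle : μ ≤ m
      · exact absurd (by rw [← h, tsub_add_cancel_of_le hle]) hne
      · rw [mbin_eq_zero hle]; simp
    · rfl
  · intro h
    have : coeff (n + μ) F = 0 := by simpa using h
    simp [this]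

lemma hd_add (μ : σ →₀ ℕ) (F G : MvP σ R) : hd μ (F + G) = hd μ F + hd μ G := by
  ext n; simp [coeff_hd, mul_add]

lemma hd_C_mul (μ : σ →₀ ℕ) (a : R) (F : MvP σ R) : hd μ (C a * F) = C a * hd μ F := by
  ext n; simp [coeff_hd, mul_left_comm]

/-- Hasse derivative as a linear map. -/
def hdl (μ : σ →₀ ℕ) : MvP σ R →ₗ[R] MvP σ R where
  toFun := hd μ
  map_add' := hd_add μ
  map_smul' a F := by simp [smul_eq_C_mul, hd_C_mul]

lemma hd_sum {ι : Type*} (μ : σ →₀ ℕ) (s : Finset ι) (F : ι → MvP σ R) :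
    hd μ (∑ i ∈ s, F i) = ∑ i ∈ s, hd μ (F i) := map_sum (hdl μ) F s

lemma hd_zero (F : MvP σ R) : hd 0 F = F := by
  ext n; simp [coeff_hd, mbin]

lemma hd_map {S : Type*} [CommRing S] (f : R →+* S) (μ : σ →₀ ℕ) (F : MvP σ R) :
    hd μ (map f F) = map f (hd μ F) := by
  ext n; simp [coeff_hd, coeff_map]

lemma pderiv_hd (h : σ) (μ : σ →₀ ℕ) (F : MvP σ R) :
    pderiv h (hd μ F) = C ((μ h + 1 : ℕ) : R) * hd (μ + single h 1) F := by
  classical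
  ext n
  rw [coeff_pderiv, coeff_hd, coeff_C_mul, coeff_hd]
  have e : n + single h 1 + μ = n + (μ + single h 1) := by
    rw [add_assoc, add_comm (single h 1)]
  rw [e]
  set M := n + (μ + single h 1) with hM
  have key : (n h + 1) * mbin M μ = (μ h + 1) * mbin M (μ + single h 1) := by
    have hs : μ.support ⊆ insert h μ.support := subset_insert _ _
    have hs' : (μ + single h 1).support ⊆ insert h μ.support := by
      intro x hx
      by_cases hxh : x = h
      · simp [hxh]
      · have : (single h 1) x = 0 := by
          rw [single_apply, if_neg (Ne.symm hxh)]
        simp [this] at hx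
        simp [hxh, hx]
    rw [mbin_eq_prod hs, mbin_eq_prod hs', ← mul_prod_erase _ _ (mem_insert_self h _),
      ← mul_prod_erase _ (fun x => (M x).choose ((μ + single h 1 : σ →₀ ℕ) x))
        (mem_insert_self h _)]
    have e2 : ∏ x ∈ (insert h μ.support).erase h, (M x).choose (μ x) =
      ∏ x ∈ (insert h μ.support).erase h, (M x).choose ((μ + single h 1 : σ →₀ ℕ) x) := by
      refine prod_congr rfl fun x hx => ?_
      have : (single h 1) x = 0 := by
        rw [single_apply, if_neg (Ne.symm (ne_of_mem_erase hx))]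
      simp [this]
    rw [e2, ← mul_assoc, ← mul_assoc]
    congr 1
    have hMh : M h = n h + 1 + μ h := by simp [hM]; ring
    simp only [Finsupp.add_apply, single_eq_same]
    have h1 := Nat.choose_succ_right_eq (M h) (μ h)
    have h2 : M h - μ h = n h + 1 := by omega
    rw [h2] at h1
    linarith
  have key' : ((n h : R) + 1) * (mbin M μ : R) =
      ((μ h + 1 : ℕ) : R) * (mbin M (μ + single h 1) : R) := by
    have := congrArg (Nat.cast : ℕ → R) key
    push_cast at this ⊢
    exact this
  calc _ = (((n h : R) + 1) * (mbin M μ : R)) * coeff M F := by ring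
    _ = _ := by rw [key']; ring

lemma DegLe.hd {d : σ → ℕ} {F : MvP σ R} (hF : DegLe d F) (μ : σ →₀ ℕ) :
    DegLe d (hd μ F) := by
  intro m hm h
  rw [coeff_hd] at hm
  exact le_trans (by simp) (hF _ (right_ne_zero_of_mul hm) h)

/-- shift of variables -/
def shift (ξ : σ → R) : MvP σ R →ₐ[R] MvP σ R :=
  aeval fun h => X h + C (ξ h)

lemma pderiv_shift (ξ : σ → R) (h : σ) (F : MvP σ R) :
    pderiv h (shift ξ F) = shift ξ (pderiv h F) := by
  classical
  induction F using MvPolynomial.induction_on with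
  | C a => simp [shift]
  | add p q hp hq => simp [hp, hq]
  | mul_X p i hp =>
    simp only [map_mul, Derivation.leibniz, smul_eq_mul, hp, map_add, pderiv_X]
    simp only [shift, aeval_X, map_add, pderiv_X, pderiv_C]
    congr 1
    by_cases hi : i = h
    · subst hi; simp
    · simp [hi]

lemma fs_ind {P : (σ →₀ ℕ) → Prop} (h0 : P 0)
    (hs : ∀ μ h, P μ → P (μ + single h 1)) (μ : σ →₀ ℕ) : P μ := by
  classical
  induction μ using Finsupp.induction with
  | zero => exact h0
  | single_add a b f ha hb ih =>
    clear hb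
    rw [add_comm]
    induction b with
    | zero => simpa using ih
    | succ b ihb =>
      rw [Finsupp.single_add, ← add_assoc]
      exact hs _ _ ihb

lemma IndGe.pderiv {w : σ → ℝ} {t : ℝ} {F : MvP σ R} (hF : IndGe w t F) (h : σ) :
    IndGe w (t - w h) (pderiv h F) := by
  intro m hm
  rw [coeff_pderiv] at hm
  have h1 : coeff (m + single h 1) F ≠ 0 := by
    intro h0; simp [h0] at hm
  have := hF _ h1
  rw [wt_add, wt_single] at this
  simp at this
  linarith

section dom
variable [IsDomain R] [CharZero R]

lemma C_nat_ne (a : ℕ) : (C ((a + 1 : ℕ) : R) : MvP σ R) ≠ 0 := by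
  rw [Ne, C_eq_zero]
  exact_mod_cast Nat.succ_ne_zero a

lemma hd_shift (ξ : σ → R) (μ : σ →₀ ℕ) (F : MvP σ R) :
    hd μ (shift ξ F) = shift ξ (hd μ F) := by
  classical
  induction μ using fs_ind with
  | h0 => simp [hd_zero]
  | hs μ h ih =>
    have h1 := congrArg (pderiv h) ih
    rw [pderiv_hd, pderiv_shift, pderiv_hd, map_mul] at h1
    have h2 : shift ξ (C ((μ h + 1 : ℕ) : R) : MvP σ R) = C ((μ h + 1 : ℕ) : R) := by
      simp [shift]
    rw [h2] at h1
    exact mul_left_cancel₀ (C_nat_ne _) h1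

lemma IndGe.hd {w : σ → ℝ} {t : ℝ} {F : MvP σ R} (hF : IndGe w t F) (μ : σ →₀ ℕ) :
    IndGe w (t - wt w μ) (hd μ F) := by
  intro m hm
  rw [coeff_hd] at hm
  have := hF _ (right_ne_zero_of_mul hm)
  rw [wt_add] at this
  linarith

lemma eq_zero_of_hd (ξ : σ → R) (F : MvP σ R) (h : ∀ μ, eval ξ (hd μ F) = 0) : F = 0 := by
  have h1 : shift ξ F = 0 := by
    ext μ
    have h2 : ∀ G : MvP σ R, eval 0 (shift ξ G) = eval ξ G := by
      intro G
      induction G using MvPolynomial.induction_on with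
      | C a => simp [shift]
      | add p q hp hq => rw [map_add, map_add, hp, hq, map_add]
      | mul_X p i hp => rw [map_mul, map_mul, hp, map_mul]; simp [shift]
    have h3 := h2 (Sub.hd μ F)
    rw [← hd_shift, h μ] at h3
    have h4 : coeff 0 (Sub.hd μ (shift ξ F)) = 0 := by
      rw [← constantCoeff_eq, ← eval_zero]; exact h3
    rw [coeff_hd] at h4
    have h5 : mbin (0 + μ) μ = 1 := by simp [mbin, Finsupp.prod]
    rw [h5] at h4
    simpa using h4
  have h6 : shift (-ξ) (shift ξ F) = F := by
    have : (shift (-ξ)).comp (shift ξ) = AlgHom.id R (MvP σ R) := by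
      apply algHom_ext
      intro i
      simp [shift]
    exact congrArg (fun f => f F) this
  rw [← h6, h1, map_zero]

/-- Leibniz for disjoint variables -/
lemma hd_mul_left (P G : MvP σ R) (μ : σ →₀ ℕ)
    (hG : ∀ h, μ h ≠ 0 → pderiv h G = 0) : hd μ (P * G) = hd μ P * G := by
  classical
  induction μ using fs_ind with
  | h0 => simp [hd_zero]
  | hs μ h ih =>
    have h0 : pderiv h G = 0 := hG h (by simp)
    have h1 := congrArg (pderiv h) (ih fun i hi => hG i (by simp [hi]))
    rw [pderiv_hd, Derivation.leibniz, pderiv_hd, h0] at h1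
    refine mul_left_cancel₀ (C_nat_ne (μ h)) (h1.trans ?_)
    simp only [smul_zero, zero_add, smul_eq_mul]
    ring

end dom

section wn
variable {S : Type*} [CommRing S]

/-- weighted l1 norm -/
def wn (v : AbsoluteValue S ℝ) (ρ : σ → ℝ) (F : MvP σ S) : ℝ :=
  ∑ m ∈ F.support, v (coeff m F) * m.prod fun h a => ρ h ^ a

lemma mprod_nonneg {ρ : σ → ℝ} (hρ : ∀ h, 0 ≤ ρ h) (m : σ →₀ ℕ) :
    0 ≤ m.prod fun h a => ρ h ^ a := prod_nonneg fun h _ => pow_nonneg (hρ h) _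

lemma wn_nonneg (v : AbsoluteValue S ℝ) {ρ : σ → ℝ} (hρ : ∀ h, 0 ≤ ρ h) (F : MvP σ S) :
    0 ≤ wn v ρ F := sum_nonneg fun m _ => mul_nonneg (v.nonneg _) (mprod_nonneg hρ m)

lemma wn_eq_sum (v : AbsoluteValue S ℝ) (ρ : σ → ℝ) {F : MvP σ S} {s : Finset (σ →₀ ℕ)}
    (hs : F.support ⊆ s) : wn v ρ F = ∑ m ∈ s, v (coeff m F) * m.prod fun h a => ρ h ^ a := by
  refine sum_subset hs fun m _ hm => ?_
  have : coeff m F = 0 := by simpa using hm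
  simp [this]

lemma wn_add (v : AbsoluteValue S ℝ) {ρ : σ → ℝ} (hρ : ∀ h, 0 ≤ ρ h) (F G : MvP σ S) :
    wn v ρ (F + G) ≤ wn v ρ F + wn v ρ G := by
  classical
  rw [wn_eq_sum v ρ (s := F.support ∪ G.support) (support_add),
    wn_eq_sum v ρ (F := F) (s := F.support ∪ G.support) subset_union_left,
    wn_eq_sum v ρ (F := G) (s := F.support ∪ G.support) subset_union_right, ← sum_add_distrib]
  refine sum_le_sum fun m _ => ?_
  rw [← add_mul, coeff_add]
  exact mul_le_mul_of_nonneg_right (v.add_le _ _) (mprod_nonneg hρ m)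

@[simp] lemma wn_zero (v : AbsoluteValue S ℝ) (ρ : σ → ℝ) : wn v ρ (0 : MvP σ S) = 0 := by
  simp [wn]

lemma wn_sum {ι : Type*} (v : AbsoluteValue S ℝ) {ρ : σ → ℝ} (hρ : ∀ h, 0 ≤ ρ h) (s : Finset ι)
    (F : ι → MvP σ S) : wn v ρ (∑ i ∈ s, F i) ≤ ∑ i ∈ s, wn v ρ (F i) := by
  classical
  induction s using Finset.induction_on with
  | empty => simp
  | insert a s ha ih =>
    rw [sum_insert ha, sum_insert ha]
    exact (wn_add v hρ _ _).trans (by linarith)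

lemma wn_monomial (v : AbsoluteValue S ℝ) (ρ : σ → ℝ) (m : σ →₀ ℕ) (a : S) :
    wn v ρ (monomial m a) = v a * m.prod fun h a => ρ h ^ a := by
  classical
  rw [wn_eq_sum v ρ (s := {m}) support_monomial_subset]
  simp

lemma wn_mul (v : AbsoluteValue S ℝ) {ρ : σ → ℝ} (hρ : ∀ h, 0 ≤ ρ h) (F G : MvP σ S) :
    wn v ρ (F * G) ≤ wn v ρ F * wn v ρ G := by
  classical
  have hF := F.as_sum
  have hG := G.as_sum
  have : F * G = ∑ m ∈ F.support, ∑ n ∈ G.support, monomial (m + n) (coeff m F * coeff n G) := by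
    conv_lhs => rw [hF, hG]
    rw [sum_mul_sum]
    simp [monomial_mul]
  rw [this]
  refine (wn_sum v hρ _ _).trans ?_
  unfold wn
  rw [sum_mul_sum]
  refine sum_le_sum fun m _ => (wn_sum v hρ _ _).trans (sum_le_sum fun n _ => ?_)
  rw [wn_monomial, v.map_mul, Finsupp.prod_add_index' (by simp) (by intros; rw [pow_add])]
  apply le_of_eq
  ring

lemma wn_C (v : AbsoluteValue S ℝ) (ρ : σ → ℝ) (a : S) : wn v ρ (C a) = v a := by
  rw [← monomial_zero', wn_monomial]; simp

lemma wn_X (v : AbsoluteValue S ℝ) [Nontrivial S] (ρ : σ → ℝ) (h : σ) : wn v ρ (X h : MvP σ S) = ρ h := by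
  rw [X, wn_monomial]; simp

lemma wn_prod [Nontrivial S] {ι : Type*} (v : AbsoluteValue S ℝ) {ρ : σ → ℝ} (hρ : ∀ h, 0 ≤ ρ h) (s : Finset ι)
    (F : ι → MvP σ S) : wn v ρ (∏ i ∈ s, F i) ≤ ∏ i ∈ s, wn v ρ (F i) := by
  classical
  induction s using Finset.induction_on with
  | empty =>
    have := wn_C v ρ (1 : S)
    simp at this
    simp [this]
  | insert a s ha ih =>
    rw [prod_insert ha, prod_insert ha]
    exact (wn_mul v hρ _ _).trans (mul_le_mul_of_nonneg_left ih (wn_nonneg v hρ _))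

lemma wn_pow [Nontrivial S] (v : AbsoluteValue S ℝ) {ρ : σ → ℝ} (hρ : ∀ h, 0 ≤ ρ h) (F : MvP σ S) (n : ℕ) :
    wn v ρ (F ^ n) ≤ wn v ρ F ^ n := by
  have := wn_prod v hρ (range n) fun _ => F
  simpa using this

lemma coeff_le_wn (v : AbsoluteValue S ℝ) {ρ : σ → ℝ} (hρ : ∀ h, 0 ≤ ρ h) (F : MvP σ S)
    (m : σ →₀ ℕ) : v (coeff m F) * (m.prod fun h a => ρ h ^ a) ≤ wn v ρ F := by
  classical
  rw [wn_eq_sum v ρ (s := insert m F.support) (subset_insert _ _)]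
  exact single_le_sum (f := fun m => v (coeff m F) * (m.prod fun h a => ρ h ^ a))
    (fun m _ => mul_nonneg (v.nonneg _) (mprod_nonneg hρ m)) (mem_insert_self _ _)

lemma wn_det [Nontrivial S] {n : ℕ} (v : AbsoluteValue S ℝ) {ρ : σ → ℝ} (hρ : ∀ h, 0 ≤ ρ h) 
    (A : Sq n (MvP σ S)) (b : ℝ) (hb : ∀ i j, wn v ρ (A i j) ≤ b) :
    wn v ρ A.det ≤ n.factorial * b ^ n := by
  rw [det_apply]
  refine (wn_sum v hρ _ _).trans ?_
  have : ∀ π ∈ (univ : Finset (Perm (Fin n))),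
      wn v ρ (Perm.sign π • ∏ i, A (π i) i) ≤ b ^ n := by
    intro π _
    have h1 : wn v ρ (Perm.sign π • ∏ i, A (π i) i) = wn v ρ (∏ i, A (π i) i) := by
      rcases units_eq_one_or (Perm.sign π) with h | h
      · rw [h]; simp
      · rw [h]; simp [wn]
    rw [h1]
    refine (wn_prod v hρ _ _).trans ?_
    refine (Finset.prod_le_prod (fun i _ => wn_nonneg v hρ _) (fun i _ => hb _ _)).trans ?_
    simp
  refine (sum_le_sum this).trans ?_
  simp [card_perm]

end wn
end R1

section R2
variable {σ : Type*}

lemma wronsk_aux {s : ℕ} (P : Fin s → MvP σ ℤ)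
    (hP : ∀ g : Fin s → ℤ, ∑ j, C (g j) * P j = 0 → g = 0) (r : ℕ) (hr : r ≤ s) :
    ∃ μ : Fin r → (σ →₀ ℕ), (∀ i, (μ i).degree ≤ i) ∧
      ∀ g : Fin r → MvP σ ℤ, (∀ j, ∑ i, g i * hd (μ i) (P j) = 0) → g = 0 := by
  classical
  induction r with
  | zero => exact ⟨fun _ => 0, by simp, fun g _ => Subsingleton.elim _ _⟩
  | succ r ih =>
    obtain ⟨μ, hμ, hli⟩ := ih (by omega)
    by_contra hcon
    push Not at hcon
    -- saturation
    let Sat : (Fin s → MvP σ ℤ) → Prop := fun x =>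
      ∃ p : MvP σ ℤ, p ≠ 0 ∧ ∃ g : Fin r → MvP σ ℤ,
        ∀ j, p * x j = ∑ i, g i * hd (μ i) (P j)
    have sat_add : ∀ x y, Sat x → Sat y → Sat (x + y) := by
      rintro x y ⟨p, hp, g, hg⟩ ⟨q, hq, f, hf⟩
      refine ⟨p * q, mul_ne_zero hp hq, fun i => q * g i + p * f i, fun j => ?_⟩
      simp only [Pi.add_apply, add_mul, sum_add_distrib, mul_assoc, ← mul_sum]
      rw [← hg, ← hf]; ring
    have sat_smul : ∀ (c : MvP σ ℤ) x, Sat x → Sat (c • x) := by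
      rintro c x ⟨p, hp, g, hg⟩
      refine ⟨p, hp, fun i => c * g i, fun j => ?_⟩
      simp only [Pi.smul_apply, smul_eq_mul, mul_assoc, ← mul_sum]
      rw [← hg]; ring
    have sat_sum : ∀ (x : Fin r → Fin s → MvP σ ℤ), (∀ i, Sat (x i)) → Sat (∑ i, x i) := by
      intro x hx
      refine sum_induction x Sat sat_add ⟨1, one_ne_zero, 0, by simp⟩ fun i _ => hx i
    have sat_of : ∀ (c : MvP σ ℤ) x, c ≠ 0 → Sat (c • x) → Sat x := by
      rintro c x hc ⟨p, hp, g, hg⟩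
      exact ⟨p * c, mul_ne_zero hp hc, g, fun j => by rw [mul_assoc]; exact hg j⟩
    let v : (σ →₀ ℕ) → Fin s → MvP σ ℤ := fun ν j => hd ν (P j)
    have hA : ∀ ν : σ →₀ ℕ, ν.degree ≤ r → Sat (v ν) := by
      intro ν hν
      obtain ⟨g, hg, hg0⟩ := hcon (Fin.snoc μ ν) (by
        intro i
        refine Fin.lastCases ?_ (fun i => ?_) i
        · simpa using hν
        · simpa using hμ i)
      have hg' : ∀ j, (∑ i, g (Fin.castSucc i) * hd (μ i) (P j)) + g (Fin.last r) * hd ν (P j) = 0 := by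
        intro j
        have := hg j
        rw [Fin.sum_univ_castSucc] at this
        simpa using this
      refine ⟨g (Fin.last r), ?_, fun i => - g (Fin.castSucc i), ?_⟩
      · intro h0
        apply hg0
        have := hli (fun i => g (Fin.castSucc i)) (fun j => by simpa [h0] using hg' j)
        funext i
        refine Fin.lastCases h0 (fun i => ?_) i
        exact congrFun this i
      · intro j
        have := hg' j
        simp only [neg_mul, sum_neg_distrib]
        linear_combination this
    have hB : ∀ ν : σ →₀ ℕ, Sat (v ν) := by
      intro ν
      induction ν using fs_ind with
      | h0 => exact hA 0 (by simp)
      | hs ν h ih =>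
        have ih' := ih
        obtain ⟨p, hp, g, hg⟩ := ih
        apply sat_of (p * C ((ν h + 1 : ℕ) : ℤ)) _ (mul_ne_zero hp (C_nat_ne _))
        have e : (p * C ((ν h + 1 : ℕ) : ℤ)) • v (ν + single h 1) =
            (- pderiv h p) • v ν + ((∑ i, (pderiv h (g i)) • v (μ i)) +
             ∑ i, (g i * C ((μ i h + 1 : ℕ) : ℤ)) • v (μ i + single h 1)) := by
          funext j
          have h1 := congrArg (pderiv h) (hg j)
          rw [map_sum] at h1
          simp only [Derivation.leibniz, smul_eq_mul, v, pderiv_hd, sum_add_distrib] at h1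
          simp only [Pi.smul_apply, Pi.add_apply, Finset.sum_apply, smul_eq_mul, v]
          have h2 : ∑ i, hd (μ i) (P j) * pderiv h (g i) = ∑ i, pderiv h (g i) * hd (μ i) (P j) :=
            sum_congr rfl fun i _ => mul_comm _ _
          rw [h2] at h1
          simp only [mul_assoc]
          linear_combination h1
        rw [e]
        refine sat_add _ _ (sat_smul _ _ ih') (sat_add _ _ (sat_sum _ fun i => ?_) (sat_sum _ fun i => ?_))
        · exact sat_smul _ _ (hA _ ((hμ i).trans i.2.le))
        · refine sat_smul _ _ (hA _ ?_)
          have h1 := hμ i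
          have h2 := i.2
          have h3 : (single h 1 : σ →₀ ℕ).degree = 1 := by simp
          rw [map_add, h3]
          omega
    -- annihilator
    have hM : ∃ l : Fin s → MvP σ ℤ, l ≠ 0 ∧ ∀ i : Fin r, ∑ j, hd (μ i) (P j) * l j = 0 := by
      let M : Sq s (MvP σ ℤ) := fun i j =>
        if h : (i : ℕ) < r then hd (μ ⟨i, h⟩) (P j) else 0
      have hd0 : M.det = 0 := det_eq_zero_of_row_eq_zero ⟨r, by omega⟩ (by intro j; simp [M])
      obtain ⟨l, hl, hl0⟩ := Matrix.exists_mulVec_eq_zero_iff.2 hd0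
      refine ⟨l, hl, fun i => ?_⟩
      have := congrFun hl0 ⟨i, by omega⟩
      simpa [mulVec, dotProduct, M] using this
    obtain ⟨l, hl, hl0⟩ := hM
    have hC : ∀ ν, ∑ j, hd ν (P j) * l j = 0 := by
      intro ν
      obtain ⟨p, hp, g, hg⟩ := hB ν
      have : p * ∑ j, hd ν (P j) * l j = 0 := by
        rw [mul_sum]
        simp only [← mul_assoc]
        have : ∀ j, p * hd ν (P j) * l j = ∑ i, g i * (hd (μ i) (P j) * l j) := by
          intro j
          rw [show p * hd ν (P j) = p * v ν j from rfl, hg j, sum_mul]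
          simp only [mul_assoc]
        simp only [this]
        rw [sum_comm]
        simp only [← mul_sum, hl0, mul_zero, sum_const_zero]
      exact (mul_eq_zero.1 this).resolve_left hp
    obtain ⟨j0, hj0⟩ := ne_iff.1 hl
    obtain ⟨x0, hx0⟩ : ∃ x0 : σ → ℤ, eval x0 (l j0) ≠ 0 := by
      by_contra hx
      push Not at hx
      exact hj0 (MvPolynomial.funext fun x => by simpa using hx x)
    have hH : ∑ j, C (eval x0 (l j)) * P j = 0 := by
      apply eq_zero_of_hd x0
      intro ν
      rw [hd_sum, map_sum]
      have := congrArg (eval x0) (hC ν)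
      rw [map_sum, map_zero] at this
      rw [← this]
      refine sum_congr rfl fun j _ => ?_
      rw [hd_C_mul, map_mul, map_mul, eval_C, mul_comm]
    exact hx0 (congrFun (hP _ hH) j0)

lemma wronsk {s : ℕ} (P : Fin s → MvP σ ℤ)
    (hP : ∀ g : Fin s → ℤ, ∑ j, C (g j) * P j = 0 → g = 0) :
    ∃ μ : Fin s → (σ →₀ ℕ), (∀ i, (μ i).degree ≤ i) ∧
      (of fun i j => hd (μ i) (P j)).det ≠ 0 := by
  obtain ⟨μ, hμ, hli⟩ := wronsk_aux P hP s le_rfl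
  refine ⟨μ, hμ, fun h0 => ?_⟩
  obtain ⟨g, hg, hg0⟩ := Matrix.exists_vecMul_eq_zero_iff.2 h0
  apply hg
  apply hli
  intro j
  simpa [vecMul, dotProduct] using congrFun hg0 j

end R2

section R3

/-- usual absolute value on the integers, real valued -/
def zabs : AbsoluteValue ℤ ℝ :=
  (AbsoluteValue.abs : AbsoluteValue ℝ ℝ).comp (f := castRingHom ℝ) Int.cast_injective

@[simp] lemma zabs_apply (z : ℤ) : zabs z = |(z : ℝ)| := rfl

/-- l1 norm -/
def n1 {σ : Type*} (F : MvP σ ℤ) : ℝ := wn zabs (fun _ => 1) F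

lemma coeff_le_n1 {σ : Type*} (F : MvP σ ℤ) (m : σ →₀ ℕ) : |((coeff m F : ℤ) : ℝ)| ≤ n1 F := by
  have := coeff_le_wn zabs (ρ := fun _ => 1) (fun _ => zero_le_one) F m
  simpa [Finsupp.prod, n1] using this

variable {σ : Type*}

lemma pderiv_eq_zero {R : Type*} [CommRing R] {d : σ → ℕ} {F : MvP σ R} (hF : DegLe d F) {h : σ} (hd : d h = 0) :
    pderiv h F = 0 := by
  classical
  ext m
  rw [coeff_pderiv]
  by_cases h0 : coeff (m + single h 1) F = 0
  · simp [h0]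
  · have := hF _ h0 h
    simp [hd] at this

lemma coeff_mul_disj {R : Type*} [CommRing R] {k : σ} {d e : σ → ℕ} {P G : MvP σ R} (hP : DegLe d P)
    (hG : DegLe e G) (hd : d k = 0) (he : ∀ h, h ≠ k → e h = 0) (m : σ →₀ ℕ) :
    coeff m (P * G) = coeff (m.erase k) P * coeff (single k (m k)) G := by
  classical
  rw [coeff_mul]
  have hm : m.erase k + single k (m k) = m := erase_add_single k m
  rw [sum_eq_single (m.erase k, single k (m k))]
  · rintro ⟨a, b⟩ hab hne
    rw [HasAntidiagonal.mem_antidiagonal] at hab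
    by_contra h0
    have ha := hP a (left_ne_zero_of_mul h0) k
    have hb := fun h => hG b (right_ne_zero_of_mul h0) h
    apply hne
    simp only at hab
    rw [Prod.mk.injEq]
    constructor
    · ext h
      by_cases hk : h = k
      · subst hk; simp; omega
      · have := hb h
        rw [he h hk] at this
        have h2 := DFunLike.congr_fun hab h
        simp at h2
        rw [erase_ne hk]; omega
    · ext h
      by_cases hk : h = k
      · subst hk
        have h2 := DFunLike.congr_fun hab h
        simp at h2 ⊢; omega
      · have := hb h
        rw [he h hk] at this
        rw [single_apply, if_neg (Ne.symm hk)]; simpa using this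
  · intro h; exact absurd (by rw [HasAntidiagonal.mem_antidiagonal]; exact hm) h

lemma DegLe.X_add {R : Type*} [CommRing R] [DecidableEq σ] (h : σ) (c : R) : DegLe (Pi.single h 1) (X h + C c) := by
  intro m hm i
  rw [coeff_add, coeff_X', coeff_C] at hm
  by_cases h1 : single h 1 = m
  · rw [← h1, single_apply]
    by_cases hi : h = i
    · subst hi; simp
    · simp [hi]
  · by_cases h2 : 0 = m
    · simp [← h2]
    · simp [h1, h2] at hm

lemma DegLe.C_mul {R : Type*} [CommRing R] {d : σ → ℕ} {F : MvP σ R} (hF : DegLe d F) (c : R) :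
    DegLe d (C c * F) := by
  intro m hm
  rw [coeff_C_mul] at hm
  exact hF m (right_ne_zero_of_mul hm)

lemma DegLe.map {R S : Type*} [CommRing R] [CommRing S] {d : σ → ℕ} {F : MvP σ R} (hF : DegLe d F) (f : R →+* S) :
    DegLe d (map f F) := by
  intro m hm
  rw [coeff_map] at hm
  exact hF m (fun h => hm (by simp [h]))

lemma DegLe.shift {R : Type*} [CommRing R] {d : σ → ℕ} {F : MvP σ R} (hF : DegLe d F) (ξ : σ → R) :
    DegLe d (shift ξ F) := by
  classical
  rw [F.as_sum, map_sum]
  refine DegLe.sum _ fun m hm => ?_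
  have hm' : coeff m F ≠ 0 := by simpa using hm
  rw [Sub.shift, aeval_monomial, algebraMap_eq]
  apply DegLe.C_mul
  have : DegLe (∑ h ∈ m.support, ∑ _i ∈ range (m h), Pi.single h 1)
      (∏ h ∈ m.support, ∏ _i ∈ range (m h), ((X h : MvP σ R) + C (ξ h))) := by
    refine DegLe.prod _ fun h _ => DegLe.prod _ fun i _ => DegLe.X_add h (ξ h)
  simp only [prod_const, card_range] at this
  refine DegLe.mono this fun h => ?_
  refine le_trans ?_ (hF m hm' h)
  simp only [sum_const, card_range, Finset.sum_apply, Pi.smul_apply, smul_eq_mul, Pi.single_apply]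
  simp
  split_ifs <;> omega

/-- univariate step -/
lemma uni (k : σ) (d : σ → ℕ) (hd : ∀ h, h ≠ k → d h = 0) (F : MvP σ ℤ) (hF : F ≠ 0)
    (hdeg : DegLe d F) (p : ℤ) (q : ℕ) (hq : 0 < q) (hpq : IsCoprime p (q : ℤ)) (ξ : σ → ℚ)
    (hξ : ξ k = p / q) :
    ∃ a : ℕ, coeff (single k a) (shift ξ (map (castRingHom ℚ) F)) ≠ 0 ∧
      (q : ℝ) ^ a ≤ n1 F := by
  classical
  let G : Polynomial ℤ := ∑ m ∈ F.support, Polynomial.monomial (m k) (coeff m F)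
  have hmk : ∀ m ∈ F.support, single k (m k) = m := by
    intro m hm
    ext h
    by_cases hk : h = k
    · subst hk; simp
    · have := hdeg m (by simpa using hm) h
      rw [hd h hk] at this
      rw [single_apply, if_neg (Ne.symm hk)]; omega
  have hFG : Polynomial.aeval (X k : MvP σ ℤ) G = F := by
    conv_rhs => rw [F.as_sum]
    rw [map_sum]
    refine sum_congr rfl fun m hm => ?_
    rw [Polynomial.aeval_monomial, algebraMap_eq]
    rw [C_mul_X_pow_eq_monomial, hmk m hm]
  have hco : ∀ {R : Type} [CommRing R] (H : Polynomial R) (a : ℕ),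
      coeff (single k a) (Polynomial.aeval (X k : MvP σ R) H) = H.coeff a := by
    intro R _ H a
    induction H using Polynomial.induction_on' with
    | add p q hp hq => simp [hp, hq]
    | monomial n c =>
      rw [Polynomial.aeval_monomial, algebraMap_eq, C_mul_X_pow_eq_monomial, coeff_monomial,
        Polynomial.coeff_monomial]
      simp [Finsupp.single_left_inj, (Finsupp.single_injective k).eq_iff]
  let Gq := G.map (castRingHom ℚ)
  have hG0 : G ≠ 0 := by
    intro h; rw [h, map_zero] at hFG; exact hF hFG.symm
  have hGq0 : Gq ≠ 0 := by
    rwa [Ne, Polynomial.map_eq_zero_iff (RingHom.injective_int _)]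
  let T := Polynomial.taylor (ξ k) Gq
  have hT0 : T ≠ 0 := by
    intro h; exact hGq0 ((Polynomial.taylor_injective (ξ k)) (by simpa [T] using h))
  have hsh : shift ξ (map (castRingHom ℚ) F) = Polynomial.aeval (X k : MvP σ ℚ) T := by
    rw [← hFG]
    have : ∀ H : Polynomial ℤ, shift ξ (map (castRingHom ℚ) (Polynomial.aeval (X k : MvP σ ℤ) H))
        = Polynomial.aeval (X k : MvP σ ℚ) (Polynomial.taylor (ξ k) (H.map (castRingHom ℚ))) := by
      intro H
      induction H using Polynomial.induction_on' with
      | add p q hp hq => simp [hp, hq]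
      | monomial n c => simp [shift, Polynomial.aeval_monomial, Polynomial.taylor_monomial]
    exact this G
  refine ⟨T.natTrailingDegree, ?_, ?_⟩
  · rw [hsh, hco]
    exact Polynomial.trailingCoeff_nonzero_iff_nonzero.2 hT0
  · set a := T.natTrailingDegree
    have h1 : (Polynomial.X : Polynomial ℚ) ^ a ∣ T := by
      rw [Polynomial.X_pow_dvd_iff]
      intro i hi
      exact Polynomial.coeff_eq_zero_of_lt_natTrailingDegree hi
    have h2 : (Polynomial.X - Polynomial.C (ξ k)) ^ a ∣ Gq := by
      obtain ⟨c, hc⟩ := h1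
      refine ⟨Polynomial.taylor (- ξ k) c, ?_⟩
      have := congrArg (Polynomial.taylor (-ξ k)) hc
      rw [Polynomial.taylor_mul, Polynomial.taylor_taylor] at this
      simp [Polynomial.taylor_pow] at this
      simpa [sub_eq_add_neg] using this
    let L : Polynomial ℤ := Polynomial.C (q : ℤ) * Polynomial.X - Polynomial.C p
    have hLprim : L.IsPrimitive := by
      intro r hr
      have c0 := (Polynomial.C_dvd_iff_dvd_coeff r L).1 hr
      have e0 := c0 0
      have e1 := c0 1
      simp only [L, Polynomial.coeff_sub, Polynomial.coeff_C_mul, Polynomial.coeff_X, Polynomial.coeff_C] at e0 e1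
      simp at e0 e1
      exact hpq.isUnit_of_dvd' e0 e1
    have hLa : (L ^ a).IsPrimitive := by
      have : ∀ n, (L ^ n).IsPrimitive := by
       intro n
       induction n with
       | zero => simpa using Polynomial.isPrimitive_one
       | succ n ih => rw [pow_succ]; exact ih.mul hLprim
      exact this a
    have h3 : (L ^ a) ∣ G := by
      rw [Polynomial.IsPrimitive.Int.dvd_iff_map_cast_dvd_map_cast _ _ hLa]
      have hqq : (q : ℚ) ≠ 0 := by exact_mod_cast hq.ne'
      have e : Polynomial.map (castRingHom ℚ) (L ^ a) =
          Polynomial.C ((q : ℚ) ^ a) * (Polynomial.X - Polynomial.C (ξ k)) ^ a := by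
        rw [Polynomial.map_pow, Polynomial.C_pow, ← mul_pow]
        congr 1
        simp only [L, Polynomial.map_sub, Polynomial.map_mul, Polynomial.map_C, Polynomial.map_X, mul_sub]
        rw [← Polynomial.C_mul, hξ, mul_div_cancel₀ _ hqq]
        simp
      rw [e]
      refine (IsUnit.mul_left_dvd ?_).2 h2
      exact Polynomial.isUnit_C.2 (IsUnit.mk0 _ (pow_ne_zero _ hqq))
    obtain ⟨c, hc⟩ := h3
    have h4 : G.leadingCoeff = (q : ℤ) ^ a * c.leadingCoeff := by
      rw [hc, Polynomial.leadingCoeff_mul, Polynomial.leadingCoeff_pow]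
      congr 2
      have : (q : ℤ) ≠ 0 := by exact_mod_cast hq.ne'
      have hL : L = Polynomial.C (q : ℤ) * Polynomial.X + Polynomial.C (-p) := by simp [L, sub_eq_add_neg]
      rw [hL, Polynomial.leadingCoeff_linear this]
    have h5 : |(G.leadingCoeff : ℝ)| ≤ n1 F := by
      have := coeff_le_n1 F (single k G.natDegree)
      conv_lhs at this => rw [← hFG, hco]
      exact this
    refine le_trans ?_ h5
    have hc0 : c.leadingCoeff ≠ 0 := by
      intro h0; rw [h0, mul_zero] at h4; exact hG0 (Polynomial.leadingCoeff_eq_zero.1 h4)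
    rw [h4]
    push_cast
    rw [abs_mul, abs_of_nonneg (by positivity : (0:ℝ) ≤ (q:ℝ)^a)]
    have : (1:ℝ) ≤ |(c.leadingCoeff : ℝ)| := by exact_mod_cast one_le_abs hc0
    nlinarith [pow_pos (by exact_mod_cast hq : (0:ℝ) < q) a]

end R3

section R4
variable {σ : Type*} [DecidableEq σ]

/-- coefficient of `X k ^ c` -/
def part (k : σ) (c : ℕ) (F : MvP σ ℤ) : MvP σ ℤ :=
  ∑ m ∈ F.support with m k = c, monomial (m.erase k) (coeff m F)

lemma coeff_part (k : σ) (c : ℕ) (F : MvP σ ℤ) (n : σ →₀ ℕ) :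
    coeff n (part k c F) = if n k = 0 then coeff (n + single k c) F else 0 := by
  unfold part
  rw [coeff_sum]
  simp only [coeff_monomial]
  have hm : ∀ m : σ →₀ ℕ, m.erase k + single k (m k) = m := fun m => erase_add_single k m
  split_ifs with h
  · rw [sum_eq_single (n + single k c)]
    · rw [if_pos]
      ext i
      by_cases hi : i = k
      · subst hi; simp [h]
      · simp [erase_ne hi, single_apply, Ne.symm hi]
    · intro m hm1 hne
      rw [if_neg]
      rintro rfl
      apply hne
      rw [mem_filter] at hm1
      rw [← hm1.2, hm]
    · intro h1
      rw [mem_filter] at h1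
      simp only [Finsupp.add_apply, single_eq_same, h, zero_add, and_true] at h1
      split_ifs
      · simpa using h1
      · rfl
  · refine sum_eq_zero fun m hm1 => ?_
    rw [if_neg]
    rintro rfl
    simp at h

lemma wn_mono_sum (s : Finset (σ →₀ ℕ)) (F : MvP σ ℤ) (hs : s ⊆ F.support)
    (g : (σ →₀ ℕ) → (σ →₀ ℕ)) : n1 (∑ m ∈ s, monomial (g m) (coeff m F)) ≤ n1 F := by
  unfold n1
  refine (wn_sum zabs (fun _ => zero_le_one) _ _).trans ?_
  simp only [wn_monomial]
  unfold wn
  simp only [one_pow, prod_const_one, Finsupp.prod, mul_one]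
  exact sum_le_sum_of_subset_of_nonneg hs (fun _ _ _ => zabs.nonneg _)

lemma n1_part (k : σ) (c : ℕ) (F : MvP σ ℤ) : n1 (part k c F) ≤ n1 F :=
  wn_mono_sum _ _ (filter_subset _ _) _

/-- coefficient of the monomial `m0` in the other variables -/
def copart (k : σ) (m0 : σ →₀ ℕ) (F : MvP σ ℤ) : MvP σ ℤ :=
  ∑ m ∈ F.support with m.erase k = m0, monomial (single k (m k)) (coeff m F)

lemma n1_copart (k : σ) (m0 : σ →₀ ℕ) (F : MvP σ ℤ) : n1 (copart k m0 F) ≤ n1 F :=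
  wn_mono_sum _ _ (filter_subset _ _) _

lemma coeff_copart (k : σ) (m0 : σ →₀ ℕ) (hm0 : m0 k = 0) (F : MvP σ ℤ) (n : σ →₀ ℕ) :
    coeff n (copart k m0 F) = if n = single k (n k) then coeff (m0 + n) F else 0 := by
  unfold copart
  rw [coeff_sum]
  simp only [coeff_monomial]
  have hm : ∀ m : σ →₀ ℕ, m.erase k + single k (m k) = m := fun m => erase_add_single k m
  split_ifs with h
  · rw [sum_eq_single (m0 + n)]
    · rw [if_pos]
      simp [hm0, ← h]
    · intro m hm1 hne
      rw [if_neg]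
      rintro rfl
      apply hne
      rw [mem_filter] at hm1
      rw [← hm1.2, hm]
    · intro h1
      rw [mem_filter] at h1
      have : (m0 + n).erase k = m0 := by
        rw [h]
        ext i
        by_cases hi : i = k
        · subst hi; simp [hm0]
        · simp [erase_ne hi, single_apply, Ne.symm hi]
      simp only [this, and_true] at h1
      split_ifs
      · simpa using h1
      · rfl
  · refine sum_eq_zero fun m hm1 => ?_
    rw [if_neg]
    rintro rfl
    simp at h

lemma degLe_part {d : σ → ℕ} (k : σ) (c : ℕ) {F : MvP σ ℤ} (hF : DegLe d F) :
    DegLe (update d k 0) (part k c F) := by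
  intro m hm h
  rw [coeff_part] at hm
  split_ifs at hm with h0
  · by_cases hk : h = k
    · subst hk; simp [h0]
    · rw [update_of_ne hk]
      exact le_trans (by simp) (hF _ hm h)
  · exact absurd rfl hm

lemma DegLe.add {d : σ → ℕ} {F G : MvP σ ℤ} (hF : DegLe d F) (hG : DegLe d G) : DegLe d (F + G) := by
  intro m hm
  rw [coeff_add] at hm
  by_cases h : coeff m F = 0
  · rw [h, zero_add] at hm; exact hG m hm
  · exact hF m h

lemma decomp {d : σ → ℕ} (k : σ) {F : MvP σ ℤ} (hF : DegLe d F) :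
    ∃ s ≤ d k + 1, ∃ N : ℤ, N ≠ 0 ∧ ∃ P G : Fin s → MvP σ ℤ,
      C N * F = ∑ j, P j * G j ∧ (∀ j, DegLe (update d k 0) (P j)) ∧
      (∀ j, DegLe (Pi.single k (d k)) (G j)) ∧
      (∀ g : Fin s → ℤ, ∑ j, C (g j) * P j = 0 → g = 0) ∧
      (∀ g : Fin s → ℤ, ∑ j, C (g j) * G j = 0 → g = 0) := by
  let D : ℕ → Prop := fun s => ∃ N : ℤ, N ≠ 0 ∧ ∃ P G : Fin s → MvP σ ℤ,
      C N * F = ∑ j, P j * G j ∧ (∀ j, DegLe (update d k 0) (P j)) ∧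
      (∀ j, DegLe (Pi.single k (d k)) (G j))
  have hD : D (d k + 1) := by
    refine ⟨1, one_ne_zero, fun j => part k j F, fun j => X k ^ (j : ℕ), ?_, fun j => degLe_part k j hF, ?_⟩
    · rw [C_1, one_mul, Fin.sum_univ_eq_sum_range (fun j => part k j F * X k ^ j)]
      conv_lhs => rw [F.as_sum]
      rw [← sum_fiberwise_of_maps_to (s := F.support) (t := range (d k + 1)) (g := fun m => m k)]
      · refine sum_congr rfl fun j _ => ?_
        unfold part
        rw [sum_mul]
        refine sum_congr rfl fun m hm => ?_
        rw [mem_filter] at hm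
        rw [X_pow_eq_monomial, monomial_mul, mul_one, ← hm.2, erase_add_single]
      · intro m hm
        rw [mem_range]
        have := hF m (by simpa using hm) k
        omega
    · intro j m hm h
      rw [coeff_X_pow] at hm
      have : single k (j : ℕ) = m := by
        by_contra hc; simp [hc] at hm
      rw [← this]
      by_cases hk : h = k
      · subst hk; simp; omega
      · simp [single_apply, Ne.symm hk]
  classical
  obtain ⟨s, ⟨N, hN, P, G, hPG, hP, hG⟩, hmin⟩ : ∃ s, D s ∧ ∀ t, D t → s ≤ t :=
    ⟨Nat.find ⟨_, hD⟩, Nat.find_spec ⟨_, hD⟩, fun t ht => Nat.find_min' _ ht⟩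
  refine ⟨s, hmin _ hD, N, hN, P, G, hPG, hP, hG, ?_, ?_⟩
  all_goals
    clear hD
    intro g hg
    by_contra hne
    obtain ⟨i, hi⟩ := ne_iff.1 hne
    simp only [Pi.zero_apply] at hi
    obtain ⟨s, rfl⟩ : ∃ t, s = t + 1 := ⟨s - 1, by have := i.2; omega⟩
    rw [Fin.sum_univ_succAbove _ i] at hg hPG
    have := hmin s
    suffices D s by have := hmin s this; omega
  · refine ⟨g i * N, mul_ne_zero hi hN, fun j => P (i.succAbove j),
      fun j => C (g i) * G (i.succAbove j) + C (- g (i.succAbove j)) * G i, ?_, fun j => hP _, fun j => ?_⟩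
    · rw [C_mul, mul_assoc, hPG, mul_add]
      have : C (g i) * P i = - ∑ j, C (g (i.succAbove j)) * P (i.succAbove j) := by linear_combination hg
      rw [← mul_assoc, this]
      have e : ∀ j, P (i.succAbove j) * (C (g i) * G (i.succAbove j) + C (- g (i.succAbove j)) * G i) =
        C (g i) * (P (i.succAbove j) * G (i.succAbove j)) - (C (g (i.succAbove j)) * P (i.succAbove j)) * G i := by
        intro j; rw [C_neg]; ring
      simp only [e, sum_sub_distrib, ← mul_sum, ← sum_mul]
      ring
    · exact ((hG _).C_mul _).add ((hG _).C_mul _)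
  · refine ⟨g i * N, mul_ne_zero hi hN, 
      fun j => C (g i) * P (i.succAbove j) + C (- g (i.succAbove j)) * P i, fun j => G (i.succAbove j), ?_, fun j => ?_, fun j => hG _⟩
    · rw [C_mul, mul_assoc, hPG, mul_add]
      have : C (g i) * G i = - ∑ j, C (g (i.succAbove j)) * G (i.succAbove j) := by linear_combination hg
      rw [mul_left_comm, this]
      have e : ∀ j, (C (g i) * P (i.succAbove j) + C (- g (i.succAbove j)) * P i) * G (i.succAbove j) =
        C (g i) * (P (i.succAbove j) * G (i.succAbove j)) - P i * (C (g (i.succAbove j)) * G (i.succAbove j)) := by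
        intro j; rw [C_neg]; ring
      simp only [e, sum_sub_distrib, ← mul_sum, ← sum_mul]
      ring
    · exact ((hP _).C_mul _).add ((hP _).C_mul _)

end R4

lemma n1_nonneg {σ : Type*} (F : MvP σ ℤ) : 0 ≤ n1 F := wn_nonneg _ (fun _ => zero_le_one) _

lemma n1_hd {σ : Type*} {d : σ → ℕ} {F : MvP σ ℤ} (hF : DegLe d F) (D : ℕ)
    (hD : ∀ t : Finset σ, ∑ h ∈ t, d h ≤ D) (μ : σ →₀ ℕ) : n1 (hd μ F) ≤ 2 ^ D * n1 F := by
  unfold n1 hd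
  refine (wn_sum zabs (fun _ => zero_le_one) _ _).trans ?_
  simp only [wn_monomial]
  unfold wn
  simp only [one_pow, prod_const_one, Finsupp.prod, mul_one, mul_sum]
  refine sum_le_sum fun m hm => ?_
  rw [zabs.map_mul]
  refine mul_le_mul_of_nonneg_right ?_ (zabs.nonneg _)
  have h1 : mbin m μ ≤ 2 ^ D := by
    unfold mbin Finsupp.prod
    calc ∏ h ∈ μ.support, (m h).choose (μ h) ≤ ∏ h ∈ μ.support, 2 ^ (d h) := by
          refine prod_le_prod' fun h _ => ?_
          refine (Nat.choose_le_two_pow _ _).trans ?_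
          exact Nat.pow_le_pow_right (by norm_num) (hF m (by simpa using hm) h)
      _ = 2 ^ ∑ h ∈ μ.support, d h := by rw [prod_pow_eq_pow_sum]
      _ ≤ _ := Nat.pow_le_pow_right (by norm_num) (hD _)
  simp
  exact_mod_cast h1

lemma count_bound (s D : ℕ) (hD : 1 ≤ D) (hs : s ≤ D + 1) (τ : ℝ) (h0 : 0 < τ) (h1 : τ ≤ 1) :
    s * τ ^ 2 / 8 ≤ ∑ l ∈ range s, max 0 (τ - l / D) := by
  set n := ⌈(s * τ / 4 : ℝ)⌉₊ with hn
  have hD0 : (0:ℝ) < D := by exact_mod_cast hD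
  have hns : n ≤ s := by
    rw [hn, Nat.ceil_le]
    have : (0:ℝ) ≤ s := Nat.cast_nonneg _
    nlinarith
  have hsD : (s : ℝ) ≤ 2 * D := by
    have : s ≤ 2 * D := by omega
    exact_mod_cast this
  calc (s * τ ^ 2 / 8 : ℝ) ≤ n * (τ / 2) := by
        have : (s * τ / 4 : ℝ) ≤ n := Nat.le_ceil _
        nlinarith
    _ = ∑ l ∈ range n, τ / 2 := by simp
    _ ≤ ∑ l ∈ range n, max 0 (τ - l / D) := by
        refine sum_le_sum fun l hl => le_max_of_le_right ?_
        have h3 : (l : ℝ) < s * τ / 4 := by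
          rw [mem_range, hn] at hl
          exact Nat.lt_ceil.1 hl
        have : (l : ℝ) / D ≤ τ / 2 := by
          rw [div_le_iff₀ hD0]; nlinarith
        linarith
    _ ≤ _ := sum_le_sum_of_subset_of_nonneg (range_subset_range.2 hns) fun _ _ _ => le_max_left _ _

/-- algebraic step of Roth's lemma -/
lemma roth_alg {d : ℕ → ℕ} (k : ℕ) {F : MvP ℕ ℤ} (hF0 : F ≠ 0) (hF : DegLe d F) :
    ∃ s ≤ d k + 1, 1 ≤ s ∧ ∃ μ ν : Fin s → (ℕ →₀ ℕ),
      (∀ i, (μ i).degree ≤ i) ∧ (∀ i, (ν i).degree ≤ i) ∧ (∀ i, μ i k = 0) ∧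
      (∀ i h, d h = 0 → μ i h = 0) ∧ (∀ i h, h ≠ k → ν i h = 0) ∧
      ∃ (N : ℤ) (U V : MvP ℕ ℤ), N ≠ 0 ∧ U ≠ 0 ∧ V ≠ 0 ∧
        DegLe (s • update d k 0) U ∧ DegLe (s • (Pi.single k (d k) : ℕ → ℕ)) V ∧
        C N * (of fun i l => hd (μ i) (hd (ν l) F)).det = U * V := by
  classical
  obtain ⟨s, hs, N, hN, P, G, hPG, hP, hG, hPi, hGi⟩ := decomp k hF
  obtain ⟨μ, hμ, hU⟩ := wronsk P hPi
  obtain ⟨ν, hν, hV⟩ := wronsk G hGi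
  have detdeg : ∀ (e : ℕ → ℕ) (Q : Fin s → Fin s → MvP ℕ ℤ), (∀ i j, DegLe e (Q i j)) →
      DegLe (s • e) (of Q).det := by
    intro e Q hQ
    rw [det_apply]
    refine DegLe.sum _ fun π _ => ?_
    have h1 := DegLe.prod univ (F := fun i => Q (π i) i) (d := fun _ => e) (fun i _ => hQ _ _)
    simp only [sum_const, card_univ, Fintype.card_fin] at h1
    rcases units_eq_one_or (Perm.sign π) with h | h
    · rw [h]; simpa using h1
    · rw [h]
      have := h1.C_mul (-1)
      simpa using this
  have hker : ∀ (e : ℕ → ℕ) (Q : Fin s → MvP ℕ ℤ) (η : Fin s → (ℕ →₀ ℕ)), (∀ j, DegLe e (Q j)) →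
      (of fun i j => hd (η i) (Q j)).det ≠ 0 → ∀ i h, e h = 0 → η i h = 0 := by
    intro e Q η hQ hdet i h he
    by_contra hne
    apply hdet
    apply det_eq_zero_of_row_eq_zero i
    intro j
    simp only [of_apply]
    ext n
    rw [coeff_hd, coeff_zero]
    by_cases h0 : coeff (n + η i) (Q j) = 0
    · rw [h0, mul_zero]
    · have := hQ j _ h0 h
      rw [he] at this
      simp at this
      exact absurd this.2 hne
  have hμk : ∀ i, μ i k = 0 := fun i => hker _ P μ hP hU i k (by simp)
  have hνk : ∀ i h, h ≠ k → ν i h = 0 := fun i h hk => hker _ G ν hG hV i h (by simp [hk])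
  refine ⟨s, hs, ?_, μ, ν, hμ, hν, hμk, ?_, hνk, N ^ s, (of fun i j => hd (μ i) (P j)).det,
    (of fun i j => hd (ν i) (G j)).det, pow_ne_zero _ hN, hU, hV,
    detdeg _ _ fun i j => (hP j).hd _, detdeg _ _ fun i j => (hG j).hd _, ?_⟩
  · by_contra h0
    have : s = 0 := by omega
    subst this
    simp at hPG
    exact hPG.elim hN hF0
  · intro i h hd0
    by_cases hk : h = k
    · rw [hk]; exact hμk i
    · exact hker _ P μ hP hU i h (by simp [hk, hd0])
  · rw [← Matrix.det_transpose (of fun i j => hd (ν i) (G j)), ← det_mul]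
    have : (of fun i j => hd (μ i) (P j)) * (of fun i j => hd (ν i) (G j)).transpose =
        (C N : MvP ℕ ℤ) • (of fun i l => hd (μ i) (hd (ν l) F)) := by
      ext1 i l
      rw [Matrix.mul_apply]
      simp only [of_apply, Matrix.transpose_apply, Matrix.smul_apply, smul_eq_mul]
      rw [← hd_C_mul, ← hd_C_mul, hPG, hd_sum, hd_sum]
      refine sum_congr rfl fun j _ => ?_
      rw [mul_comm (P j) (G j), hd_mul_left (G j) (P j) (ν l), mul_comm (hd (ν l) (G j)) (P j), hd_mul_left (P j) _ (μ i)]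
      · intro h hh
        refine pderiv_eq_zero ((hG j).hd _) ?_
        rw [Pi.single_apply, if_neg]
        rintro rfl
        exact hh (hμk i)
      · intro h hh
        refine pderiv_eq_zero (hP j) ?_
        have : h = k := by
          by_contra hne; exact hh (hνk l h hne)
        simp [this]
    rw [this, det_smul]
    simp

/-- rational points -/
def ratpt (p : ℕ → ℤ) (q : ℕ → ℕ) : ℕ → ℚ := fun h => (p h : ℚ) / q h

/-- map to rational coefficients and shift -/
def shq (ξ : ℕ → ℚ) (F : MvP ℕ ℤ) : MvP ℕ ℚ :=
  shift ξ (map (castRingHom ℚ) F)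

lemma shq_mul (ξ : ℕ → ℚ) (F G) : shq ξ (F * G) = shq ξ F * shq ξ G := by simp [shq]
lemma shq_C (ξ : ℕ → ℚ) (a : ℤ) : shq ξ (C a) = C (a : ℚ) := by simp [shq, shift]

lemma roth_upper {s k : ℕ} {d e : ℕ → ℕ} (hdk : d k = 0) (he : ∀ h, h ≠ k → e h = 0)
    {N : ℤ} (hN : N ≠ 0) {U V W : MvP ℕ ℤ} (hU0 : U ≠ 0) (hV0 : V ≠ 0)
    (hU : DegLe d U) (hV : DegLe e V) (h : C N * W = U * V) :
    ∃ Wu Wv : MvP ℕ ℤ, Wu ≠ 0 ∧ Wv ≠ 0 ∧ DegLe d Wu ∧ DegLe e Wv ∧ n1 Wu ≤ n1 W ∧ n1 Wv ≤ n1 W ∧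
      ∀ (ξ : ℕ → ℚ) (f : ℕ →₀ ℕ) (a : ℕ), coeff f (shq ξ Wu) ≠ 0 →
        coeff (single k a) (shq ξ Wv) ≠ 0 → coeff (f + single k a) (shq ξ W) ≠ 0 ∧ f k = 0 := by
  classical
  obtain ⟨m0, hm0⟩ := ne_zero_iff.1 hU0
  obtain ⟨c0, hc0⟩ := ne_zero_iff.1 hV0
  have hm0k : m0 k = 0 := by have := hU m0 hm0 k; omega
  have hc0k : c0 = single k (c0 k) := by
    ext h
    by_cases hk : h = k
    · subst hk; simp
    · have := hV c0 hc0 h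
      rw [he h hk] at this
      rw [single_apply, if_neg (Ne.symm hk)]; omega
  have hW : ∀ m, N * coeff m W = coeff (m.erase k) U * coeff (single k (m k)) V := by
    intro m
    rw [← coeff_mul_disj hU hV hdk he, ← h, coeff_C_mul]
  have hWu : C N * part k (c0 k) W = C (coeff c0 V) * U := by
    ext n
    rw [coeff_C_mul, coeff_C_mul, coeff_part]
    split_ifs with h0
    · rw [hW]
      have e1 : (n + single k (c0 k)).erase k = n := by
        ext i
        by_cases hi : i = k
        · subst hi; simp [h0]
        · simp [erase_ne hi, single_apply, Ne.symm hi]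
      rw [e1]
      simp only [Finsupp.add_apply, h0, single_eq_same, zero_add]
      rw [← hc0k, mul_comm]
    · by_cases h1 : coeff n U = 0
      · simp [h1]
      · have := hU n h1 k; omega
  have hWv : C N * copart k m0 W = C (coeff m0 U) * V := by
    ext n
    rw [coeff_C_mul, coeff_C_mul, coeff_copart k m0 hm0k]
    split_ifs with h0
    · rw [hW]
      have e1 : (m0 + n).erase k = m0 := by
        rw [h0]
        ext i
        by_cases hi : i = k
        · subst hi; simp [hm0k]
        · simp [erase_ne hi, single_apply, Ne.symm hi]
      rw [e1]
      simp only [Finsupp.add_apply, hm0k, zero_add]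
      rw [← h0]
    · by_cases h1 : coeff n V = 0
      · simp [h1]
      · exfalso
        apply h0
        ext i
        by_cases hi : i = k
        · subst hi; simp
        · have := hV n h1 i
          rw [he i hi] at this
          rw [single_apply, if_neg (Ne.symm hi)]; omega
  have hCN : (C N : MvP ℕ ℤ) ≠ 0 := by rwa [Ne, C_eq_zero]
  refine ⟨part k (c0 k) W, copart k m0 W, ?_, ?_, ?_, ?_, n1_part _ _ _, n1_copart _ _ _, ?_⟩
  · intro h0; rw [h0, mul_zero] at hWu
    exact mul_ne_zero (by rwa [Ne, C_eq_zero]) hU0 hWu.symm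
  · intro h0; rw [h0, mul_zero] at hWv
    exact mul_ne_zero (by rwa [Ne, C_eq_zero]) hV0 hWv.symm
  · intro m hm
    have h1 : coeff m (C N * part k (c0 k) W) ≠ 0 := by rw [coeff_C_mul]; exact mul_ne_zero hN hm
    rw [hWu, coeff_C_mul] at h1
    exact hU m (right_ne_zero_of_mul h1)
  · intro m hm
    have h1 : coeff m (C N * copart k m0 W) ≠ 0 := by rw [coeff_C_mul]; exact mul_ne_zero hN hm
    rw [hWv, coeff_C_mul] at h1
    exact hV m (right_ne_zero_of_mul h1)
  · intro ξ f a hf ha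
    have hNq : (N : ℚ) ≠ 0 := by exact_mod_cast hN
    have h1 := congrArg (fun P => coeff f (shq ξ P)) hWu
    have h2 := congrArg (fun P => coeff (single k a) (shq ξ P)) hWv
    simp only [shq_mul, shq_C, coeff_C_mul] at h1 h2
    have hfU : coeff f (shq ξ U) ≠ 0 := by
      intro h0; rw [h0, mul_zero] at h1; exact mul_ne_zero hNq hf h1
    have haV : coeff (single k a) (shq ξ V) ≠ 0 := by
      intro h0; rw [h0, mul_zero] at h2; exact mul_ne_zero hNq ha h2
    have hdU : DegLe d (shq ξ U) := (hU.map _).shift ξ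
    have hdV : DegLe e (shq ξ V) := (hV.map _).shift ξ
    have hfk : f k = 0 := by have := hdU f hfU k; omega
    refine ⟨?_, hfk⟩
    have h3 := congrArg (fun P => coeff (f + single k a) (shq ξ P)) h
    simp only [shq_mul, shq_C, coeff_C_mul] at h3
    rw [coeff_mul_disj hdU hdV hdk he] at h3
    have e1 : (f + single k a).erase k = f := by
      ext i
      by_cases hi : i = k
      · subst hi; simp [hfk]
      · simp [erase_ne hi, single_apply, Ne.symm hi]
    rw [e1] at h3
    simp only [Finsupp.add_apply, hfk, single_eq_same, zero_add] at h3
    intro h0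
    rw [h0, mul_zero] at h3
    exact mul_ne_zero hfU haV h3.symm

/-- Roth's lemma -/
theorem roth (k : ℕ) : ∀ θ : ℝ, 0 < θ → θ ≤ 1 → ∃ σ : ℝ, 0 < σ ∧ σ ≤ 1 ∧
    ∀ d : ℕ → ℕ, (∀ h < k, 1 ≤ d h) → (∀ h, k ≤ h → d h = 0) → (∀ h, (d (h + 1) : ℝ) ≤ σ * d h) →
    ∀ F : MvP ℕ ℤ, F ≠ 0 → DegLe d F → ∀ A : ℝ, 0 ≤ A → n1 F ≤ exp A →
    ∀ (p : ℕ → ℤ) (q : ℕ → ℕ), (∀ h < k, 0 < q h ∧ IsCoprime (p h) (q h : ℤ)) →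
      (∀ h < k, A + d 0 ≤ σ * (d h * log (q h))) →
    ∃ f, coeff f (shq (ratpt p q) F) ≠ 0 ∧ wt (fun h => (d h : ℝ)⁻¹) f < θ := by
  classical
  induction k with
  | zero =>
    intro θ h0 h1
    refine ⟨1, one_pos, le_rfl, fun d _ hd _ F hF hdeg A hA _ p q _ _ => ⟨0, ?_, by simpa using h0⟩⟩
    have hFC : F = C (coeff 0 F) := by
      ext m
      rw [coeff_C]
      split_ifs with h
      · rw [h]
      · by_contra hne
        apply h
        ext i
        have := hdeg m hne i
        rw [hd i (Nat.zero_le _)] at this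
        simp; omega
    rw [hFC, shq_C, coeff_C, if_pos rfl]
    intro h
    apply hF
    rw [hFC]
    have : coeff 0 F = 0 := by exact_mod_cast h
    rw [this, C_0]
  | succ k ih =>
    intro θ h0 h1
    obtain ⟨σ', hσ0, hσ1, ih⟩ := ih (θ ^ 2 / 64) (by positivity) (by nlinarith)
    set σ := σ' * θ ^ 2 / (64 * (2 * k + 4)) with hσ
    have hk0 : (0:ℝ) ≤ k := Nat.cast_nonneg _
    have hσpos : 0 < σ := by positivity
    have hθ2 : θ ^ 2 ≤ 1 := by nlinarith
    have hσk : σ * (2 * k + 4) = σ' * θ ^ 2 / 64 := by rw [hσ]; field_simp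
    have hσle : σ * (2 * k + 4) ≤ σ' := by rw [hσk]; nlinarith
    have hσle2 : σ * (2 * k + 4) ≤ θ ^ 2 / 64 := by
      rw [hσk]
      have := mul_le_mul_of_nonneg_right hσ1 (by positivity : 0 ≤ θ ^ 2)
      linarith
    have hσσ' : σ ≤ σ' := by nlinarith
    have hσθ : σ ≤ θ / 2 := by nlinarith
    refine ⟨σ, hσpos, hσσ'.trans hσ1, ?_⟩
    intro d hd1 hd0 hdσ F hF0 hF A hA hn p q hpq hlog
    set w : ℕ → ℝ := fun h => (d h : ℝ)⁻¹ with hw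
    have hw0 : ∀ h, 0 ≤ w h := fun h => by positivity
    set ξ := ratpt p q with hξ
    have hanti : Antitone (fun h => (d h : ℝ)) := antitone_nat_of_succ_le fun h => by
      refine (hdσ h).trans ?_
      have : (0:ℝ) ≤ d h := Nat.cast_nonneg _
      nlinarith
    have hdk1 : 1 ≤ d k := hd1 k (by omega)
    have hdkpos : (0:ℝ) < d k := by exact_mod_cast hdk1
    obtain ⟨s, hs, hs1, μ, ν, hμ, hν, hμk, hμd, hνk, N, U, V, hN, hU0, hV0, hU, hV, hdet⟩ := roth_alg k hF0 hF
    set W := (of fun i l => hd (μ i) (hd (ν l) F)).det with hW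
    have hspos : (0:ℝ) < s := by exact_mod_cast hs1
    -- norm bound
    set A' : ℝ := s * (A + (2 * k + 3) * d 0) with hA'
    have hd00 : (0:ℝ) ≤ d 0 := Nat.cast_nonneg _
    have hnW : n1 W ≤ exp A' := by
      have hDs : ∀ t : Finset ℕ, ∑ h ∈ t, d h ≤ (k + 1) * d 0 := by
        intro t
        calc ∑ h ∈ t, d h = ∑ h ∈ t with h < k + 1, d h := by
              rw [sum_filter]
              refine sum_congr rfl fun h _ => ?_
              split_ifs with h3
              · rfl
              · exact hd0 h (by omega)
          _ ≤ ∑ h ∈ range (k + 1), d h := by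
              refine sum_le_sum_of_subset fun h hh => ?_
              simpa using (mem_filter.1 hh).2
          _ ≤ ∑ h ∈ range (k + 1), d 0 := by
              refine sum_le_sum fun h _ => ?_
              have h9 : (d h : ℝ) ≤ d 0 := hanti (Nat.zero_le h)
              exact_mod_cast h9
          _ = _ := by simp
      have hb : ∀ i l, n1 (hd (μ i) (hd (ν l) F)) ≤ exp (A + (2 * k + 2) * d 0) := by
        intro i l
        have e1 := n1_hd (hF.hd (ν l)) _ hDs (μ i)
        have e2 := n1_hd hF _ hDs (ν l)
        have e3 : (2:ℝ) ^ ((k + 1) * d 0) ≤ exp ((k + 1) * d 0) := by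
          have h2e : (2:ℝ) ≤ exp 1 := by linarith [Real.add_one_le_exp (1:ℝ)]
          calc (2:ℝ) ^ ((k + 1) * d 0) ≤ (exp 1) ^ ((k + 1) * d 0) :=
                pow_le_pow_left₀ (by norm_num) h2e _
            _ = _ := by rw [← exp_nat_mul]; push_cast; ring_nf
        calc _ ≤ exp ((k + 1) * d 0) * (exp ((k + 1) * d 0) * exp A) := by
              refine e1.trans (mul_le_mul e3 (e2.trans ?_) (n1_nonneg _) (exp_pos _).le)
              exact mul_le_mul e3 hn (n1_nonneg _) (exp_pos _).le
          _ = _ := by rw [← exp_add, ← exp_add]; congr 1; ring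
      have e4 := wn_det zabs (ρ := fun _ => 1) (fun _ => zero_le_one)
        (of fun i l => hd (μ i) (hd (ν l) F)) _ hb
      refine e4.trans ?_
      have e5 : (s.factorial : ℝ) ≤ exp (s * d 0) := by
        calc (s.factorial : ℝ) ≤ (s : ℝ) ^ s := by exact_mod_cast Nat.factorial_le_pow s
          _ ≤ (exp (d 0)) ^ s := by
              refine pow_le_pow_left₀ hspos.le ?_ _
              have : (s : ℝ) ≤ d k + 1 := by exact_mod_cast hs
              have h5 : (d k : ℝ) ≤ d 0 := hanti (Nat.zero_le k)
              linarith [Real.add_one_le_exp (d 0 : ℝ)]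
          _ = _ := by rw [← exp_nat_mul]
      calc _ ≤ exp (s * d 0) * exp (A + (2 * k + 2) * d 0) ^ s :=
            mul_le_mul_of_nonneg_right e5 (by positivity)
        _ = _ := by rw [← exp_nat_mul, ← exp_add]; congr 1; rw [hA']; ring
    have hA'0 : 0 ≤ A' := by positivity
    obtain ⟨Wu, Wv, hWu0, hWv0, hWu, hWv, hnu, hnv, hcomb⟩ := roth_upper (s := s) (k := k)
      (d := s • update d k 0) (e := s • (Pi.single k (d k) : ℕ → ℕ)) (by simp)
      (by intro h hh; simp [hh]) hN hU0 hV0 hU hV hdet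
    have hlog' : ∀ h < k + 1, A' + s * d 0 ≤ s * ((σ * (2 * k + 4)) * (d h * log (q h))) := by
      intro h hh
      have := hlog h hh
      have e6 : A + (2 * k + 4) * d 0 ≤ (2 * k + 4) * (A + d 0) := by nlinarith
      have e7 : (2 * k + 4) * (A + d 0) ≤ (2 * k + 4) * (σ * (d h * log (q h))) :=
        mul_le_mul_of_nonneg_left this (by positivity)
      calc A' + s * d 0 = s * (A + (2 * k + 4) * d 0) := by rw [hA']; ring
        _ ≤ s * ((2 * k + 4) * (σ * (d h * log (q h)))) :=
            mul_le_mul_of_nonneg_left (e6.trans e7) hspos.le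
        _ = _ := by ring
    have hdlpos : ∀ h < k + 1, 0 < d h * log (q h) := by
      intro h hh
      have := hlog h hh
      have e8 : (1:ℝ) ≤ d 0 := by exact_mod_cast hd1 0 (by omega)
      by_contra hc
      push Not at hc
      have : σ * (d h * log (q h)) ≤ 0 := mul_nonpos_of_nonneg_of_nonpos hσpos.le hc
      linarith
    -- upper bound
    obtain ⟨f, hf, hfw⟩ := ih (s • update d k 0)
      (by intro h hh
          have : 1 ≤ d h := hd1 h (by omega)
          simp [update_of_ne (show h ≠ k by omega)]
          exact Nat.mul_pos hs1 this)
      (by intro h hh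
          by_cases hk : h = k
          · subst hk; simp
          · simp [update_of_ne hk, hd0 h (by omega)])
      (by intro h
          by_cases hk : h + 1 = k
          · simp [hk]; positivity
          · by_cases hk' : h = k
            · have : d (h + 1) = 0 := hd0 _ (by omega)
              simp [update_of_ne hk, hk', this] 
              rw [← hk', this]; simp
            · simp only [Pi.smul_apply, update_of_ne hk, update_of_ne hk', smul_eq_mul]
              push_cast
              have := hdσ h
              have h9 : (0:ℝ) ≤ d h := Nat.cast_nonneg _
              nlinarith [mul_le_mul_of_nonneg_right hσσ' h9])
      Wu hWu0 hWu A' hA'0 (hnu.trans hnW) p q (fun h hh => hpq h (by omega))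
      (by intro h hh
          simp only [Pi.smul_apply, smul_eq_mul, update_of_ne (show h ≠ k by omega)]
          have e9 := hlog' h (by omega)
          have e10 := hdlpos h (by omega)
          have e11 : σ * (2 * k + 4) * (d h * log (q h)) ≤ σ' * (d h * log (q h)) :=
            mul_le_mul_of_nonneg_right hσle e10.le
          have e12 : ((update d k 0 0 : ℕ) : ℝ) ≤ d 0 := by
            by_cases hk : 0 = k
            · subst hk; simp
            · rw [update_of_ne hk]
          push_cast
          have e13 := mul_le_mul_of_nonneg_left e11 hspos.le
          have e14 := mul_le_mul_of_nonneg_left e12 hspos.le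
          nlinarith)
    obtain ⟨hqk0, hqk⟩ := hpq k (by omega)
    obtain ⟨a, ha, hqa⟩ := uni k _ (by intro h hh; simp [hh]) Wv hWv0 hWv (p k) (q k) hqk0 hqk ξ rfl
    obtain ⟨hcf, hfk⟩ := hcomb ξ f a hf ha
    have haw : (a : ℝ) / d k ≤ s * (θ ^ 2 / 64) := by
      have hlq : 0 < log (q k) := by
        have := hdlpos k (by omega)
        exact (pos_iff_pos_of_mul_pos this).1 hdkpos
      have e1 : (a : ℝ) * log (q k) ≤ A' := by
        have e2 := (hqa.trans hnv).trans hnW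
        have hq0 : (0:ℝ) < q k := by exact_mod_cast hqk0
        rw [← Real.log_le_log_iff (by positivity) (exp_pos _), log_exp, log_pow] at e2
        exact e2
      rw [div_le_iff₀ hdkpos]
      have e3 := hlog' k (by omega)
      have e4 : 0 ≤ s * (d 0 : ℝ) := by positivity
      have e5 := mul_le_mul_of_nonneg_right hσle2 (hdlpos k (by omega)).le
      have e6 := mul_le_mul_of_nonneg_left e5 hspos.le
      have : (a : ℝ) * log (q k) ≤ (s * (θ ^ 2 / 64) * d k) * log (q k) := by
        calc _ ≤ _ := e1
          _ ≤ _ := by linarith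
          _ ≤ _ := e6
          _ = _ := by ring
      exact le_of_mul_le_mul_right this hlq
    have hwf : wt w f ≤ s * wt (fun h => (((s • update d k 0) h : ℕ) : ℝ)⁻¹) f := by
      unfold wt Finsupp.sum
      rw [mul_sum]
      refine sum_le_sum fun h _ => ?_
      by_cases hk : h = k
      · subst hk; simp [hfk]
      · apply le_of_eq
        simp only [Pi.smul_apply, update_of_ne hk, smul_eq_mul, hw]
        push_cast
        rw [mul_inv]
        field_simp
    have hupper : wt w (f + single k a) < s * (θ ^ 2 / 32) := by
      rw [wt_add, wt_single]
      have e1 := mul_lt_mul_of_pos_left hfw hspos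
      have e2 : (a : ℝ) * w k = a / d k := by rw [hw]; rfl
      rw [e2]
      linarith
    by_contra hcon
    push Not at hcon
    have hind : IndGe w θ (shq ξ F) := fun m hm => hcon m hm
    have hent : ∀ i l : Fin s, IndGe w (max 0 (θ / 2 - (l : ℕ) / d k)) (shq ξ (hd (μ i) (hd (ν l) F))) := by
      intro i l m hm
      refine max_le (wt_nonneg hw0 m) ?_
      have e1 : IndGe w (θ - wt w (ν l) - wt w (μ i)) (shq ξ (hd (μ i) (hd (ν l) F))) := by
        unfold shq
        rw [← hd_map, ← hd_map, ← hd_shift, ← hd_shift]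
        exact (hind.hd _).hd _
      have e2 := e1 m hm
      have e3 : wt w (ν l) ≤ (l : ℕ) / d k := by
        have : ν l = single k (ν l k) := by
          ext h
          by_cases hk : h = k
          · subst hk; simp
          · rw [hνk l h hk, single_apply, if_neg (Ne.symm hk)]
        rw [this, wt_single]
        have e4 := hν l
        rw [this, Finsupp.degree_single] at e4
        have : (ν l k : ℝ) ≤ (l : ℕ) := by exact_mod_cast e4
        exact mul_le_mul_of_nonneg_right this (hw0 k)
      have e5 : wt w (μ i) ≤ σ := by
        have e6 : ∀ h, (μ i h : ℝ) * w h ≤ (μ i h) * (σ / d k) := by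
          intro h
          by_cases h0 : μ i h = 0
          · simp [h0]
          · have hdh : d h ≠ 0 := fun h3 => h0 (hμd i h h3)
            have hhk : h < k := by
              by_contra hge
              by_cases hk : h = k
              · subst hk; exact h0 (hμk i)
              · exact hdh (hd0 h (by omega))
            refine mul_le_mul_of_nonneg_left ?_ (Nat.cast_nonneg _)
            have hdhp : (0:ℝ) < d h := by exact_mod_cast Nat.pos_of_ne_zero hdh
            rw [hw]
            simp only
            rw [inv_eq_one_div, div_le_div_iff₀ hdhp hdkpos, one_mul]
            exact (hanti hhk).trans (hdσ h)
        calc wt w (μ i) ≤ ∑ h ∈ (μ i).support, (μ i h : ℝ) * (σ / d k) :=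
              sum_le_sum fun h _ => e6 h
          _ = ((μ i).degree : ℝ) * (σ / d k) := by
              rw [← sum_mul, Finsupp.degree_apply]; push_cast; rfl
          _ ≤ d k * (σ / d k) := by
              refine mul_le_mul_of_nonneg_right ?_ (by positivity)
              have := hμ i
              have h3 := i.2
              exact_mod_cast (by omega : (μ i).degree ≤ d k)
          _ = σ := by field_simp
      linarith
    have hWind : IndGe w (∑ l : Fin s, max 0 (θ / 2 - (l : ℕ) / d k)) (shq ξ W) := by
      have e1 : shq ξ W = (of fun i l => shq ξ (hd (μ i) (hd (ν l) F))).det := by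
        rw [hW]
        unfold shq
        have := AlgHom.map_det (shift ξ) ((of fun i l => map (castRingHom ℚ) (hd (μ i) (hd (ν l) F))))
        have h2 := map_det (map (castRingHom ℚ)) (of fun i l => hd (μ i) (hd (ν l) F))
        rw [h2]
        exact this
      rw [e1, det_apply]
      refine IndGe.sum _ fun π _ => ?_
      have e2 := IndGe.prod hw0 univ (F := fun l => shq ξ (hd (μ (π l)) (hd (ν l) F))) (fun l _ => hent (π l) l)
      rcases units_eq_one_or (Perm.sign π) with h | h
      · rw [h]; simpa using e2
      · rw [h]
        intro m hm
        apply e2 m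
        simpa using hm
    have e1 := hWind _ hcf
    have e2 := count_bound s (d k) hdk1 hs (θ / 2) (by linarith) (by linarith)
    rw [Fin.sum_univ_eq_sum_range (fun l => max 0 (θ / 2 - (l : ℝ) / d k))] at e1
    have : s * (θ / 2) ^ 2 / 8 = s * (θ ^ 2 / 32) := by ring
    linarith

lemma abv_int_le {K : Type*} [Field K] (v : AbsoluteValue K ℝ) (z : ℤ) : v (z : K) ≤ |(z : ℝ)| := by
  have hn : ∀ n : ℕ, v (n : K) ≤ n := by
    intro n
    induction n with
    | zero => simp
    | succ n ih =>
      push_cast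
      refine (v.add_le _ _).trans ?_
      rw [v.map_one]; linarith
  rcases le_total 0 z with h | h
  · obtain ⟨n, rfl⟩ := Int.eq_ofNat_of_zero_le h
    simpa using hn n
  · obtain ⟨n, hn'⟩ := Int.eq_ofNat_of_zero_le (neg_nonneg.2 h)
    have : z = -(n : ℤ) := by linarith
    subst this
    simpa using hn n

lemma abv_sum_le {K ι : Type*} [CommRing K] [Nontrivial K] (v : AbsoluteValue K ℝ) (s : Finset ι) (f : ι → K) :
    v (∑ i ∈ s, f i) ≤ ∑ i ∈ s, v (f i) := by
  classical
  induction s using Finset.induction_on with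
  | empty => simp
  | insert a s ha ih =>
    rw [sum_insert ha, sum_insert ha]
    exact (v.add_le _ _).trans (by linarith)

lemma abv_int_ge {K V : Type*} [Field K] [Fintype V] (v : V → AbsoluteValue K ℝ)
    (hv : ∀ z : ℤ, z ≠ 0 → 1 ≤ ∏ i, v i (z : K)) (i : V) {z : ℤ} (hz : z ≠ 0) :
    1 ≤ |(z : ℝ)| ^ Fintype.card V * v i (z : K) := by
  classical
  have h1 : (1:ℝ) ≤ |(z : ℝ)| := by exact_mod_cast one_le_abs hz
  refine (hv z hz).trans ?_
  rw [← mul_prod_erase univ _ (mem_univ i), mul_comm]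
  refine mul_le_mul_of_nonneg_right ?_ ((v i).nonneg _)
  calc ∏ x ∈ univ.erase i, v x (z : K) ≤ ∏ x ∈ univ.erase i, |(z : ℝ)| :=
        Finset.prod_le_prod (fun _ _ => (v _).nonneg _) fun _ _ => abv_int_le _ _
    _ = |(z : ℝ)| ^ (univ.erase i).card := by simp
    _ ≤ _ := pow_le_pow_right₀ h1 (card_le_card (subset_univ _))

lemma det_int_le {D : Type*} [Fintype D] [DecidableEq D] (M : Matrix D D ℤ) (b : ℝ) (hb : ∀ i j, |(M i j : ℝ)| ≤ b) :
    |(M.det : ℝ)| ≤ (Fintype.card D).factorial * b ^ Fintype.card D := by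
  rw [det_apply]
  push_cast
  refine (abs_sum_le_sum_abs _ _).trans ?_
  have : ∀ π ∈ (univ : Finset (Perm D)), |((Perm.sign π • ∏ i, M (π i) i : ℤ) : ℝ)| ≤ b ^ Fintype.card D := by
    intro π _
    have : |((Perm.sign π • ∏ i, M (π i) i : ℤ) : ℝ)| = ∏ i, |(M (π i) i : ℝ)| := by
      rcases units_eq_one_or (Perm.sign π) with h | h <;> rw [h] <;> simp [abs_prod]
    rw [this]
    calc ∏ i, |(M (π i) i : ℝ)| ≤ ∏ i : D, b := Finset.prod_le_prod (fun _ _ => abs_nonneg _) fun _ _ => hb _ _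
      _ = _ := by simp
  refine (sum_le_card_nsmul _ _ _ this).trans ?_
  simp [card_perm]

/-- Liouville-type inequality -/
lemma liouville {K V ι : Type*} [Field K] [NumberField K] [Fintype V] [Fintype ι] (v : V → AbsoluteValue K ℝ)
    (hv : ∀ z : ℤ, z ≠ 0 → 1 ≤ ∏ i, v i (z : K)) (a : ι → K) :
    ∃ (C : ℝ) (E : ℕ), 0 < C ∧ ∀ (m : ι → ℤ) (H : ℝ), 1 ≤ H → (∀ i, |(m i : ℝ)| ≤ H) →
      ∑ i, (m i : K) * a i ≠ 0 → ∀ i, 1 ≤ C * H ^ E * v i (∑ i, (m i : K) * a i) := by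
  classical
  let ω := Module.finBasis ℚ K
  set D := finrank ℚ K with hD
  have hDpos : 0 < D := Module.finrank_pos
  -- common denominator
  obtain ⟨N, hN⟩ := IsLocalization.exist_integer_multiples (nonZeroDivisors ℤ) (univ : Finset (ι × Fin D × Fin D))
    (fun x => Algebra.leftMulMatrix ω (a x.1) x.2.1 x.2.2)
  have hN0 : (N : ℤ) ≠ 0 := nonZeroDivisors.coe_ne_zero N
  choose! A hA using fun x => hN x (mem_univ x)
  let M : (ι → ℤ) → Sq D ℤ := fun m => of fun s t => ∑ i, m i * A (i, s, t)
  have hM : ∀ m, (M m).map (Int.cast : ℤ → ℚ) = Algebra.leftMulMatrix ω ((N : ℤ) * ∑ i, (m i : K) * a i) := by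
    intro m
    ext s t
    have e1 : (((N : ℤ) : K) * ∑ i, (m i : K) * a i) = ∑ i, ((N : ℤ) * m i : ℤ) • a i := by
      rw [mul_sum]; refine sum_congr rfl fun i _ => ?_
      simp [mul_assoc]
    rw [e1, map_sum, Matrix.sum_apply]
    simp only [map_apply, M, of_apply, Int.cast_sum, Int.cast_mul]
    refine sum_congr rfl fun i _ => ?_
    have := hA (i, s, t)
    rw [map_zsmul, Matrix.smul_apply]
    simp at this ⊢
    rw [this]; ring
  -- bound of A
  obtain ⟨a0, ha0⟩ : ∃ a0 : ℝ, ∀ x, |(A x : ℝ)| ≤ a0 :=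
    ⟨∑ x, |(A x : ℝ)|, fun x => single_le_sum (f := fun x => |(A x : ℝ)|) (fun _ _ => abs_nonneg _) (mem_univ x)⟩
  set a1 : ℝ := max 1 (Fintype.card ι * |a0|) with ha1
  have ha11 : 1 ≤ a1 := le_max_left _ _
  have hMb : ∀ (m : ι → ℤ) (H : ℝ), 1 ≤ H → (∀ i, |(m i : ℝ)| ≤ H) → ∀ s t, |(M m s t : ℝ)| ≤ a1 * H := by
    intro m H hH hm s t
    simp only [M, of_apply, Int.cast_sum, Int.cast_mul]
    refine (abs_sum_le_sum_abs _ _).trans ?_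
    have : ∀ i ∈ univ, |(m i : ℝ) * A (i, s, t)| ≤ H * |a0| := by
      intro i _
      rw [abs_mul]
      exact mul_le_mul (hm i) ((ha0 _).trans (le_abs_self _)) (abs_nonneg _) (by linarith)
    refine (sum_le_card_nsmul _ _ _ this).trans ?_
    have h2 : (Fintype.card ι * |a0|) ≤ a1 := le_max_right _ _
    simp only [card_univ, nsmul_eq_mul]
    nlinarith
  set f := (D.factorial : ℝ) with hf
  have hf1 : 1 ≤ f := by rw [hf]; exact_mod_cast Nat.succ_le_of_lt (Nat.factorial_pos D)
  let i0 : Fin D := ⟨0, hDpos⟩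
  -- constant
  set W : ℝ := ∑ i : V, ∑ t, v i (ω t) with hW
  have hWi : ∀ i, ∑ t, v i (ω t) ≤ W := fun i => single_le_sum (f := fun i => ∑ t, v i (ω t))
    (fun i _ => sum_nonneg fun _ _ => (v i).nonneg _) (mem_univ i)
  have hW0 : 0 ≤ W := sum_nonneg fun i _ => sum_nonneg fun _ _ => (v i).nonneg _
  set w : ℝ := ∑ i : V, (v i (ω i0))⁻¹ with hw
  have hωpos : ∀ i, 0 < v i (ω i0) := fun i => (v i).pos (ω.ne_zero _)
  have hwi : ∀ i, 1 ≤ w * v i (ω i0) := by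
    intro i
    have h1 : (v i (ω i0))⁻¹ ≤ w := single_le_sum (f := fun i => (v i (ω i0))⁻¹)
      (fun i _ => inv_nonneg.2 ((v i).nonneg _)) (mem_univ i)
    calc (1:ℝ) = (v i (ω i0))⁻¹ * v i (ω i0) := (inv_mul_cancel₀ (hωpos i).ne').symm
      _ ≤ _ := mul_le_mul_of_nonneg_right h1 (hωpos i).le
  have hw0 : 0 ≤ w := sum_nonneg fun i _ => inv_nonneg.2 ((v i).nonneg _)
  set c := Fintype.card V with hc
  set B := f * a1 ^ D with hB
  have hB1 : 1 ≤ B := one_le_mul_of_one_le_of_one_le hf1 (one_le_pow₀ ha11)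
  refine ⟨B ^ c * w * B * W * |((N : ℤ) : ℝ)| + 1, D * c + D, by positivity, ?_⟩
  intro m H hH hm hx i
  set x := ∑ i, (m i : K) * a i with hxdef
  have hH0 : 0 ≤ H := by linarith
  have hdet : (M m).det ≠ 0 := by
    intro h0
    have h1 : ((M m).map (Int.cast : ℤ → ℚ)).det = 0 := by
      have := map_det (castRingHom ℚ) (M m)
      rw [h0] at this
      simpa using this.symm
    rw [hM] at h1
    have h2 : Algebra.leftMulMatrix ω (((N : ℤ) : K) * x) * Algebra.leftMulMatrix ω (((N : ℤ) : K) * x)⁻¹ = 1 := by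
      rw [← map_mul, mul_inv_cancel₀, map_one]
      exact mul_ne_zero (by exact_mod_cast hN0) hx
    have h3 := congrArg det h2
    rw [det_mul, h1, zero_mul, det_one] at h3
    exact zero_ne_one h3
  have hdb : |((M m).det : ℝ)| ≤ B * H ^ D := by
    have := det_int_le (M m) (a1 * H) (hMb m H hH hm)
    rw [Fintype.card_fin, mul_pow, ← mul_assoc] at this
    exact this
  -- adjugate
  have hadj : ∀ s t, |((M m).adjugate s t : ℝ)| ≤ B * H ^ D := by
    intro s t
    rw [Matrix.adjugate_apply]
    have := det_int_le ((M m).updateRow t (Pi.single s 1)) (a1 * H) (by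
      intro i j
      rw [Matrix.updateRow_apply]
      split_ifs
      · rw [Pi.single_apply]
        split_ifs <;> simp <;> nlinarith
      · exact hMb m H hH hm _ _)
    rw [Fintype.card_fin, mul_pow, ← mul_assoc] at this
    exact this
  -- key identity
  have hkey : ((M m).det : K) * ω i0 = ((N : ℤ) * x) * ∑ t, ((M m).adjugate t i0 : K) * ω t := by
    have h1 : ∀ t, ((N : ℤ) * x) * ω t = ∑ s, ((M m) s t : K) * ω s := by
      intro t
      have h2 := ω.sum_repr (((N : ℤ) * x) * ω t)
      rw [← h2]
      refine sum_congr rfl fun s _ => ?_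
      have h3 := congrFun (congrFun (hM m) s) t
      rw [Algebra.leftMulMatrix_eq_repr_mul] at h3
      rw [← h3, Algebra.smul_def]
      simp
    have h4 : ∀ s, ∑ t, ((M m) s t : K) * ((M m).adjugate t i0 : K) = if s = i0 then ((M m).det : K) else 0 := by
      intro s
      have := congrFun (congrFun (mul_adjugate (M m)) s) i0
      rw [Matrix.mul_apply, Matrix.smul_apply, Matrix.one_apply] at this
      have h5 := congrArg (Int.cast : ℤ → K) this
      push_cast at h5
      rw [h5]
      split_ifs <;> simp
    rw [mul_sum]
    calc ((M m).det : K) * ω i0 = ∑ s, (if s = i0 then ((M m).det : K) else 0) * ω s := by simp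
      _ = ∑ s, ∑ t, ((M m) s t : K) * ((M m).adjugate t i0 : K) * ω s := by
        refine sum_congr rfl fun s _ => ?_
        rw [← h4, sum_mul]
      _ = ∑ t, ((N : ℤ) * x) * (((M m).adjugate t i0 : K) * ω t) := by
        rw [sum_comm]
        refine sum_congr rfl fun t _ => ?_
        rw [mul_left_comm, h1, mul_sum]
        refine sum_congr rfl fun s _ => ?_
        ring
  have hv1 := congrArg (v i) hkey
  rw [map_mul, map_mul, map_mul] at hv1
  have hsum : v i (∑ t, ((M m).adjugate t i0 : K) * ω t) ≤ B * H ^ D * W := by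
    refine (abv_sum_le _ _ _).trans ?_
    refine le_trans ?_ (mul_le_mul_of_nonneg_left (hWi i) (by positivity))
    rw [mul_sum]
    refine sum_le_sum fun t _ => ?_
    rw [map_mul]
    exact mul_le_mul_of_nonneg_right ((abv_int_le _ _).trans (hadj _ _)) ((v i).nonneg _)
  have hge := abv_int_ge v hv i hdet
  have hxv := (v i).nonneg x
  have hNv := abv_int_le (v i) (N : ℤ)
  calc (1:ℝ) ≤ |((M m).det : ℝ)| ^ c * v i ((M m).det : K) := hge
    _ ≤ (B * H ^ D) ^ c * v i ((M m).det : K) :=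
        mul_le_mul_of_nonneg_right (pow_le_pow_left₀ (abs_nonneg _) hdb _) ((v i).nonneg _)
    _ ≤ (B * H ^ D) ^ c * (v i ((M m).det : K) * (w * v i (ω i0))) := by
        refine mul_le_mul_of_nonneg_left ?_ (by positivity)
        exact le_mul_of_one_le_right ((v i).nonneg _) (hwi i)
    _ = (B * H ^ D) ^ c * w * (v i ((M m).det : K) * v i (ω i0)) := by ring
    _ = (B * H ^ D) ^ c * w * (v i ((N : ℤ) : K) * v i x * v i (∑ t, ((M m).adjugate t i0 : K) * ω t)) := by rw [hv1]
    _ ≤ (B * H ^ D) ^ c * w * (|((N : ℤ) : ℝ)| * v i x * (B * H ^ D * W)) := by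
        refine mul_le_mul_of_nonneg_left ?_ (by positivity)
        refine mul_le_mul (mul_le_mul_of_nonneg_right hNv hxv) hsum ((v i).nonneg _) (by positivity)
    _ = (B ^ c * w * B * W * |((N : ℤ) : ℝ)|) * H ^ (D * c + D) * v i x := by
        rw [mul_pow, ← pow_mul, pow_add]; ring
    _ ≤ _ := by
        refine mul_le_mul_of_nonneg_right ?_ hxv
        refine mul_le_mul_of_nonneg_right ?_ (by positivity)
        linarith

section P2

lemma prim_normal {n : Type*} [Fintype n] [DecidableEq n] (B : Matrix n n ℤ) (o : n) (hB : B.det ≠ 0) :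
    ∃ (m : n → ℤ) (κ g : ℤ), κ ≠ 0 ∧ g ≠ 0 ∧ univ.gcd m = 1 ∧ vecMul m B = Pi.single o κ ∧
      ∀ i, B.adjugate o i = g * m i := by
  have hne : ∃ i, B.adjugate o i ≠ 0 := by
    by_contra! h
    have h1 := congrFun (congrFun (adjugate_mul B) o) o
    rw [Matrix.mul_apply] at h1
    simp [h] at h1
    exact hB h1.symm
  obtain ⟨i0, hi0⟩ := hne
  obtain ⟨m, hm, hg⟩ := Finset.extract_gcd (fun i => B.adjugate o i) (⟨i0, mem_univ _⟩ : (univ : Finset n).Nonempty)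
  set g := univ.gcd (fun i => B.adjugate o i) with hgdef
  have hm' : ∀ i, B.adjugate o i = g * m i := fun i => hm i (mem_univ i)
  have hg0 : g ≠ 0 := by
    intro h0; apply hi0; rw [hm' i0, h0, zero_mul]
  have h1 : ∀ l, g * (vecMul m B) l = if o = l then B.det else 0 := by
    intro l
    have h1 := congrFun (congrFun (adjugate_mul B) o) l
    rw [Matrix.mul_apply, Matrix.smul_apply, Matrix.one_apply] at h1
    simp only [hm', mul_assoc] at h1
    rw [← mul_sum] at h1
    simp only [vecMul, dotProduct]
    rw [h1]
    split_ifs <;> simp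
  refine ⟨m, vecMul m B o, g, ?_, hg0, hg, ?_, hm'⟩
  · intro h0
    have := h1 o
    rw [h0] at this
    simp at this
    exact hB this.symm
  · ext l
    by_cases hl : l = o
    · subst hl; simp
    · rw [Pi.single_apply, if_neg hl]
      have := h1 l
      rw [if_neg (fun h => hl h.symm)] at this
      exact (mul_eq_zero.1 this).resolve_left hg0

lemma adj_bound {K n : Type*} [Field K] [Fintype n] [DecidableEq n] (v : AbsoluteValue K ℝ) (A : Matrix n n K)
    (o i : n) (β : n → ℝ) (hβ : ∀ i, 0 ≤ β i) (hA : ∀ i l, l ≠ o → v (A i l) ≤ β i) :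
    v (A.adjugate o i) ≤ (Fintype.card n).factorial * ∏ i' ∈ univ.erase i, β i' := by
  rw [Matrix.adjugate_apply, det_apply]
  refine (abv_sum_le _ _ _).trans ?_
  have : ∀ π ∈ (univ : Finset (Perm n)),
      v (Perm.sign π • ∏ l, (A.updateRow i (Pi.single o 1)) (π l) l) ≤ ∏ i' ∈ univ.erase i, β i' := by
    intro π _
    have h0 : v (Perm.sign π • ∏ l, (A.updateRow i (Pi.single o 1)) (π l) l)
        = ∏ l, v ((A.updateRow i (Pi.single o 1)) (π l) l) := by
      rcases units_eq_one_or (Perm.sign π) with h | h <;> rw [h] <;> simp [map_prod]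
    rw [h0]
    by_cases hπ : π o = i
    · rw [← mul_prod_erase univ _ (mem_univ o)]
      simp only [hπ, updateRow_self, Pi.single_eq_same, map_one, one_mul]
      have h2 : ∏ i' ∈ univ.erase i, β i' = ∏ l ∈ univ.erase o, β (π l) := by
        symm
        refine prod_bij (fun l _ => π l) ?_ ?_ ?_ ?_
        · intro l hl
          simp at hl ⊢
          intro h; apply hl; apply π.injective; rw [h, hπ]
        · intro a _ b _ h; exact π.injective h
        · intro b hb
          refine ⟨π.symm b, ?_, by simp⟩
          simp at hb ⊢
          intro h; apply hb; rw [← hπ, ← h]; simp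
        · intros; rfl
      rw [h2]
      refine Finset.prod_le_prod (fun _ _ => v.nonneg _) fun l hl => ?_
      simp at hl
      have : π l ≠ i := by
        intro h; apply hl; apply π.injective; rw [h, hπ]
      rw [updateRow_ne this]
      exact hA _ _ hl
    · have : v ((A.updateRow i (Pi.single o 1)) (π (π.symm i)) (π.symm i)) = 0 := by
        have h3 : π.symm i ≠ o := by
          intro h; apply hπ; rw [← h]; simp
        simp [Pi.single_apply, h3]
      rw [prod_eq_zero (mem_univ (π.symm i)) this]
      exact prod_nonneg fun _ _ => hβ _
  refine (sum_le_card_nsmul _ _ _ this).trans ?_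
  simp [card_perm]

lemma freq_pigeon {α : Type*} [Finite α] {P : ℕ → Prop} (f : ℕ → α) (h : ∃ᶠ j in atTop, P j) :
    ∃ z, ∃ᶠ j in atTop, P j ∧ f j = z := by
  by_contra! hc
  have h1 : ∀ᶠ j in atTop, ∀ z, ¬ (P j ∧ f j = z) := by
    rw [Filter.eventually_all]
    intro z
    exact (hc z).mono fun j hj h => hj h.1 h.2
  exact h (h1.mono fun j hj hP => hj (f j) ⟨hP, rfl⟩)

variable {K V n : Type*} [Field K] [NumberField K] [Fintype V] [Fintype n] [DecidableEq n]

lemma height_lower (v : V → AbsoluteValue K ℝ)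
    (hv : ∀ z : ℤ, z ≠ 0 → 1 ≤ ∏ i, v i (z : K)) (o : n) (L P : V → Matrix n n K)
    (hPL : ∀ i, P i * L i = 1) (c : V → n → ℝ) (hc : ∑ i, ∑ t, c i t < 0)
    (Q : ℕ → ℝ) (hQ : Tendsto Q atTop atTop) (B : ℕ → Matrix n n ℤ)
    (hdet : ∀ j, (B j).det ≠ 0)
    (hB : ∀ j i t l, l ≠ o → v i ((L i * (B j).map (Int.cast : ℤ → K)) t l) ≤ Q j ^ c i t)
    (hneg : ∀ m : n → ℤ, m ≠ 0 → ∀ᶠ j in atTop, ∃ l, l ≠ o ∧ vecMul m (B j) l ≠ 0)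
    (m : ℕ → n → ℤ) (κ g : ℕ → ℤ) (hκ : ∀ j, κ j ≠ 0) (hg : ∀ j, g j ≠ 0)
    (hm : ∀ j, vecMul (m j) (B j) = Pi.single o (κ j))
    (hadj : ∀ j i, (B j).adjugate o i = g j * m j i) :
    ∃ η : ℝ, 0 < η ∧ ∀ᶠ j in atTop, ∃ i, Q j ^ η ≤ |(m j i : ℝ)| := by
  classical
  set δ := -∑ i, ∑ t, c i t with hδ
  have hδ0 : 0 < δ := by linarith
  have hLP : ∀ i, L i * P i = 1 := fun i => mul_eq_one_comm.1 (hPL i)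
  have hLdet : ∀ i, (L i).det ≠ 0 := by
    intro i h0
    have := congrArg det (hPL i)
    rw [det_mul, h0, mul_zero, det_one] at this
    exact zero_ne_one this
  -- Liouville constants, uniform over (i,t)
  have hL := fun x : V × n => liouville v hv (fun s => P x.1 s x.2)
  choose CL EL hCL hLi using hL
  set C1 : ℝ := 1 + ∑ x, CL x with hC1
  set E1 : ℕ := ∑ x, EL x with hE1
  have hC1pos : 0 < C1 := by
    have : 0 ≤ ∑ x, CL x := sum_nonneg fun x _ => (hCL x).le
    linarith
  have hliou : ∀ (x : V × n) (m : n → ℤ) (H : ℝ), 1 ≤ H → (∀ i, |(m i : ℝ)| ≤ H) →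
      ∑ s, (m s : K) * P x.1 s x.2 ≠ 0 → 1 ≤ C1 * H ^ E1 * v x.1 (∑ s, (m s : K) * P x.1 s x.2) := by
    intro x m H hH hm hne
    refine (hLi x m H hH hm hne x.1).trans ?_
    refine mul_le_mul_of_nonneg_right ?_ ((v _).nonneg _)
    have h1 : CL x ≤ C1 := by
      have := single_le_sum (f := CL) (fun x _ => (hCL x).le) (mem_univ x)
      linarith
    have h2 : EL x ≤ E1 := single_le_sum (f := EL) (fun x _ => Nat.zero_le _) (mem_univ x)
    exact mul_le_mul h1 (pow_le_pow_right₀ hH h2) (by positivity) hC1pos.le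
  set NV := Fintype.card V with hNV
  set η : ℝ := δ / (4 * (E1 * NV + 1)) with hη
  have hη0 : 0 < η := by positivity
  refine ⟨η, hη0, ?_⟩
  by_contra hcon
  have hfr : ∃ᶠ j in atTop, ∀ i, |(m j i : ℝ)| < Q j ^ η := by
    intro h
    apply hcon
    filter_upwards [h] with j hj
    push Not at hj
    exact hj
  let Z : ℕ → (V × n → Prop) := fun j x => ∑ s, (m j s : K) * P x.1 s x.2 = 0
  obtain ⟨Z0, hZ0⟩ := freq_pigeon (α := V × n → Prop) Z hfr
  obtain ⟨j0, hj0, hZj0⟩ := hZ0.exists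
  have hm0 : ∀ j, m j ≠ 0 := by
    intro j h0
    have := congrFun (hm j) o
    rw [h0] at this
    simp at this
    exact hκ j this.symm
  -- some non-vanishing for each i
  have hex : ∀ i : V, ∃ t, ¬ Z0 (i, t) := by
    intro i
    by_contra! h
    have h1 : vecMul (fun s => (m j0 s : K)) (P i) = 0 := by
      ext t
      have := h t
      rw [← hZj0] at this
      exact this
    have h2 : vecMul (vecMul (fun s => (m j0 s : K)) (P i)) (L i) = 0 := by rw [h1]; simp
    rw [vecMul_vecMul, hPL, vecMul_one] at h2
    apply hm0 j0
    ext s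
    have := congrFun h2 s
    simpa using this
  have hmax : ∀ i : V, ∃ t, ¬ Z0 (i, t) ∧ ∀ t', ¬ Z0 (i, t') → c i t' ≤ c i t := by
    intro i
    obtain ⟨t, ht⟩ := hex i
    obtain ⟨t0, ht0, hmx⟩ := exists_max_image (univ.filter fun t => ¬ Z0 (i, t)) (c i) ⟨t, by simpa using ht⟩
    refine ⟨t0, by simpa using ht0, fun t' h' => hmx t' (by simpa using h')⟩
  choose τ hτ hτmax using hmax
  set S := ∑ i, c i (τ i) with hS
  -- constants
  set f : ℝ := ((Fintype.card n).factorial : ℝ) with hf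
  have hf0 : 0 < f := by rw [hf]; exact_mod_cast Nat.factorial_pos _
  have hQ1 : ∀ᶠ j in atTop, 1 ≤ Q j := hQ.eventually_ge_atTop 1
  -- step 1
  set D1 : ℝ := ∏ i, (f * C1 * (v i (L i).det)⁻¹) with hD1
  have hD10 : 0 < D1 := prod_pos fun i _ => by
    have := (v i).pos (hLdet i); positivity
  have step1 : ∀ j, 1 ≤ Q j → (∀ i, |(m j i : ℝ)| < Q j ^ η) → Z j = Z0 →
      1 ≤ D1 * Q j ^ (-δ - S + η * E1 * NV) := by
    intro j hQj hmj hZj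
    have hQ0 : 0 < Q j := by linarith
    have hH : 1 ≤ Q j ^ η := Real.one_le_rpow hQj hη0.le
    have hi : ∀ i, v i (g j : K) ≤ (f * C1 * (v i (L i).det)⁻¹) * Q j ^ (∑ t, c i t - c i (τ i) + η * E1) := by
      intro i
      set x := ∑ s, (m j s : K) * P i s (τ i) with hx
      have hx0 : x ≠ 0 := by
        have := hτ i
        rw [← hZj] at this
        exact this
      have h1 := hliou (i, τ i) (m j) (Q j ^ η) hH (fun s => (hmj s).le) hx0
      have h2 := adj_bound (v i) (L i * (B j).map (Int.cast : ℤ → K)) o (τ i) (fun t => Q j ^ c i t)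
        (fun t => by positivity) (fun t l hl => hB j i t l hl)
      have hP : (L i).adjugate = (L i).det • P i := by
        have h5 := congrArg (· * P i) (adjugate_mul (L i))
        simp only [Matrix.mul_assoc, hLP, mul_one, Matrix.smul_mul, one_mul] at h5
        exact h5
      have hBad : ((B j).map (Int.cast : ℤ → K)).adjugate = (B j).adjugate.map (Int.cast : ℤ → K) := by
        have := RingHom.map_adjugate (castRingHom K) (B j)
        exact this.symm
      have h3 : (L i * (B j).map (Int.cast : ℤ → K)).adjugate o (τ i) = (g j : K) * ((L i).det * x) := by
        rw [Matrix.adjugate_mul_distrib, hP, hBad, Matrix.mul_apply, hx, mul_sum, mul_sum]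
        refine sum_congr rfl fun s _ => ?_
        simp only [map_apply, hadj, Matrix.smul_apply, smul_eq_mul, Int.cast_mul]
        ring
      rw [h3, map_mul, map_mul] at h2
      have h4 : ∏ i' ∈ univ.erase (τ i), Q j ^ c i i' = Q j ^ (∑ t, c i t - c i (τ i)) := by
        rw [← add_sum_erase univ (c i) (mem_univ (τ i)), add_sub_cancel_left, rpow_sum_of_pos hQ0]
      rw [h4] at h2
      have hd := (v i).pos (hLdet i)
      have hxp := (v i).pos hx0
      have hgv := (v i).nonneg (g j : K)
      have e1 : (Q j ^ η) ^ E1 = Q j ^ (η * E1) := by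
        rw [Real.rpow_mul hQ0.le, Real.rpow_natCast]
      rw [e1] at h1
      rw [rpow_add hQ0]
      set a1 := Q j ^ (∑ t, c i t - c i (τ i))
      set a2 := Q j ^ (η * E1)
      have ha2 : 0 < a2 := by positivity
      calc v i (g j : K) ≤ v i (g j : K) * (C1 * a2 * v i x) := le_mul_of_one_le_right hgv h1
        _ = (v i (g j : K) * (v i (L i).det * v i x)) * (C1 * a2 * (v i (L i).det)⁻¹) := by
            field_simp
        _ ≤ (f * a1) * (C1 * a2 * (v i (L i).det)⁻¹) := mul_le_mul_of_nonneg_right h2 (by positivity)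
        _ = _ := by ring
    calc (1:ℝ) ≤ ∏ i, v i (g j : K) := hv _ (hg j)
      _ ≤ ∏ i, ((f * C1 * (v i (L i).det)⁻¹) * Q j ^ (∑ t, c i t - c i (τ i) + η * E1)) :=
          Finset.prod_le_prod (fun _ _ => (v _).nonneg _) fun i _ => hi i
      _ = D1 * Q j ^ (∑ i, (∑ t, c i t - c i (τ i) + η * E1)) := by
          rw [prod_mul_distrib, ← rpow_sum_of_pos hQ0]
      _ = _ := by
          congr 2
          rw [sum_add_distrib, sum_sub_distrib]
          simp [hδ, hS, hNV]
          ring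
  -- step 2
  set D2 : ℝ := ∏ i, ∑ t, v i (∑ s, (m j0 s : K) * P i s t) with hD2
  have step2 : ∀ j, 1 ≤ Q j → (∃ l, l ≠ o ∧ vecMul (m j0) (B j) l ≠ 0) → 1 ≤ D2 * Q j ^ S := by
    rintro j hQj ⟨l, hl, hne⟩
    have hQ0 : 0 < Q j := by linarith
    have hid : ∀ i, ((vecMul (m j0) (B j) l : ℤ) : K) =
        ∑ t, (∑ s, (m j0 s : K) * P i s t) * (L i * (B j).map (Int.cast : ℤ → K)) t l := by
      intro i
      have h1 : vecMul (vecMul (fun s => (m j0 s : K)) (P i)) (L i * (B j).map (Int.cast : ℤ → K))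
          = vecMul (fun s => (m j0 s : K)) ((B j).map (Int.cast : ℤ → K)) := by
        rw [vecMul_vecMul, ← Matrix.mul_assoc, hPL, one_mul]
      have h2 := congrFun h1 l
      simp only [vecMul, dotProduct, map_apply] at h2 ⊢
      push_cast
      exact h2.symm
    have hi : ∀ i, v i ((vecMul (m j0) (B j) l : ℤ) : K) ≤
        (∑ t, v i (∑ s, (m j0 s : K) * P i s t)) * Q j ^ c i (τ i) := by
      intro i
      rw [hid i]
      refine (abv_sum_le _ _ _).trans ?_
      rw [sum_mul]
      refine sum_le_sum fun t _ => ?_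
      rw [map_mul]
      by_cases hz : Z0 (i, t)
      · have : ∑ s, (m j0 s : K) * P i s t = 0 := by
          rw [← hZj0] at hz; exact hz
        rw [this]; simp
      · refine mul_le_mul_of_nonneg_left ?_ ((v i).nonneg _)
        refine (hB j i t l hl).trans ?_
        exact rpow_le_rpow_of_exponent_le hQj (hτmax i t hz)
    calc (1:ℝ) ≤ ∏ i, v i ((vecMul (m j0) (B j) l : ℤ) : K) := hv _ hne
      _ ≤ ∏ i, ((∑ t, v i (∑ s, (m j0 s : K) * P i s t)) * Q j ^ c i (τ i)) :=
          Finset.prod_le_prod (fun _ _ => (v _).nonneg _) fun i _ => hi i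
      _ = _ := by rw [prod_mul_distrib, ← rpow_sum_of_pos hQ0]
  -- contradiction
  have hηE : η * E1 * NV ≤ δ / 4 := by
    have h1 : η * (E1 * NV + 1) = δ / 4 := by rw [hη]; field_simp
    nlinarith
  by_cases hSδ : S < -δ / 2
  · have ht : Tendsto (fun j => D2 * Q j ^ S) atTop (nhds (D2 * 0)) := by
      refine Tendsto.const_mul _ ?_
      have := (tendsto_rpow_neg_atTop (show 0 < -S by linarith)).comp hQ
      simpa [comp_def] using this
    rw [mul_zero] at ht
    have h1 := ht.eventually (gt_mem_nhds (show (0:ℝ) < 1 by norm_num))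
    obtain ⟨j, hj1, hj2, hj3⟩ := (h1.and (hQ1.and (hneg (m j0) (hm0 j0)))).exists
    have := step2 j hj2 hj3
    linarith
  · have hexp : 0 < -(-δ - S + η * E1 * NV) := by push Not at hSδ; linarith
    have ht : Tendsto (fun j => D1 * Q j ^ (-δ - S + η * E1 * NV)) atTop (nhds (D1 * 0)) := by
      refine Tendsto.const_mul _ ?_
      have := (tendsto_rpow_neg_atTop hexp).comp hQ
      rw [neg_neg] at this
      simpa [comp_def] using this
    rw [mul_zero] at ht
    have h1 := ht.eventually (gt_mem_nhds (show (0:ℝ) < 1 by norm_num))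
    obtain ⟨j, ⟨hj1, hj2⟩, hj3, hj4⟩ := ((hZ0.and_eventually (hQ1.and h1))).exists
    have := step1 j hj3 hj1 hj2
    linarith

end P2

section P3

section count
variable {n : Type*} [Fintype n] [DecidableEq n]

/-- compositions -/
def comp (n : Type*) [Fintype n] [DecidableEq n] (d : ℕ) : Finset (n → ℕ) := piAntidiag univ d

lemma mem_comp {d : ℕ} {e : n → ℕ} : e ∈ comp n d ↔ ∑ i, e i = d := by simp [comp]

lemma comp_le {d : ℕ} {e : n → ℕ} (h : e ∈ comp n d) (i : n) : e i ≤ d := by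
  rw [← mem_comp.1 h]
  exact single_le_sum (f := e) (fun _ _ => Nat.zero_le _) (mem_univ i)

lemma comp_card_le (d : ℕ) : (comp n d).card ≤ (d + 1) ^ Fintype.card n := by
  have : comp n d ⊆ piFinset fun _ => range (d + 1) := by
    intro e he
    simp only [mem_piFinset, mem_range]
    intro i
    have := comp_le he i
    omega
  refine (card_le_card this).trans ?_
  simp

lemma comp_card_pos [Nonempty n] (d : ℕ) : 0 < (comp n d).card := by
  rw [card_pos]
  refine ⟨Pi.single (Classical.arbitrary n) d, ?_⟩
  rw [mem_comp]; simp

lemma sum_coord (d : ℕ) (i : n) :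
    (∑ e ∈ comp n d, (e i : ℝ)) * Fintype.card n = d * (comp n d).card := by
  have h1 : ∀ j, ∑ e ∈ comp n d, (e j : ℝ) = ∑ e ∈ comp n d, (e i : ℝ) := by
    intro j
    refine sum_bij (fun e _ => e ∘ swap i j) ?_ ?_ ?_ ?_
    · intro e he
      rw [mem_comp] at he ⊢
      rw [← he]
      exact Equiv.sum_comp (swap i j) e
    · intro a _ b _ h
      ext x
      have := congrFun h (swap i j x)
      simpa using this
    · intro b hb
      refine ⟨b ∘ swap i j, ?_, ?_⟩
      · rw [mem_comp] at hb ⊢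
        rw [← hb]
        exact Equiv.sum_comp (swap i j) b
      · ext x; simp
    · intro e _; simp
  have h2 : ∑ j, ∑ e ∈ comp n d, (e j : ℝ) = d * (comp n d).card := by
    rw [sum_comm]
    have : ∀ e ∈ comp n d, ∑ j, (e j : ℝ) = d := by
      intro e he
      have := mem_comp.1 he
      exact_mod_cast this
    rw [sum_congr rfl this]
    simp [mul_comm]
  rw [← h2, sum_congr rfl fun j _ => h1 j]
  simp [mul_comm]

/-- deviation function -/
def dev (c : n → ℝ) (d : ℕ) (e : n → ℕ) : ℝ := ∑ i, c i * (e i / d - 1 / Fintype.card n)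

lemma dev_sum [Nonempty n] (c : n → ℝ) (d : ℕ) (hd : 1 ≤ d) : ∑ e ∈ comp n d, dev c d e = 0 := by
  unfold dev
  rw [sum_comm]
  refine sum_eq_zero fun i _ => ?_
  rw [← mul_sum, sum_sub_distrib, ← sum_div]
  have h := sum_coord (n := n) d i
  have hN : (Fintype.card n : ℝ) ≠ 0 := by exact_mod_cast Fintype.card_ne_zero
  have hd' : (d : ℝ) ≠ 0 := by positivity
  have : (∑ e ∈ comp n d, (e i : ℝ)) = d * (comp n d).card / Fintype.card n := by
    rw [← h]; field_simp
  rw [this]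
  simp
  right
  field_simp
  ring

lemma dev_abs [Nonempty n] (c : n → ℝ) (d : ℕ) (hd : 1 ≤ d) {e : n → ℕ} (he : e ∈ comp n d) :
    |dev c d e| ≤ ∑ i, |c i| := by
  unfold dev
  refine (abs_sum_le_sum_abs _ _).trans (sum_le_sum fun i _ => ?_)
  rw [abs_mul]
  refine mul_le_of_le_one_right (abs_nonneg _) ?_
  have hd' : (0:ℝ) < d := by exact_mod_cast hd
  have h1 : (e i : ℝ) / d ≤ 1 := by
    rw [div_le_one hd']; exact_mod_cast comp_le he i
  have h2 : (0:ℝ) ≤ (e i : ℝ) / d := by positivity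
  have h3 : (1:ℝ) / Fintype.card n ≤ 1 := by
    rw [div_le_one (by exact_mod_cast Fintype.card_pos)]
    exact_mod_cast Nat.succ_le_of_lt Fintype.card_pos
  have h4 : (0:ℝ) ≤ 1 / Fintype.card n := by positivity
  rw [abs_le]; constructor <;> linarith

lemma dev_exp [Nonempty n] (c : n → ℝ) (d : ℕ) (hd : 1 ≤ d) (C t : ℝ) (hC : ∑ i, |c i| ≤ C) (ht : 0 ≤ t) (htC : t * C ≤ 1) :
    ∑ e ∈ comp n d, exp (t * dev c d e) ≤ (comp n d).card * exp (t ^ 2 * C ^ 2) := by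
  have h1 : ∀ e ∈ comp n d, exp (t * dev c d e) ≤ (1 + t ^ 2 * C ^ 2) + t * dev c d e := by
    intro e he
    have h2 := (dev_abs c d hd he).trans hC
    have h3 : |t * dev c d e| ≤ t * C := by
      rw [abs_mul, abs_of_nonneg ht]
      exact mul_le_mul_of_nonneg_left h2 ht
    have h4 := Real.abs_exp_sub_one_sub_id_le (h3.trans htC)
    have h5 : (t * dev c d e) ^ 2 ≤ (t * C) ^ 2 := by
      rw [← sq_abs]
      exact pow_le_pow_left₀ (abs_nonneg _) h3 2
    have := (abs_le.1 h4).2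
    nlinarith
  refine (sum_le_sum h1).trans ?_
  rw [sum_add_distrib, ← mul_sum, dev_sum c d hd]
  simp only [sum_const, nsmul_eq_mul, mul_zero, add_zero]
  refine mul_le_mul_of_nonneg_left ?_ (Nat.cast_nonneg _)
  have := Real.add_one_le_exp (t ^ 2 * C ^ 2)
  linarith

/-- exponents -/
def Epi (n : Type*) [Fintype n] [DecidableEq n] {k : ℕ} (d : Fin k → ℕ) : Finset (Fin k → n → ℕ) :=
  piFinset fun h => comp n (d h)

lemma Epi_card {k : ℕ} (d : Fin k → ℕ) : (Epi n d).card = ∏ h, (comp n (d h)).card := by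
  simp [Epi]

lemma bad_count [Nonempty n] (c : n → ℝ) (ε : ℝ) (hε : 0 < ε) : ∃ r : ℝ, 0 < r ∧ ∀ (k : ℕ) (d : Fin k → ℕ),
    (∀ h, 1 ≤ d h) → (((Epi n d).filter fun e => ε * k < ∑ h, dev c (d h) (e h)).card : ℝ)
      ≤ exp (- r * k) * (Epi n d).card := by
  set C := ∑ i, |c i| + 1 + ε with hC
  have hs : 0 ≤ ∑ i, |c i| := sum_nonneg fun _ _ => abs_nonneg _
  have hC0 : 0 < C := by positivity
  set t := ε / (2 * C ^ 2) with ht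
  have ht0 : 0 < t := by positivity
  have htC : t * C ≤ 1 := by
    have : t * C = ε / (2 * C) := by rw [ht]; field_simp
    rw [this, div_le_one (by positivity)]; linarith
  refine ⟨ε ^ 2 / (4 * C ^ 2), by positivity, ?_⟩
  intro k d hd
  have h1 : ∑ e ∈ Epi n d, exp (t * ∑ h, dev c (d h) (e h)) ≤ (Epi n d).card * exp (k * (t ^ 2 * C ^ 2)) := by
    have e1 : ∀ e : Fin k → n → ℕ, exp (t * ∑ h, dev c (d h) (e h)) = ∏ h, exp (t * dev c (d h) (e h)) := by
      intro e; rw [mul_sum, exp_sum]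
    simp only [e1]
    unfold Epi
    rw [← prod_univ_sum (fun h => comp n (d h)) (fun h x => exp (t * dev c (d h) x))]
    refine (Finset.prod_le_prod (fun h _ => sum_nonneg fun _ _ => (exp_pos _).le)
      fun h _ => dev_exp c (d h) (hd h) C t (by linarith) ht0.le htC).trans ?_
    rw [prod_mul_distrib, Fintype.card_piFinset, prod_const, card_univ, Fintype.card_fin, ← exp_nat_mul,
      Nat.cast_prod]
  have h2 : (((Epi n d).filter fun e => ε * k < ∑ h, dev c (d h) (e h)).card : ℝ) * exp (t * (ε * k)) ≤
      ∑ e ∈ Epi n d, exp (t * ∑ h, dev c (d h) (e h)) := by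
    have h21 : ∀ e ∈ (Epi n d).filter (fun e => ε * k < ∑ h, dev c (d h) (e h)),
        exp (t * (ε * k)) ≤ exp (t * ∑ h, dev c (d h) (e h)) := by
      intro e he
      have := (mem_filter.1 he).2
      exact exp_le_exp.2 (mul_le_mul_of_nonneg_left this.le ht0.le)
    have h22 := card_nsmul_le_sum _ _ _ h21
    rw [nsmul_eq_mul] at h22
    refine h22.trans ?_
    rw [sum_filter]
    refine sum_le_sum fun e _ => ?_
    split_ifs
    · exact le_rfl
    · exact (exp_pos _).le
  have h3 := h2.trans h1
  have h4 : exp (-(ε ^ 2 / (4 * C ^ 2)) * k) = exp (k * (t ^ 2 * C ^ 2)) * exp (-(t * (ε * k))) := by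
    rw [← exp_add]
    congr 1
    rw [ht]; field_simp; ring
  rw [h4]
  have h5 : exp (t * (ε * k)) * exp (-(t * (ε * k))) = 1 := by rw [← exp_add]; simp
  calc _ = (((Epi n d).filter fun e => ε * k < ∑ h, dev c (d h) (e h)).card : ℝ) * exp (t * (ε * k)) * exp (-(t * (ε * k))) := by
        rw [mul_assoc, h5, mul_one]
    _ ≤ (Epi n d).card * exp (k * (t ^ 2 * C ^ 2)) * exp (-(t * (ε * k))) :=
        mul_le_mul_of_nonneg_right h3 (exp_pos _).le
    _ = _ := by ring
end count

lemma siegel' {α β : Type*} [Fintype α] [Fintype β] [DecidableEq β] (A : Matrix α β ℤ) (b : ℝ) (hb : 1 ≤ b)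
    (hA : ∀ i j, |(A i j : ℝ)| ≤ b) (hcard : 2 * Fintype.card α ≤ Fintype.card β) (hβ : 0 < Fintype.card β) :
    ∃ t : β → ℤ, t ≠ 0 ∧ A.mulVec t = 0 ∧ ∀ i, |(t i : ℝ)| ≤ Fintype.card β * b := by
  have hβ1 : (1:ℝ) ≤ Fintype.card β := by exact_mod_cast hβ
  rcases Nat.eq_zero_or_pos (Fintype.card α) with h0 | h0
  · obtain ⟨i0⟩ := card_pos_iff.1 hβ
    haveI := Fintype.card_eq_zero_iff.1 h0
    refine ⟨Pi.single i0 1, by simp, Subsingleton.elim _ _, ?_⟩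
    intro i
    rw [Pi.single_apply]
    split_ifs <;> simp <;> nlinarith
  · letI : SeminormedAddCommGroup (Matrix α β ℤ) := Matrix.seminormedAddCommGroup
    obtain ⟨t, ht0, ht, hn⟩ := Int.Matrix.exists_ne_zero_int_vec_norm_le A (by omega) h0
    refine ⟨t, ht0, ht, fun i => ?_⟩
    have h1 : |(t i : ℝ)| ≤ ‖t‖ := by
      have := norm_le_pi_norm t i
      simpa [Int.norm_eq_abs] using this
    have h2 : ‖A‖ ≤ b := by
      rw [Matrix.norm_le_iff (by linarith)]
      intro i j
      rw [Int.norm_eq_abs]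
      exact hA i j
    have h3 : max 1 ‖A‖ ≤ b := max_le hb h2
    have h4 : (1:ℝ) ≤ max 1 ‖A‖ := le_max_left _ _
    refine h1.trans (hn.trans ?_)
    have hpos : (0:ℝ) < Fintype.card β - Fintype.card α := by
      have : Fintype.card α < Fintype.card β := by omega
      have : (Fintype.card α : ℝ) < Fintype.card β := by exact_mod_cast this
      linarith
    have h5 : (Fintype.card α : ℝ) / (Fintype.card β - Fintype.card α) ≤ 1 := by
      rw [div_le_one hpos]
      have : (2 * Fintype.card α : ℝ) ≤ Fintype.card β := by exact_mod_cast hcard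
      linarith
    calc _ ≤ ((Fintype.card β : ℝ) * max 1 ‖A‖) ^ (1:ℝ) :=
          rpow_le_rpow_of_exponent_le (by nlinarith) h5
      _ = _ := Real.rpow_one _
      _ ≤ _ := mul_le_mul_of_nonneg_left h3 (by linarith)

end P3

section P4

section lin
variable {σ R : Type*} [CommRing R]

lemma wn_mono (v : AbsoluteValue R ℝ) {ρ ρ' : σ → ℝ} (hρ : ∀ h, 0 ≤ ρ h) (h : ∀ x, ρ x ≤ ρ' x) (F : MvP σ R) :
    wn v ρ F ≤ wn v ρ' F := by
  unfold wn
  refine sum_le_sum fun m _ => mul_le_mul_of_nonneg_left ?_ (v.nonneg _)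
  exact Finset.prod_le_prod (fun x _ => pow_nonneg (hρ x) _) fun x _ => pow_le_pow_left₀ (hρ x) (h x) _

lemma wn_aeval [Nontrivial R] {τ : Type*} (v : AbsoluteValue R ℝ) {ρ : τ → ℝ} (hρ : ∀ h, 0 ≤ ρ h) (g : σ → MvP τ R)
    (F : MvP σ R) : wn v ρ (aeval g F) ≤ wn v (fun x => wn v ρ (g x)) F := by
  conv_lhs => rw [F.as_sum]
  rw [map_sum]
  refine (wn_sum v hρ _ _).trans ?_
  unfold wn
  refine sum_le_sum fun m _ => ?_
  rw [aeval_monomial]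
  refine (wn_mul v hρ _ _).trans ?_
  rw [algebraMap_eq, wn_C]
  refine mul_le_mul_of_nonneg_left ?_ (v.nonneg _)
  unfold Finsupp.prod
  refine (wn_prod v hρ _ _).trans (Finset.prod_le_prod (fun x _ => wn_nonneg v hρ _) fun x _ => ?_)
  exact wn_pow v hρ _ _

variable {n : Type*} [Fintype n] [DecidableEq n] {k : ℕ}

/-- linear substitution -/
def lin (M : Fin k → Matrix n n R) : MvP (Fin k × n) R →ₐ[R] MvP (Fin k × n) R :=
  aeval fun x => ∑ l, C (M x.1 x.2 l) * X (x.1, l)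

lemma lin_X (M : Fin k → Matrix n n R) (x : Fin k × n) : lin M (X x) = ∑ l, C (M x.1 x.2 l) * X (x.1, l) := by
  simp [lin]

lemma lin_lin (M M' : Fin k → Matrix n n R) (F : MvP (Fin k × n) R) :
    lin M (lin M' F) = lin (fun h => M' h * M h) F := by
  have : (lin M).comp (lin M') = lin (fun h => M' h * M h) := by
    ext1 x
    rw [AlgHom.comp_apply, lin_X, lin_X, map_sum]
    simp only [map_mul, lin_X, algHom_C, algebraMap_eq, Matrix.mul_apply, map_sum, sum_mul, mul_sum]
    rw [sum_comm]
    refine sum_congr rfl fun i _ => sum_congr rfl fun j _ => by ring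
  rw [← this]; rfl

lemma lin_one (F : MvP (Fin k × n) R) : lin (fun _ => (1 : Matrix n n R)) F = F := by
  have : lin (fun _ : Fin k => (1 : Matrix n n R)) = AlgHom.id R _ := by
    ext1 x
    rw [lin_X]
    simp [Matrix.one_apply]
  rw [this]; rfl

lemma map_lin {S : Type*} [CommRing S] (f : R →+* S) (M : Fin k → Matrix n n R) (F : MvP (Fin k × n) R) :
    map f (lin M F) = lin (fun h => (M h).map f) (map f F) := by
  induction F using MvPolynomial.induction_on with
  | C a => simp [algHom_C]
  | add p q hp hq => simp [hp, hq]
  | mul_X p x hp => simp [hp, lin_X, map_sum]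

lemma wn_lin [Nontrivial R] (v : AbsoluteValue R ℝ) {ρ ρ' : Fin k × n → ℝ} (hρ : ∀ h, 0 ≤ ρ h) (M : Fin k → Matrix n n R)
    (h : ∀ x, ∑ l, v (M x.1 x.2 l) * ρ (x.1, l) ≤ ρ' x) (F : MvP (Fin k × n) R) :
    wn v ρ (lin M F) ≤ wn v ρ' F := by
  refine (wn_aeval v hρ _ F).trans (wn_mono v (fun x => wn_nonneg v hρ _) (fun x => le_trans ?_ (h x)) F)
  refine (wn_sum v hρ _ _).trans (sum_le_sum fun l _ => (wn_mul v hρ _ _).trans ?_)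
  rw [wn_C, wn_X]

/-- multihomogeneous -/
def MH (d : Fin k → ℕ) (F : MvP (Fin k × n) R) : Prop := ∀ m, coeff m F ≠ 0 → ∀ h, ∑ i, m (h, i) = d h

lemma MH.mul {d e : Fin k → ℕ} {F G : MvP (Fin k × n) R} (hF : MH d F) (hG : MH e G) :
    MH (d + e) (F * G) := by
  intro m hm h
  obtain ⟨a, b, hab, ha, hb⟩ := coeff_mul_ne hm
  rw [← hab]
  simp [sum_add_distrib, hF _ ha, hG _ hb]

lemma MH.sum {ι : Type*} {d : Fin k → ℕ} (s : Finset ι) {F : ι → MvP (Fin k × n) R} (hF : ∀ i ∈ s, MH d (F i)) :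
    MH d (∑ i ∈ s, F i) := by
  intro m hm h
  rw [coeff_sum] at hm
  obtain ⟨i, hi, hne⟩ := exists_ne_zero_of_sum_ne_zero hm
  exact hF i hi m hne h

lemma MH.C (a : R) : MH (0 : Fin k → ℕ) (C a : MvP (Fin k × n) R) := by
  intro m hm h
  rw [coeff_C] at hm
  split_ifs at hm with h0
  · subst h0; simp
  · exact absurd rfl hm

lemma MH.pow {d : Fin k → ℕ} {F : MvP (Fin k × n) R} (hF : MH d F) (a : ℕ) : MH (a • d) (F ^ a) := by
  induction a with
  | zero => simpa using MH.C (1:R)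
  | succ a ih => rw [pow_succ, add_smul, one_smul]; exact ih.mul hF

lemma MH.prod {ι : Type*} {d : ι → Fin k → ℕ} (s : Finset ι) {F : ι → MvP (Fin k × n) R} (hF : ∀ i ∈ s, MH (d i) (F i)) :
    MH (∑ i ∈ s, d i) (∏ i ∈ s, F i) := by
  classical
  induction s using Finset.induction_on with
  | empty => simpa using MH.C (1:R)
  | insert a s ha ih =>
    rw [sum_insert ha, prod_insert ha]
    exact (hF a (mem_insert_self _ _)).mul (ih fun i hi => hF i (mem_insert_of_mem hi))

lemma MH.X (x : Fin k × n) : MH (Pi.single x.1 1) (X x : MvP (Fin k × n) R) := by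
  intro m hm h
  rw [coeff_X'] at hm
  split_ifs at hm with h0
  · subst h0
    rcases x with ⟨x1, x2⟩
    simp only [single_apply, Prod.mk.injEq, Pi.single_apply]
    by_cases hx : x1 = h
    · simp [hx]
    · simp [hx, Ne.symm hx]
  · exact absurd rfl hm

lemma MH.lin {d : Fin k → ℕ} {F : MvP (Fin k × n) R} (hF : MH d F) (M : Fin k → Matrix n n R) :
    MH d (lin M F) := by
  rw [F.as_sum, map_sum]
  refine MH.sum _ fun m hm => ?_
  have hd := hF m (mem_support_iff.1 hm)
  unfold Sub.lin
  rw [aeval_monomial, algebraMap_eq]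
  unfold Finsupp.prod
  have h1 : MH (0 + ∑ x ∈ m.support, m x • (Pi.single x.1 1 : Fin k → ℕ)) (MvPolynomial.C (coeff m F) *
      ∏ x ∈ m.support, (∑ l, MvPolynomial.C (M x.1 x.2 l) * MvPolynomial.X (x.1, l)) ^ m x) := by
    refine (MH.C _).mul (MH.prod _ fun x _ => MH.pow (MH.sum _ fun l _ => ?_) _)
    have := (MH.C (n := n) (k := k) (M x.1 x.2 l)).mul (MH.X (R := R) (x.1, l))
    simpa using this
  convert h1 using 1
  funext h
  rw [← hd h, zero_add, Finset.sum_apply, sum_subset (subset_univ m.support), sum_prod_type, sum_eq_single h]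
  · simp
  · intro b _ hb
    simp [Pi.single_apply, hb.symm]
  · simp
  · intro x _ hx
    simp [Finsupp.notMem_support_iff.1 hx]

lemma MH.map {S : Type*} [CommRing S] (f : R →+* S) {d : Fin k → ℕ} {F : MvP (Fin k × n) R} (hF : MH d F) :
    MH d (MvPolynomial.map f F) := by
  intro m hm h
  rw [coeff_map] at hm
  exact hF m (fun h0 => hm (by rw [h0, map_zero])) h

/-- exponent vector as finsupp -/
def toF (e : Fin k → n → ℕ) : Fin k × n →₀ ℕ := Finsupp.equivFunOnFinite.symm fun x => e x.1 x.2

lemma toF_apply (e : Fin k → n → ℕ) (x : Fin k × n) : toF e x = e x.1 x.2 := rfl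

lemma toF_inj : Injective (toF (n := n) (k := k)) := by
  intro e f h
  funext a b
  have := DFunLike.congr_fun h (a, b)
  simpa [toF_apply] using this

lemma toF_surj (m : Fin k × n →₀ ℕ) : toF (fun h i => m (h, i)) = m := by
  ext x; simp [toF_apply]

end lin

section aux
variable {n : Type*} [Fintype n] [DecidableEq n] [Nonempty n]

lemma aux_poly {O : Type*} [CommRing O] [Nontrivial O] {ι τ V : Type*} [Fintype ι] [Fintype τ] [Fintype V]
    (r : ι → O →+ ℤ) (hr : ∀ x, (∀ i, r i x = 0) → x = 0) (w : τ → AbsoluteValue O ℝ) (C : ℝ) (hC : 0 ≤ C)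
    (hrw : ∀ i x, |(r i x : ℝ)| ≤ C * ∑ t, w t x) (P : V → Matrix n n O) (c : V → n → ℝ) (ε : ℝ) (hε : 0 < ε) :
    ∃ (k0 : ℕ) (C1 : ℝ), 0 < C1 ∧ ∀ k, k0 ≤ k → 1 ≤ k → ∀ d : Fin k → ℕ, (∀ h, 1 ≤ d h) →
      ∃ G : MvP (Fin k × n) ℤ, G ≠ 0 ∧ MH d G ∧ n1 G ≤ exp (C1 * ∑ h, (d h : ℝ)) ∧
        ∀ v e, coeff e (lin (fun _ => P v) (map (castRingHom O) G)) ≠ 0 →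
          ∑ h, dev (c v) (d h) (fun i => e (h, i)) ≤ ε * k := by
  classical
  choose ρ hρ0 hρ using fun v => bad_count (c v) ε hε
  have hlim : Tendsto (fun k : ℕ => (Fintype.card ι : ℝ) * ∑ v, exp (- ρ v * k)) atTop (nhds 0) := by
    have : Tendsto (fun k : ℕ => (Fintype.card ι : ℝ) * ∑ v, exp (- ρ v * k)) atTop
        (nhds ((Fintype.card ι : ℝ) * ∑ v : V, 0)) := by
      refine Tendsto.const_mul _ (tendsto_finsetSum _ fun v _ => ?_)
      refine Real.tendsto_exp_atBot.comp ?_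
      exact Tendsto.const_mul_atTop_of_neg (by linarith [hρ0 v]) tendsto_natCast_atTop_atTop
    simpa using this
  obtain ⟨k0, hk0⟩ := eventually_atTop.1 (hlim.eventually (ge_mem_nhds (show (0:ℝ) < 1/2 by norm_num)))
  -- bound for the entries
  set B : ℝ := 1 + ∑ v, ∑ t, ∑ i, ∑ j, w t (P v i j) with hB
  have hB1 : 1 ≤ B := by
    have : 0 ≤ ∑ v, ∑ t, ∑ i, ∑ j, w t (P v i j) := by positivity
    linarith
  have hrow : ∀ v t i, ∑ j, w t (P v i j) ≤ B := by
    intro v t i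
    have h1 : ∑ j, w t (P v i j) ≤ ∑ i, ∑ j, w t (P v i j) :=
      single_le_sum (f := fun i => ∑ j, w t (P v i j)) (fun _ _ => by positivity) (mem_univ i)
    have h2 : ∑ i, ∑ j, w t (P v i j) ≤ ∑ t, ∑ i, ∑ j, w t (P v i j) :=
      single_le_sum (f := fun t => ∑ i, ∑ j, w t (P v i j)) (fun _ _ => by positivity) (mem_univ t)
    have h3 : ∑ t, ∑ i, ∑ j, w t (P v i j) ≤ ∑ v, ∑ t, ∑ i, ∑ j, w t (P v i j) :=
      single_le_sum (f := fun v => ∑ t, ∑ i, ∑ j, w t (P v i j)) (fun _ _ => by positivity) (mem_univ v)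
    linarith
  set N := Fintype.card n
  set C' : ℝ := C * Fintype.card τ + 1 with hC'
  have hC'1 : 1 ≤ C' := by have : 0 ≤ C * Fintype.card τ := by positivity
                           linarith
  refine ⟨k0, 2 * N + log B + log C' + 1, ?_, ?_⟩
  · have := log_nonneg hB1
    have := log_nonneg hC'1
    positivity
  intro k hk hk1 d hd
  set S : ℝ := ∑ h, (d h : ℝ) with hS
  have hS1 : 1 ≤ S := by
    have : (d ⟨0, hk1⟩ : ℝ) ≤ S := single_le_sum (f := fun h => (d h : ℝ)) (fun _ _ => by positivity) (mem_univ _)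
    have h2 : (1:ℝ) ≤ d ⟨0, hk1⟩ := by exact_mod_cast hd _
    linarith
  let β := {e // e ∈ Epi n d}
  let α := (Σ v : V, {e // e ∈ (Epi n d).filter fun e => ε * k < ∑ h, dev (c v) (d h) (e h)}) × ι
  let A : Matrix α β ℤ := fun a f => r a.2 (coeff (toF a.1.2.1) (lin (fun _ => P a.1.1) (monomial (toF f.1) 1)))
  have hβc : Fintype.card β = (Epi n d).card := card_coe _
  have hβpos : 0 < Fintype.card β := by
    rw [hβc, Epi_card]
    exact prod_pos fun h _ => comp_card_pos _
  have hβle : (Fintype.card β : ℝ) ≤ exp (N * S) := by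
    rw [hβc, Epi_card, hS, mul_sum, exp_sum]
    push_cast
    refine Finset.prod_le_prod (fun _ _ => Nat.cast_nonneg _) fun h _ => ?_
    have h1 : ((comp n (d h)).card : ℝ) ≤ ((d h : ℝ) + 1) ^ N := by exact_mod_cast comp_card_le (n := n) (d h)
    refine h1.trans ?_
    rw [exp_nat_mul]
    exact pow_le_pow_left₀ (by positivity) (Real.add_one_le_exp _) _
  have hαβ : 2 * Fintype.card α ≤ Fintype.card β := by
    have h1 : (Fintype.card α : ℝ) ≤ 1/2 * Fintype.card β := by
      have h2 : (Fintype.card α : ℝ) = (∑ v : V, (((Epi n d).filter fun e => ε * k < ∑ h, dev (c v) (d h) (e h)).card : ℝ)) * Fintype.card ι := by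
        simp only [α, Fintype.card_prod, Fintype.card_sigma, card_coe]
        push_cast
        rfl
      rw [h2]
      have h3 : (∑ v : V, (((Epi n d).filter fun e => ε * k < ∑ h, dev (c v) (d h) (e h)).card : ℝ)) ≤ ∑ v, exp (-ρ v * k) * Fintype.card β :=
        sum_le_sum fun v _ => by rw [hβc]; exact hρ v k d hd
      have h4 := hk0 k hk
      rw [← sum_mul] at h3
      calc _ ≤ ((∑ v, exp (-ρ v * k)) * Fintype.card β) * Fintype.card ι := mul_le_mul_of_nonneg_right h3 (by positivity)
        _ = ((Fintype.card ι : ℝ) * ∑ v, exp (- ρ v * k)) * Fintype.card β := by ring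
        _ ≤ _ := mul_le_mul_of_nonneg_right h4 (by positivity)
    have h2 : (2 * Fintype.card α : ℝ) ≤ Fintype.card β := by linarith
    exact_mod_cast h2
  have hBS : (1:ℝ) ≤ exp (log B * S) := Real.one_le_exp (mul_nonneg (log_nonneg hB1) (by linarith))
  have hA : ∀ a f, |(A a f : ℝ)| ≤ C' * exp (log B * S) := by
    rintro ⟨⟨v, e⟩, i⟩ f
    refine (hrw i _).trans ?_
    have h1 : ∀ t, w t (coeff (toF e.1) (lin (fun _ => P v) (monomial (toF f.1) 1))) ≤ exp (log B * S) := by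
      intro t
      have h2 := coeff_le_wn (w t) (ρ := fun _ : Fin k × n => (1:ℝ)) (fun _ => zero_le_one) (lin (fun _ => P v) (monomial (toF f.1) 1)) (toF e.1)
      simp only [one_pow, Finsupp.prod, prod_const_one, mul_one] at h2
      refine h2.trans ((wn_lin (w t) (fun _ => zero_le_one) _ (ρ' := fun _ => B) ?_ _).trans ?_)
      · intro x
        simpa using hrow v t x.2
      · rw [wn_monomial, map_one, one_mul, prod_fintype _ _ (by simp)]
        rw [prod_pow_eq_pow_sum, mul_comm, hS, sum_prod_type]
        have h3 : ∀ h, ∑ y, toF f.1 (h, y) = d h := by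
          intro h
          have := mem_piFinset.1 f.2 h
          exact mem_comp.1 this
        simp only [h3]
        rw [← Nat.cast_sum, exp_nat_mul, exp_log (by linarith)]
    calc _ ≤ C * ∑ t : τ, exp (log B * S) := mul_le_mul_of_nonneg_left (sum_le_sum fun t _ => h1 t) hC
      _ = C * Fintype.card τ * exp (log B * S) := by simp; ring
      _ ≤ _ := mul_le_mul_of_nonneg_right (by linarith) (by positivity)
  obtain ⟨t, ht0, htA, htb⟩ := siegel' A _ (by nlinarith) hA hαβ hβpos
  set G : MvP (Fin k × n) ℤ := ∑ f : β, monomial (toF f.1) (t f) with hG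
  have hcoef : ∀ f : β, coeff (toF f.1) G = t f := by
    intro f
    rw [hG, coeff_sum, sum_eq_single f]
    · simp
    · intro g _ hg
      rw [coeff_monomial, if_neg]
      intro h
      exact hg (Subtype.ext (toF_inj h))
    · simp
  have hMH : MH d G := by
    refine MH.sum _ fun f _ => ?_
    intro m hm h
    rw [coeff_monomial] at hm
    split_ifs at hm with h0
    · rw [← h0]
      have := mem_piFinset.1 f.2 h
      exact mem_comp.1 this
    · exact absurd rfl hm
  refine ⟨G, ?_, hMH, ?_, ?_⟩
  · intro h0
    apply ht0
    funext f
    rw [← hcoef f, h0]; simp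
  · unfold n1
    rw [hG]
    refine (wn_sum _ (fun _ => zero_le_one) _ _).trans ?_
    have h1 : ∀ f : β, wn zabs (fun _ : Fin k × n => (1:ℝ)) (monomial (toF f.1) (t f)) ≤ Fintype.card β * (C' * exp (log B * S)) := by
      intro f
      rw [wn_monomial]
      simp only [one_pow, Finsupp.prod, prod_const_one, mul_one]
      exact htb f
    refine (sum_le_sum fun f _ => h1 f).trans ?_
    rw [sum_const, card_univ, nsmul_eq_mul]
    have h2 : C' ≤ exp (log C' * S) := by
      calc C' = exp (log C' * 1) := by rw [mul_one, exp_log (by linarith)]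
        _ ≤ _ := exp_le_exp.2 (mul_le_mul_of_nonneg_left hS1 (log_nonneg hC'1))
    calc _ ≤ exp (N * S) * (exp (N * S) * (exp (log C' * S) * exp (log B * S))) := by gcongr
      _ = exp ((2 * N + log B + log C') * S) := by
          rw [← exp_add, ← exp_add, ← exp_add]; congr 1; ring
      _ ≤ _ := exp_le_exp.2 (by nlinarith)
  · intro v e he
    by_contra hlt
    push Not at hlt
    apply he
    have hmh := (hMH.map (castRingHom O)).lin (fun _ => P v) e he
    have hmem : (fun h i => e (h, i)) ∈ (Epi n d).filter fun e => ε * k < ∑ h, dev (c v) (d h) (e h) := by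
      rw [mem_filter]
      refine ⟨mem_piFinset.2 fun h => mem_comp.2 (hmh h), hlt⟩
    apply hr
    intro i
    have h1 := congrFun htA (⟨v, _, hmem⟩, i)
    simp only [mulVec, dotProduct, Pi.zero_apply, A, toF_surj] at h1
    rw [hG, map_sum, map_sum, coeff_sum, map_sum, ← h1]
    refine sum_congr rfl fun f _ => ?_
    have h2 : map (castRingHom O) (monomial (toF f.1) (t f)) = t f • (monomial (toF f.1) (1:O)) := by
      rw [map_monomial, smul_monomial]; simp
    rw [h2, map_zsmul, coeff_smul, map_zsmul]
    simp [mul_comm]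
end aux

end P4

open NumberField
lemma aux_nf (K : Type*) [Field K] [NumberField K] : ∃ (r : (K →+* ℂ) → 𝓞 K →+ ℤ)
   (w : (K →+* ℂ) → AbsoluteValue (𝓞 K) ℝ) (C : ℝ), 0 ≤ C ∧ (∀ x, (∀ i, r i x = 0) → x = 0) ∧ 
    (∀ i x, |(r i x : ℝ)| ≤ C * ∑ t, w t x) := by
  classical
  let b := (NumberField.RingOfIntegers.basis K)
  obtain ⟨C, hC⟩ : ∃ C : ℝ, ∀ (α : 𝓞 K) i, ‖((((integralBasis K).reindex (equivReindex K).symm).repr (algebraMap (𝓞 K) K α) i : ℚ) : ℂ)‖ ≤ C * house (algebraMap (𝓞 K) K α) :=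
    ⟨_, fun α i => NumberField.house.basis_repr_norm_le_const_mul_house K α i⟩
  refine ⟨fun i => (b.coord (equivReindex K i)).toAddMonoidHom, fun t => (place t).comp (f := algebraMap (𝓞 K) K) RingOfIntegers.coe_injective, max C 0, le_max_right _ _, ?_, ?_⟩
  · intro x hx
    apply b.repr.injective
    ext i
    have := hx ((equivReindex K).symm i)
    simpa using this
  · intro i x
    have h1 := hC x i
    have h2 : ((((integralBasis K).reindex (equivReindex K).symm).repr (algebraMap (𝓞 K) K x) i : ℚ)) = ((b.repr x (equivReindex K i) : ℤ) : ℚ) := by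
      rw [Basis.repr_reindex_apply]
      simp only [Equiv.symm_symm]
      exact integralBasis_repr_apply K x _
    rw [h2] at h1
    have h3 : |((b.repr x (equivReindex K i) : ℤ) : ℝ)| ≤ C * house (algebraMap (𝓞 K) K x) := by
      refine le_trans (le_of_eq ?_) h1
      simp
    have h4 : house (algebraMap (𝓞 K) K x) ≤ ∑ t : K →+* ℂ, ‖t (algebraMap (𝓞 K) K x)‖ := by
      rw [house_eq_sup']
      obtain ⟨t, _, ht⟩ := exists_mem_eq_sup' (s := (univ : Finset (K →+* ℂ))) univ_nonempty (fun φ => ‖φ (algebraMap (𝓞 K) K x)‖₊)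
      rw [ht]
      exact single_le_sum (f := fun t : K →+* ℂ => ‖t (algebraMap (𝓞 K) K x)‖) (fun _ _ => norm_nonneg _) (mem_univ t)
    refine h3.trans ?_
    calc _ ≤ max C 0 * house (algebraMap (𝓞 K) K x) := mul_le_mul_of_nonneg_right (le_max_left _ _) (house_nonneg _)
      _ ≤ _ := mul_le_mul_of_nonneg_left h4 (le_max_right _ _)

theorem aux_poly' (K : Type*) [Field K] [NumberField K] {n V : Type*} [Fintype n] [DecidableEq n] [Nonempty n] [Fintype V]
    (P : V → Matrix n n (𝓞 K)) (c : V → n → ℝ) (ε : ℝ) (hε : 0 < ε) :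
    ∃ (k0 : ℕ) (C1 : ℝ), 0 < C1 ∧ ∀ k, k0 ≤ k → 1 ≤ k → ∀ d : Fin k → ℕ, (∀ h, 1 ≤ d h) →
      ∃ G : MvP (Fin k × n) ℤ, G ≠ 0 ∧ MH d G ∧ n1 G ≤ exp (C1 * ∑ h, (d h : ℝ)) ∧
        ∀ v e, coeff e (lin (fun _ => (P v).map (algebraMap (𝓞 K) K)) (map (castRingHom K) G)) ≠ 0 →
          ∑ h, dev (c v) (d h) (fun i => e (h, i)) ≤ ε * k := by
  obtain ⟨r, w, C, hC, hr, hrw⟩ := aux_nf K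
  obtain ⟨k0, C1, hC1, h⟩ := aux_poly r hr w C hC hrw P c ε hε
  refine ⟨k0, C1, hC1, fun k hk hk1 d hd => ?_⟩
  obtain ⟨G, h0, h1, h2, h3⟩ := h k hk hk1 d hd
  refine ⟨G, h0, h1, h2, fun v e he => h3 v e fun h4 => he ?_⟩
  have h5 := map_lin (algebraMap (𝓞 K) K) (fun _ : Fin k => P v) (map (castRingHom (𝓞 K)) G)
  rw [MvPolynomial.map_map] at h5
  have h6 : (algebraMap (𝓞 K) K).comp (castRingHom (𝓞 K)) = castRingHom K := Subsingleton.elim _ _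
  rw [h6] at h5
  rw [← h5, coeff_map, h4, map_zero]

lemma coeff_lin_smul {R n : Type*} [CommRing R] [Fintype n] [DecidableEq n] {k : ℕ} (s : R) (F : MvP (Fin k × n) R) (e) :
    coeff e (lin (fun _ => s • (1 : Matrix n n R)) F) = s ^ (∑ x, e x) * coeff e F := by
  have h1 : ∀ m a, lin (fun _ : Fin k => s • (1 : Matrix n n R)) (monomial m a) = monomial m (s ^ (∑ x, m x) * a) := by
    intro m a
    unfold lin
    rw [aeval_monomial, algebraMap_eq, monomial_eq, prod_fintype _ _ (by simp), prod_fintype _ _ (by simp)]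
    have : ∀ x : Fin k × n, ∑ l, C ((s • (1 : Matrix n n R)) x.2 l) * X (x.1, l) = C s * (X x : MvP (Fin k × n) R) := by
      intro x
      rw [sum_eq_single x.2]
      · simp
      · intro b _ hb
        simp [Matrix.one_apply, hb.symm]
      · simp
    simp only [this, mul_pow, prod_mul_distrib, ← map_pow, ← map_prod, prod_pow_eq_pow_sum]
    rw [map_mul]; ring
  induction F using MvPolynomial.induction_on' with
  | monomial m a =>
    rw [h1, coeff_monomial, coeff_monomial]
    split_ifs with h
    · rw [h]
    · simp
  | add p q hp hq => rw [map_add, coeff_add, hp, hq, coeff_add, mul_add]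

theorem aux_poly2 (K : Type*) [Field K] [NumberField K] {n V : Type*} [Fintype n] [DecidableEq n] [Nonempty n] [Fintype V]
    (P : V → Matrix n n K) (c : V → n → ℝ) (ε : ℝ) (hε : 0 < ε) :
    ∃ (k0 : ℕ) (C1 : ℝ), 0 < C1 ∧ ∀ k, k0 ≤ k → 1 ≤ k → ∀ d : Fin k → ℕ, (∀ h, 1 ≤ d h) →
      ∃ G : MvP (Fin k × n) ℤ, G ≠ 0 ∧ MH d G ∧ n1 G ≤ exp (C1 * ∑ h, (d h : ℝ)) ∧
        ∀ v e, coeff e (lin (fun _ => P v) (map (castRingHom K) G)) ≠ 0 →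
          ∑ h, dev (c v) (d h) (fun i => e (h, i)) ≤ ε * k := by
  classical
  obtain ⟨⟨s, hs⟩, hsP⟩ := IsLocalization.exist_integer_multiples_of_finite (nonZeroDivisors (𝓞 K)) (fun x : V × n × n => P x.1 x.2.1 x.2.2)
  have hs0 : algebraMap (𝓞 K) K s ≠ 0 := by
    have := nonZeroDivisors.ne_zero hs
    simpa using this
  choose p hp using hsP
  obtain ⟨k0, C1, hC1, h⟩ := aux_poly' K (fun v => of fun i j => p (v, i, j)) c ε hε
  refine ⟨k0, C1, hC1, fun k hk hk1 d hd => ?_⟩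
  obtain ⟨G, h0, h1, h2, h3⟩ := h k hk hk1 d hd
  refine ⟨G, h0, h1, h2, fun v e he => h3 v e ?_⟩
  have h4 : (of fun i j => p (v, i, j)).map (algebraMap (𝓞 K) K) = P v * (algebraMap (𝓞 K) K s • (1 : Matrix n n K)) := by
    ext i j
    have := hp (v, i, j)
    simp only [map_apply, of_apply, Matrix.mul_smul, Matrix.mul_one, Matrix.smul_apply, smul_eq_mul]
    rw [this, Algebra.smul_def]
  simp only [h4]
  rw [← lin_lin (fun _ => (algebraMap (𝓞 K) K s • (1 : Matrix n n K))) (fun _ => P v), coeff_lin_smul]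
  exact mul_ne_zero (pow_ne_zero _ hs0) he

section P6

lemma wn_map_int {K σ : Type*} [Field K] (v : AbsoluteValue K ℝ) {ρ : σ → ℝ} (hρ : ∀ x, 0 ≤ ρ x) (G : MvP σ ℤ) :
    wn v ρ (map (castRingHom K) G) ≤ wn zabs ρ G := by
  rw [wn_eq_sum v ρ (s := G.support) (support_map_subset _ _)]
  refine sum_le_sum fun m _ => mul_le_mul_of_nonneg_right ?_ (mprod_nonneg hρ m)
  rw [coeff_map]
  exact abv_int_le v _

lemma wn_MH {R n : Type*} [CommRing R] [Fintype n] [DecidableEq n] {k : ℕ} (v : AbsoluteValue R ℝ) {d : Fin k → ℕ}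
    (F : MvP (Fin k × n) R) (hF : MH d F) (b : ℝ) :
    wn v (fun _ => b) F = b ^ (∑ h, d h) * wn v (fun _ => 1) F := by
  unfold wn
  rw [mul_sum]
  refine sum_congr rfl fun m hm => ?_
  have h1 := hF m (mem_support_iff.1 hm)
  rw [prod_fintype _ _ (by simp), prod_fintype _ _ (by simp), prod_pow_eq_pow_sum, sum_prod_type]
  simp only [h1, one_pow, prod_const_one]
  ring

variable {K : Type*} [Field K] {n V : Type*} [Fintype n] [DecidableEq n] [Nonempty n] [Fintype V]

lemma expo_bound {k : ℕ} (d : Fin k → ℕ) (hd : ∀ h, 1 ≤ d h) (c : n → ℝ) (Cc : ℝ) (hCc : ∑ i, |c i| ≤ Cc) (ε T : ℝ)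
    (hT : 0 ≤ T) (q : Fin k → ℝ) (hq : ∀ h, 0 ≤ q h) (h1 : ∀ h, d h * q h ≤ T) (h2 : ∀ h, T - q h ≤ d h * q h)
    (e : Fin k → n → ℕ) (he : ∀ h, ∑ i, e h i = d h) (hdev : ∑ h, dev c (d h) (e h) ≤ ε * k) :
    ∑ h, ∑ i, c i * e h i * q h ≤ T * k * (ε + (∑ i, c i) / Fintype.card n) + Cc * ∑ h, q h := by
  have hN : (Fintype.card n : ℝ) ≠ 0 := by exact_mod_cast Fintype.card_ne_zero
  have key : ∀ h, ∑ i, c i * e h i * q h ≤ T * (dev c (d h) (e h) + (∑ i, c i) / Fintype.card n) + Cc * q h := by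
    intro h
    have hd0 : (0:ℝ) < d h := by exact_mod_cast hd h
    set s := ∑ i, c i * (e h i / d h) with hs
    have e1 : dev c (d h) (e h) + (∑ i, c i) / Fintype.card n = s := by
      unfold dev
      rw [sum_div, ← sum_add_distrib]
      refine sum_congr rfl fun i _ => by ring
    have e2 : ∑ i, c i * e h i * q h = s * (d h * q h) := by
      rw [hs, sum_mul]
      refine sum_congr rfl fun i _ => by field_simp
    have e3 : |s| ≤ Cc := by
      refine (abs_sum_le_sum_abs _ _).trans (le_trans (sum_le_sum fun i _ => ?_) hCc)
      rw [abs_mul]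
      refine mul_le_of_le_one_right (abs_nonneg _) ?_
      rw [abs_of_nonneg (by positivity), div_le_one hd0]
      have : e h i ≤ d h := by
        rw [← he h]; exact single_le_sum (f := e h) (fun _ _ => Nat.zero_le _) (mem_univ i)
      exact_mod_cast this
    rw [e1, e2]
    have e4 : s * (d h * q h - T) ≤ Cc * q h := by
      calc s * (d h * q h - T) ≤ |s * (d h * q h - T)| := le_abs_self _
        _ = |s| * |d h * q h - T| := abs_mul _ _
        _ ≤ Cc * q h := by
            refine mul_le_mul e3 ?_ (abs_nonneg _) (le_trans (abs_nonneg _) e3)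
            rw [abs_le]; constructor <;> linarith [h1 h, h2 h]
    linarith
  refine (sum_le_sum fun h _ => key h).trans ?_
  rw [sum_add_distrib, ← mul_sum, ← mul_sum, sum_add_distrib]
  simp only [sum_const, card_univ, Fintype.card_fin, nsmul_eq_mul]
  have := mul_le_mul_of_nonneg_left hdev hT
  nlinarith

lemma vanish_one (v : AbsoluteValue K ℝ) (o : n) (L P : Matrix n n K) (hPL : P * L = 1) (c : n → ℝ) (C0 C' Cc C1 : ℝ)
    (hC' : 0 ≤ C') (hC0 : ∀ t, C0 - C' ≤ c t) (hCc : ∑ t, |c t| ≤ Cc) :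
    ∃ C2 : ℝ, 0 < C2 ∧ ∀ (k : ℕ) (d : Fin k → ℕ), (∀ h, 1 ≤ d h) → ∀ (G : MvP (Fin k × n) ℤ), MH d G →
      n1 G ≤ exp (C1 * ∑ h, (d h : ℝ)) → ∀ (ε : ℝ), 
      (∀ e, coeff e (lin (fun _ => P) (map (castRingHom K) G)) ≠ 0 →
          ∑ h, dev c (d h) (fun i => e (h, i)) ≤ ε * k) → ∀ (Q : Fin k → ℝ) (T : ℝ), 0 ≤ T → (∀ h, 1 ≤ Q h) →
      (∀ h, d h * log (Q h) ≤ T) → (∀ h, T - log (Q h) ≤ d h * log (Q h)) → ∀ (B : Fin k → Matrix n n ℤ),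
      (∀ h t l, l ≠ o → v ((L * (B h).map (Int.cast : ℤ → K)) t l) ≤ Q h ^ c t) →
      (∀ h t, v ((L * (B h).map (Int.cast : ℤ → K)) t o) ≤ Q h ^ C0) → ∀ f θ, ∑ h, (f (h, o) : ℝ) / d h ≤ θ * k →
      v ((coeff f (lin B G) : ℤ) : K) ≤ exp (C2 * ∑ h, (d h : ℝ) + T * k * (ε + (∑ i, c i) / Fintype.card n) + Cc * ∑ h, log (Q h) + C' * θ * k * T) := by
  set BP : ℝ := 1 + ∑ i, ∑ j, v (P i j) with hBP
  have hBP1 : 1 ≤ BP := by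
    have : 0 ≤ ∑ i, ∑ j, v (P i j) := by positivity
    linarith
  have hrow : ∀ i, ∑ j, v (P i j) ≤ BP := by
    intro i
    have h1 : ∑ j, v (P i j) ≤ ∑ i, ∑ j, v (P i j) :=
      single_le_sum (f := fun i => ∑ j, v (P i j)) (fun _ _ => by positivity) (mem_univ i)
    linarith
  set N : ℝ := (Fintype.card n : ℝ) with hN
  have hN1 : 1 ≤ N := by rw [hN]; exact_mod_cast Nat.succ_le_of_lt Fintype.card_pos
  refine ⟨|C1| + log BP + log N + 1, ?_, ?_⟩
  · have := log_nonneg hBP1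
    have := log_nonneg hN1
    positivity
  intro k d hd G hG hn1 ε hdev Q T hT hQ1 hQT hQT' B hB hBo f θ hf
  set S : ℝ := ∑ h, (d h : ℝ) with hS
  have hS0 : 0 ≤ S := by positivity
  have hQ0 : ∀ h, 0 < Q h := fun h => lt_of_lt_of_le one_pos (hQ1 h)
  set GK := map (castRingHom K) G with hGK
  set H := lin (fun _ : Fin k => P) GK with hH
  have hHMH : MH d H := (hG.map _).lin _
  -- norm of H
  have hHn : wn v (fun _ => 1) H ≤ exp ((|C1| + log BP) * S) := by
    refine (wn_lin v (fun _ => zero_le_one) _ (ρ' := fun _ => BP) (by intro x; simpa using hrow x.2) _).trans ?_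
    rw [wn_MH v _ (hG.map _)]
    have h1 : wn v (fun _ => 1) GK ≤ exp (|C1| * S) :=
      (wn_map_int v (fun _ => zero_le_one) G).trans (hn1.trans (exp_le_exp.2 (mul_le_mul_of_nonneg_right (le_abs_self _) hS0)))
    have h2 : BP ^ (∑ h, d h) = exp (log BP * S) := by
      rw [mul_comm, hS, ← Nat.cast_sum, exp_nat_mul, exp_log (by linarith)]
    rw [h2, add_mul, exp_add, mul_comm]
    exact mul_le_mul_of_nonneg_right h1 (exp_pos _).le
  -- expression of coefficient
  have hrel : map (castRingHom K) (lin B G) = lin (fun h => L * (B h).map (Int.cast : ℤ → K)) H := by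
    rw [hH, lin_lin, map_lin]
    congr 2
    funext h
    rw [← Matrix.mul_assoc, hPL, Matrix.one_mul]
    rfl
  set ρ : Fin k × n → ℝ := fun x => if x.2 = o then Q x.1 ^ (-C') else 1 with hρ
  have hρ0 : ∀ x, 0 ≤ ρ x := by
    intro x; rw [hρ]; dsimp only
    split_ifs
    · exact Real.rpow_nonneg (hQ0 _).le _
    · exact zero_le_one
  set ρ' : Fin k × n → ℝ := fun x => N * Q x.1 ^ c x.2 with hρ'
  have hstep : wn v ρ (lin (fun h => L * (B h).map (Int.cast : ℤ → K)) H) ≤ wn v ρ' H := by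
    refine wn_lin v hρ0 _ ?_ H
    rintro ⟨h, t⟩
    have h1 : ∀ l, v ((L * (B h).map (Int.cast : ℤ → K)) t l) * ρ (h, l) ≤ Q h ^ c t := by
      intro l
      by_cases hl : l = o
      · subst hl
        simp only [hρ, if_true]
        calc _ ≤ Q h ^ C0 * Q h ^ (-C') := mul_le_mul_of_nonneg_right (hBo h t) (Real.rpow_nonneg (hQ0 _).le _)
          _ = Q h ^ (C0 - C') := by rw [← rpow_add (hQ0 h)]; rfl
          _ ≤ _ := rpow_le_rpow_of_exponent_le (hQ1 h) (hC0 t)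
      · simp only [hρ, if_neg hl, mul_one]
        exact hB h t l hl
    refine (sum_le_sum fun l _ => h1 l).trans ?_
    simp [hρ', hN]
  have hbig : wn v ρ' H ≤ exp (log N * S + (T * k * (ε + (∑ i, c i) / Fintype.card n) + Cc * ∑ h, log (Q h))) * wn v (fun _ => 1) H := by
    unfold wn
    rw [mul_sum]
    refine sum_le_sum fun e he => ?_
    have he' := mem_support_iff.1 he
    have h1 : (e.prod fun x a => ρ' x ^ a) = exp (log N * S + ∑ h, ∑ i, c i * e (h, i) * log (Q h)) := by
      rw [prod_fintype _ _ (by simp)]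
      have h2 : ∀ x, ρ' x ^ e x = exp (log N * e x + c x.2 * e x * log (Q x.1)) := by
        intro x
        have : ρ' x = exp (log N + c x.2 * log (Q x.1)) := by
          rw [exp_add, exp_log (by linarith), mul_comm (c x.2), ← Real.rpow_def_of_pos (hQ0 _)]
        rw [this, ← exp_nat_mul]
        congr 1; ring
      simp only [h2]
      rw [← exp_sum, sum_add_distrib, sum_prod_type, sum_prod_type]
      congr 2
      rw [hS, mul_sum]
      refine sum_congr rfl fun h _ => ?_
      rw [← mul_sum, ← hHMH e he' h, Nat.cast_sum]
    rw [h1]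
    simp only [one_pow, Finsupp.prod, prod_const_one, mul_one]
    rw [mul_comm]
    refine mul_le_mul_of_nonneg_right (exp_le_exp.2 ?_) (v.nonneg _)
    have := expo_bound d hd c Cc hCc ε T hT (fun h => log (Q h)) (fun h => log_nonneg (hQ1 h)) hQT hQT'
      (fun h i => e (h, i)) (hHMH e he') (hdev e he')
    linarith
  have hcoef := coeff_le_wn v hρ0 (map (castRingHom K) (lin B G)) f
  rw [coeff_map] at hcoef
  have hprod : exp (-(C' * θ * k * T)) ≤ f.prod fun x a => ρ x ^ a := by
    rw [prod_fintype _ _ (by simp), Fintype.prod_prod_type]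
    have h1 : ∀ h, ∏ i, ρ (h, i) ^ f (h, i) = exp (-(C' * (f (h, o) * log (Q h)))) := by
      intro h
      rw [prod_eq_single o]
      · simp only [hρ, if_true]
        rw [Real.rpow_def_of_pos (hQ0 h), ← exp_nat_mul]
        congr 1; ring
      · intro b _ hb
        simp [hρ, hb]
      · simp
    simp only [h1]
    rw [← exp_sum, exp_le_exp, sum_neg_distrib, ← mul_sum, neg_le_neg_iff]
    have h2 : ∑ h, (f (h, o) : ℝ) * log (Q h) ≤ (∑ h, (f (h, o) : ℝ) / d h) * T := by
      rw [sum_mul]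
      refine sum_le_sum fun h _ => ?_
      have hd0 : (0:ℝ) < d h := by exact_mod_cast hd h
      calc (f (h, o) : ℝ) * log (Q h) = (f (h, o) : ℝ) / d h * (d h * log (Q h)) := by field_simp
        _ ≤ _ := mul_le_mul_of_nonneg_left (hQT h) (by positivity)
    calc _ ≤ C' * ((θ * k) * T) := mul_le_mul_of_nonneg_left (h2.trans (mul_le_mul_of_nonneg_right hf hT)) hC'
      _ = _ := by ring
  have hfin : v ((coeff f (lin B G) : ℤ) : K) * exp (-(C' * θ * k * T)) ≤ 
      exp (log N * S + (T * k * (ε + (∑ i, c i) / Fintype.card n) + Cc * ∑ h, log (Q h))) * exp ((|C1| + log BP) * S) := by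
    calc _ ≤ v ((coeff f (lin B G) : ℤ) : K) * f.prod fun x a => ρ x ^ a := mul_le_mul_of_nonneg_left hprod (v.nonneg _)
      _ ≤ wn v ρ (map (castRingHom K) (lin B G)) := hcoef
      _ ≤ wn v ρ' H := by rw [hrel]; exact hstep
      _ ≤ _ := hbig
      _ ≤ _ := mul_le_mul_of_nonneg_left hHn (exp_pos _).le
  rw [← exp_add] at hfin
  have h9 : v ((coeff f (lin B G) : ℤ) : K) = v ((coeff f (lin B G) : ℤ) : K) * exp (-(C' * θ * k * T)) * exp (C' * θ * k * T) := by
    rw [mul_assoc, ← exp_add]; simp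
  rw [h9]
  refine (mul_le_mul_of_nonneg_right hfin (exp_pos _).le).trans ?_
  rw [← exp_add, exp_le_exp]
  nlinarith

lemma vanish (v : V → AbsoluteValue K ℝ) (hv : ∀ z : ℤ, z ≠ 0 → 1 ≤ ∏ i, v i (z : K)) (o : n) (L P : V → Matrix n n K)
    (hPL : ∀ i, P i * L i = 1) (c : V → n → ℝ) (C0 C' Cc C1 : ℝ)
    (hC' : 0 ≤ C') (hC0 : ∀ i t, C0 - C' ≤ c i t) (hCc : ∀ i, ∑ t, |c i t| ≤ Cc) :
    ∃ C2 : ℝ, 0 < C2 ∧ ∀ (k : ℕ) (d : Fin k → ℕ), (∀ h, 1 ≤ d h) → ∀ (G : MvP (Fin k × n) ℤ), MH d G →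
      n1 G ≤ exp (C1 * ∑ h, (d h : ℝ)) → ∀ (ε : ℝ), 
      (∀ i e, coeff e (lin (fun _ => P i) (map (castRingHom K) G)) ≠ 0 →
          ∑ h, dev (c i) (d h) (fun i => e (h, i)) ≤ ε * k) → ∀ (Q : Fin k → ℝ) (T : ℝ), 0 ≤ T → (∀ h, 1 ≤ Q h) →
      (∀ h, d h * log (Q h) ≤ T) → (∀ h, T - log (Q h) ≤ d h * log (Q h)) → ∀ (B : Fin k → Matrix n n ℤ),
      (∀ i h t l, l ≠ o → v i ((L i * (B h).map (Int.cast : ℤ → K)) t l) ≤ Q h ^ c i t) →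
      (∀ i h t, v i ((L i * (B h).map (Int.cast : ℤ → K)) t o) ≤ Q h ^ C0) → ∀ f θ, ∑ h, (f (h, o) : ℝ) / d h ≤ θ * k →
      Fintype.card V * (C2 * ∑ h, (d h : ℝ) + T * k * ε + Cc * ∑ h, log (Q h) + C' * θ * k * T) + 
        T * k * ((∑ i, ∑ t, c i t) / Fintype.card n) < 0 → coeff f (lin B G) = 0 := by
  choose C2 hC2 h using fun i => vanish_one (v i) o (L i) (P i) (hPL i) (c i) C0 C' Cc C1 hC' (hC0 i) (hCc i)
  refine ⟨∑ i, C2 i + 1, ?_, ?_⟩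
  · have := sum_nonneg (s := univ) fun i _ => (hC2 i).le
    linarith
  intro k d hd G hG hn1 ε hdev Q T hT hQ1 hQT hQT' B hB hBo f θ hf hneg
  by_contra hne
  have h1 := hv _ hne
  have h2 : ∏ i, v i ((coeff f (lin B G) : ℤ) : K) ≤ ∏ i, exp (C2 i * ∑ h, (d h : ℝ) + T * k * (ε + (∑ t, c i t) / Fintype.card n) + Cc * ∑ h, log (Q h) + C' * θ * k * T) :=
    Finset.prod_le_prod (fun i _ => (v i).nonneg _) fun i _ => h i k d hd G hG hn1 ε (hdev i) Q T hT hQ1 hQT hQT' B (hB i) (hBo i) f θ hf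
  rw [← exp_sum] at h2
  have h3 := Real.one_le_exp_iff.1 (h1.trans h2)
  have h4 : ∑ i, (C2 i * ∑ h, (d h : ℝ) + T * k * (ε + (∑ t, c i t) / Fintype.card n) + Cc * ∑ h, log (Q h) + C' * θ * k * T)
     ≤ Fintype.card V * ((∑ i, C2 i + 1) * ∑ h, (d h : ℝ) + T * k * ε + Cc * ∑ h, log (Q h) + C' * θ * k * T) + 
        T * k * ((∑ i, ∑ t, c i t) / Fintype.card n) := by
    have h5 : T * k * ((∑ i, ∑ t, c i t) / Fintype.card n) = ∑ i, T * k * ((∑ t, c i t) / Fintype.card n) := by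
      rw [← mul_sum, sum_div]
    have h55 : ∀ x : ℝ, (Fintype.card V : ℝ) * x = ∑ i : V, x := by intro x; simp
    rw [h5, h55, ← sum_add_distrib]
    refine sum_le_sum fun i _ => ?_
    have h6 : C2 i ≤ ∑ i, C2 i + 1 := by
      have := single_le_sum (f := C2) (fun i _ => (hC2 i).le) (mem_univ i)
      linarith
    have h7 : 0 ≤ ∑ h, (d h : ℝ) := by positivity
    have := mul_le_mul_of_nonneg_right h6 h7
    linarith
  linarith
end P6

section P7

lemma sep {σ : Type*} [Fintype σ] (A : Finset (σ → ℤ)) (hA : ∀ z ∈ A, z ≠ 0) :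
    ∃ E : σ → ℕ, (∀ x, 1 ≤ E x) ∧ ∀ z ∈ A, ∑ x, (E x : ℤ) * z x ≠ 0 := by
  classical
  let p : (σ → ℤ) → Polynomial ℤ := fun z => ∑ x, Polynomial.monomial (Fintype.equivFin σ x : ℕ) (z x)
  have hp : ∀ z, z ≠ 0 → p z ≠ 0 := by
    intro z hz h0
    apply hz
    funext x
    have := congrArg (fun q => q.coeff (Fintype.equivFin σ x : ℕ)) h0
    simp only [p, Polynomial.finset_sum_coeff, Polynomial.coeff_monomial, Polynomial.coeff_zero] at this
    rw [sum_eq_single x] at this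
    · simpa using this
    · intro y _ hy
      rw [if_neg]
      intro h
      exact hy ((Fintype.equivFin σ).injective (Fin.ext h))
    · simp
  have hP : ∏ z ∈ A, p z ≠ 0 := prod_ne_zero_iff.2 fun z hz => hp z (hA z hz)
  obtain ⟨N, hN1, hN⟩ : ∃ N : ℕ, 1 ≤ N ∧ (∏ z ∈ A, p z).eval (N : ℤ) ≠ 0 := by
    by_contra hcon
    push Not at hcon
    apply hP
    apply Polynomial.eq_zero_of_infinite_isRoot
    refine Set.infinite_of_injective_forall_mem (f := fun j : ℕ => ((j + 1 : ℕ) : ℤ)) ?_ ?_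
    · intro i j h
      have : ((i + 1 : ℕ) : ℤ) = ((j + 1 : ℕ) : ℤ) := h
      omega
    · intro j
      exact hcon (j + 1) (by omega)
  refine ⟨fun x => N ^ (Fintype.equivFin σ x : ℕ), fun x => Nat.one_le_pow _ _ hN1, fun z hz => ?_⟩
  rw [Polynomial.eval_prod] at hN
  have := prod_ne_zero_iff.1 hN z hz
  simp only [p, Polynomial.eval_finset_sum, Polynomial.eval_monomial] at this
  convert this using 2
  push_cast; ring

lemma IndGe.map {σ R S : Type*} [CommRing R] [CommRing S] {w : σ → ℝ} {t : ℝ} {F : MvP σ R} (hF : IndGe w t F) (f : R →+* S) :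
    IndGe w t (MvPolynomial.map f F) := by
  intro m hm
  rw [coeff_map] at hm
  exact hF m fun h => hm (by rw [h, map_zero])

lemma IndGe.C_mul' {σ R : Type*} [CommRing R] [IsDomain R] {w : σ → ℝ} {t : ℝ} {F : MvP σ R} {a : R} (ha : a ≠ 0)
    (hF : IndGe w t (C a * F)) : IndGe w t F := by
  intro m hm
  refine hF m ?_
  rw [coeff_C_mul]
  exact mul_ne_zero ha hm

lemma IndGe.pow {σ R : Type*} [CommRing R] {w : σ → ℝ} (hw : ∀ h, 0 ≤ w h) {t : ℝ} {F : MvP σ R} (hF : IndGe w t F) (a : ℕ) :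
    IndGe w (a * t) (F ^ a) := by
  induction a with
  | zero => simpa using IndGe.zero hw
  | succ a ih =>
    rw [pow_succ]
    refine (ih.mul hF).mono ?_
    push_cast; linarith

lemma IndGe.CX {σ R : Type*} [CommRing R] (w : σ → ℝ) (c : R) (h : σ) : IndGe w (w h) (C c * X h : MvP σ R) := by
  classical
  intro m hm
  rw [coeff_C_mul, coeff_X'] at hm
  split_ifs at hm with h0
  · rw [← h0, wt_single]; simp
  · simp at hm

lemma map_shift {σ R S : Type*} [CommRing R] [CommRing S] (f : R →+* S) (ξ : σ → R) (F : MvP σ R) :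
    map f (shift ξ F) = shift (fun x => f (ξ x)) (map f F) := by
  unfold shift
  induction F using MvPolynomial.induction_on with
  | C a => simp [algHom_C]
  | add p q hp hq => simp only [map_add, hp, hq]
  | mul_X p x hp => simp only [map_mul, hp, aeval_X, map_X, map_add, map_C]

variable {n : Type*} [Fintype n] [DecidableEq n] {k : ℕ}

lemma index_aux {S : Type*} [CommRing S] (w : ℕ → ℝ) (hw : ∀ h, 0 ≤ w h) (o : n) (g : Fin k × n → MvP ℕ S)
    (hg : ∀ h : Fin k, IndGe w (w h) (g (h, o))) (t : ℝ) (H : MvP (Fin k × n) S)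
    (hH : ∀ f, coeff f H ≠ 0 → t ≤ ∑ h : Fin k, (f (h, o) : ℝ) * w h) : IndGe w t (aeval g H) := by
  rw [H.as_sum, map_sum]
  refine IndGe.sum _ fun f hf => ?_
  rw [aeval_monomial]
  have h1 := hH f (mem_support_iff.1 hf)
  have h2 : IndGe w (0 + ∑ x : Fin k × n, (if x.2 = o then (f x : ℝ) * w x.1 else 0))
      (algebraMap S (MvP ℕ S) (coeff f H) * ∏ x, g x ^ f x) := by
    refine (IndGe.zero hw).mul (IndGe.prod hw _ fun x _ => ?_)
    split_ifs with hx
    · rcases x with ⟨h, l⟩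
      simp only at hx
      subst hx
      exact (hg h).pow hw _
    · exact IndGe.zero hw
  rw [prod_fintype _ _ (by simp)]
  refine h2.mono ?_
  rw [zero_add, sum_prod_type]
  simpa using h1

/-- leading exponents -/
def mae (a : Fin k → n) (m : Fin k × n →₀ ℕ) : ℕ →₀ ℕ := ∑ h : Fin k, single (h : ℕ) (m (h, a h))

lemma mae_apply (a : Fin k → n) (m : Fin k × n →₀ ℕ) (h : Fin k) : mae a m h = m (h, a h) := by
  unfold mae
  rw [Finsupp.finset_sum_apply, sum_eq_single h]
  · simp
  · intro b _ hb
    rw [single_apply, if_neg]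
    intro h'; exact hb (Fin.ext h')
  · simp

lemma mae_apply' (a : Fin k → n) (m : Fin k × n →₀ ℕ) (h : ℕ) (hh : k ≤ h) : mae a m h = 0 := by
  unfold mae
  rw [Finsupp.finset_sum_apply]
  refine sum_eq_zero fun b _ => ?_
  rw [single_apply, if_neg]
  have := b.2
  omega

lemma prod_X_mae {S : Type*} [CommRing S] (a : Fin k → n) (m : Fin k × n →₀ ℕ) :
    ∏ h : Fin k, (X (h : ℕ) : MvP ℕ S) ^ m (h, a h) = monomial (mae a m) 1 := by
  unfold mae
  rw [monomial_sum_one]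
  refine prod_congr rfl fun h _ => ?_
  rw [X_pow_eq_monomial]

abbrev PQ := Polynomial ℚ

set_option maxHeartbeats 1000000 in
theorem onevar (d : ℕ → ℕ) (hd : ∀ h, k ≤ h → d h = 0) (G : MvP (Fin k × n) ℤ) (hG0 : G ≠ 0)
    (hG : MH (fun h : Fin k => d h) G) (o : n) (B : Fin k → Matrix n n ℤ) (hdet : ∀ h, (B h).det ≠ 0)
    (m : Fin k → n → ℤ) (κ : Fin k → ℤ) (hκ : ∀ h, κ h ≠ 0) (hm : ∀ h, vecMul (m h) (B h) = Pi.single o (κ h))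
    (a b : Fin k → n) (hab : ∀ h, a h ≠ b h) (hma : ∀ h, m h (a h) ≠ 0) (t : ℝ)
    (hvan : ∀ f, ∑ h : Fin k, (f (h, o) : ℝ) / d h < t → coeff f (lin B G) = 0) :
    ∃ F : MvP ℕ ℤ, F ≠ 0 ∧ DegLe d F ∧ n1 F ≤ n1 G ∧ ∀ ξ : ℕ → ℚ, 
      (∀ h : Fin k, ξ h = - (m h (b h) : ℚ) / m h (a h)) → IndGe (fun h => (d h : ℝ)⁻¹) t (shq ξ F) := by
  classical
  -- restriction of exponent vectors
  let good : Fin k × n → Prop := fun x => x.2 ≠ a x.1 ∧ x.2 ≠ b x.1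
  let rs : (Fin k × n →₀ ℕ) → (Fin k × n → ℤ) := fun e x => if good x then (e x : ℤ) else 0
  obtain ⟨E, hE1, hE⟩ := sep (((G.support ×ˢ G.support).image fun p => rs p.1 - rs p.2).erase 0) (fun z hz => ne_of_mem_erase hz)
  let Ew : (Fin k × n →₀ ℕ) → ℕ := fun e => ∑ x, if good x then E x * e x else 0
  have hinj : ∀ e ∈ G.support, ∀ e' ∈ G.support, Ew e = Ew e' → rs e = rs e' := by
    intro e he e' he' h
    by_contra hne
    refine hE (rs e - rs e') (mem_erase.2 ⟨sub_ne_zero.2 hne, mem_image.2 ⟨(e, e'), mem_product.2 ⟨he, he'⟩, rfl⟩⟩) ?_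
    have h1 : ∀ e, (Ew e : ℤ) = ∑ x, (E x : ℤ) * rs e x := by
      intro e
      simp only [Ew, rs]
      push_cast
      refine sum_congr rfl fun x _ => ?_
      split_ifs <;> simp
    simp only [Pi.sub_apply, mul_sub, sum_sub_distrib]
    rw [← h1, ← h1, h, sub_self]
  have hinj2 : ∀ e ∈ G.support, ∀ e' ∈ G.support, Ew e = Ew e' → mae a e = mae a e' → e = e' := by
    intro e he e' he' h h'
    have h1 := hinj e he e' he' h
    have hA : ∀ h, e (h, a h) = e' (h, a h) := fun h => by rw [← mae_apply, ← mae_apply, h']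
    have hO : ∀ h l, l ≠ b h → e (h, l) = e' (h, l) := by
      intro h l hl
      by_cases hla : l = a h
      · rw [hla]; exact hA h
      · have := congrFun h1 (h, l)
        simp only [rs, good] at this
        rw [if_pos ⟨hla, hl⟩, if_pos ⟨hla, hl⟩] at this
        exact_mod_cast this
    ext ⟨h, l⟩
    by_cases hl : l = b h
    · subst hl
      have s1 := hG e (mem_support_iff.1 he) h
      have s2 := hG e' (mem_support_iff.1 he') h
      rw [← add_sum_erase _ _ (mem_univ (b h))] at s1 s2
      have s3 : ∑ x ∈ univ.erase (b h), e (h, x) = ∑ x ∈ univ.erase (b h), e' (h, x) :=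
        sum_congr rfl fun x hx => hO h x (ne_of_mem_erase hx)
      omega
    · exact hO h l hl
  have hne : G.support.Nonempty := by rwa [nonempty_iff_ne_empty, Ne, support_eq_empty]
  obtain ⟨e0, he0, hmin⟩ := exists_min_image G.support Ew hne
  set τ := Ew e0 with hτ
  let M0 := G.support.filter fun e => Ew e = τ
  let F : MvP ℕ ℤ := ∑ e ∈ M0, monomial (mae a e) (coeff e G)
  have hF0 : coeff (mae a e0) F = coeff e0 G := by
    simp only [F]
    rw [coeff_sum, sum_eq_single e0]
    · simp
    · intro e he hne
      rw [coeff_monomial, if_neg]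
      intro h
      rw [mem_filter] at he
      exact hne (hinj2 e he.1 e0 he0 he.2 h)
    · intro h
      exact absurd (show e0 ∈ M0 from mem_filter.2 ⟨he0, hτ.symm⟩) h
  refine ⟨F, ?_, ?_, ?_, ?_⟩
  · intro h
    rw [h, coeff_zero] at hF0
    exact mem_support_iff.1 he0 hF0.symm
  · refine DegLe.sum _ fun e he => ?_
    intro μ hμ h
    rw [coeff_monomial] at hμ
    split_ifs at hμ with h0
    · rw [← h0]
      by_cases hk : h < k
      · have h1 := mae_apply a e ⟨h, hk⟩
        simp only at h1
        rw [h1]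
        refine le_trans ?_ (hG e (mem_support_iff.1 (mem_filter.1 he).1) ⟨h, hk⟩).le
        exact single_le_sum (f := fun i => e (⟨h, hk⟩, i)) (fun _ _ => Nat.zero_le _) (mem_univ _)
      · rw [mae_apply' a e h (by omega)]; exact Nat.zero_le _
    · exact absurd rfl hμ
  · unfold n1
    refine (wn_sum _ (fun _ => zero_le_one) _ _).trans ?_
    unfold wn
    refine le_trans (sum_le_sum fun e he => ?_) (sum_le_sum_of_subset_of_nonneg (filter_subset _ _) fun _ _ _ => ?_)
    · have := wn_monomial zabs (fun _ : ℕ => (1:ℝ)) (mae a e) (coeff e G)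
      unfold wn at this
      rw [this]
      simp [Finsupp.prod]
    · exact mul_nonneg (zabs.nonneg _) (mprod_nonneg (fun _ => zero_le_one) _)
  intro ξ hξ
  let ι : ℤ →+* PQ := castRingHom PQ
  let s : PQ := Polynomial.X
  let gφ : Fin k × n → MvP ℕ PQ := fun x => if x.2 = a x.1 then X (x.1 : ℕ) else if x.2 = b x.1 then 1 else C (s ^ E x)
  let Φ : MvP ℕ PQ := ∑ e ∈ G.support, monomial (mae a e) (s ^ (Ew e - τ) * ι (coeff e G))
  have hφ : aeval gφ (map ι G) = C (s ^ τ) * Φ := by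
    conv_lhs => rw [G.as_sum]
    simp only [Φ, map_sum, mul_sum, map_monomial, aeval_monomial]
    refine sum_congr rfl fun e he => ?_
    have h1 : e.prod (fun x j => gφ x ^ j) = C (s ^ Ew e) * monomial (mae a e) 1 := by
      rw [prod_fintype _ _ (by simp)]
      have h2 : ∀ x : Fin k × n, gφ x ^ e x = C (s ^ (if good x then E x * e x else 0)) * (if x.2 = a x.1 then X (x.1 : ℕ) ^ e x else 1) := by
        intro x
        by_cases h1 : x.2 = a x.1
        · simp [gφ, good, h1]
        · by_cases h2 : x.2 = b x.1
          · simp only [gφ, good, if_neg h1, if_pos h2]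
            simp [h1, h2]
          · simp only [gφ, good, if_neg h1, if_neg h2, if_pos (show x.2 ≠ a x.1 ∧ x.2 ≠ b x.1 from ⟨h1, h2⟩)]
            rw [← map_pow, ← pow_mul, mul_one]
      simp only [h2, prod_mul_distrib, ← map_prod, prod_pow_eq_pow_sum]
      rw [← prod_X_mae, Fintype.prod_prod_type (f := fun x : Fin k × n => if x.2 = a x.1 then (X (x.1 : ℕ) : MvP ℕ PQ) ^ e x else 1)]
      simp only [prod_ite_eq', mem_univ, if_true]
      rfl
    rw [h1, algebraMap_eq, C_mul_monomial, C_mul_monomial, C_mul_monomial]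
    congr 1
    have h3 : τ + (Ew e - τ) = Ew e := by have := hmin e he; omega
    rw [mul_one, ← mul_assoc, ← pow_add, h3, mul_comm]
  -- the point
  let ξS : ℕ → PQ := fun h => if hk : h < k then
    - Polynomial.C ((m ⟨h, hk⟩ (a ⟨h, hk⟩) : ℚ)⁻¹) * (Polynomial.C (m ⟨h, hk⟩ (b ⟨h, hk⟩) : ℚ) + 
      ∑ l ∈ univ.filter (fun l => good (⟨h, hk⟩, l)), Polynomial.C (m ⟨h, hk⟩ l : ℚ) * s ^ E (⟨h, hk⟩, l)) else Polynomial.C (ξ h)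
  let gψ : Fin k × n → MvP ℕ PQ := fun x => shift ξS (gφ x)
  have hψ : aeval gψ (map ι G) = C (s ^ τ) * shift ξS Φ := by
    have h1 : aeval gψ (map ι G) = shift ξS (aeval gφ (map ι G)) := by
      rw [← AlgHom.comp_apply, comp_aeval]
    rw [h1, hφ, map_mul]
    congr 1
    simp [shift, algHom_C]
  -- the linear forms
  have hlin : ∀ h : Fin k, ∑ l, C (ι (m h l)) * gψ (h, l) = C (ι (m h (a h))) * X (h : ℕ) := by
    intro h
    have hma' : (m h (a h) : ℚ) ≠ 0 := by exact_mod_cast hma h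
    have hξS : ι (m h (a h)) * ξS h + ι (m h (b h)) + ∑ l ∈ univ.filter (fun l => good (h, l)), ι (m h l) * s ^ E (h, l) = 0 := by
      have hι : ∀ z : ℤ, ι z = Polynomial.C (z : ℚ) := by intro z; simp [ι]
      simp only [ξS, dif_pos h.2, hι]
      have h2 : (Polynomial.C (m h (a h) : ℚ) : PQ) * Polynomial.C ((m h (a h) : ℚ)⁻¹) = 1 := by
        rw [← Polynomial.C_mul, mul_inv_cancel₀ hma']; simp
      simp only [Fin.eta]
      linear_combination (-(Polynomial.C (m h (b h) : ℚ) + ∑ l ∈ univ.filter (fun l => good (h, l)), Polynomial.C (m h l : ℚ) * s ^ E (h, l))) * h2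
    have hsplit : ∀ l, C (ι (m h l)) * gψ (h, l) = (if l = a h then C (ι (m h (a h))) * X (h:ℕ) + C (ι (m h (a h)) * ξS h) else 0) + 
        (if l = b h then C (ι (m h (b h))) else 0) + (if good (h, l) then C (ι (m h l) * s ^ E (h, l)) else 0) := by
      intro l
      by_cases h1 : l = a h
      · subst h1
        simp [gψ, gφ, good, hab h, shift]
        ring
      · by_cases h2 : l = b h
        · subst h2
          simp [gψ, gφ, good, (hab h).symm]
        · simp [gψ, gφ, good, h1, h2, shift, algHom_C]
    simp only [hsplit, sum_add_distrib, sum_ite_eq', mem_univ, if_true]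
    rw [← sum_filter, ← map_sum]
    have := congrArg (C : PQ → MvP ℕ PQ) hξS
    rw [map_add, map_add, map_zero] at this
    linear_combination this
  -- inverse matrices
  let Bq : Fin k → Matrix n n ℚ := fun h => (B h).map (Int.cast : ℤ → ℚ)
  have hBq : ∀ h, IsUnit (Bq h).det := by
    intro h
    have : (Bq h).det = ((B h).det : ℚ) := by
      have := (castRingHom ℚ).map_det (B h)
      exact this.symm
    rw [this, isUnit_iff_ne_zero]
    exact_mod_cast hdet h
  let Bi : Fin k → Matrix n n PQ := fun h => ((Bq h)⁻¹).map (algebraMap ℚ PQ)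
  have hBi : ∀ h, Bi h * (B h).map ι = 1 := by
    intro h
    have h1 : (B h).map ι = (Bq h).map (algebraMap ℚ PQ) := by
      ext i j; simp [Bq, ι]
    simp only [Bi]
    rw [h1, ← Matrix.map_mul, nonsing_inv_mul _ (hBq h)]
    simp
  have hBi' : ∀ h, (B h).map ι * Bi h = 1 := fun h => mul_eq_one_comm.1 (hBi h)
  have hBio : ∀ h l, ι (κ h) * Bi h o l = ι (m h l) := by
    intro h l
    have h1 : vecMul (fun l => ι (m h l)) ((B h).map ι) = Pi.single o (ι (κ h)) := by
      have := congrArg (fun f => ι ∘ f) (hm h)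
      funext j
      have := congrFun this j
      simp only [Function.comp, vecMul, dotProduct, map_sum, map_mul] at this
      simp only [vecMul, dotProduct, map_apply]
      rw [this]
      by_cases hj : j = o
      · subst hj; simp
      · simp [hj]
    have h2 := congrArg (fun f => vecMul f (Bi h) l) h1
    simp only [vecMul_vecMul, hBi', vecMul_one, Matrix.single_vecMul] at h2
    rw [h2]
    simp [Matrix.row]
  let H := map ι (lin B G)
  have hGH : map ι G = lin Bi H := by
    simp only [H]
    rw [map_lin, lin_lin]
    simp only [hBi']
    rw [lin_one]
  let gY : Fin k × n → MvP ℕ PQ := fun x => ∑ l, C (Bi x.1 x.2 l) * gψ (x.1, l)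
  have hY : aeval gψ (map ι G) = aeval gY H := by
    rw [hGH]
    unfold lin
    rw [← AlgHom.comp_apply, comp_aeval]
    congr 2
    funext x
    simp only [map_sum, map_mul, aeval_X, algHom_C, algebraMap_eq, gY]
  have hw : ∀ h, (0:ℝ) ≤ (d h : ℝ)⁻¹ := fun h => by positivity
  have hind : IndGe (fun h => (d h : ℝ)⁻¹) t (aeval gY H) := by
    refine index_aux _ hw o gY ?_ t H ?_
    · intro h
      have hκ' : ι (κ h) ≠ 0 := by
        simp only [ι, eq_intCast]
        exact_mod_cast hκ h
      refine IndGe.C_mul' hκ' ?_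
      have : C (ι (κ h)) * gY (h, o) = C (ι (m h (a h))) * X (h : ℕ) := by
        rw [← hlin h]
        simp only [gY, mul_sum]
        refine sum_congr rfl fun l _ => ?_
        rw [← mul_assoc, ← map_mul, hBio]
      rw [this]
      exact IndGe.CX _ _ _
    · intro f hf
      by_contra hlt
      push Not at hlt
      apply hf
      simp only [H]
      rw [coeff_map, hvan f (by simpa [div_eq_mul_inv] using hlt), map_zero]
  rw [← hY, hψ] at hind
  have hs : s ^ τ ≠ 0 := pow_ne_zero _ Polynomial.X_ne_zero
  have h5 := (IndGe.C_mul' hs hind).map (Polynomial.evalRingHom (0:ℚ))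
  rw [map_shift] at h5
  convert h5 using 1
  unfold shq
  have e1 : (fun x => (Polynomial.evalRingHom (0:ℚ)) (ξS x)) = ξ := by
    funext h
    by_cases hk : h < k
    · simp only [ξS, dif_pos hk]
      have := hξ ⟨h, hk⟩
      simp only at this
      rw [this]
      simp only [map_mul, map_neg, map_add, map_sum, map_pow, Polynomial.coe_evalRingHom, Polynomial.eval_C, s, Polynomial.eval_X]
      rw [sum_eq_zero]
      · simp only [add_zero, neg_mul, neg_inj, neg_div]; rw [div_eq_inv_mul]
      · intro l _
        rw [zero_pow (by have := hE1 (⟨h, hk⟩, l); omega), mul_zero]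
    · simp [ξS, hk]
  rw [e1]
  congr 1
  simp only [F, Φ, M0, map_sum, map_monomial]
  rw [sum_filter]
  refine sum_congr rfl fun e he => ?_
  have := hmin e he
  split_ifs with h
  · rw [h]; simp [ι, hτ]
  · have h6 : Ew e - τ ≠ 0 := by omega
    simp [s, h6]

end P7

section P8

lemma exists_b {n : Type*} [Fintype n] [DecidableEq n] [Nontrivial n] (m : n → ℤ) (hg : univ.gcd m = 1) (a : n) (ha : m a ≠ 0) :
    ∃ b, a ≠ b ∧ |(m a : ℝ)| ≤ ((-(m b : ℚ) / m a).den : ℝ) ^ Fintype.card n := by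
  obtain ⟨b0, hb0⟩ := exists_ne a
  obtain ⟨b, hb, hmax⟩ := exists_max_image (univ.erase a) (fun b => (-(m b : ℚ) / m a).den) ⟨b0, by simp [hb0]⟩
  have hba : b ≠ a := by simpa using hb
  refine ⟨b, fun h => hba h.symm, ?_⟩
  set D : ℤ := ∏ b ∈ univ.erase a, ((-(m b : ℚ) / m a).den : ℤ) with hD
  have h1 : ∀ x, m a ∣ D * m x := by
    intro x
    by_cases hx : x = a
    · subst hx; exact dvd_mul_left _ _
    have h2 : ((-(m x : ℚ) / m a).den : ℤ) ∣ D := dvd_prod_of_mem (fun b => ((-(m b : ℚ) / m a).den : ℤ)) (by simp [hx])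
    have h3 : m a ∣ ((-(m x : ℚ) / m a).den : ℤ) * m x := by
      refine ⟨-(-(m x : ℚ) / m a).num, ?_⟩
      have h4 := Rat.num_div_den (-(m x : ℚ) / m a)
      set r : ℚ := (-(m x : ℚ) / m a) with hr
      have h5 : (r.den : ℚ) ≠ 0 := by exact_mod_cast r.den_ne_zero
      have h6 : (m a : ℚ) ≠ 0 := by exact_mod_cast ha
      have : ((r.den : ℤ) * m x : ℚ) = m a * -(r.num : ℚ) := by
        have h7 : (r.num : ℚ) = r * r.den := by field_simp at h4; linarith
        rw [h7, hr]
        push_cast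
        field_simp
      exact_mod_cast this
    exact h3.trans (mul_dvd_mul_right h2 _)
  have h2 : m a ∣ D := by
    have h3 : m a ∣ univ.gcd (fun x => D * m x) := dvd_gcd fun x _ => h1 x
    rw [Finset.gcd_mul_left, hg, mul_one] at h3
    exact (dvd_normalize_iff).1 h3
  have hDpos : 0 < D := prod_pos fun x _ => by exact_mod_cast Rat.den_pos _
  have h3 : |m a| ≤ D := by
    have := Int.le_of_dvd hDpos ((abs_dvd _ _).2 h2)
    exact this
  have h4 : (D : ℝ) ≤ ((-(m b : ℚ) / m a).den : ℝ) ^ (univ.erase a).card := by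
    rw [hD]; push_cast
    rw [← prod_const]
    exact Finset.prod_le_prod (fun _ _ => by positivity) fun x hx => by exact_mod_cast hmax x hx
  calc |(m a : ℝ)| = ((|m a| : ℤ) : ℝ) := by push_cast; rfl
    _ ≤ D := by exact_mod_cast h3
    _ ≤ _ := h4
    _ ≤ _ := pow_le_pow_right₀ (by exact_mod_cast Rat.den_pos _) (by
        rw [← card_univ]; exact card_le_card (erase_subset _ _))

variable {K V n : Type*} [Field K] [NumberField K] [Fintype V] [Fintype n] [DecidableEq n]

set_option maxHeartbeats 2000000 in
theorem thmP (v : V → AbsoluteValue K ℝ)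
    (hv : ∀ z : ℤ, z ≠ 0 → 1 ≤ ∏ i, v i (z : K)) (o : n) (L P : V → Matrix n n K)
    (hPL : ∀ i, P i * L i = 1) (c : V → n → ℝ) (hc : ∑ i, ∑ t, c i t < 0) (C0 : ℝ)
    (Q : ℕ → ℝ) (hQ : Tendsto Q atTop atTop) (B : ℕ → Matrix n n ℤ)
    (hdet : ∀ j, (B j).det ≠ 0)
    (hB : ∀ j i t l, l ≠ o → v i ((L i * (B j).map (Int.cast : ℤ → K)) t l) ≤ Q j ^ c i t)
    (hBo : ∀ j i t, v i ((L i * (B j).map (Int.cast : ℤ → K)) t o) ≤ Q j ^ C0) :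
    ∃ m : n → ℤ, m ≠ 0 ∧ ∃ᶠ j in atTop, ∀ l, l ≠ o → vecMul m (B j) l = 0 := by
  classical
  by_contra hcon
  have hneg : ∀ m : n → ℤ, m ≠ 0 → ∀ᶠ j in atTop, ∃ l, l ≠ o ∧ vecMul m (B j) l ≠ 0 := by
    intro m hm
    by_contra h1
    refine hcon ⟨m, hm, fun h2 => h1 (h2.mono fun j hj => ?_)⟩
    push Not at hj
    exact hj
  haveI : Nonempty n := ⟨o⟩
  haveI : Nontrivial n := by
    obtain ⟨j, l, hl, _⟩ := (hneg (fun _ => 1) (fun h => by simpa using congrFun h o)).exists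
    exact ⟨l, o, hl⟩
  set δ := -∑ i, ∑ t, c i t with hδ
  have hδ0 : 0 < δ := by linarith
  have hV : 0 < Fintype.card V := by
    by_contra h0
    have : IsEmpty V := Fintype.card_eq_zero_iff.1 (by omega)
    simp at hc
  set N : ℝ := (Fintype.card n : ℝ) with hN
  have hN1 : 1 ≤ N := by rw [hN]; exact_mod_cast Fintype.card_pos
  set W : ℝ := (Fintype.card V : ℝ) with hW
  have hW1 : 1 ≤ W := by rw [hW]; exact_mod_cast hV
  choose m κ g hκ hg hgcd hm hadj using fun j => prim_normal (B j) o (hdet j)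
  obtain ⟨η, hη, hH⟩ := height_lower v hv o L P hPL c hc Q hQ B hdet hB hneg m κ g hκ hg hm hadj
  set Cc : ℝ := ∑ i, ∑ t, |c i t| with hCcdef
  have hCc1 : ∀ i, ∑ t, |c i t| ≤ Cc := fun i =>
    single_le_sum (f := fun i => ∑ t, |c i t|) (fun i _ => sum_nonneg fun t _ => abs_nonneg _) (mem_univ i)
  have hCc0 : 0 ≤ Cc := sum_nonneg fun i _ => sum_nonneg fun t _ => abs_nonneg _
  have hcit : ∀ i t, |c i t| ≤ Cc := fun i t =>
    (single_le_sum (f := fun t => |c i t|) (fun t _ => abs_nonneg _) (mem_univ t)).trans (hCc1 i)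
  set C' : ℝ := |C0| + Cc with hC'def
  have hC'0 : 0 ≤ C' := by positivity
  have hC0 : ∀ i t, C0 - C' ≤ c i t := by
    intro i t
    have := (abs_le.1 (hcit i t)).1
    have h2 := le_abs_self C0
    linarith
  set ε : ℝ := δ / (8 * N * W) with hε
  have hε0 : 0 < ε := by positivity
  obtain ⟨k0, C1, hC1, hP5⟩ := aux_poly2 K P c ε hε0
  obtain ⟨C2, hC2, hP6⟩ := vanish v hv o L P hPL c C0 C' Cc C1 hC'0 hC0 hCc1
  set θ : ℝ := min 1 (δ / (8 * N * W * (C' + 1))) with hθ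
  have hθ0 : 0 < θ := lt_min one_pos (by positivity)
  have hθ1 : θ ≤ 1 := min_le_left _ _
  have hθ2 : W * (C' * θ) ≤ δ / (8 * N) := by
    have h1 : θ ≤ δ / (8 * N * W * (C' + 1)) := min_le_right _ _
    calc W * (C' * θ) ≤ W * ((C' + 1) * (δ / (8 * N * W * (C' + 1)))) := by gcongr; linarith
      _ = _ := by field_simp
  set k : ℕ := max k0 1 with hk
  have hk1 : 1 ≤ k := le_max_right _ _
  obtain ⟨σ, hσ0, hσ1, hroth⟩ := roth k θ hθ0 hθ1
  have hlog : Tendsto (fun j => log (Q j)) atTop atTop := Real.tendsto_log_atTop.comp hQ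
  set Λ : ℝ := 1 + 8 * N * W * C2 / δ + 2 * N * (C1 * k + 1) / (σ * η) with hΛ
  have hev : ∀ᶠ j in atTop, 1 ≤ Q j ∧ ∃ a b, a ≠ b ∧ m j a ≠ 0 ∧
      η * log (Q j) ≤ N * log ((-(m j b : ℚ) / m j a).den : ℝ) := by
    filter_upwards [hH, hQ.eventually_ge_atTop 1] with j hj hj1
    refine ⟨hj1, ?_⟩
    obtain ⟨a, ha⟩ := hj
    have hpos : 0 < Q j ^ η := rpow_pos_of_pos (by linarith) _
    have hma : m j a ≠ 0 := by
      intro h0; rw [h0] at ha; simp at ha; linarith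
    obtain ⟨b, hab, hb⟩ := exists_b (m j) (hgcd j) a hma
    refine ⟨a, b, hab, hma, ?_⟩
    have h1 := log_le_log hpos (ha.trans hb)
    rwa [Real.log_rpow (by linarith), log_pow] at h1
  have hchoose : ∀ x : ℝ, ∃ j, x ≤ log (Q j) ∧ 1 ≤ Q j ∧ ∃ a b, a ≠ b ∧ m j a ≠ 0 ∧
      η * log (Q j) ≤ N * log ((-(m j b : ℚ) / m j a).den : ℝ) := fun x =>
    ((hlog.eventually_ge_atTop x).and hev).exists
  choose J hJ hJ1 hJ2 using hchoose
  let js : ℕ → ℝ := fun h => Nat.rec Λ (fun _ x => (2 / σ) * log (Q (J x))) h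
  let l : ℕ → ℝ := fun h => log (Q (J (js h)))
  have hjs : ∀ h, js (h + 1) = 2 / σ * l h := fun h => rfl
  have hls : ∀ h, js h ≤ l h := fun h => hJ _
  have hΛ1 : 1 ≤ Λ := by
    rw [hΛ]
    have : 0 ≤ 8 * N * W * C2 / δ := by positivity
    have : 0 ≤ 2 * N * (C1 * k + 1) / (σ * η) := by positivity
    linarith
  have hlmono : ∀ h, 2 / σ * l h ≤ l (h + 1) := fun h => (hjs h) ▸ hls (h + 1)
  have h2σ : 2 ≤ 2 / σ := by rw [le_div_iff₀ hσ0]; linarith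
  have hlΛ : ∀ h, Λ ≤ l h ∧ l 0 ≤ l h := by
    intro h
    induction h with
    | zero => exact ⟨hls 0, le_rfl⟩
    | succ h ih => 
      have := hlmono h
      have h3 : 0 < l h := by linarith
      constructor <;> nlinarith
  have hlpos : ∀ h, 0 < l h := fun h => by linarith [(hlΛ h).1]
  choose a b hab hma hden using fun h => hJ2 (js h)
  set S : ℝ := ∑ h ∈ range k, l h with hS
  have hS0 : 0 ≤ S := sum_nonneg fun h _ => (hlpos h).le
  have hlS : ∀ h < k, l h ≤ S := fun h hh => single_le_sum (f := l) (fun h _ => (hlpos h).le) (by simpa using hh)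
  set T : ℝ := 2 * S + 8 * N * W * Cc * S / δ with hT
  have hT1 : 2 * S ≤ T := by
    have : 0 ≤ 8 * N * W * Cc * S / δ := by positivity
    linarith
  have hSpos : 0 < S := lt_of_lt_of_le (hlpos 0) (hlS 0 (by omega))
  have hTpos : 0 < T := by linarith
  let d : ℕ → ℕ := fun h => if h < k then ⌊T / l h⌋₊ else 0
  have hdk : ∀ h, k ≤ h → d h = 0 := fun h hh => if_neg (by omega)
  have hdle : ∀ h, (d h : ℝ) * l h ≤ T := by
    intro h
    by_cases hh : h < k
    · simp only [d, if_pos hh]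
      rw [← le_div_iff₀ (hlpos h)]
      exact Nat.floor_le (by have := hlpos h; positivity)
    · simp only [d, if_neg hh]; simp; linarith
  have hdge : ∀ h < k, T - l h ≤ (d h : ℝ) * l h := by
    intro h hh
    simp only [d, if_pos hh]
    have h1 := (Nat.lt_floor_add_one (T / l h)).le
    rw [div_le_iff₀ (hlpos h)] at h1
    linarith
  have hdge2 : ∀ h < k, T / 2 ≤ (d h : ℝ) * l h := fun h hh => by
    have := hdge h hh; have := hlS h hh; linarith
  have hd1 : ∀ h < k, 1 ≤ d h := by
    intro h hh
    have h1 := hdge2 h hh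
    by_contra h0
    have h2 : d h = 0 := by omega
    rw [h2] at h1; simp at h1; linarith
  have hdσ : ∀ h, (d (h + 1) : ℝ) ≤ σ * d h := by
    intro h
    by_cases hh : h + 1 < k
    · have h1 := hdge2 h (by omega)
      have h2 := hdle (h + 1)
      have h3 := hlmono h
      have h4 := hlpos h
      have h5 : (d (h + 1) : ℝ) * (2 / σ * l h) ≤ 2 * (d h * l h) :=
        (mul_le_mul_of_nonneg_left h3 (by positivity)).trans (by linarith)
      have h6 : (d (h + 1) : ℝ) * (2 / σ * l h) = (d (h + 1) : ℝ) / σ * (2 * l h) := by ring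
      rw [h6] at h5
      have h7 : (d (h + 1) : ℝ) / σ ≤ d h := by
        by_contra h8; push Not at h8; nlinarith
      rw [div_le_iff₀ hσ0] at h7; linarith
    · rw [hdk (h + 1) (by omega)]; simp; positivity
  have hdsum : ∑ h : Fin k, (d h : ℝ) ≤ k * (T / l 0) := by
    have : ∀ h ∈ (univ : Finset (Fin k)), (d h : ℝ) ≤ T / l 0 := by
      intro h _
      rw [le_div_iff₀ (hlpos 0)]
      exact (mul_le_mul_of_nonneg_left (hlΛ h).2 (by positivity)).trans (hdle h)
    refine (sum_le_card_nsmul _ _ _ this).trans ?_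
    simp
  obtain ⟨G, hG0, hGM, hGn, hGdev⟩ := hP5 k (le_max_left _ _) hk1 (fun h : Fin k => d h) (fun h => hd1 h h.2)
  have hl0a : W * C2 / l 0 ≤ δ / (8 * N) := by
    have h1 : 8 * N * W * C2 / δ ≤ l 0 := by
      have : 0 ≤ 2 * N * (C1 * k + 1) / (σ * η) := by positivity
      have := (hlΛ 0).1
      linarith
    rw [div_le_iff₀ hδ0] at h1
    rw [div_le_div_iff₀ (hlpos 0) (by positivity)]
    linarith
  have hl0b : (C1 * k + 1) * (T / l 0) ≤ σ * (T / 2 * (η / N)) := by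
    have h1 : 2 * N * (C1 * k + 1) / (σ * η) ≤ l 0 := by
      have : 0 ≤ 8 * N * W * C2 / δ := by positivity
      have := (hlΛ 0).1
      linarith
    rw [div_le_iff₀ (by positivity)] at h1
    have h2 : (C1 * k + 1) / l 0 ≤ σ * η / (2 * N) := by
      rw [div_le_div_iff₀ (hlpos 0) (by positivity)]
      linarith
    calc (C1 * k + 1) * (T / l 0) = (C1 * k + 1) / l 0 * T := by ring
      _ ≤ σ * η / (2 * N) * T := by gcongr
      _ = _ := by ring
  have hvan : ∀ f, ∑ h : Fin k, (f (h, o) : ℝ) / d h < θ * k → coeff f (lin (fun h : Fin k => B (J (js h))) G) = 0 := by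
    intro f hf
    refine hP6 k (fun h : Fin k => d h) (fun h => hd1 h h.2) G hGM hGn ε hGdev (fun h => Q (J (js h))) T hTpos.le
      (fun h => hJ1 _) (fun h => hdle h) (fun h => hdge h h.2) _ (fun i h t l hl => hB _ i t l hl)
      (fun i h t => hBo _ i t) f θ hf.le ?_
    have e1 : ∑ h : Fin k, log (Q (J (js h))) = S := by
      rw [hS, sum_range]
    rw [e1]
    have hkp : (0 : ℝ) < k := by exact_mod_cast hk1
    have hcs : ∑ i, ∑ t, c i t = -δ := by rw [hδ]; ring
    rw [hcs]
    have b1 : W * (C2 * ∑ h : Fin k, (d h : ℝ)) ≤ T * k * (δ / (8 * N)) := by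
      calc W * (C2 * ∑ h : Fin k, (d h : ℝ)) ≤ W * (C2 * (k * (T / l 0))) := by gcongr
        _ = W * C2 / l 0 * (T * k) := by ring
        _ ≤ δ / (8 * N) * (T * k) := by gcongr
        _ = _ := by ring
    have b2 : W * (T * k * ε) = T * k * (δ / (8 * N)) := by rw [hε]; field_simp
    have b3 : W * (Cc * S) ≤ T * k * (δ / (8 * N)) := by
      have h1 : 8 * N * W * Cc * S / δ ≤ T := by linarith
      rw [div_le_iff₀ hδ0] at h1
      have h2 : W * (Cc * S) ≤ T * (δ / (8 * N)) := by
        rw [← mul_div_assoc, le_div_iff₀ (by positivity)]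
        linarith
      have h3 : T * (δ / (8 * N)) ≤ T * k * (δ / (8 * N)) := by
        have : (1 : ℝ) ≤ k := by exact_mod_cast hk1
        have : T * 1 ≤ T * k := by gcongr
        have h5 : 0 ≤ δ / (8 * N) := by positivity
        nlinarith
      linarith
    have b4 : W * (C' * θ * k * T) ≤ T * k * (δ / (8 * N)) := by
      calc W * (C' * θ * k * T) = T * k * (W * (C' * θ)) := by ring
        _ ≤ _ := by gcongr
    have b5 : T * k * (-δ / N) = -(8 * (T * k * (δ / (8 * N)))) := by field_simp
    have b6 : 0 < T * k * (δ / (8 * N)) := by positivity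
    rw [b5, mul_add, mul_add, mul_add, b2]
    linarith
  obtain ⟨F, hF0, hFd, hFn, hFi⟩ := onevar d hdk G hG0 hGM o (fun h : Fin k => B (J (js h))) (fun h => hdet _)
    (fun h : Fin k => m (J (js h))) (fun h => κ (J (js h))) (fun h => hκ _) (fun h => hm _) (fun h => a h) (fun h => b h)
    (fun h => hab h) (fun h => hma h) (θ * k) hvan
  let ξ : ℕ → ℚ := fun h => -(m (J (js h)) (b h) : ℚ) / m (J (js h)) (a h)
  have hξ : ratpt (fun h => (ξ h).num) (fun h => (ξ h).den) = ξ := by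
    funext h; exact Rat.num_div_den _
  have hI := hFi ξ (fun h => rfl)
  obtain ⟨f, hf, hfw⟩ := hroth d hd1 hdk hdσ F hF0 hFd (C1 * ∑ h : Fin k, (d h : ℝ)) (by positivity) (hFn.trans hGn)
    (fun h => (ξ h).num) (fun h => (ξ h).den) (fun h _ => ⟨Rat.den_pos _, by
      rw [Int.isCoprime_iff_nat_coprime]; exact (ξ h).reduced⟩) (by
      intro h hh
      have hd0 : (d 0 : ℝ) ≤ T / l 0 := by rw [le_div_iff₀ (hlpos 0)]; exact hdle 0
      calc C1 * ∑ h : Fin k, (d h : ℝ) + d 0 ≤ C1 * (k * (T / l 0)) + T / l 0 := by gcongr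
        _ = (C1 * k + 1) * (T / l 0) := by ring
        _ ≤ _ := hl0b
        _ ≤ _ := by
          have h1 : η / N * l h ≤ log ((ξ h).den : ℝ) := by
            have := hden h
            rw [div_mul_eq_mul_div, div_le_iff₀ (by positivity)]
            linarith
          have h2 : T / 2 * (η / N) ≤ d h * log ((ξ h).den : ℝ) := by
            calc T / 2 * (η / N) ≤ (d h * l h) * (η / N) := by gcongr; exact hdge2 h hh
              _ = d h * (η / N * l h) := by ring
              _ ≤ _ := by gcongr
          gcongr)
  rw [hξ] at hf
  have h1 := hI f hf
  have h2 : θ ≤ θ * k := by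
    have : (1 : ℝ) ≤ k := by exact_mod_cast hk1
    nlinarith
  linarith

end P8

section S1

abbrev SM (s r : ℕ) := {f : Fin s → Fin r // StrictMono f}
noncomputable instance (s r : ℕ) : Fintype (SM s r) := Fintype.ofFinite _

variable {s r : ℕ}

lemma sum_inj {R : Type*} [AddCommMonoid R] (F : (Fin s → Fin r) → R) (hF : ∀ p, ¬ Injective p → F p = 0) :
    ∑ p, F p = ∑ τ : SM s r, ∑ g : Perm (Fin s), F (τ.1 ∘ g) := by
  classical
  have h1 : ∑ p, F p = ∑ p with Injective p, F p :=
    (sum_subset (filter_subset _ _) fun p _ hp => hF p (by simpa using hp)).symm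
  rw [h1, ← sum_product']
  symm
  refine sum_bij (fun x _ => x.1.1 ∘ x.2) ?_ ?_ ?_ ?_
  · intro x _
    simp only [mem_filter, mem_univ, true_and]
    exact x.1.2.injective.comp x.2.injective
  · rintro ⟨τ, g⟩ _ ⟨τ', g'⟩ _ h
    simp only at h
    have hr : Set.range τ.1 = Set.range τ'.1 := by
      rw [← g.surjective.range_comp τ.1, h, g'.surjective.range_comp]
    have ht : τ = τ' := Subtype.ext ((StrictMono.range_inj τ.2 τ'.2).1 hr)
    subst ht
    have : g = g' := by
      ext x
      have := congrFun h x
      simpa using congrArg Fin.val (τ.2.injective this)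
    rw [this]
  · intro p hp
    have hp' : Injective p := by simpa using hp
    refine ⟨(⟨p ∘ Tuple.sort p, ?_⟩, (Tuple.sort p)⁻¹), by simp, ?_⟩
    · exact (Tuple.monotone_sort p).strictMono_of_injective (hp'.comp (Tuple.sort p).injective)
    · funext x; simp
  · intro x _; rfl

lemma cauchy_binet {R : Type*} [CommRing R] (A : Matrix (Fin s) (Fin r) R) (B : Matrix (Fin r) (Fin s) R) :
    (A * B).det = ∑ ρ : SM s r, (A.submatrix id ρ.1).det * (B.submatrix ρ.1 id).det := by
  classical
  have h1 : (A * B).det = ∑ p : Fin s → Fin r, (∏ x, B (p x) x) * (A.submatrix id p).det := by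
    simp only [Matrix.det_apply', Matrix.mul_apply, prod_univ_sum, mul_sum, Fintype.piFinset_univ]
    rw [sum_comm]
    refine sum_congr rfl fun p _ => sum_congr rfl fun g _ => ?_
    rw [prod_mul_distrib]
    simp only [Matrix.submatrix_apply, id]
    ring
  rw [h1, sum_inj]
  · refine sum_congr rfl fun ρ _ => ?_
    have h2 : ∀ g : Perm (Fin s), (A.submatrix id (ρ.1 ∘ g)).det = (Perm.sign g : R) * (A.submatrix id ρ.1).det := by
      intro g
      rw [← Matrix.det_permute' g (A.submatrix id ρ.1)]
      rfl
    simp only [h2]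
    rw [Matrix.det_apply' (B.submatrix ρ.1 id), mul_sum]
    refine sum_congr rfl fun g _ => ?_
    simp only [Matrix.submatrix_apply, id, Function.comp]
    ring
  · intro p hp
    simp only [Injective] at hp
    push Not at hp
    obtain ⟨i, j, hij, hne⟩ := hp
    rw [Matrix.det_zero_of_column_eq hne (by intro k; simp [hij]), mul_zero]

def cmp {R : Type*} [CommRing R] (s : ℕ) (M : Sq r R) : Matrix (SM s r) (SM s r) R :=
  fun τ σ => (M.submatrix τ.1 σ.1).det

lemma cmp_mul {R : Type*} [CommRing R] (A B : Sq r R) : cmp s (A * B) = cmp s A * cmp s B := by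
  ext τ σ
  rw [Matrix.mul_apply]
  have : (A * B).submatrix τ.1 σ.1 = (A.submatrix τ.1 id) * (B.submatrix id σ.1) := by
    ext i j; simp [Matrix.mul_apply]
  rw [cmp, this, cauchy_binet]
  rfl

lemma cmp_scalar {R : Type*} [CommRing R] (c : R) : cmp s (c • (1 : Sq r R)) = c ^ s • 1 := by
  classical
  ext τ σ
  by_cases h : τ = σ
  · subst h
    rw [cmp, Matrix.smul_apply, Matrix.one_apply_eq, smul_eq_mul, mul_one]
    have : (c • (1 : Sq r R)).submatrix τ.1 τ.1 = c • 1 := by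
      ext i j
      simp [Matrix.one_apply, τ.2.injective.eq_iff]
    rw [this, det_smul, det_one]
    simp
  · rw [cmp, Matrix.smul_apply, Matrix.one_apply_ne h, smul_zero]
    have : ∃ a, ∀ b, τ.1 a ≠ σ.1 b := by
      by_contra! hc
      apply h
      have h1 : Set.range τ.1 ⊆ Set.range σ.1 := by
        rintro _ ⟨a, rfl⟩
        obtain ⟨b, hb⟩ := hc a
        exact ⟨b, hb.symm⟩
      refine Subtype.ext ((StrictMono.range_inj τ.2 σ.2).1 ?_)
      refine Set.eq_of_subset_of_ncard_le h1 ?_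
      rw [← Set.image_univ, ← Set.image_univ, Set.ncard_image_of_injective _ σ.2.injective,
        Set.ncard_image_of_injective _ τ.2.injective]
    obtain ⟨a, ha⟩ := this
    exact det_eq_zero_of_row_eq_zero a fun b => by simp [Matrix.one_apply, ha b]

lemma cmp_map {R S : Type*} [CommRing R] [CommRing S] (f : R →+* S) (A : Sq r R) :
    cmp s (A.map f) = (cmp s A).map f := by
  ext τ σ
  simp only [cmp, map_apply]
  rw [map_det]; rfl

lemma cmp_det_ne {R : Type*} [CommRing R] [IsDomain R] (A : Sq r R) (hA : A.det ≠ 0) : (cmp s A).det ≠ 0 := by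
  have h : cmp s A * cmp s A.adjugate = A.det ^ s • 1 := by
    rw [← cmp_mul, mul_adjugate, cmp_scalar]
  have := congrArg det h
  rw [det_mul, det_smul, det_one, mul_one] at this
  intro h0
  rw [h0, zero_mul] at this
  exact pow_ne_zero _ (pow_ne_zero _ hA) this.symm

lemma cmp_count (s r : ℕ) [NeZero r] : ∃ κ : ℝ, 0 ≤ κ ∧ ∀ g : Fin r → ℝ, ∑ τ : SM s r, ∑ a, g (τ.1 a) = κ * ∑ i, g i := by
  classical
  obtain ⟨E, hE⟩ : ∃ E : ℝ, E = ((univ.filter (fun p : Fin s → Fin r => Injective p)).card : ℝ) := ⟨_, rfl⟩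
  have hE0 : 0 ≤ E := by rw [hE]; positivity
  have hr : (0 : ℝ) < r := by exact_mod_cast Nat.pos_of_ne_zero (NeZero.ne r)
  refine ⟨E * s / (r * s.factorial), by positivity, fun g => ?_⟩
  let F : (Fin s → Fin r) → ℝ := fun p => if Injective p then ∑ a, g (p a) else 0
  have h1 : ∑ p, F p = s.factorial * ∑ τ : SM s r, ∑ a, g (τ.1 a) := by
    rw [sum_inj F (fun p hp => if_neg hp), mul_sum]
    refine sum_congr rfl fun τ _ => ?_
    have : ∀ h : Perm (Fin s), F (τ.1 ∘ h) = ∑ a, g (τ.1 a) := by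
      intro h
      simp only [F]
      rw [if_pos (τ.2.injective.comp h.injective)]
      exact Equiv.sum_comp h (fun a => g (τ.1 a))
    simp [this, card_perm]
  have h2 : ∀ c : Fin r, ∑ p : Fin s → Fin r, F (fun a => p a + c) = ∑ p, F p := by
    intro c
    exact Equiv.sum_comp (Equiv.arrowCongr (Equiv.refl (Fin s)) (Equiv.addRight c)) F
  have h3 : (r : ℝ) * ∑ p, F p = E * (s * ∑ i, g i) := by
    calc (r : ℝ) * ∑ p, F p = ∑ c : Fin r, ∑ p : Fin s → Fin r, F (fun a => p a + c) := by simp [h2]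
      _ = ∑ p : Fin s → Fin r, ∑ c : Fin r, F (fun a => p a + c) := by rw [sum_comm]
      _ = ∑ p : Fin s → Fin r, if Injective p then s * ∑ i, g i else 0 := by
        refine sum_congr rfl fun p _ => ?_
        have : ∀ c, Injective (fun a => p a + c) ↔ Injective p := by
          intro c
          constructor
          · intro h x y hxy; exact h (by simp [hxy])
          · intro h x y hxy; exact h (by simpa using hxy)
        simp only [F, this]
        split_ifs with hp
        · rw [sum_comm]
          have : ∀ a : Fin s, ∑ c, g (p a + c) = ∑ i, g i := fun a => Equiv.sum_comp (Equiv.addLeft (p a)) g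
          simp [this]
        · simp
      _ = _ := by
        rw [← sum_filter, sum_const, nsmul_eq_mul, hE]
  rw [h1] at h3
  have hs : (0 : ℝ) < s.factorial := by exact_mod_cast Nat.factorial_pos s
  field_simp
  linarith

/-- bound for minors -/
lemma minor_bound {K : Type*} [Field K] (v : AbsoluteValue K ℝ) (A : Sq s K) (β : Fin s → ℝ)
    (hA : ∀ i l, v (A i l) ≤ β i) : v A.det ≤ s.factorial * ∏ i, β i := by
  rw [det_apply]
  refine (abv_sum_le _ _ _).trans ?_
  have : ∀ π ∈ (univ : Finset (Perm (Fin s))), v (Perm.sign π • ∏ l, A (π l) l) ≤ ∏ i, β i := by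
    intro π _
    have h0 : v (Perm.sign π • ∏ l, A (π l) l) = ∏ l, v (A (π l) l) := by
      rcases units_eq_one_or (Perm.sign π) with h | h <;> rw [h] <;> simp [map_prod]
    rw [h0, ← Equiv.prod_comp π β]
    exact Finset.prod_le_prod (fun _ _ => v.nonneg _) fun l _ => hA _ _
  refine (sum_le_card_nsmul _ _ _ this).trans ?_
  simp [card_perm]

lemma SM_eq_top {i : ℕ} (h : i + s = r) (τ : SM s r) (hs : 0 < s) (h0 : i ≤ (τ.1 ⟨0, hs⟩ : ℕ)) (a : Fin s) : (τ.1 a : ℕ) = i + a := by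
  have key : ∀ x : ℕ, ∀ hx : x < s, i + x ≤ (τ.1 ⟨x, hx⟩ : ℕ) := by
    intro x
    induction x with
    | zero => intro hx; simpa using h0
    | succ x ih =>
      intro hx
      have h1 := ih (by omega)
      have h2 : τ.1 ⟨x, by omega⟩ < τ.1 ⟨x + 1, hx⟩ := τ.2 (by simp [Fin.lt_def])
      have h3 : (τ.1 ⟨x, by omega⟩ : ℕ) < (τ.1 ⟨x + 1, hx⟩ : ℕ) := h2
      omega
  have key2 : ∀ y : ℕ, ∀ hy : y < s, (τ.1 ⟨s - 1 - y, by omega⟩ : ℕ) + y < r := by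
    intro y
    induction y with
    | zero => intro hy; simp
    | succ y ih =>
      intro hy
      have h1 := ih (by omega)
      have h2 : τ.1 ⟨s - 1 - (y + 1), by omega⟩ < τ.1 ⟨s - 1 - y, by omega⟩ := τ.2 (by simp [Fin.lt_def]; omega)
      have h3 : (τ.1 ⟨s - 1 - (y + 1), by omega⟩ : ℕ) < (τ.1 ⟨s - 1 - y, by omega⟩ : ℕ) := h2
      omega
  have h1 := key a a.2
  have h2 := key2 (s - 1 - a) (by omega)
  have h3 : (⟨s - 1 - (s - 1 - a), by omega⟩ : Fin s) = a := by
    apply Fin.ext; simp; omega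
  rw [h3] at h2
  have : (⟨a, a.2⟩ : Fin s) = a := rfl
  rw [this] at h1
  omega

lemma SM_le_top {i : ℕ} (h : i + s = r) (τ : SM s r) (a : Fin s) : (τ.1 a : ℕ) ≤ i + a := by
  have key2 : ∀ y : ℕ, ∀ hy : y < s, (τ.1 ⟨s - 1 - y, by omega⟩ : ℕ) + y < r := by
    intro y
    induction y with
    | zero => intro hy; simp
    | succ y ih =>
      intro hy
      have h1 := ih (by omega)
      have h2 : τ.1 ⟨s - 1 - (y + 1), by omega⟩ < τ.1 ⟨s - 1 - y, by omega⟩ := τ.2 (by simp [Fin.lt_def]; omega)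
      have h3 : (τ.1 ⟨s - 1 - (y + 1), by omega⟩ : ℕ) < (τ.1 ⟨s - 1 - y, by omega⟩ : ℕ) := h2
      omega
  have h2 := key2 (s - 1 - a) (by omega)
  have h3 : (⟨s - 1 - (s - 1 - a), by omega⟩ : Fin s) = a := by
    apply Fin.ext; simp; omega
  rw [h3] at h2
  omega

end S1

lemma unimod {r : ℕ} (z : Fin (r+1) → ℤ) (hz : z ≠ 0) : ∃ (U : Matrix (Fin (r+1)) (Fin (r+1)) ℤ) (a : ℤ), IsUnit U.det ∧ 
    ∀ i, z i = a * U i 0 := by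
  classical
  let N : Submodule ℤ (Fin (r+1) → ℤ) := span ℤ {z}
  obtain ⟨n, S⟩ := Submodule.smithNormalForm (Pi.basisFun ℤ (Fin (r+1))) N
  let bz : Basis Unit ℤ N := (Basis.singleton Unit ℤ).map (LinearEquiv.toSpanNonzeroSingleton ℤ _ z hz)
  let e := bz.indexEquiv S.bN
  let i0 := e ()
  have hz1 : (⟨z, mem_span_singleton_self z⟩ : N) = S.bN.repr ⟨z, mem_span_singleton_self z⟩ i0 • S.bN i0 := by
    conv_lhs => rw [← S.bN.sum_repr ⟨z, mem_span_singleton_self z⟩]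
    rw [sum_eq_single i0]
    · intro b _ hb
      exact absurd (by have : e.symm b = e.symm i0 := Subsingleton.elim _ _
                       exact e.symm.injective this) hb
    · simp
  have hz2 := congrArg Subtype.val hz1
  simp only [Submodule.coe_smul, S.snf] at hz2
  let b' := S.bM.reindex (swap 0 (S.f i0))
  refine ⟨(Pi.basisFun ℤ (Fin (r+1))).toMatrix b', S.bN.repr ⟨z, mem_span_singleton_self z⟩ i0 * S.a i0, ?_, ?_⟩
  · have := (Pi.basisFun ℤ (Fin (r+1))).isUnit_det b'
    rwa [Basis.det_apply] at this
  · intro i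
    have := congrFun hz2 i
    simp only [Pi.smul_apply, smul_eq_mul] at this
    rw [this]
    simp [Basis.toMatrix_apply, b', mul_assoc]

lemma cast_mulVec {r : ℕ} {R : Type*} [CommRing R] (M : Sq r R) (U : Sq r ℤ) (z : Fin r → ℤ) :
    mulVec M (fun l => ((mulVec U z l : ℤ) : R)) = mulVec (M * U.map (Int.cast : ℤ → R)) (fun l => (z l : R)) := by
  rw [← mulVec_mulVec]
  congr 1
  funext l
  simp [mulVec, dotProduct]

lemma min_vec {r : ℕ} (M : Matrix (Fin (r+1)) (Fin (r+1)) ℝ) (hM : M.det ≠ 0) :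
    ∃ z : Fin (r+1) → ℤ, z ≠ 0 ∧ ∀ z' : Fin (r+1) → ℤ, z' ≠ 0 →
      ‖mulVec M (fun l => (z l : ℝ))‖ ≤ ‖mulVec M (fun l => (z' l : ℝ))‖ := by
  classical
  let f : (Fin (r+1) → ℤ) → ℝ := fun z => ‖mulVec M (fun l => (z l : ℝ))‖
  let e0 : Fin (r+1) → ℤ := fun _ => 1
  let X := f e0
  let S : ℝ := ∑ i, ∑ l, |M⁻¹ i l|
  have hb : ∀ z, f z ≤ X → ∀ l, |z l| ≤ ⌈S * X⌉ := by
    intro z hz l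
    have h1 : (fun l => (z l : ℝ)) = mulVec M⁻¹ (mulVec M (fun l => (z l : ℝ))) := by
      rw [mulVec_mulVec, nonsing_inv_mul _ (isUnit_iff_ne_zero.2 hM), one_mulVec]
    have h2 : |(z l : ℝ)| ≤ S * X := by
      have h3 : (z l : ℝ) = ∑ m, M⁻¹ l m * mulVec M (fun l => (z l : ℝ)) m := congrFun h1 l
      rw [h3]
      calc |∑ m, M⁻¹ l m * mulVec M (fun l => (z l : ℝ)) m| ≤ ∑ m, |M⁻¹ l m| * X := by
            refine (abs_sum_le_sum_abs _ _).trans (sum_le_sum fun m _ => ?_)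
            rw [abs_mul]
            gcongr
            exact (norm_le_pi_norm (mulVec M (fun l => (z l : ℝ))) m).trans hz
        _ = (∑ m, |M⁻¹ l m|) * X := by rw [sum_mul]
        _ ≤ S * X := by
            gcongr
            exact single_le_sum (f := fun i => ∑ l, |M⁻¹ i l|) (fun i _ => sum_nonneg fun _ _ => abs_nonneg _) (mem_univ l)
    have h4 : ((|z l| : ℤ) : ℝ) ≤ (⌈S * X⌉ : ℝ) := by
      push_cast; exact h2.trans (Int.le_ceil _)
    exact_mod_cast h4
  have hfin : {z : Fin (r+1) → ℤ | z ≠ 0 ∧ f z ≤ X}.Finite := by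
    refine (Set.Finite.pi' (fun _ : Fin (r+1) => Set.finite_Icc (-⌈S * X⌉) ⌈S * X⌉)).subset ?_
    intro z hz l
    exact abs_le.1 (hb z hz.2 l)
  obtain ⟨z, hz, hmin⟩ := Set.exists_min_image _ f hfin ⟨e0, fun h => by simpa [e0] using congrFun h 0, le_rfl⟩
  refine ⟨z, hz.1, fun z' hz' => ?_⟩
  by_cases h : f z' ≤ X
  · exact hmin z' ⟨hz', h⟩
  · exact (hz.2.trans (not_le.1 h).le)

lemma det_col0 {r : ℕ} {R : Type*} [CommRing R] (B : Matrix (Fin (r+1)) (Fin (r+1)) R) (h : ∀ i : Fin r, B i.succ 0 = 0) :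
    B.det = B 0 0 * (B.submatrix Fin.succ Fin.succ).det := by
  rw [Matrix.det_succ_column_zero, Fin.sum_univ_succ]
  simp [h]

set_option maxHeartbeats 1000000 in
theorem redn (r : ℕ) : ∃ C : ℝ, 1 ≤ C ∧ ∀ M : Sq r ℝ, M.det ≠ 0 →
    ∃ (U : Sq r ℤ) (π : Perm (Fin r)) (la : Fin r → ℝ), IsUnit U.det ∧ (∀ i, 0 < la i) ∧
      (∀ i l, |(M * U.map (Int.cast : ℤ → ℝ)) (π i) l| ≤ C * la i ∧ |(M * U.map (Int.cast : ℤ → ℝ)) (π i) l| ≤ C * la l) ∧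
      ∏ i, la i = |M.det| ∧ (∀ i l, i ≤ l → la i ≤ C * la l) ∧
      ∀ (z : Fin r → ℤ) (X : ℝ), (∀ i, |mulVec (M * U.map (Int.cast : ℤ → ℝ)) (fun l => (z l : ℝ)) i| ≤ X) →
        ∀ t, z t ≠ 0 → la t ≤ C * X := by
  classical
  induction r with
  | zero =>
    refine ⟨1, le_rfl, fun M _ => ⟨1, 1, fun i => i.elim0, by simp, fun i => i.elim0, fun i => i.elim0, by simp, fun i => i.elim0, fun _ _ _ i => i.elim0⟩⟩
  | succ r ih =>
    obtain ⟨C, hC, ih⟩ := ih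
    refine ⟨2 * C, by linarith, fun M hM => ?_⟩
    obtain ⟨z, hz, hmin⟩ := min_vec M hM
    obtain ⟨U1, a, hU1, hza⟩ := unimod z hz
    have ha : a ≠ 0 := by
      rintro rfl; exact hz (funext fun i => by simp [hza])
    let f : (Fin (r+1) → ℤ) → ℝ := fun z => ‖mulVec M (fun l => (z l : ℝ))‖
    let u0 : Fin (r+1) → ℤ := fun i => U1 i 0
    have hfu : f u0 ≤ f z := by
      have h1 : mulVec M (fun l => (z l : ℝ)) = (a : ℝ) • mulVec M (fun l => (u0 l : ℝ)) := by
        rw [← mulVec_smul]; congr 1; funext i; simp [hza, u0]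
      have h2 : f z = |(a : ℝ)| * f u0 := by
        simp only [f]; rw [h1, norm_smul]; rfl
      have h3 : (1 : ℝ) ≤ |(a : ℝ)| := by exact_mod_cast one_le_abs ha
      rw [h2]
      have : 0 ≤ f u0 := norm_nonneg _
      nlinarith
    obtain ⟨l1, hl1⟩ : ∃ l1, l1 = f u0 := ⟨_, rfl⟩
    have hmin1 : ∀ z' : Fin (r+1) → ℤ, z' ≠ 0 → l1 ≤ f z' := fun z' hz' => hl1 ▸ hfu.trans (hmin z' hz')
    obtain ⟨M1, hM1⟩ : ∃ M1, M1 = M * U1.map (Int.cast : ℤ → ℝ) := ⟨_, rfl⟩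
    have hM1c : ∀ i, M1 i 0 = mulVec M (fun l => (u0 l : ℝ)) i := by
      intro i; rw [hM1, Matrix.mul_apply]; rfl
    have hU1r : |((U1.det : ℤ) : ℝ)| = 1 := by
      rcases Int.isUnit_iff.1 hU1 with h | h <;> rw [h] <;> simp
    have hdetmap : ∀ W : Matrix (Fin (r+1)) (Fin (r+1)) ℤ, (W.map (Int.cast : ℤ → ℝ)).det = ((W.det : ℤ) : ℝ) := by
      intro W; exact ((castRingHom ℝ).map_det W).symm
    have hM1d : |M1.det| = |M.det| := by
      rw [hM1, det_mul, hdetmap, abs_mul, hU1r, mul_one]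
    have hle1 : ∀ i, |M1 i 0| ≤ l1 := by
      intro i; rw [hM1c, hl1]; exact norm_le_pi_norm (mulVec M (fun l => (u0 l : ℝ))) i
    obtain ⟨p0, _, hp0⟩ := exists_max_image univ (fun i => |M1 i 0|) ⟨0, mem_univ _⟩
    have hp1 : |M1 p0 0| = l1 := by
      refine le_antisymm (hle1 _) ?_
      rw [hl1]
      refine (pi_norm_le_iff_of_nonneg (abs_nonneg _)).2 fun i => ?_
      rw [← hM1c]; exact hp0 i (mem_univ i)
    obtain ⟨M2, hM2⟩ : ∃ M2 : Matrix (Fin (r+1)) (Fin (r+1)) ℝ, M2 = M1.submatrix (swap 0 p0) id := ⟨_, rfl⟩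
    have hM2d : |M2.det| = |M.det| := by
      rw [hM2, Matrix.det_permute, abs_mul, ← hM1d]
      rcases units_eq_one_or (Perm.sign (swap 0 p0)) with h | h <;> rw [h] <;> simp
    obtain ⟨α, hα⟩ : ∃ α, α = M2 0 0 := ⟨_, rfl⟩
    have hαl : |α| = l1 := by rw [hα, hM2]; simpa using hp1
    have hM20 : ∀ i, |M2 i 0| ≤ l1 := fun i => by rw [hM2]; exact hle1 _
    have hu0 : u0 ≠ 0 := by
      intro h; apply hz; funext i; rw [hza]; have := congrFun h i; simp only [u0] at this; rw [this]; simp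
    have hl1pos : 0 < l1 := by
      rw [hl1]
      refine norm_pos_iff.2 fun h => hu0 ?_
      have := Matrix.eq_zero_of_mulVec_eq_zero hM h
      funext i; have := congrFun this i; simpa using this
    have hα0 : α ≠ 0 := by intro h; rw [h] at hαl; simp at hαl; linarith
    let S : Sq r ℝ := fun i l => M2 i.succ l.succ - M2 i.succ 0 / α * M2 0 l.succ
    have hSd : M2.det = α * S.det := by
      let B : Matrix (Fin (r+1)) (Fin (r+1)) ℝ := fun i j => M2 i j - (if i = 0 then 0 else M2 i 0 / α) * M2 0 j
      have h1 : M2.det = B.det := by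
        refine Matrix.det_eq_of_forall_row_eq_smul_add_const (fun i => if i = 0 then 0 else M2 i 0 / α) 0 (by simp) ?_
        intro i j
        simp only [B]
        simp
      rw [h1, det_col0 B (by
        intro i; simp only [B, Fin.succ_ne_zero, if_false]; rw [← hα]; field_simp; ring)]
      have h2 : B.submatrix Fin.succ Fin.succ = S := by
        ext i j; show B i.succ j.succ = S i j; simp only [B, S, Fin.succ_ne_zero, if_false]
      rw [h2]; simp [B, hα]
    have hM2ne : M2.det ≠ 0 := by
      intro h; rw [h] at hM2d; simp at hM2d; exact hM (abs_eq_zero.1 hM2d.symm)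
    have hSne : S.det ≠ 0 := by intro h; rw [hSd, h, mul_zero] at hM2ne; exact hM2ne rfl
    obtain ⟨U', π', la', hU', hla', hent, hprod, hmono, hz'⟩ := ih S hSne
    let kk : Fin r → ℤ := fun l => -round ((∑ m : Fin r, M2 0 m.succ * (U' m l : ℝ)) / α)
    let W : Matrix (Fin (r+1)) (Fin (r+1)) ℤ := Fin.cons (Fin.cons 1 kk) (fun m => Fin.cons 0 (U' m))
    have hWd : W.det = U'.det := by
      rw [det_col0 W (fun i => by simp [W])]
      have : W.submatrix Fin.succ Fin.succ = U' := by ext i j; show W i.succ j.succ = U' i j; simp [W]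
      rw [this]; simp [W]
    have w00 : W 0 0 = 1 := rfl
    have w0s : ∀ l : Fin r, W 0 l.succ = kk l := fun l => rfl
    have ws0 : ∀ m : Fin r, W m.succ 0 = 0 := fun m => rfl
    have wss : ∀ m l : Fin r, W m.succ l.succ = U' m l := fun m l => rfl
    clear_value W
    obtain ⟨Y, hY⟩ : ∃ Y, Y = M2 * W.map (Int.cast : ℤ → ℝ) := ⟨_, rfl⟩
    have hY0 : ∀ i, Y i 0 = M2 i 0 := by
      intro i; rw [hY, Matrix.mul_apply, Fin.sum_univ_succ]; simp [w00, ws0]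
    have hYs : ∀ i (l : Fin r), Y i l.succ = M2 i 0 * kk l + ∑ m : Fin r, M2 i m.succ * (U' m l : ℝ) := by
      intro i l; rw [hY, Matrix.mul_apply, Fin.sum_univ_succ]; simp [w0s, wss]
    have hY0s : ∀ l : Fin r, |Y 0 l.succ| ≤ l1 / 2 := by
      intro l
      rw [hYs, ← hα]
      set x := (∑ m : Fin r, M2 0 m.succ * (U' m l : ℝ)) with hx
      have h1 : α * (kk l : ℝ) + x = α * (x / α - round (x / α)) := by
        simp only [kk]; push_cast; field_simp; ring
      rw [h1, abs_mul, hαl]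
      have := abs_sub_round (x / α)
      nlinarith
    have hYss : ∀ i l : Fin r, Y i.succ l.succ = (S * U'.map (Int.cast : ℤ → ℝ)) i l + M2 i.succ 0 / α * Y 0 l.succ := by
      intro i l
      rw [hYs, hYs, Matrix.mul_apply]
      simp only [S, sub_mul, sum_sub_distrib, map_apply]
      rw [mul_add, mul_sum, ← hα]
      have : M2 i.succ 0 / α * (α * (kk l : ℝ)) = M2 i.succ 0 * kk l := by field_simp
      rw [this]
      simp only [mul_assoc]
      ring
    have hratio : ∀ i, |M2 i 0 / α| ≤ 1 := by
      intro i; rw [abs_div, hαl, div_le_one hl1pos]; exact hM20 i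
    let π : Perm (Fin (r+1)) := Perm.decomposeFin.symm (p0, π')
    have hMU : ∀ i l, (M * (U1 * W).map (Int.cast : ℤ → ℝ)) (swap 0 p0 i) l = Y i l := by
      intro i l
      have h1 : (U1 * W).map (Int.cast : ℤ → ℝ) = U1.map (Int.cast : ℤ → ℝ) * W.map (Int.cast : ℤ → ℝ) :=
        Matrix.map_mul (f := castRingHom ℝ)
      rw [h1, ← Matrix.mul_assoc, ← hM1, hY, hM2]
      rfl
    have hUdet : IsUnit (U1 * W).det := by rw [det_mul, hWd]; exact hU1.mul hU'
    have hUdet0 : (U1 * W).det ≠ 0 := hUdet.ne_zero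
    -- rows
    have hMUz : ∀ (z : Fin (r+1) → ℤ) i, mulVec (M * (U1 * W).map (Int.cast : ℤ → ℝ)) (fun l => (z l : ℝ)) (swap 0 p0 i)
        = ∑ l, Y i l * z l := by
      intro z i; simp only [mulVec, dotProduct, hMU]
    have hlow : ∀ z : Fin (r+1) → ℤ, z ≠ 0 → ∀ X, (∀ i, |∑ l, Y i l * z l| ≤ X) → l1 ≤ X := by
      intro z hz X hX
      have h1 : mulVec (U1 * W) z ≠ 0 := fun h => hz (Matrix.eq_zero_of_mulVec_eq_zero hUdet0 h)
      refine (hmin1 _ h1).trans ?_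
      simp only [f]
      rw [cast_mulVec]
      refine (pi_norm_le_iff_of_nonneg ((abs_nonneg _).trans (hX 0))).2 fun i => ?_
      rw [← Equiv.swap_apply_self 0 p0 i, hMUz]
      exact hX _
    have hl1la : ∀ l, l1 ≤ 2 * C * la' l := by
      intro l
      have h1 := hlow (Pi.single l.succ 1) (by simp) (max (l1 / 2) (C * la' l + l1 / 2)) (by
        intro i
        have h2 : ∑ l', Y i l' * ((Pi.single l.succ 1 : Fin (r+1) → ℤ) l' : ℝ) = Y i l.succ := by
          rw [sum_eq_single l.succ]
          · simp
          · intro b _ hb; simp [Pi.single_apply, hb]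
          · simp
        rw [h2]
        refine Fin.cases ?_ (fun i => ?_) i
        · exact (hY0s l).trans (le_max_left _ _)
        · refine le_trans ?_ (le_max_right _ _)
          rw [hYss]
          have h3 := (hent (π'.symm i) l).2
          rw [Equiv.apply_symm_apply] at h3
          refine (abs_add_le _ _).trans (add_le_add h3 ?_)
          rw [abs_mul]
          have := hratio i.succ
          have := hY0s l
          have := abs_nonneg (Y 0 l.succ)
          nlinarith)
      rcases le_max_iff.1 h1 with h | h <;> nlinarith [hla' l]
    refine ⟨U1 * W, π, Fin.cons l1 la', hUdet, ?_, ?_, ?_, ?_, ?_⟩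
    · intro i; refine Fin.cases ?_ (fun i => ?_) i
      · simpa using hl1pos
      · simpa using hla' i
    · intro i
      have hπ0 : π 0 = swap 0 p0 0 := by simp [π]
      have hπs : ∀ i : Fin r, π i.succ = swap 0 p0 (π' i).succ := by intro i; simp [π]
      refine Fin.cases ?_ (fun i => ?_) i
      · intro l
        rw [hπ0, hMU]
        refine Fin.cases ?_ (fun l => ?_) l
        · rw [hY0]; simp only [Fin.cons_zero]
          have := hM20 0
          constructor <;> nlinarith
        · simp only [Fin.cons_zero, Fin.cons_succ]
          have := hY0s l
          have := hl1la l
          constructor <;> nlinarith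
      · intro l
        rw [hπs, hMU]
        refine Fin.cases ?_ (fun l => ?_) l
        · rw [hY0]; simp only [Fin.cons_zero, Fin.cons_succ]
          have := hM20 (π' i).succ
          have := hl1la i
          constructor <;> nlinarith
        · simp only [Fin.cons_succ]
          rw [hYss]
          have h1 := hent i l
          have h2 : |M2 (π' i).succ 0 / α * Y 0 l.succ| ≤ l1 / 2 := by
            rw [abs_mul]
            have := hratio (π' i).succ
            have := hY0s l
            have := abs_nonneg (Y 0 l.succ)
            nlinarith
          have h3 := hl1la l
          have h4 := hl1la i
          have h5 := abs_add_le ((S * U'.map (Int.cast : ℤ → ℝ)) (π' i) l) (M2 (π' i).succ 0 / α * Y 0 l.succ)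
          constructor <;> linarith [h1.1, h1.2]
    · rw [Fin.prod_univ_succ]
      simp only [Fin.cons_zero, Fin.cons_succ]
      rw [hprod, ← hM2d, hSd, abs_mul, hαl]
    · intro i l hil
      revert hil
      refine Fin.cases ?_ (fun i => ?_) i <;> refine Fin.cases ?_ (fun l => ?_) l
      · intro _; simp only [Fin.cons_zero]; nlinarith
      · intro _; simpa using hl1la l
      · intro h; exact absurd h (by simp)
      · intro h; simp only [Fin.cons_succ]
        have := hmono i l (by simpa using h)
        nlinarith [hla' l]
    · intro z X hX
      have hX' : ∀ i, |∑ l, Y i l * z l| ≤ X := fun i => by rw [← hMUz]; exact hX _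
      have hX0 : 0 ≤ X := (abs_nonneg _).trans (hX' 0)
      intro t
      refine Fin.cases ?_ (fun t => ?_) t
      · intro ht
        have := hlow z (fun h => ht (by rw [h]; rfl)) X hX'
        simp only [Fin.cons_zero]
        nlinarith
      · intro ht
        simp only [Fin.cons_succ]
        have := hz' (fun l => z l.succ) (2 * X) (by
          intro i
          have h1 : mulVec (S * U'.map (Int.cast : ℤ → ℝ)) (fun l => ((z (Fin.succ l) : ℤ) : ℝ)) i
             = ∑ l, Y i.succ l * z l - M2 i.succ 0 / α * ∑ l, Y 0 l * z l := by
            rw [Fin.sum_univ_succ, Fin.sum_univ_succ, hY0, hY0, ← hα]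
            simp only [hYss, add_mul, sum_add_distrib, mul_add, mul_sum, mulVec, dotProduct]
            have : M2 i.succ 0 / α * (α * (z 0 : ℝ)) = M2 i.succ 0 * z 0 := by field_simp
            rw [this]
            simp only [mul_assoc]
            ring
          rw [h1]
          have h2 := abs_sub (∑ l, Y i.succ l * z l) (M2 i.succ 0 / α * ∑ l, Y 0 l * z l)
          have h3 := hX' i.succ
          have h4 := hX' 0
          rw [abs_mul] at h2
          have h5 := hratio i.succ
          have h6 := abs_nonneg (M2 i.succ 0 / α)
          nlinarith [abs_nonneg (∑ l, Y 0 l * z l)]) t ht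
        linarith

def topSM {i s r : ℕ} (h : i + s = r) : SM s r :=
  ⟨fun a => ⟨i + a, by omega⟩, fun a b hab => by
    simp only [Fin.lt_def] at hab ⊢; omega⟩

theorem geom {i s r : ℕ} (h : i + s = r) (hs : 0 < s)
    (B : ℕ → Sq r ℤ) (hdet : ∀ j, (B j).det ≠ 0)
    (y : ℕ → Fin r → ℤ) (hy : ∀ᶠ j in atTop, ∀ t : Fin r, i ≤ (t : ℕ) → y j t = 0)
    (m : SM s r → ℤ) (hm : m ≠ 0)
    (hf : ∃ᶠ j in atTop, ∀ σ, σ ≠ topSM h → vecMul m (cmp s (B j)) σ = 0) :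
    ∃ ψ : Fin r → ℤ, ψ ≠ 0 ∧ ∃ᶠ j in atTop, ψ ⬝ᵥ ((B j).mulVec (y j)) = 0 := by
  classical
  obtain ⟨j0, hj0⟩ := hf.exists
  obtain ⟨G, hG⟩ : ∃ G : Matrix (Fin r) (Fin s) ℤ, G = (B j0).submatrix id (topSM h).1 := ⟨_, rfl⟩
  let z : Fin s := ⟨0, hs⟩
  let Φ : (Fin r → ℤ) →ₗ[ℤ] ℤ := ∑ τ : SM s r, m τ •
    ((proj z) ∘ₗ (Matrix.cramer (G.submatrix τ.1 id)) ∘ₗ (funLeft ℤ ℤ τ.1))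
  have hΦ : ∀ x, Φ x = ∑ τ : SM s r, m τ * ((G.updateCol z x).submatrix τ.1 id).det := by
    intro x
    simp only [Φ, LinearMap.sum_apply, LinearMap.smul_apply, comp_apply,
      LinearMap.proj_apply, smul_eq_mul, Matrix.cramer_apply]
    refine sum_congr rfl fun τ _ => ?_
    congr 2
  have hψ : ∀ x, (fun t => Φ (Pi.single t 1)) ⬝ᵥ x = Φ x := by
    intro x
    rw [LinearMap.pi_apply_eq_sum_univ Φ x]
    simp only [dotProduct, smul_eq_mul]
    refine sum_congr rfl fun t _ => ?_
    rw [mul_comm]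
    congr 2
    ext l
    simp [Pi.single_apply, eq_comm]
  refine ⟨fun t => Φ (Pi.single t 1), ?_, (hf.and_eventually hy).mono fun j ⟨hj, hyj⟩ => ?_⟩
  · intro h0
    have h1 : Φ (fun t => G t z) = 0 := by
      rw [← hψ, h0]; simp
    rw [hΦ, Matrix.updateCol_eq_self] at h1
    apply hm
    apply Matrix.eq_zero_of_vecMul_eq_zero (cmp_det_ne (s := s) (B j0) (hdet j0))
    ext σ
    by_cases hσ : σ = topSM h
    · rw [hσ, Pi.zero_apply, ← h1]
      simp only [vecMul, dotProduct, cmp, hG, Matrix.submatrix_submatrix]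
      rfl
    · exact hj0 σ hσ
  · rw [hψ, hΦ]
    obtain ⟨x, hx⟩ : ∃ x, x = (B j).mulVec (y j) := ⟨_, rfl⟩
    rw [← hx]
    obtain ⟨Y, hY⟩ : ∃ Y, Y = (B j).adjugate * (G.updateCol z x) := ⟨_, rfl⟩
    have hBY : B j * Y = (B j).det • G.updateCol z x := by
      rw [hY, ← Matrix.mul_assoc, mul_adjugate, Matrix.smul_mul, Matrix.one_mul]
    have hY0 : (Y.submatrix (topSM h).1 id).det = 0 := by
      apply Matrix.det_eq_zero_of_column_eq_zero z
      intro a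
      have : Y ((topSM h).1 a) z = ((B j).adjugate.mulVec x) ((topSM h).1 a) := by
        rw [hY, Matrix.mul_apply]
        simp [mulVec, dotProduct]
      simp only [Matrix.submatrix_apply, id]
      rw [this, hx, mulVec_mulVec, adjugate_mul, smul_mulVec, one_mulVec]
      simp only [Pi.smul_apply, smul_eq_mul]
      rw [hyj, mul_zero]
      simp [topSM]
    have key : (B j).det ^ s * ∑ τ : SM s r, m τ * ((G.updateCol z x).submatrix τ.1 id).det
        = ∑ ρ : SM s r, vecMul m (cmp s (B j)) ρ * (Y.submatrix ρ.1 id).det := by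
      rw [mul_sum]
      simp only [vecMul, dotProduct, sum_mul]
      rw [sum_comm]
      refine sum_congr rfl fun τ _ => ?_
      have e1 : (B j).det ^ s * ((G.updateCol z x).submatrix τ.1 id).det
          = ((B j * Y).submatrix τ.1 id).det := by
        rw [hBY]
        have : ((B j).det • G.updateCol z x).submatrix τ.1 id
          = (B j).det • ((G.updateCol z x).submatrix τ.1 id) := rfl
        rw [this, det_smul, Fintype.card_fin]
      have e2 : (B j * Y).submatrix τ.1 id = (B j).submatrix τ.1 id * Y := by
        ext a b; simp [Matrix.mul_apply]
      calc _ = m τ * ((B j).det ^ s * ((G.updateCol z x).submatrix τ.1 id).det) := by ring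
        _ = _ := by
          rw [e1, e2, cauchy_binet, mul_sum]
          refine sum_congr rfl fun ρ _ => ?_
          simp only [cmp, Matrix.submatrix_submatrix, mul_assoc]
          rfl
    rw [sum_eq_zero (s := (univ : Finset (SM s r))) (f := fun ρ => vecMul m (cmp s (B j)) ρ * (Y.submatrix ρ.1 id).det)] at key
    · exact (mul_eq_zero.1 key).resolve_left (pow_ne_zero _ (hdet j))
    · intro ρ _
      by_cases hρ : ρ = topSM h
      · rw [hρ, hY0, mul_zero]
      · rw [hj ρ hρ, zero_mul]

lemma minor_bound2 {s : ℕ} {K : Type*} [Field K] (v : AbsoluteValue K ℝ) (A : Sq s K) (β d : Fin s → ℝ)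
    (hA : ∀ i l, v (A i l) ≤ β i * d l) : v A.det ≤ s.factorial * ((∏ i, β i) * ∏ i, d i) := by
  rw [det_apply]
  refine (abv_sum_le _ _ _).trans ?_
  have : ∀ π ∈ (univ : Finset (Perm (Fin s))), v (Perm.sign π • ∏ l, A (π l) l) ≤ (∏ i, β i) * ∏ i, d i := by
    intro π _
    have h0 : v (Perm.sign π • ∏ l, A (π l) l) = ∏ l, v (A (π l) l) := by
      rcases units_eq_one_or (Perm.sign π) with h | h <;> rw [h] <;> simp [map_prod]
    rw [h0, ← Equiv.prod_comp π β, ← prod_mul_distrib]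
    exact Finset.prod_le_prod (fun _ _ => v.nonneg _) fun l _ => hA _ _
  refine (sum_le_card_nsmul _ _ _ this).trans ?_
  simp [card_perm]

lemma freq_shift {P : ℕ → Prop} (N : ℕ) (h : ∃ᶠ j in atTop, P (j + N)) : ∃ᶠ j in atTop, P j := by
  rw [frequently_atTop] at h ⊢
  intro a
  obtain ⟨b, hb, h1⟩ := h a
  exact ⟨b + N, by omega, h1⟩

theorem splitP {K V : Type*} [Field K] [NumberField K] [Fintype V] (v : V → AbsoluteValue K ℝ)
    (hv : ∀ z : ℤ, z ≠ 0 → 1 ≤ ∏ i, v i (z : K)) (i0 : V) {i s r : ℕ} (h : i + s = r) (hs : 0 < s)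
    (L : V → Sq r K) (hL : ∀ i, (L i).det ≠ 0)
    (Q : ℕ → ℝ) (hQ : Tendsto Q atTop atTop)
    (B : ℕ → Sq r ℤ) (hdet : ∀ j, (B j).det ≠ 0)
    (Ω : V → Fin r → ℝ) (w ℓ : Fin r → ℝ) (hw : ∀ t, Ω i0 t = w t + ℓ t)
    (hsum : ∑ i, ∑ t, Ω i t ≤ 0) (hsort : ∀ t l, t ≤ l → ℓ t ≤ ℓ l)
    (γ : ℝ) (hγ : 0 < γ) (hgap : ∀ t l : Fin r, (t : ℕ) < i → i ≤ (l : ℕ) → ℓ t + γ ≤ ℓ l)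
    (hb1 : ∀ ε > 0, ∀ᶠ j in atTop, ∀ i t l, v i ((L i * (B j).map (Int.cast : ℤ → K)) t l) ≤ Q j ^ (Ω i t + ε))
    (hb2 : ∀ ε > 0, ∀ᶠ j in atTop, ∀ t l, v i0 ((L i0 * (B j).map (Int.cast : ℤ → K)) t l) ≤ Q j ^ (w t + ℓ l + ε)) :
    ∃ m : SM s r → ℤ, m ≠ 0 ∧ ∃ᶠ j in atTop, ∀ σ, σ ≠ topSM h → vecMul m (cmp s (B j)) σ = 0 := by
  classical
  haveI : NeZero r := ⟨by omega⟩
  obtain ⟨κ, hκ, hcount⟩ := cmp_count s r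
  obtain ⟨N, hN⟩ : ∃ N : ℝ, N = (Fintype.card V : ℝ) * (Fintype.card (SM s r)) * (s + 1) := ⟨_, rfl⟩
  have hN0 : 0 < N := by
    have h1 : 0 < Fintype.card V := card_pos_iff.2 ⟨i0⟩
    have h2 : 0 < Fintype.card (SM s r) := card_pos_iff.2 ⟨topSM h⟩
    have h1' : (0:ℝ) < Fintype.card V := by exact_mod_cast h1
    have h2' : (0:ℝ) < Fintype.card (SM s r) := by exact_mod_cast h2
    rw [hN]; positivity
  obtain ⟨ε, hε⟩ : ∃ ε : ℝ, ε = γ / (2 * N) := ⟨_, rfl⟩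
  have hε0 : 0 < ε := by rw [hε]; positivity
  have hNε : N * ε = γ / 2 := by rw [hε]; field_simp
  let c : V → SM s r → ℝ := fun i τ => ∑ a, Ω i (τ.1 a) + (s + 1) * ε -
    (if i = i0 ∧ τ = topSM h then γ else 0)
  have hc : ∑ i, ∑ τ, c i τ < 0 := by
    have h1 : ∑ i, ∑ τ, c i τ = κ * ∑ i, ∑ t, Ω i t + N * ε - γ := by
      simp only [c, sum_sub_distrib, sum_add_distrib, hcount]
      rw [← mul_sum]
      congr 1
      · simp [hN]; ring
      · have : ∀ i : V, ∑ τ : SM s r, (if i = i0 ∧ τ = topSM h then γ else 0) = if i = i0 then γ else 0 := by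
          intro i
          by_cases hi : i = i0 <;> simp [hi]
        simp [this]
    rw [h1, hNε]
    nlinarith
  obtain ⟨C0, hC0⟩ : ∃ C0 : ℝ, C0 = ∑ i, ∑ τ, |c i τ| + γ := ⟨_, rfl⟩
  have hcC : ∀ i τ, c i τ + γ ≤ C0 := by
    intro i τ
    rw [hC0]
    have h1 : |c i τ| ≤ ∑ τ, |c i τ| := single_le_sum (f := fun τ => |c i τ|) (fun _ _ => abs_nonneg _) (mem_univ τ)
    have h2 : ∑ τ, |c i τ| ≤ ∑ i, ∑ τ, |c i τ| := single_le_sum (f := fun i => ∑ τ, |c i τ|) (fun _ _ => sum_nonneg fun _ _ => abs_nonneg _) (mem_univ i)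
    linarith [le_abs_self (c i τ)]
  have hfac : ∀ᶠ j in atTop, (s.factorial : ℝ) ≤ Q j ^ ε :=
    ((tendsto_rpow_atTop hε0).comp hQ).eventually_ge_atTop _
  have hQ1 : ∀ᶠ j in atTop, 1 ≤ Q j := hQ.eventually_ge_atTop 1
  obtain ⟨N0, hN0⟩ := eventually_atTop.1 ((hb1 ε hε0).and ((hb2 ε hε0).and (hfac.and hQ1)))
  have hminor : ∀ j, N0 ≤ j → ∀ i (τ σ : SM s r), v i ((cmp s (L i) * (cmp s (B j)).map (Int.cast : ℤ → K)) τ σ)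
      = v i ((L i * (B j).map (Int.cast : ℤ → K)).submatrix τ.1 σ.1).det := by
    intro j _ i τ σ
    have : (cmp s (B j)).map (Int.cast : ℤ → K) = cmp s ((B j).map (Int.cast : ℤ → K)) := by
      exact (cmp_map (castRingHom K) (B j)).symm
    rw [this, ← cmp_mul]
    rfl
  have hbd1 : ∀ j, N0 ≤ j → ∀ i (τ σ : SM s r), v i ((cmp s (L i) * (cmp s (B j)).map (Int.cast : ℤ → K)) τ σ)
      ≤ Q j ^ (∑ a, Ω i (τ.1 a) + (s + 1) * ε) := by
    intro j hj i τ σ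
    obtain ⟨g1, g2, g3, g4⟩ := hN0 j hj
    have hq : 0 < Q j := by linarith
    rw [hminor j hj]
    refine (minor_bound (v i) _ (fun a => Q j ^ (Ω i (τ.1 a) + ε)) (fun a b => g1 i _ _)).trans ?_
    rw [← rpow_sum_of_pos hq]
    refine (mul_le_mul_of_nonneg_right g3 (by positivity)).trans ?_
    rw [← rpow_add hq]
    apply le_of_eq; congr 1
    simp [sum_add_distrib]; ring
  have hbd2 : ∀ j, N0 ≤ j → ∀ (σ : SM s r), σ ≠ topSM h → v i0 ((cmp s (L i0) * (cmp s (B j)).map (Int.cast : ℤ → K)) (topSM h) σ)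
      ≤ Q j ^ (∑ a, Ω i0 ((topSM h).1 a) + (s + 1) * ε - γ) := by
    intro j hj σ hσ
    obtain ⟨g1, g2, g3, g4⟩ := hN0 j hj
    have hq : 0 < Q j := by linarith
    rw [hminor j hj]
    refine (minor_bound2 (v i0) _ (fun a => Q j ^ (w ((topSM h).1 a))) (fun b => Q j ^ (ℓ (σ.1 b) + ε)) (fun a b => ?_)).trans ?_
    · rw [← rpow_add hq, ← add_assoc]
      exact g2 _ _
    rw [← rpow_sum_of_pos hq, ← rpow_sum_of_pos hq]
    refine (mul_le_mul_of_nonneg_right g3 (by positivity)).trans ?_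
    rw [← rpow_add hq, ← rpow_add hq]
    apply rpow_le_rpow_of_exponent_le g4
    have h0 : (σ.1 ⟨0, hs⟩ : ℕ) < i := by
      by_contra hcon
      apply hσ
      apply Subtype.ext
      funext a
      apply Fin.ext
      rw [SM_eq_top h σ hs (by omega) a]
      rfl
    have hle : ∀ a, ℓ (σ.1 a) ≤ ℓ ((topSM h).1 a) := fun a => hsort _ _ (by
      rw [Fin.le_def]; exact SM_le_top h σ a)
    have hkey : ∑ a, ℓ (σ.1 a) + γ ≤ ∑ a, ℓ ((topSM h).1 a) := by
      rw [← add_sum_erase _ (fun a => ℓ (σ.1 a)) (mem_univ (⟨0, hs⟩ : Fin s)),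
        ← add_sum_erase _ (fun a => ℓ ((topSM h).1 a)) (mem_univ (⟨0, hs⟩ : Fin s))]
      have h1 : ∑ x ∈ univ.erase (⟨0, hs⟩ : Fin s), ℓ (σ.1 x) ≤ ∑ x ∈ univ.erase (⟨0, hs⟩ : Fin s), ℓ ((topSM h).1 x) :=
        sum_le_sum fun a _ => hle a
      have h2 := hgap (σ.1 ⟨0, hs⟩) ((topSM h).1 ⟨0, hs⟩) h0 (by simp [topSM])
      linarith
    simp only [hw, sum_add_distrib]
    simp
    linarith
  have hP : ∀ i, ∃ P : Matrix (SM s r) (SM s r) K, P * cmp s (L i) = 1 := by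
    intro i
    refine ⟨cmp s (L i)⁻¹, ?_⟩
    rw [← cmp_mul, nonsing_inv_mul _ (isUnit_iff_ne_zero.2 (hL i))]
    have := cmp_scalar (s := s) (r := r) (1 : K)
    simpa using this
  choose P hP using hP
  obtain ⟨m, hm, hf⟩ := thmP v hv (topSM h) (fun i => cmp s (L i)) P hP c hc C0 (fun j => Q (j + N0))
    (hQ.comp (tendsto_add_atTop_nat N0)) (fun j => cmp s (B (j + N0))) (fun j => cmp_det_ne _ (hdet _))
    (by
      intro j i τ σ hσ
      by_cases hi : i = i0 ∧ τ = topSM h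
      · obtain ⟨rfl, rfl⟩ := hi
        have := hbd2 (j + N0) (by omega) σ hσ
        simpa [c] using this
      · have := hbd1 (j + N0) (by omega) i τ σ
        simpa [c, hi] using this)
    (by
      intro j i τ
      refine (hbd1 (j + N0) (by omega) i τ _).trans (rpow_le_rpow_of_exponent_le (hN0 (j + N0) (by omega)).2.2.2 ?_)
      have h1 := hcC i τ
      simp only [c] at h1
      split_ifs at h1 <;> linarith)
  exact ⟨m, hm, freq_shift N0 hf⟩

lemma lowbd {r : ℕ} (R : Sq r ℝ) (hR : R.det ≠ 0) : ∃ c : ℝ, 0 < c ∧ ∀ b : Fin r → ℤ, b ≠ 0 →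
    ∀ X, (∀ i, |R.mulVec (fun l => (b l : ℝ)) i| ≤ X) → c ≤ X := by
  obtain ⟨S, hS⟩ : ∃ S : ℝ, S = ∑ k, ∑ i, |R⁻¹ k i| := ⟨_, rfl⟩
  have hS0 : 0 ≤ S := by rw [hS]; exact sum_nonneg fun _ _ => sum_nonneg fun _ _ => abs_nonneg _
  refine ⟨1 / (S + 1), by positivity, fun b hb X hX => ?_⟩
  obtain ⟨k, hk⟩ := ne_iff.1 hb
  have hX0 : 0 ≤ X := (abs_nonneg _).trans (hX k)
  have h1 : (b k : ℝ) = ∑ i, R⁻¹ k i * R.mulVec (fun l => (b l : ℝ)) i := by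
    have : R⁻¹.mulVec (R.mulVec (fun l => (b l : ℝ))) = (fun l => (b l : ℝ)) := by
      rw [mulVec_mulVec, nonsing_inv_mul _ (isUnit_iff_ne_zero.2 hR), one_mulVec]
    exact (congrFun this k).symm
  have h2 : (1 : ℝ) ≤ |(b k : ℝ)| := by
    have : 1 ≤ |b k| := one_le_abs hk
    exact_mod_cast this
  have h3 : |(b k : ℝ)| ≤ S * X := by
    rw [h1]
    refine (abs_sum_le_sum_abs _ _).trans ?_
    have : ∑ i, |R⁻¹ k i| ≤ S := by
      rw [hS]
      exact single_le_sum (f := fun k => ∑ i, |R⁻¹ k i|) (fun _ _ => sum_nonneg fun _ _ => abs_nonneg _) (mem_univ k)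
    refine le_trans ?_ (mul_le_mul_of_nonneg_right this hX0)
    rw [sum_mul]
    refine sum_le_sum fun i _ => ?_
    rw [abs_mul]
    exact mul_le_mul_of_nonneg_left (hX i) (abs_nonneg _)
  rw [div_le_iff₀ (by positivity)]
  nlinarith

theorem thmS {K V : Type*} [Field K] [NumberField K] [Fintype V] (v0 : AbsoluteValue K ℝ) (v : V → AbsoluteValue K ℝ)
    (hna : ∀ i, IsNonarchimedean (v i)) (hv : ∀ z : ℤ, z ≠ 0 → 1 ≤ v0 (z : K) * ∏ i, v i (z : K)) {r : ℕ}
    (L0 : Sq r K) (hL0 : L0.det ≠ 0) (R : Sq r ℝ) (hR : R.det ≠ 0)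
    (hRL : ∀ (x : Fin r → ℤ) t, v0 (L0.mulVec (fun l => (x l : K)) t) = |R.mulVec (fun l => (x l : ℝ)) t|)
    (L : V → Sq r K) (hL : ∀ i, (L i).det ≠ 0)
    (Q : ℕ → ℝ) (hQ1 : ∀ j, 1 < Q j) (hQ : Tendsto Q atTop atTop)
    (D : ℕ → Sq r ℤ) (hdet : ∀ j, (D j).det ≠ 0)
    (Δ : ℝ) (hΔ : Tendsto (fun j => log |((D j).det : ℝ)| / log (Q j)) atTop (𝓝 Δ))
    (w : Fin r → ℝ) (W : V → Fin r → ℝ) (hW : Δ + ∑ i, ∑ t, W i t ≤ 0) (hw : ∑ t, w t < Δ)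
    (z : ℕ → Fin r → ℤ)
    (hb1 : ∀ ε > 0, ∀ᶠ j in atTop, ∀ i t l, v i ((L i * (D j).map (Int.cast : ℤ → K)) t l) ≤ Q j ^ (W i t + ε))
    (hb2 : ∀ ε > 0, ∀ᶠ j in atTop, ∀ t, |R.mulVec (fun l => (((D j).mulVec (z j) l : ℤ) : ℝ)) t| ≤ Q j ^ (w t + ε)) :
    ∃ ψ : Fin r → ℤ, ψ ≠ 0 ∧ ∃ᶠ j in atTop, ψ ⬝ᵥ ((D j).mulVec (z j)) = 0 := by
  classical
  have hQ0 : ∀ j, 0 < Q j := fun j => by linarith [hQ1 j]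
  have hlogQ : ∀ j, 0 < log (Q j) := fun j => log_pos (hQ1 j)
  have hlogT : Tendsto (fun j => log (Q j)) atTop atTop := Real.tendsto_log_atTop.comp hQ
  obtain ⟨e, he⟩ : ∃ e : ℝ, e = (Δ - ∑ t, w t) / (2 * (r + 1)) := ⟨_, rfl⟩
  have he0 : 0 < e := by rw [he]; apply div_pos (by linarith) (by positivity)
  have her : ∑ t, w t + r * e < Δ := by
    have : (r + 1 : ℝ) * e = (Δ - ∑ t, w t) / 2 := by rw [he]; field_simp
    nlinarith
  -- scaled matrices
  obtain ⟨M, hM⟩ : ∃ M : ℕ → Sq r ℝ, ∀ j, M j =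
    diagonal (fun t => Q j ^ (-(w t + e))) * (R * (D j).map (Int.cast : ℤ → ℝ)) := ⟨_, fun _ => rfl⟩
  have hMt : ∀ j (X : Sq r ℝ) t l, (M j * X) t l = Q j ^ (-(w t + e)) * (R * (D j).map (Int.cast : ℤ → ℝ) * X) t l := by
    intro j X t l
    rw [hM, Matrix.mul_assoc, Matrix.diagonal_mul]
  have hDR : ∀ j, ((D j).map (Int.cast : ℤ → ℝ)).det = ((D j).det : ℝ) := by
    intro j
    exact ((castRingHom ℝ).map_det (D j)).symm
  have hMdet : ∀ j, (M j).det = Q j ^ (∑ t, -(w t + e)) * (R.det * ((D j).det : ℝ)) := by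
    intro j
    rw [hM, det_mul, Matrix.det_diagonal, det_mul, hDR, rpow_sum_of_pos (hQ0 j)]
  have hMne : ∀ j, (M j).det ≠ 0 := by
    intro j
    rw [hMdet]
    have h1 : ((D j).det : ℝ) ≠ 0 := by exact_mod_cast hdet j
    have h2 := (rpow_pos_of_pos (hQ0 j) (∑ t, -(w t + e))).ne'
    exact mul_ne_zero h2 (mul_ne_zero hR h1)
  obtain ⟨C, hC1, hred⟩ := redn r
  have hred' := fun j => hred (M j) (hMne j)
  choose U π la hU hla hbd hprod hsort hsucc using hred'
  have hC0 : 0 < C := by linarith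
  obtain ⟨ℓ, hℓ⟩ : ∃ ℓ : ℕ → Fin r → ℝ, ∀ j t, ℓ j t = log (la j t) / log (Q j) := ⟨_, fun _ _ => rfl⟩
  have hlaQ : ∀ j t, la j t = Q j ^ ℓ j t := by
    intro j t
    rw [Real.rpow_def_of_pos (hQ0 j), hℓ, mul_div_cancel₀ _ (hlogQ j).ne', exp_log (hla j t)]
  -- sum of exponents
  obtain ⟨S, hS⟩ : ∃ S : ℝ, S = Δ - (∑ t, w t + r * e) := ⟨_, rfl⟩
  have hsumℓ : Tendsto (fun j => ∑ t, ℓ j t) atTop (𝓝 S) := by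
    have h1 : ∀ j, ∑ t, ℓ j t = -(∑ t, w t + r * e) + log |R.det| / log (Q j)
        + log |((D j).det : ℝ)| / log (Q j) := by
      intro j
      simp only [hℓ]
      rw [← sum_div, ← Real.log_prod (fun t _ => (hla j t).ne'), hprod, hMdet, abs_mul, abs_mul,
        log_mul (by have := (rpow_pos_of_pos (hQ0 j) (∑ t, -(w t + e))).ne'; positivity)
          (by have : ((D j).det : ℝ) ≠ 0 := (by exact_mod_cast hdet j); positivity),
        log_mul (by positivity) (by have : ((D j).det : ℝ) ≠ 0 := (by exact_mod_cast hdet j); positivity),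
        abs_of_pos (rpow_pos_of_pos (hQ0 j) _), Real.log_rpow (hQ0 j)]
      have := (hlogQ j).ne'
      field_simp
      simp [sum_add_distrib]
      ring
    simp only [h1]
    have h2 : Tendsto (fun j => log |R.det| / log (Q j)) atTop (𝓝 0) := hlogT.const_div_atTop _
    have h3 := (h2.const_add (-(∑ t, w t + r * e))).add hΔ
    convert h3 using 2
    rw [hS]; ring
  -- constants are negligible
  have hconst : ∀ X : ℝ, ∀ ε : ℝ, ε > 0 → ∀ᶠ j in atTop, X ≤ Q j ^ ε := fun X ε hε =>
    ((tendsto_rpow_atTop hε).comp hQ).eventually_ge_atTop _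
  have hpowle : ∀ j (a b : ℝ), Q j ^ a ≤ Q j ^ b → a ≤ b := fun j a b h =>
    (Real.rpow_le_rpow_left_iff (hQ1 j)).1 h
  obtain ⟨B, hB⟩ : ∃ B : ℕ → Sq r ℤ, ∀ j, B j = D j * U j := ⟨_, fun _ => rfl⟩
  have hBdet : ∀ j, (B j).det ≠ 0 := by
    intro j
    rw [hB, det_mul]
    exact mul_ne_zero (hdet j) (hU j).ne_zero
  have hBR : ∀ j, (B j).map (Int.cast : ℤ → ℝ) = (D j).map Int.cast * (U j).map Int.cast := by
    intro j
    rw [hB]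
    exact Matrix.map_mul (f := castRingHom ℝ)
  have hBK : ∀ j, (B j).map (Int.cast : ℤ → K) = (D j).map Int.cast * (U j).map Int.cast := by
    intro j
    rw [hB]
    exact Matrix.map_mul (f := castRingHom K)
  have hRB : ∀ j t l, |(R * (B j).map (Int.cast : ℤ → ℝ)) t l| = Q j ^ (w t + e) * |(M j * (U j).map (Int.cast : ℤ → ℝ)) t l| := by
    intro j t l
    have h0 : Q j ^ (w t + e) * Q j ^ (-(w t + e)) = 1 := by
      rw [← rpow_add (hQ0 j)]; simp
    rw [hMt, hBR, abs_mul, abs_of_pos (rpow_pos_of_pos (hQ0 j) _), Matrix.mul_assoc]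
    rw [show ∀ a b c : ℝ, a * (b * c) = (a * b) * c from fun a b c => (mul_assoc a b c).symm, h0, one_mul]
  -- lower bound for ell
  obtain ⟨c, hc, hlow⟩ := lowbd R hR
  obtain ⟨wm, hwm⟩ : ∃ wm : ℝ, wm = ∑ t, |w t| + e := ⟨_, rfl⟩
  have hwle : ∀ t, w t + e ≤ wm := by
    intro t
    rw [hwm]
    have := single_le_sum (f := fun t => |w t|) (fun _ _ => abs_nonneg _) (mem_univ t)
    linarith [le_abs_self (w t)]
  have hℓlow : ∀ᶠ j in atTop, ∀ t, -(wm + 1) ≤ ℓ j t := by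
    filter_upwards [hconst (C / c) 1 one_pos] with j hj l
    have hcol : ∀ i, |R.mulVec (fun k => ((B j k l : ℤ) : ℝ)) i| ≤ Q j ^ wm * (C * la j l) := by
      intro i
      have h1 : R.mulVec (fun k => ((B j k l : ℤ) : ℝ)) i = (R * (B j).map (Int.cast : ℤ → ℝ)) i l := by
        simp [Matrix.mul_apply, mulVec, dotProduct]
      rw [h1, hRB]
      have h2 := (hbd j ((π j).symm i) l).2
      rw [Equiv.apply_symm_apply] at h2
      exact mul_le_mul (rpow_le_rpow_of_exponent_le (hQ1 j).le (hwle i)) h2 (abs_nonneg _) (rpow_pos_of_pos (hQ0 j) _).le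
    have hne : (fun k => B j k l) ≠ 0 := by
      intro h0
      exact hBdet j (Matrix.det_eq_zero_of_column_eq_zero l fun k => congrFun h0 k)
    have h3 := hlow _ hne _ hcol
    apply hpowle j
    have h4 : c ≤ Q j ^ wm * (C * Q j ^ ℓ j l) := by rwa [← hlaQ]
    rw [div_le_iff₀ hc] at hj
    rw [Real.rpow_one] at hj
    rw [neg_add, rpow_add (hQ0 j), Real.rpow_neg (hQ0 j).le, Real.rpow_neg_one, ← mul_inv]
    have h5 := rpow_pos_of_pos (hQ0 j) wm
    have h6 := rpow_pos_of_pos (hQ0 j) (ℓ j l)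
    rw [inv_le_iff_one_le_mul₀ (by have := hQ0 j; positivity)]
    have h7 : C * c ≤ C * (Q j ^ ℓ j l * (Q j ^ wm * Q j) * c) := by
      calc C * c ≤ (Q j * c) * c := by gcongr
        _ ≤ (Q j * c) * (Q j ^ wm * (C * Q j ^ ℓ j l)) := by
            have := hQ0 j
            gcongr
        _ = _ := by ring
    have h8 := le_of_mul_le_mul_left h7 hC0
    nlinarith
  have hℓbdd : ∀ᶠ j in atTop, ℓ j ∈ Set.Icc (fun _ : Fin r => -(wm + 1)) (fun _ => S + 1 + r * (wm + 1)) := by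
    filter_upwards [hℓlow, hsumℓ.eventually (gt_mem_nhds (show S < S + 1 by linarith))] with j h1 h2
    refine ⟨fun t => h1 t, fun t => ?_⟩
    have h3 : ∑ t, (ℓ j t + (wm + 1)) < S + 1 + r * (wm + 1) := by
      rw [sum_add_distrib]; simp; linarith
    have h4 := single_le_sum (f := fun t => ℓ j t + (wm + 1)) (fun t _ => by linarith [h1 t]) (mem_univ t)
    have h5 : 0 ≤ wm + 1 := by
      have : 0 ≤ ∑ t, |w t| := sum_nonneg fun _ _ => abs_nonneg _
      linarith
    simp only at h4 ⊢
    linarith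
  -- subsequences
  obtain ⟨π0, hπ0⟩ := freq_pigeon (P := fun _ => True) π (Frequently.of_forall fun _ => trivial)
  obtain ⟨φ1, hφ1, hπφ⟩ := extraction_of_frequently_atTop hπ0
  obtain ⟨ℓs, -, φ2, hφ2, hℓs⟩ := tendsto_subseq_of_frequently_bounded (Metric.isBounded_Icc _ _)
    ((hφ1.tendsto_atTop.eventually hℓbdd).frequently)
  obtain ⟨φ, hφ⟩ : ∃ φ : ℕ → ℕ, φ = φ1 ∘ φ2 := ⟨_, rfl⟩
  have hφT : Tendsto φ atTop atTop := by rw [hφ]; exact (hφ1.comp hφ2).tendsto_atTop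
  have hπ : ∀ j, π (φ j) = π0 := fun j => by rw [hφ]; exact (hπφ (φ2 j)).2
  have hlim : ∀ t, Tendsto (fun j => ℓ (φ j) t) atTop (𝓝 (ℓs t)) := by
    intro t
    rw [hφ]
    exact (tendsto_pi_nhds.1 hℓs) t
  have hQφ := hQ.comp hφT
  have hlogC : Tendsto (fun j => log C / log (Q (φ j))) atTop (𝓝 0) := (hlogT.comp hφT).const_div_atTop _
  have hsum' : ∑ t, ℓs t = S := by
    refine tendsto_nhds_unique ?_ (hsumℓ.comp hφT)
    exact tendsto_finsetSum _ fun t _ => hlim t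
  have hsort' : ∀ t l, t ≤ l → ℓs t ≤ ℓs l := by
    intro t l htl
    have h1 : ∀ j, ℓ (φ j) t ≤ log C / log (Q (φ j)) + ℓ (φ j) l := by
      intro j
      rw [hℓ, hℓ, ← add_div]
      apply div_le_div_of_nonneg_right _ (hlogQ _).le
      rw [← log_mul hC0.ne' (hla _ _).ne']
      exact log_le_log (hla _ _) (hsort _ _ _ htl)
    have := le_of_tendsto_of_tendsto' (hlim t) (hlogC.add (hlim l)) h1
    simpa using this
  -- coordinates of the solution
  obtain ⟨y, hy⟩ : ∃ y : ℕ → Fin r → ℤ, ∀ j, y j = (U j)⁻¹.mulVec (z j) := ⟨_, fun _ => rfl⟩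
  have hUy : ∀ j, (U j).mulVec (y j) = z j := by
    intro j
    rw [hy, mulVec_mulVec, mul_nonsing_inv _ (hU j), one_mulVec]
  have hBy : ∀ j, (B j).mulVec (y j) = (D j).mulVec (z j) := by
    intro j
    rw [hB, ← mulVec_mulVec, hUy]
  have hy1 : ∀ᶠ j in atTop, ∀ t, y j t ≠ 0 → ℓ j t ≤ log C / log (Q j) := by
    filter_upwards [hb2 e he0] with j hj t ht
    have h1 := hsucc j (y j) 1 (fun i => by
      rw [← cast_mulVec, hUy, hM, ← mulVec_mulVec, mulVec_diagonal, ← mulVec_mulVec]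
      have h2 : ((D j).map (Int.cast : ℤ → ℝ)).mulVec (fun l => (z j l : ℝ)) = fun l => (((D j).mulVec (z j) l : ℤ) : ℝ) := by
        ext l; simp [mulVec, dotProduct]
      rw [h2, abs_mul, abs_of_pos (rpow_pos_of_pos (hQ0 j) _)]
      calc _ ≤ Q j ^ (-(w i + e)) * Q j ^ (w i + e) := by
            have := rpow_pos_of_pos (hQ0 j) (-(w i + e))
            gcongr; exact hj i
        _ = 1 := by rw [← rpow_add (hQ0 j)]; simp) t ht
    rw [hℓ]
    apply div_le_div_of_nonneg_right _ (hlogQ _).le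
    exact log_le_log (hla _ _) (by linarith)
  -- splitting index
  have hex : ∃ n : ℕ, ∃ hn : n < r, 0 < ℓs ⟨n, hn⟩ := by
    by_contra hcon
    push Not at hcon
    have : ∑ t, ℓs t ≤ 0 := sum_nonpos fun t _ => hcon t t.2
    rw [hsum', hS] at this
    linarith
  obtain ⟨hir, hpos⟩ := Nat.find_spec hex
  have hmin : ∀ n (hn : n < r), n < Nat.find hex → ℓs ⟨n, hn⟩ ≤ 0 := by
    intro n hn h1
    by_contra h2
    exact Nat.find_min hex h1 ⟨hn, not_le.1 h2⟩
  obtain ⟨i, hi⟩ : ∃ i, i = Nat.find hex := ⟨_, rfl⟩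
  simp only [← hi] at hir hpos hmin
  have h : i + (r - i) = r := by omega
  have hyz : ∀ᶠ j in atTop, ∀ t : Fin r, i ≤ (t : ℕ) → y (φ j) t = 0 := by
    rw [eventually_all]
    intro t
    by_cases hit : i ≤ (t : ℕ)
    · have h1 : 0 < ℓs t := hpos.trans_le (hsort' _ _ (by simpa [Fin.le_def] using hit))
      filter_upwards [hφT.eventually hy1, hlogC.eventually_lt (hlim t) h1] with j h2 h3 _
      by_contra h4
      exact absurd (h2 t h4) (not_le.2 h3)
    · exact Eventually.of_forall fun j h' => absurd h' hit
  -- apply splitP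
  obtain ⟨v', hv'⟩ : ∃ v' : Option V → AbsoluteValue K ℝ, v' = fun o => o.elim v0 v := ⟨_, rfl⟩
  obtain ⟨L', hL'⟩ : ∃ L' : Option V → Sq r K, L' = fun o => o.elim (L0.submatrix π0 id) L := ⟨_, rfl⟩
  obtain ⟨Ω, hΩ⟩ : ∃ Ω : Option V → Fin r → ℝ, Ω = fun o => o.elim (fun t => (w (π0 t) + e) + ℓs t) W := ⟨_, rfl⟩
  have hnone : ∀ j t l, v0 (((L0.submatrix π0 id) * (B (φ j)).map (Int.cast : ℤ → K)) t l)
      = Q (φ j) ^ (w (π0 t) + e) * |(M (φ j) * (U (φ j)).map (Int.cast : ℤ → ℝ)) (π0 t) l| := by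
    intro j t l
    rw [← hRB]
    have h1 := hRL (fun k => B (φ j) k l) (π0 t)
    have h2 : ((L0.submatrix π0 id) * (B (φ j)).map (Int.cast : ℤ → K)) t l = L0.mulVec (fun k => ((B (φ j) k l : ℤ) : K)) (π0 t) := by
      simp [Matrix.mul_apply, mulVec, dotProduct]
    have h3 : (R * (B (φ j)).map (Int.cast : ℤ → ℝ)) (π0 t) l = R.mulVec (fun k => ((B (φ j) k l : ℤ) : ℝ)) (π0 t) := by
      simp [Matrix.mul_apply, mulVec, dotProduct]
    rw [h2, h1, h3]
  have hboth : ∀ ε > 0, ∀ᶠ j in atTop, ∀ t l, v0 (((L0.submatrix π0 id) * (B (φ j)).map (Int.cast : ℤ → K)) t l) ≤ Q (φ j) ^ ((w (π0 t) + e) + ℓs t + ε)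
      ∧ v0 (((L0.submatrix π0 id) * (B (φ j)).map (Int.cast : ℤ → K)) t l) ≤ Q (φ j) ^ ((w (π0 t) + e) + ℓs l + ε) := by
    intro ε hε
    have h1 : ∀ᶠ j in atTop, ∀ t, ℓ (φ j) t < ℓs t + ε / 2 := by
      rw [eventually_all]
      intro t
      exact (hlim t).eventually (gt_mem_nhds (by linarith))
    filter_upwards [h1, hφT.eventually (hconst C (ε / 2) (by linarith))] with j h2 h3 t l
    have h4 := hbd (φ j) t l
    rw [hπ] at h4
    rw [hnone]
    have key : ∀ s, C * la (φ j) s ≤ Q (φ j) ^ (ℓs s + ε) := by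
      intro s
      rw [hlaQ]
      calc _ ≤ Q (φ j) ^ (ε / 2) * Q (φ j) ^ (ℓs s + ε / 2) := by
            refine mul_le_mul h3 (rpow_le_rpow_of_exponent_le (hQ1 _).le (h2 s).le) (rpow_pos_of_pos (hQ0 _) _).le (rpow_pos_of_pos (hQ0 _) _).le
        _ = _ := by rw [← rpow_add (hQ0 _)]; congr 1; ring
    have hp := (rpow_pos_of_pos (hQ0 (φ j)) (w (π0 t) + e)).le
    constructor
    · rw [add_assoc, rpow_add (hQ0 _) (w (π0 t) + e) (ℓs t + ε)]
      exact mul_le_mul_of_nonneg_left (h4.1.trans (key t)) hp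
    · rw [add_assoc, rpow_add (hQ0 _) (w (π0 t) + e) (ℓs l + ε)]
      exact mul_le_mul_of_nonneg_left (h4.2.trans (key l)) hp
  obtain ⟨m, hm, hf⟩ := splitP v' (by
      intro n hn
      rw [Fintype.prod_option, hv']
      exact hv n hn) none h (by omega) L' (by
      rintro (_ | i)
      · simp only [hL', Option.elim]
        rw [Matrix.det_permute]
        refine mul_ne_zero ?_ hL0
        rcases units_eq_one_or (Perm.sign π0) with h | h <;> rw [h] <;> simp
      · simp only [hL', Option.elim]; exact hL i) (Q ∘ φ) hQφ (B ∘ φ) (fun j => hBdet _) Ω (fun t => w (π0 t) + e) ℓs (fun t => by rw [hΩ]; rfl)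
      (by
        rw [Fintype.sum_option, hΩ]
        simp only [Option.elim]
        rw [sum_add_distrib, sum_add_distrib, hsum', hS, Equiv.sum_comp π0 w]
        simp only [sum_const, card_univ, Fintype.card_fin, nsmul_eq_mul]
        linarith) hsort' (ℓs ⟨i, hir⟩) hpos (by
        intro t l ht hl
        have h1 := hmin t t.2 ht
        have h2 := hsort' ⟨i, hir⟩ l (by simpa [Fin.le_def] using hl)
        have h3 : ℓs ⟨t, t.2⟩ = ℓs t := rfl
        linarith)
      (by
        intro ε hε
        have h1 : ∀ᶠ j in atTop, ∀ i t l, v i ((L i * (B (φ j)).map (Int.cast : ℤ → K)) t l) ≤ Q (φ j) ^ (W i t + ε) := by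
          filter_upwards [hφT.eventually (hb1 ε hε)] with j hj i t l
          rw [hBK, ← Matrix.mul_assoc, Matrix.mul_apply]
          have hp := (rpow_pos_of_pos (hQ0 (φ j)) (W i t + ε)).le
          haveI : Nonempty (Fin r) := ⟨t⟩
          obtain ⟨k, -, hk⟩ := (hna i).finset_image_add_of_nonempty (t := (univ : Finset (Fin r)))
            (fun k => (L i * (D (φ j)).map (Int.cast : ℤ → K)) t k * ((U (φ j)).map (Int.cast : ℤ → K)) k l) univ_nonempty
          refine hk.trans ?_
          rw [map_mul]
          refine (mul_le_of_le_one_right ((v i).nonneg _) ?_).trans (hj i t k)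
          exact (hna i).apply_intCast_le_one
        filter_upwards [h1, hboth ε hε] with j h2 h3
        rintro (_ | i) t l
        · simp only [hv', hL', hΩ, Option.elim, Function.comp]; exact (h3 t l).1
        · simp only [hv', hL', hΩ, Option.elim, Function.comp]; exact h2 i t l)
      (by
        intro ε hε
        filter_upwards [hboth ε hε] with j h3 t l
        simp only [hv', hL', Option.elim, Function.comp]; exact (h3 t l).2)
  obtain ⟨ψ, hψ, hfψ⟩ := geom h (by omega) (B ∘ φ) (fun j => hBdet _) (y ∘ φ) hyz m hm hf
  refine ⟨ψ, hψ, hφT.frequently (hfψ.mono fun j hj => ?_)⟩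
  simp only [Function.comp] at hj
  rwa [hBy] at hj

section M1

variable {q : ℕ} [hq : Fact q.Prime]

lemma hansel_div (ρ : ℝ) (h0 : 0 < ρ) (h1 : ρ ≤ 1) (k : ℕ) (P Q : Polynomial ℚ_[q]) (t : ℕ)
    (hP : ∀ i, ‖P.coeff i‖ ≤ ρ ^ (i + k)) (hPQ : P = (Polynomial.X - Polynomial.C (t : ℚ_[q])) * Q) :
    ∀ i, ‖Q.coeff i‖ ≤ ρ ^ (i + (k + 1)) := by
  have key : ∀ d i, Q.natDegree < i + d → ‖Q.coeff i‖ ≤ ρ ^ (i + (k + 1)) := by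
    intro d
    induction d with
    | zero =>
      intro i hi
      rw [Polynomial.coeff_eq_zero_of_natDegree_lt (by omega), norm_zero]
      positivity
    | succ d ih =>
      intro i hi
      have h2 := ih (i + 1) (by omega)
      have h3 : Q.coeff i = P.coeff (i + 1) + t * Q.coeff (i + 1) := by
        rw [hPQ, Polynomial.coeff_X_sub_C_mul]; ring
      rw [h3]
      refine (Padic.nonarchimedean _ _).trans (max_le ?_ ?_)
      · refine (hP (i + 1)).trans (le_of_eq ?_); congr 1; omega
      · rw [norm_mul]
        have h4 : ‖(t : ℚ_[q])‖ ≤ 1 := by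
          have := Padic.norm_int_le_one (p := q) (t : ℤ)
          simpa using this
        calc _ ≤ 1 * ρ ^ (i + 1 + (k + 1)) := by gcongr
          _ ≤ _ := by rw [one_mul]; exact pow_le_pow_of_le_one h0.le h1 (by omega)
  intro i
  exact key (Q.natDegree + 1) i (by omega)

lemma hansel_eval (ρ : ℝ) (h0 : 0 < ρ) (h1 : ρ ≤ 1) (Z : Finset ℕ) : ∀ (k : ℕ) (P : Polynomial ℚ_[q])
    (hP : ∀ i, ‖P.coeff i‖ ≤ ρ ^ (i + k)) (hZ : ∀ t ∈ Z, P.eval (t : ℚ_[q]) = 0) (n : ℕ),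
    ‖P.eval (n : ℚ_[q])‖ ≤ ρ ^ (Z.card + k) := by
  have hn1 : ∀ z : ℤ, ‖(z : ℚ_[q])‖ ≤ 1 := fun z => Padic.norm_int_le_one z
  induction Z using Finset.induction_on with
  | empty =>
    intro k P hP _ n
    rw [Polynomial.eval_eq_sum_range]
    refine IsUltrametricDist.norm_sum_le_of_forall_le_of_nonneg (by positivity) fun i _ => ?_
    rw [norm_mul, norm_pow]
    have h2 := hn1 n
    simp only [Int.cast_natCast] at h2
    calc _ ≤ ρ ^ (i + k) * 1 := by
          gcongr
          · exact hP i
          · exact pow_le_one₀ (norm_nonneg _) h2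
      _ ≤ _ := by rw [mul_one]; exact pow_le_pow_of_le_one h0.le h1 (by simp)
  | insert t Z ht ih =>
    intro k P hP hZ n
    obtain ⟨Q, hQ⟩ := Polynomial.dvd_iff_isRoot.2 (hZ t (mem_insert_self _ _))
    have h2 := hansel_div ρ h0 h1 k P Q t hP hQ
    have h3 := ih (k + 1) Q h2 (fun s hs => by
      have h4 := hZ s (mem_insert_of_mem hs)
      rw [hQ, Polynomial.eval_mul] at h4
      refine (mul_eq_zero.1 h4).resolve_left ?_
      simp only [Polynomial.eval_sub, Polynomial.eval_X, Polynomial.eval_C]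
      rw [sub_eq_zero]
      intro h5
      have : s = t := by exact_mod_cast h5
      exact ht (this ▸ hs)) n
    rw [hQ, Polynomial.eval_mul, norm_mul, card_insert_of_notMem ht]
    have h6 : ‖Polynomial.eval (n : ℚ_[q]) (Polynomial.X - Polynomial.C (t : ℚ_[q]))‖ ≤ 1 := by
      have := hn1 ((n : ℤ) - t)
      simpa using this
    calc _ ≤ 1 * ρ ^ (Z.card + (k + 1)) := by gcongr
      _ = _ := by rw [one_mul]; congr 1; omega

theorem hansel (hq3 : 3 ≤ q) (c : ℕ → ℤ) (v : ℕ → ℤ)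
    (hv : ∀ n N, n ≤ N → v n = ∑ j ∈ range (N + 1), (n.choose j : ℤ) * q ^ j * c j)
    (hinf : {n | v n = 0}.Infinite) : ∀ n, v n = 0 := by
  have hq0 : (0 : ℝ) < q := by exact_mod_cast hq.out.pos
  have hq1 : (1 : ℝ) < q := by exact_mod_cast hq.out.one_lt
  obtain ⟨ρ, hρ⟩ : ∃ ρ : ℝ, ρ = Real.sqrt ((q : ℝ)⁻¹) := ⟨_, rfl⟩
  have hρ0 : 0 < ρ := by rw [hρ]; positivity
  have hρ2 : ρ ^ 2 = (q : ℝ)⁻¹ := by rw [hρ]; exact Real.sq_sqrt (by positivity)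
  have hρ1 : ρ < 1 := by
    have : ρ ^ 2 < 1 := by rw [hρ2]; exact inv_lt_one_of_one_lt₀ hq1
    nlinarith
  have hfac : ∀ j : ℕ, ‖(q : ℚ_[q]) ^ j / (j.factorial : ℚ_[q])‖ ≤ ρ ^ j := by
    intro j
    have h1 : 2 * padicValNat q j.factorial ≤ j := by
      have h2 := sub_one_mul_padicValNat_factorial (p := q) j
      have h3 : 2 * padicValNat q j.factorial ≤ (q - 1) * padicValNat q j.factorial :=
        Nat.mul_le_mul_right _ (by omega)
      omega
    have h4 : (j.factorial : ℚ_[q]) ≠ 0 := by exact_mod_cast j.factorial_ne_zero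
    rw [norm_div, norm_pow, Padic.norm_p, Padic.norm_eq_zpow_neg_valuation h4, Padic.valuation_natCast, ← hρ2, zpow_neg,
      ← inv_zpow, ← hρ2, zpow_natCast, ← pow_mul, ← pow_mul, div_le_iff₀ (by positivity), ← pow_add]
    exact pow_le_pow_of_le_one hρ0.le hρ1.le (by omega)
  obtain ⟨P, hPdef⟩ : ∃ P : ℕ → Polynomial ℚ_[q], ∀ N, P N = ∑ j ∈ range (N + 1),
    Polynomial.C ((c j : ℚ_[q]) * ((q : ℚ_[q]) ^ j / (j.factorial : ℚ_[q]))) * descPochhammer ℚ_[q] j := ⟨_, fun _ => rfl⟩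
  have hPev : ∀ N n, n ≤ N → (P N).eval (n : ℚ_[q]) = (v n : ℚ_[q]) := by
    intro N n hn
    rw [hPdef, hv n N hn, Polynomial.eval_finset_sum]
    push_cast
    refine sum_congr rfl fun j _ => ?_
    rw [Polynomial.eval_mul, Polynomial.eval_C, descPochhammer_eval_eq_descFactorial,
      Nat.descFactorial_eq_factorial_mul_choose]
    have h4 : (j.factorial : ℚ_[q]) ≠ 0 := by exact_mod_cast j.factorial_ne_zero
    push_cast
    field_simp
  have hPc : ∀ N i, ‖(P N).coeff i‖ ≤ ρ ^ (i + 0) := by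
    intro N i
    rw [hPdef, Polynomial.finset_sum_coeff]
    refine IsUltrametricDist.norm_sum_le_of_forall_le_of_nonneg (by positivity) fun j _ => ?_
    rw [Polynomial.coeff_C_mul]
    by_cases hij : j < i
    · rw [Polynomial.coeff_eq_zero_of_natDegree_lt (by rw [descPochhammer_natDegree]; exact hij)]
      simp; positivity
    · have h5 : ‖(descPochhammer ℚ_[q] j).coeff i‖ ≤ 1 := by
        rw [← descPochhammer_map (castRingHom ℚ_[q]), Polynomial.coeff_map]
        exact Padic.norm_int_le_one _
      rw [norm_mul, norm_mul]
      have h6 := hfac j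
      have h7 : ‖(c j : ℚ_[q])‖ ≤ 1 := Padic.norm_int_le_one _
      calc _ ≤ (1 * ρ ^ j) * 1 := by gcongr
        _ ≤ _ := by simp only [one_mul, mul_one, add_zero]; exact pow_le_pow_of_le_one hρ0.le hρ1.le (by omega)
  intro n
  have hsm : ∀ k : ℕ, ‖(v n : ℚ_[q])‖ ≤ ρ ^ k := by
    intro k
    obtain ⟨Z, hZ, hZk⟩ := hinf.exists_subset_card_eq k
    have hn : n ≤ n + Z.sup id := by omega
    rw [← hPev _ n hn]
    have := hansel_eval ρ hρ0 hρ1.le Z 0 (P (n + Z.sup id)) (hPc _) (fun t ht => by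
      rw [hPev _ t ((le_sup (f := id) ht).trans (Nat.le_add_left _ _))]
      have : v t = 0 := hZ ht
      rw [this]; simp) n
    rwa [hZk, add_zero] at this
  have h8 : ‖(v n : ℚ_[q])‖ ≤ 0 :=
    ge_of_tendsto' (tendsto_pow_atTop_nhds_zero_of_lt_one hρ0.le hρ1) hsm
  have h9 : (v n : ℚ_[q]) = 0 := norm_le_zero_iff.1 h8
  exact_mod_cast h9

end M1

section M1b

theorem sml {r : ℕ} (A : Sq r ℤ) (hA : A.det ≠ 0) : ∃ N : ℕ, 1 ≤ N ∧ ∀ (e x : Fin r → ℤ) (j : ℕ),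
    {n | e ⬝ᵥ (A ^ (j + N * n)).mulVec x = 0}.Infinite → ∀ n, e ⬝ᵥ (A ^ (j + N * n)).mulVec x = 0 := by
  classical
  obtain ⟨q, hqle, hq⟩ := Nat.exists_infinite_primes (A.det.natAbs + 3)
  haveI : Fact q.Prime := ⟨hq⟩
  have hunit : IsUnit (A.map (Int.cast : ℤ → ZMod q)) := by
    rw [Matrix.isUnit_iff_isUnit_det, isUnit_iff_ne_zero]
    have h1 : (A.map (Int.cast : ℤ → ZMod q)).det = (A.det : ZMod q) := ((castRingHom (ZMod q)).map_det A).symm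
    rw [h1, Ne, ZMod.intCast_zmod_eq_zero_iff_dvd]
    intro h2
    have h3 := Int.natAbs_dvd_natAbs.2 h2
    have h4 := Nat.le_of_dvd (Int.natAbs_pos.2 hA) h3
    simp at h4
    omega
  obtain ⟨u, hu⟩ := hunit
  have hfin : Finite (Matrix (Fin r) (Fin r) (ZMod q))ˣ := inferInstance
  obtain ⟨N, hN⟩ : ∃ N, N = Nat.card (Matrix (Fin r) (Fin r) (ZMod q))ˣ := ⟨_, rfl⟩
  have hN1 : 1 ≤ N := by rw [hN]; exact Nat.card_pos
  have hpow : (A ^ N).map (Int.cast : ℤ → ZMod q) = 1 := by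
    have h1 : (A ^ N).map (Int.cast : ℤ → ZMod q) = (A.map (Int.cast : ℤ → ZMod q)) ^ N :=
      (castRingHom (ZMod q)).mapMatrix.map_pow A N
    rw [h1, ← hu, ← Units.val_pow_eq_pow_val, hN, pow_card_eq_one']
    rfl
  have hB : ∃ B : Sq r ℤ, A ^ N = 1 + (q : ℤ) • B := by
    have : ∀ i l, ∃ b : ℤ, (A ^ N) i l = (1 : Sq r ℤ) i l + q * b := by
      intro i l
      have h2 := congrFun (congrFun hpow i) l
      have h3 : (((A ^ N) i l - (1 : Sq r ℤ) i l : ℤ) : ZMod q) = 0 := by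
        push_cast
        rw [map_apply] at h2
        rw [h2]
        simp [Matrix.one_apply]
      rw [ZMod.intCast_zmod_eq_zero_iff_dvd] at h3
      obtain ⟨b, hb⟩ := h3
      exact ⟨b, by linarith⟩
    choose b hb using this
    exact ⟨of b, by ext i l; simp [hb]⟩
  obtain ⟨B, hB⟩ := hB
  refine ⟨N, hN1, fun e x j hinf => ?_⟩
  refine hansel (q := q) (by omega) (fun i => e ⬝ᵥ (A ^ j * B ^ i).mulVec x) _ ?_ hinf
  intro n M hnM
  have h1 : A ^ (j + N * n) = ∑ i ∈ range (M + 1), ((n.choose i : ℤ) * q ^ i) • (A ^ j * B ^ i) := by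
    rw [pow_add, pow_mul, hB, add_comm (1 : Sq r ℤ), (Commute.one_right _).add_pow, mul_sum]
    rw [← sum_subset (range_mono (show n + 1 ≤ M + 1 by omega))]
    · refine sum_congr rfl fun i _ => ?_
      rw [smul_pow, one_pow, mul_one]
      have : ((n.choose i : ℕ) : Sq r ℤ) = (n.choose i : ℤ) • 1 := by
        simp
      rw [this]
      simp only [smul_mul_assoc, mul_smul_comm, mul_one, smul_smul]
    · intro i _ hi
      rw [Nat.choose_eq_zero_of_lt (by simpa using hi)]
      simp
  rw [h1, Matrix.sum_mulVec, dotProduct_sum]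
  refine sum_congr rfl fun i _ => ?_
  rw [smul_mulVec, dotProduct_smul, smul_eq_mul]

end M1b

section A1

variable {K : Type*} [Field K] {r : ℕ}

lemma est (v : AbsoluteValue K ℝ) (B : Sq r K) (ψ : Fin r → K) (β : K) (hβ : β ≠ 0) (k : ℕ)
    (h : vecMul ψ ((B - β • (1 : Sq r K)) ^ k) = 0) :
    ∃ C : ℝ, ∀ (n : ℕ) l, v (vecMul ψ (B ^ n) l) ≤ C * (n + 1) ^ k * v β ^ n := by
  classical
  obtain ⟨N, hN⟩ : ∃ N, N = B - β • (1 : Sq r K) := ⟨_, rfl⟩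
  rw [← hN] at h
  have hz : ∀ j, k ≤ j → vecMul ψ (N ^ j) = 0 := by
    intro j hj
    rw [← Nat.add_sub_cancel' hj, pow_add, ← vecMul_vecMul, h, zero_vecMul]
  have hv : 0 < v β := v.pos hβ
  have hexp : ∀ n l, vecMul ψ (B ^ n) l = ∑ j ∈ range (n + 1), (n.choose j : K) * β ^ (n - j) * vecMul ψ (N ^ j) l := by
    intro n l
    have hB : B = N + β • (1 : Sq r K) := by rw [hN]; simp
    have hc : Commute N (β • (1 : Sq r K)) := (Commute.one_right N).smul_right β
    have h1 : B ^ n = ∑ j ∈ range (n + 1), ((n.choose j : K) * β ^ (n - j)) • N ^ j := by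
      rw [hB, hc.add_pow]
      refine sum_congr rfl fun j _ => ?_
      rw [smul_pow, one_pow]
      have : ((n.choose j : ℕ) : Sq r K) = (n.choose j : K) • 1 := by
        ext a b; simp [Matrix.smul_apply, Matrix.natCast_apply, Matrix.one_apply]
      rw [this]
      simp only [mul_smul_comm, mul_one, smul_smul]
    rw [h1]
    simp only [vecMul, dotProduct, Matrix.sum_apply, Matrix.smul_apply, smul_eq_mul, mul_sum]
    rw [sum_comm]
    refine sum_congr rfl fun j _ => sum_congr rfl fun a _ => ?_
    ring
  refine ⟨∑ j ∈ range k, ∑ l, v (vecMul ψ (N ^ j) l) / v β ^ j, fun n l => ?_⟩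
  rw [hexp]
  refine (abv_sum_le _ _ _).trans ?_
  have hterm : ∀ j ∈ range (n + 1), v ((n.choose j : K) * β ^ (n - j) * vecMul ψ (N ^ j) l) ≤
      (if j < k then (∑ l, v (vecMul ψ (N ^ j) l) / v β ^ j) * ((n + 1) ^ k * v β ^ n) else 0) := by
    intro j hj
    have hjn : j ≤ n := by simpa [Nat.lt_succ_iff] using hj
    split_ifs with hjk
    · have h2 : v (n.choose j : K) ≤ ((n : ℝ) + 1) ^ k := by
        have h3 := abv_int_le v ((n.choose j : ℕ) : ℤ)
        simp only [Int.cast_natCast] at h3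
        refine h3.trans ?_
        rw [abs_of_nonneg (by positivity)]
        have h4 : n.choose j ≤ (n + 1) ^ k :=
          (Nat.choose_le_pow n j).trans ((Nat.pow_le_pow_left (by omega) j).trans (Nat.pow_le_pow_right (by omega) hjk.le))
        exact_mod_cast h4
      rw [map_mul, map_mul, map_pow]
      have h5 : v (vecMul ψ (N ^ j) l) / v β ^ j ≤ ∑ l, v (vecMul ψ (N ^ j) l) / v β ^ j :=
        single_le_sum (f := fun l => v (vecMul ψ (N ^ j) l) / v β ^ j) (fun _ _ => div_nonneg (v.nonneg _) (by positivity)) (mem_univ l)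
      have h6 : v β ^ (n - j) * v (vecMul ψ (N ^ j) l) = v β ^ n * (v (vecMul ψ (N ^ j) l) / v β ^ j) := by
        rw [← Nat.sub_add_cancel hjn, Nat.add_sub_cancel, pow_add]
        field_simp
      rw [mul_assoc, h6]
      have h7 : 0 ≤ v (vecMul ψ (N ^ j) l) / v β ^ j := div_nonneg (v.nonneg _) (by positivity)
      calc _ ≤ ((n : ℝ) + 1) ^ k * (v β ^ n * ∑ l, v (vecMul ψ (N ^ j) l) / v β ^ j) := by gcongr
        _ = _ := by ring
    · rw [hz j (by omega)]; simp
  refine (sum_le_sum hterm).trans ?_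
  rw [sum_ite, sum_const_zero, add_zero, mul_assoc, sum_mul]
  refine sum_le_sum_of_subset_of_nonneg ?_ ?_
  · intro j hj; simp at hj ⊢; exact hj.2
  · intro j _ _
    have : 0 ≤ ∑ l, v (vecMul ψ (N ^ j) l) / v β ^ j := sum_nonneg fun _ _ => div_nonneg (v.nonneg _) (by positivity)
    positivity

lemma exp_rpow (n : ℕ) (x : ℝ) : exp n ^ x = exp (n * x) := by
  rw [← Real.exp_mul]

lemma poly_exp (C : ℝ) (k : ℕ) (ε : ℝ) (hε : 0 < ε) : ∀ᶠ n : ℕ in atTop, C * ((n : ℝ) + 1) ^ k ≤ exp (n * ε) := by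
  have h1 : Tendsto (fun x : ℝ => x ^ k * exp (-ε * x)) atTop (𝓝 0) :=
    by simpa using (tendsto_rpow_mul_exp_neg_mul_atTop_nhds_zero k ε hε)
  have h2 : Tendsto (fun n : ℕ => (n : ℝ) + 1) atTop atTop := tendsto_atTop_add_const_right _ _ tendsto_natCast_atTop_atTop
  have h3 := (h1.comp h2).const_mul (C * exp ε)
  rw [mul_zero] at h3
  filter_upwards [h3.eventually (gt_mem_nhds one_pos)] with n hn
  simp only [Function.comp] at hn
  have h4 : exp ε * exp (-ε * (n + 1)) * exp (n * ε) = 1 := by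
    rw [← exp_add, ← exp_add]; simp; ring
  have h5 := exp_pos (n * ε)
  have h6 : C * ((n : ℝ) + 1) ^ k = (C * exp ε * (((n : ℝ) + 1) ^ k * exp (-ε * (n + 1)))) * exp (n * ε) := by
    calc _ = C * ((n : ℝ) + 1) ^ k * (exp ε * exp (-ε * (n + 1)) * exp (n * ε)) := by rw [h4, mul_one]
      _ = _ := by ring
  rw [h6]
  nlinarith

lemma est' (v : AbsoluteValue K ℝ) (B : Sq r K) (ψ : Fin r → K) (β : K) (hβ : β ≠ 0) (k : ℕ)
    (h : vecMul ψ ((B - β • (1 : Sq r K)) ^ k) = 0) (ε : ℝ) (hε : 0 < ε) :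
    ∀ᶠ n : ℕ in atTop, ∀ l, v (vecMul ψ (B ^ n) l) ≤ exp (n * (log (v β) + ε)) := by
  obtain ⟨C, hC⟩ := est v B ψ β hβ k h
  filter_upwards [poly_exp C k ε hε] with n hn l
  refine (hC n l).trans ?_
  have hv : 0 < v β := v.pos hβ
  have h1 : exp (n * log (v β)) = v β ^ n := by rw [exp_nat_mul, exp_log hv]
  rw [mul_add, exp_add, h1, mul_comm (v β ^ n)]
  gcongr

lemma detineq (v : AbsoluteValue K ℝ) (A : Sq r K) (hA : A.det ≠ 0) (Ψ : Sq r K) (hΨ : Ψ.det ≠ 0)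
    (α : Fin r → K) (hα : ∀ i, α i ≠ 0) (k : ℕ)
    (h : ∀ i, vecMul (Ψ i) ((A - α i • (1 : Sq r K)) ^ k) = 0) :
    ∑ i, log (v (α i)) ≤ log (v A.det) := by
  classical
  have hAi : A * A⁻¹ = 1 := mul_nonsing_inv _ (isUnit_iff_ne_zero.2 hA)
  have hAi' : A⁻¹ * A = 1 := nonsing_inv_mul _ (isUnit_iff_ne_zero.2 hA)
  have h' : ∀ i, vecMul (Ψ i) ((A⁻¹ - (α i)⁻¹ • (1 : Sq r K)) ^ k) = 0 := by
    intro i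
    have h1 : A⁻¹ - (α i)⁻¹ • (1 : Sq r K) = (A - α i • (1 : Sq r K)) * (-(α i)⁻¹ • A⁻¹) := by
      rw [sub_mul, mul_smul_comm, hAi, smul_mul_assoc, one_mul, smul_smul]
      rw [mul_neg, mul_inv_cancel₀ (hα i)]
      simp; abel
    have hc : Commute (A - α i • (1 : Sq r K)) (-(α i)⁻¹ • A⁻¹) := by
      apply Commute.smul_right
      apply Commute.sub_left
      · exact hAi.trans hAi'.symm
      · exact (Commute.one_left _).smul_left _
    rw [h1, hc.mul_pow, ← vecMul_vecMul, h, zero_vecMul]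
  have key : ∀ ε : ℝ, 0 < ε → ∑ i, log (v (α i)) ≤ log (v A.det) + r * ε := by
    intro ε hε
    have h1 : ∀ᶠ n : ℕ in atTop, ∀ i l, v (vecMul (Ψ i) (A⁻¹ ^ n) l) ≤ exp (n * (log (v (α i)⁻¹) + ε)) := by
      rw [eventually_all]
      intro i
      exact est' v _ _ _ (inv_ne_zero (hα i)) k (h' i) ε hε
    have h2 : ∀ᶠ n : ℕ in atTop, log (v Ψ.det) / n - log (v A.det) ≤
        log r.factorial / n + (r * ε - ∑ i, log (v (α i))) := by
      filter_upwards [h1, eventually_gt_atTop 0] with n hn hn0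
      have h3 := minor_bound v (Ψ * A⁻¹ ^ n) (fun i => exp (n * (log (v (α i)⁻¹) + ε))) (fun i l => hn i l)
      rw [det_mul, det_pow, Matrix.det_nonsing_inv, Ring.inverse_eq_inv', map_mul, map_pow, map_inv₀, ← exp_sum] at h3
      have hvΨ : 0 < v Ψ.det := v.pos hΨ
      have hvA : 0 < v A.det := v.pos hA
      have h4 := log_le_log (by positivity) h3
      have hf : (0 : ℝ) < r.factorial := by exact_mod_cast r.factorial_pos
      rw [log_mul (by positivity) (by positivity), log_mul (by positivity) (by positivity), log_exp, log_pow, Real.log_inv,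
        ← mul_sum] at h4
      have h5 : ∑ i, (log (v (α i)⁻¹) + ε) = r * ε - ∑ i, log (v (α i)) := by
        simp only [map_inv₀, Real.log_inv, sum_add_distrib, sum_neg_distrib]
        simp; ring
      rw [h5] at h4
      have hn' : (0 : ℝ) < n := by exact_mod_cast hn0
      have h6 : log (v Ψ.det) / n - log (v A.det) = (log (v Ψ.det) + n * -log (v A.det)) / n := by
        field_simp; ring
      have h7 : log r.factorial / n + (r * ε - ∑ i, log (v (α i))) = (log r.factorial + n * (r * ε - ∑ i, log (v (α i)))) / n := by
        field_simp
      rw [h6, h7]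
      exact div_le_div_of_nonneg_right h4 hn'.le
    have t1 : Tendsto (fun n : ℕ => log (v Ψ.det) / n - log (v A.det)) atTop (𝓝 (0 - log (v A.det))) :=
      (tendsto_const_div_atTop_nhds_zero_nat _).sub_const _
    have t2 : Tendsto (fun n : ℕ => log r.factorial / n + (r * ε - ∑ i, log (v (α i)))) atTop (𝓝 (0 + (r * ε - ∑ i, log (v (α i))))) :=
      (tendsto_const_div_atTop_nhds_zero_nat _).add_const _
    have := le_of_tendsto_of_tendsto t1 t2 h2
    linarith
  by_contra hcon
  push Not at hcon
  have h8 := key ((∑ i, log (v (α i)) - log (v A.det)) / (2 * (r + 1))) (by apply div_pos <;> [linarith; positivity])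
  have h9 : (r : ℝ) * ((∑ i, log (v (α i)) - log (v A.det)) / (2 * (r + 1))) ≤ (∑ i, log (v (α i)) - log (v A.det)) / 2 := by
    rw [mul_div_assoc', div_le_div_iff₀ (by positivity) (by positivity)]
    nlinarith
  linarith

end A1

section A2

variable {K : Type*} [Field K] [CharZero K] {r : ℕ}

lemma cast_row (A : Sq r ℤ) (e : Fin r → ℤ) (n : ℕ) (l : Fin r) :
    vecMul (fun l => (e l : K)) ((A.map (Int.cast : ℤ → K)) ^ n) l = ((vecMul e (A ^ n) l : ℤ) : K) := by
  have h1 : (A.map (Int.cast : ℤ → K)) ^ n = (A ^ n).map (Int.cast : ℤ → K) := by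
    have := (map_pow (mapMatrix (castRingHom K) : Sq r ℤ →+* _) A n)
    simpa using this.symm
  rw [h1]
  simp [vecMul, dotProduct]

lemma int_clear {ι : Type*} [Fintype ι] (y : ι → ℚ) : ∃ d : ℤ, d ≠ 0 ∧ ∃ z : ι → ℤ, ∀ l, (z l : ℚ) = d * y l := by
  classical
  refine ⟨∏ l, ((y l).den : ℤ), ?_, fun l => (y l).num * ∏ i ∈ univ.erase l, ((y i).den : ℤ), fun l => ?_⟩
  · exact prod_ne_zero_iff.2 fun l _ => by exact_mod_cast (y l).den_nz
  · rw [← mul_prod_erase univ _ (mem_univ l)]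
    push_cast
    have : (y l).num = ((y l).den : ℚ) * y l := by rw [mul_comm]; exact (Rat.mul_den_eq_num _).symm
    rw [this]; ring

lemma stabK (A : Sq r ℤ) (e : Fin r → ℤ) (N a : ℕ)
    (he : ∀ y : Fin r → ℤ, (∀ n, e ⬝ᵥ (A ^ (a + N * n)).mulVec y = 0) → y = 0) (g : Fin r → K)
    (hg : ∀ n, (fun l => (e l : K)) ⬝ᵥ ((A.map (Int.cast : ℤ → K)) ^ (a + N * n)).mulVec g = 0) : g = 0 := by
  by_contra hne
  obtain ⟨l, hl⟩ := ne_iff.1 hne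
  obtain ⟨φ, hφ⟩ : ∃ φ : Module.Dual ℚ K, φ (g l) ≠ 0 := by
    by_contra hcon
    push Not at hcon
    exact hl ((Module.forall_dual_apply_eq_zero_iff ℚ (g l)).1 hcon)
  obtain ⟨d, hd, z, hz⟩ := int_clear (fun l => φ (g l))
  have hz0 : z = 0 := by
    apply he
    intro n
    have h1 := hg n
    rw [dotProduct_mulVec] at h1 ⊢
    simp only [dotProduct, cast_row] at h1 ⊢
    have h2 := congrArg φ h1
    rw [map_sum, map_zero] at h2
    have h3 : ∀ x : Fin r, φ (((vecMul e (A ^ (a + N * n)) x : ℤ) : K) * g x) = ((vecMul e (A ^ (a + N * n)) x : ℤ) : ℚ) * φ (g x) := by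
      intro x
      rw [← zsmul_eq_mul, map_zsmul, zsmul_eq_mul]
    simp only [h3] at h2
    have h4 : ((∑ x, vecMul e (A ^ (a + N * n)) x * z x : ℤ) : ℚ) = 0 := by
      push_cast
      simp only [hz]
      calc _ = d * ∑ x, ((vecMul e (A ^ (a + N * n)) x : ℤ) : ℚ) * φ (g x) := by
            rw [mul_sum]; exact sum_congr rfl fun _ _ => by ring
        _ = 0 := by rw [h2, mul_zero]
    exact_mod_cast h4
  have h5 := hz l
  rw [hz0] at h5
  simp at h5
  rcases h5 with h5 | h5
  · exact hd h5
  · exact hφ h5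

lemma eig_pow (M : Sq r K) (θ : K) (g : Fin r → K) (hg : M.mulVec g = θ • g) (n : ℕ) :
    (M ^ n).mulVec g = θ ^ n • g := by
  induction n with
  | zero => simp
  | succ n ih => rw [pow_succ, ← mulVec_mulVec, hg, mulVec_smul, ih, smul_smul, pow_succ']

/-- a generalized left eigenvector gives a right eigenvector -/
lemma exists_eig (M : Sq r K) (θ : K) (ψ : Fin r → K) (hψ : ψ ≠ 0) (k : ℕ)
    (h : vecMul ψ ((M - θ • (1 : Sq r K)) ^ k) = 0) :
    ∃ g : Fin r → K, g ≠ 0 ∧ M.mulVec g = θ • g := by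
  have h1 : ((M - θ • (1 : Sq r K)) ^ k).det = 0 :=
    Matrix.exists_vecMul_eq_zero_iff.1 ⟨ψ, hψ, h⟩
  rw [det_pow] at h1
  have h2 : (M - θ • (1 : Sq r K)).det = 0 := by
    by_contra h3; exact pow_ne_zero k h3 h1
  obtain ⟨g, hg, hg2⟩ := Matrix.exists_mulVec_eq_zero_iff.2 h2
  refine ⟨g, hg, ?_⟩
  rw [sub_mulVec, smul_mulVec, one_mulVec] at hg2
  exact sub_eq_zero.1 hg2

lemma left_right (M : Sq r K) (θ η : K) (ψ : Fin r → K) (k : ℕ)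
    (h : vecMul ψ ((M - θ • (1 : Sq r K)) ^ k) = 0) (g : Fin r → K) (hg : M.mulVec g = η • g) :
    (η - θ) ^ k * (ψ ⬝ᵥ g) = 0 := by
  have h1 : (M - θ • (1 : Sq r K)).mulVec g = (η - θ) • g := by
    rw [sub_mulVec, smul_mulVec, one_mulVec, hg, sub_smul]
  have h2 := eig_pow _ _ _ h1 k
  have h3 : vecMul ψ ((M - θ • (1 : Sq r K)) ^ k) ⬝ᵥ g = (η - θ) ^ k * (ψ ⬝ᵥ g) := by
    rw [← dotProduct_mulVec, h2, dotProduct_smul, smul_eq_mul]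
  rw [← h3, h, zero_dotProduct]

/-- any eigenvalue occurs among the list -/
lemma eig_mem (M Ψ : Sq r K) (hΨ : Ψ.det ≠ 0) (α : Fin r → K) (k : ℕ)
    (h : ∀ i, vecMul (Ψ i) ((M - α i • (1 : Sq r K)) ^ k) = 0) (g : Fin r → K) (hg0 : g ≠ 0) (η : K)
    (hg : M.mulVec g = η • g) : ∃ i, α i = η := by
  by_contra hcon
  push Not at hcon
  apply hg0
  refine Matrix.eq_zero_of_mulVec_eq_zero hΨ (funext fun i => ?_)
  have := left_right M (α i) η (Ψ i) k (h i) g hg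
  rcases mul_eq_zero.1 this with h1 | h1
  · exact absurd h1 (pow_ne_zero k (sub_ne_zero.2 (hcon i).symm))
  · exact h1

lemma pick (M Ψ : Sq r K) (hΨ : Ψ.det ≠ 0) (α : Fin r → K) (k : ℕ)
    (h : ∀ i, vecMul (Ψ i) ((M - α i • (1 : Sq r K)) ^ k) = 0) (g : Fin r → K) (η : K)
    (hg : M.mulVec g = η • g) (e : Fin r → K) (heg : e ⬝ᵥ g ≠ 0) : ∃ i, α i = η ∧ (Ψ.updateRow i e).det ≠ 0 := by
  obtain ⟨c, hc⟩ : ∃ c : Fin r → K, c = vecMul e Ψ⁻¹ := ⟨_, rfl⟩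
  have hce : e = vecMul c Ψ := by
    rw [hc, vecMul_vecMul, nonsing_inv_mul _ (isUnit_iff_ne_zero.2 hΨ), vecMul_one]
  have h1 : e ⬝ᵥ g = ∑ i, c i * (Ψ i ⬝ᵥ g) := by
    rw [hce, ← dotProduct_mulVec]; rfl
  rw [h1] at heg
  obtain ⟨i, _, hi⟩ := exists_ne_zero_of_sum_ne_zero heg
  refine ⟨i, ?_, ?_⟩
  · by_contra hne
    rcases mul_eq_zero.1 (left_right M (α i) η (Ψ i) k (h i) g hg) with h2 | h2
    · exact pow_ne_zero k (sub_ne_zero.2 (Ne.symm hne)) h2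
    · exact hi (by rw [h2, mul_zero])
  · have h3 : e = ∑ j, c j • Ψ j := by
      rw [hce]; ext l; simp [vecMul, dotProduct]
    rw [h3, Matrix.det_updateRow_sum, smul_eq_mul]
    exact mul_ne_zero (left_ne_zero_of_mul hi) hΨ

lemma pow_ne (A : Sq r ℤ) (e : Fin r → ℤ) (N : ℕ)
    (he : ∀ y : Fin r → ℤ, (∀ n, e ⬝ᵥ (A ^ (0 + N * n)).mulVec y = 0) → y = 0)
    (α β : K) (hαβ : α ≠ β) (g f : Fin r → K) (hg0 : g ≠ 0)
    (hg : (A.map (Int.cast : ℤ → K)).mulVec g = α • g) (hf : (A.map (Int.cast : ℤ → K)).mulVec f = β • f)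
    (hf0 : (fun l => (e l : K)) ⬝ᵥ f ≠ 0) : α ^ N ≠ β ^ N := by
  intro hN
  obtain ⟨E, hE⟩ : ∃ E : Fin r → K, E = (fun l => (e l : K)) := ⟨_, rfl⟩
  rw [← hE] at hf0
  have h1 : (E ⬝ᵥ f) • g - (E ⬝ᵥ g) • f = 0 := by
    apply stabK A e N 0 he
    intro n
    rw [← hE, Matrix.mulVec_sub, mulVec_smul, mulVec_smul, eig_pow _ _ _ hg, eig_pow _ _ _ hf, zero_add, pow_mul, pow_mul, hN]
    simp only [dotProduct_sub, dotProduct_smul, smul_eq_mul]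
    ring
  have h2 := congrArg (A.map (Int.cast : ℤ → K)).mulVec h1
  rw [Matrix.mulVec_sub, mulVec_smul, mulVec_smul, hg, hf, Matrix.mulVec_zero] at h2
  apply hg0
  have h3 : ((E ⬝ᵥ f) * (α - β)) • g = 0 := by
    have h4 : ((E ⬝ᵥ f) * (α - β)) • g = ((E ⬝ᵥ f) • α • g - (E ⬝ᵥ g) • β • f) - β • ((E ⬝ᵥ f) • g - (E ⬝ᵥ g) • f) := by
      ext l; simp; ring
    rw [h4, h2, h1]; simp
  exact (smul_eq_zero.1 h3).resolve_left (mul_ne_zero hf0 (sub_ne_zero.2 hαβ))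

end A2

section A3

variable {K : Type*} [Field K] {F : Type*} [Field F] {r : ℕ}

lemma map_data_eq (φ : K →+* F) (A : Sq r ℤ) (ψ : Fin r → K) (θ : K) (k : ℕ) (l : Fin r) :
    φ (vecMul ψ ((A.map (Int.cast : ℤ → K) - θ • (1 : Sq r K)) ^ k) l) =
    vecMul (fun l => φ (ψ l)) ((A.map (Int.cast : ℤ → F) - φ θ • (1 : Sq r F)) ^ k) l := by
  rw [RingHom.map_vecMul]
  have h2 : ((A.map (Int.cast : ℤ → K) - θ • (1 : Sq r K)) ^ k).map φ =
      (A.map (Int.cast : ℤ → F) - φ θ • (1 : Sq r F)) ^ k := by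
    have h3 := map_pow (mapMatrix φ : Sq r K →+* Sq r F) (A.map (Int.cast : ℤ → K) - θ • (1 : Sq r K)) k
    rw [mapMatrix_apply, mapMatrix_apply] at h3
    rw [h3]
    congr 1
    ext a b
    by_cases hab : a = b
    · subst hab; simp
    · simp [Matrix.one_apply_ne hab]
  rw [h2]
  rfl

lemma map_data (φ : K →+* F) (A : Sq r ℤ) (ψ : Fin r → K) (θ : K) (k : ℕ)
    (h : vecMul ψ ((A.map (Int.cast : ℤ → K) - θ • (1 : Sq r K)) ^ k) = 0) :
    vecMul (fun l => φ (ψ l)) ((A.map (Int.cast : ℤ → F) - φ θ • (1 : Sq r F)) ^ k) = 0 := by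
  ext l
  rw [← map_data_eq, h]
  simp

lemma map_eig (φ : K →+* F) (A : Sq r ℤ) (g : Fin r → K) (θ : K)
    (hg : (A.map (Int.cast : ℤ → K)).mulVec g = θ • g) :
    (A.map (Int.cast : ℤ → F)).mulVec (fun l => φ (g l)) = φ θ • (fun l => φ (g l)) := by
  ext l
  have h1 := congrArg φ (congrFun hg l)
  rw [RingHom.map_mulVec] at h1
  have h2 : (A.map (Int.cast : ℤ → K)).map φ = A.map (Int.cast : ℤ → F) := by ext; simp
  rw [h2] at h1
  simpa [comp_def] using h1

lemma map_ne (φ : K →+* F) (g : Fin r → K) (hg : g ≠ 0) : (fun l => φ (g l)) ≠ 0 := by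
  intro h
  apply hg
  ext l
  have := congrFun h l
  simpa using this

lemma map_det_ne (φ : K →+* F) (Ψ : Sq r K) (h : Ψ.det ≠ 0) : (Ψ.map φ).det ≠ 0 := by
  have := map_det φ Ψ
  rw [mapMatrix_apply] at this
  rw [← this]
  simpa using h

lemma pow_gen (M : Sq r K) (θ : K) (ψ : Fin r → K) (k t : ℕ)
    (h : vecMul ψ ((M - θ • (1 : Sq r K)) ^ k) = 0) :
    vecMul ψ ((M ^ t - θ ^ t • (1 : Sq r K)) ^ k) = 0 := by
  obtain ⟨Z, hZ⟩ : ∃ Z, Z = θ • (1 : Sq r K) := ⟨_, rfl⟩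
  have hc : Commute M Z := by rw [hZ]; exact (Commute.one_right M).smul_right θ
  have h1 : θ ^ t • (1 : Sq r K) = Z ^ t := by rw [hZ, smul_pow, one_pow]
  rw [h1]
  rw [← hZ] at h
  have h2 : M ^ t - Z ^ t = (M - Z) * ∑ i ∈ range t, M ^ i * Z ^ (t - 1 - i) := (hc.mul_geom_sum₂ t).symm
  have hc2 : Commute (M - Z) (∑ i ∈ range t, M ^ i * Z ^ (t - 1 - i)) := by
    apply Commute.sum_right
    intro i _
    have c1 : Commute (M - Z) M := (Commute.refl M).sub_left hc.symm
    have c2 : Commute (M - Z) Z := hc.sub_left (Commute.refl Z)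
    exact (c1.pow_right _).mul_right (c2.pow_right _)
  rw [h2, hc2.mul_pow, ← vecMul_vecMul, h, zero_vecMul]

/-- coefficients of the characteristic polynomial of a power -/
lemma coef_bound {F : Type*} [NormedField F] [IsAlgClosed F] [CharZero F] (A : Sq r ℤ) (Ψ : Sq r F) (hΨ : Ψ.det ≠ 0)
    (α : Fin r → F) (k : ℕ)
    (h : ∀ i, vecMul (Ψ i) ((A.map (Int.cast : ℤ → F) - α i • (1 : Sq r F)) ^ k) = 0)
    (B : ℝ) (hα : ∀ i, ‖α i‖ ≤ B) (t i : ℕ) :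
    ‖(((A ^ t).charpoly.coeff i : ℤ) : F)‖ ≤ (B ^ t) ^ (r - i) * r.choose i := by
  have h1 := Polynomial.coeff_le_of_roots_le (p := (A ^ t).charpoly) (f := castRingHom F) (B := B ^ t) i (Matrix.charpoly_monic _)
    (IsAlgClosed.splits _) ?_
  · simpa [Matrix.charpoly_natDegree_eq_dim] using h1
  · intro z hz
    have h2 : (Polynomial.map (castRingHom F) (A ^ t).charpoly).IsRoot z := (Polynomial.mem_roots'.1 hz).2
    rw [← charpoly_map, Polynomial.IsRoot, eval_charpoly] at h2
    obtain ⟨g, hg0, hg⟩ := Matrix.exists_mulVec_eq_zero_iff.2 h2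
    have h3 : (A ^ t).map (castRingHom F) = (A.map (Int.cast : ℤ → F)) ^ t := by
      have := (map_pow (mapMatrix (castRingHom F) : Sq r ℤ →+* _) A t)
      simpa using this
    rw [h3, sub_mulVec, sub_eq_zero] at hg
    have h4 : ((A.map (Int.cast : ℤ → F)) ^ t).mulVec g = z • g := by
      rw [← hg]; ext l; simp [mulVec_diagonal]
    obtain ⟨i, hi⟩ := eig_mem ((A.map (Int.cast : ℤ → F)) ^ t) Ψ hΨ (fun i => α i ^ t) k (fun i => pow_gen _ _ _ _ _ (h i)) g hg0 z h4
    rw [← hi, norm_pow]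
    exact pow_le_pow_left₀ (norm_nonneg _) (hα i) t

lemma growth [NumberField K] (p : ℕ) [Fact p.Prime] (σ : K →+* ℂ) (τ : K →+* PadicAlgCl p)
    (A : Sq r ℤ) (Ψ : Sq r K) (hΨ : Ψ.det ≠ 0) (α : Fin r → K) (k : ℕ)
    (h : ∀ i, vecMul (Ψ i) ((A.map (Int.cast : ℤ → K) - α i • (1 : Sq r K)) ^ k) = 0)
    (hα0 : ∀ i, α i ≠ 0)
    (ω : ℝ) (hω : 1 ≤ ω) (h1 : ∀ i, ‖σ (α i)‖ ≤ ω) (h2 : ∀ i, ‖τ (α i)‖ ≤ ω⁻¹) (i j : Fin r) :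
    ∃ N, 1 ≤ N ∧ α i ^ N = α j ^ N := by
  have hp1 : 1 < (p : ℝ) := by exact_mod_cast (Fact.out : p.Prime).one_lt
  have hp0 : (p : K) ≠ 0 := by exact_mod_cast (Fact.out : p.Prime).ne_zero
  have hs : ∀ t : ℕ, ∃ s : ℕ, (p : ℝ) ^ s ≤ ω ^ t ∧ ω ^ t < (p : ℝ) ^ (s + 1) := fun t => exists_nat_pow_near (one_le_pow₀ hω) hp1
  choose s hs1 hs2 using hs
  obtain ⟨c, hc⟩ : ∃ c : ℕ, (2 : ℝ) ^ r < (p : ℝ) ^ c := pow_unbounded_of_one_lt _ hp1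
  have hfin := NumberField.Embeddings.finite_of_norm_le K ℂ ((p : ℝ) ^ c * p)
  have hmem : ∀ i t, (p : K) ^ c * α i ^ t / (p : K) ^ s t ∈ {x | IsIntegral ℤ x ∧ ∀ (φ : K →+* ℂ), ‖φ x‖ ≤ (p : ℝ) ^ c * p} := by
    intro i t
    obtain ⟨g, hg0, hg⟩ := exists_eig _ _ (Ψ i) (fun h0 => hΨ (det_eq_zero_of_row_eq_zero i (fun l => congrFun h0 l))) k (h i)
    refine ⟨?_, fun φ => ?_⟩
    · have hd : ∀ m, m < r → (p : ℤ) ^ (s t * (r - m)) ∣ (A ^ t).charpoly.coeff m * (p : ℤ) ^ (c * (r - m)) := by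
        intro m hm
        have h3 := coef_bound A (Ψ.map τ) (map_det_ne τ Ψ hΨ) (fun i => τ (α i)) k (fun i => map_data τ A (Ψ i) (α i) k (h i)) ω⁻¹ h2 t m
        have h4 : ∀ z : ℤ, ‖(z : PadicAlgCl p)‖ = ‖(z : ℚ_[p])‖ := fun z => by
          have := PadicAlgCl.norm_extends p (z : ℚ_[p])
          simpa using this
        rw [h4] at h3
        have h5 := (PadicInt.norm_int_le_pow_iff_dvd (p := p) (k := (A ^ t).charpoly.coeff m * (p : ℤ) ^ (c * (r - m))) (n := s t * (r - m))).1 ?_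
        · exact h5
        have h6 : ‖(((A ^ t).charpoly.coeff m * (p : ℤ) ^ (c * (r - m)) : ℤ) : ℤ_[p])‖ = ‖(((A ^ t).charpoly.coeff m : ℤ) : ℚ_[p])‖ * ((p : ℝ) ^ (c * (r - m)))⁻¹ := by
          rw [PadicInt.norm_def]
          push_cast
          rw [norm_mul, norm_pow, Padic.norm_p, inv_pow]
        rw [h6, zpow_neg, zpow_natCast]
        have hch : ((r.choose m : ℕ) : ℝ) ≤ 2 ^ r := by exact_mod_cast Nat.choose_le_two_pow r m
        have hpc : (2 : ℝ) ^ r ≤ (p : ℝ) ^ (c * (r - m)) := by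
          refine hc.le.trans (pow_le_pow_right₀ hp1.le ?_)
          exact Nat.le_mul_of_pos_right _ (by omega)
        have hω0 : 0 < ω := by linarith
        calc _ ≤ ((ω⁻¹ ^ t) ^ (r - m) * r.choose m) * ((p : ℝ) ^ (c * (r - m)))⁻¹ := by gcongr
          _ ≤ ((((p : ℝ) ^ s t)⁻¹) ^ (r - m) * (p : ℝ) ^ (c * (r - m))) * ((p : ℝ) ^ (c * (r - m)))⁻¹ := by
              rw [inv_pow]
              gcongr
              · exact hs1 t
              · exact hch.trans hpc
          _ = _ := by
              rw [mul_assoc, mul_inv_cancel₀ (by positivity), mul_one, inv_pow, ← pow_mul]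
      choose d hd using hd
      let P : Polynomial ℤ := Polynomial.X ^ r + ∑ m : Fin r, Polynomial.C (d m m.2) * Polynomial.X ^ (m : ℕ)
      refine ⟨P, ?_, ?_⟩
      · apply Polynomial.monic_X_pow_add
        apply Polynomial.degree_sum_fin_lt
      · have h7 : (A ^ t).charpoly.eval₂ (castRingHom K) (α i ^ t) = 0 := by
          rw [← Polynomial.eval_map, ← charpoly_map, eval_charpoly]
          apply Matrix.exists_mulVec_eq_zero_iff.1
          refine ⟨g, hg0, ?_⟩
          have h3 : (A ^ t).map (castRingHom K) = (A.map (Int.cast : ℤ → K)) ^ t := by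
            have := (map_pow (mapMatrix (castRingHom K) : Sq r ℤ →+* _) A t)
            simpa using this
          rw [h3, sub_mulVec, eig_pow _ _ _ hg, sub_eq_zero]
          ext l; simp [mulVec_diagonal]
        have hr : (A ^ t).charpoly.natDegree = r := by simp [Matrix.charpoly_natDegree_eq_dim]
        have hlead : (A ^ t).charpoly.coeff r = 1 := by
          have := Matrix.charpoly_monic (A ^ t)
          rw [Polynomial.Monic, Polynomial.leadingCoeff, hr] at this
          exact this
        rw [Polynomial.eval₂_eq_sum_range, hr, sum_range_succ, hlead, sum_range] at h7
        have h8 : ∀ m : Fin r, ((d m m.2 : ℤ) : K) * ((p : K) ^ c * α i ^ t / (p : K) ^ s t) ^ (m : ℕ) =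
            ((p : K) ^ c / (p : K) ^ s t) ^ r * ((castRingHom K) ((A ^ t).charpoly.coeff m) * (α i ^ t) ^ (m : ℕ)) := by
          intro m
          have h9 := congrArg (Int.cast : ℤ → K) (hd m m.2)
          push_cast at h9
          have h10 : ((p : K) ^ c / (p : K) ^ s t) ^ r = ((p : K) ^ c / (p : K) ^ s t) ^ (m : ℕ) * ((p : K) ^ c / (p : K) ^ s t) ^ (r - m) := by
            rw [← pow_add]; congr 1; omega
          rw [h10]
          have h11 : ((d m m.2 : ℤ) : K) = ((A ^ t).charpoly.coeff m : K) * ((p : K) ^ c / (p : K) ^ s t) ^ (r - m) := by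
            rw [div_pow, ← pow_mul, ← pow_mul, mul_div_assoc', h9]
            field_simp
          rw [h11]
          have h12 : (p : K) ^ c * α i ^ t / (p : K) ^ s t = ((p : K) ^ c / (p : K) ^ s t) * α i ^ t := by ring
          rw [h12, mul_pow, eq_intCast]
          ring
        have h13 : ((p : K) ^ c * α i ^ t / (p : K) ^ s t) ^ r = ((p : K) ^ c / (p : K) ^ s t) ^ r * ((castRingHom K) 1 * (α i ^ t) ^ r) := by
          rw [map_one, one_mul, ← mul_pow]; ring
        simp only [P, Polynomial.eval₂_add, Polynomial.eval₂_pow, Polynomial.eval₂_X, Polynomial.eval₂_finset_sum, Polynomial.eval₂_mul, Polynomial.eval₂_C]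
        rw [h13]
        simp only [algebraMap_int_eq, eq_intCast] at h8 ⊢
        simp only [eq_intCast] at h7
        rw [sum_congr rfl (fun m _ => h8 m), ← mul_sum, ← mul_add, add_comm, h7, mul_zero]
    · obtain ⟨j, hj⟩ := eig_mem (A.map (Int.cast : ℤ → ℂ)) (Ψ.map σ) (map_det_ne σ Ψ hΨ) (fun i => σ (α i)) k (fun i => map_data σ A (Ψ i) (α i) k (h i))
        _ (map_ne φ g hg0) _ (map_eig φ A g _ hg)
      rw [map_div₀, map_mul, map_pow, map_pow, map_pow, map_natCast, ← hj, norm_div, norm_mul, norm_pow, norm_pow, norm_pow, Complex.norm_natCast]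
      rw [mul_div_assoc]
      have hpp : (0 : ℝ) < (p : ℝ) ^ s t := by positivity
      gcongr
      rw [div_le_iff₀ hpp, mul_comm, ← pow_succ]
      exact (pow_le_pow_left₀ (norm_nonneg _) (h1 j) t).trans (hs2 t).le
  obtain ⟨t, -, t', -, htt, heq⟩ := Set.infinite_univ.exists_ne_map_eq_of_mapsTo (s := (Set.univ : Set ℕ))
    (f := fun t => ((p : K) ^ c * α i ^ t / (p : K) ^ s t, (p : K) ^ c * α j ^ t / (p : K) ^ s t)) (fun t _ => Set.mk_mem_prod (hmem i t) (hmem j t)) (hfin.prod hfin)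
  have key : ∀ t t', t < t' → ((p : K) ^ c * α i ^ t / (p : K) ^ s t, (p : K) ^ c * α j ^ t / (p : K) ^ s t) = ((p : K) ^ c * α i ^ t' / (p : K) ^ s t', (p : K) ^ c * α j ^ t' / (p : K) ^ s t') →
      ∃ N, 1 ≤ N ∧ α i ^ N = α j ^ N := by
    intro t t' hlt heq
    refine ⟨t' - t, by omega, ?_⟩
    have h5 : ∀ i, (p : K) ^ c * α i ^ t / (p : K) ^ s t = (p : K) ^ c * α i ^ t' / (p : K) ^ s t' → α i ^ (t' - t) = (p : K) ^ s t' / (p : K) ^ s t := by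
      intro i hi
      have h6 : α i ^ t' = α i ^ t * α i ^ (t' - t) := by rw [← pow_add]; congr 1; omega
      rw [h6] at hi
      have h7 := pow_ne_zero t (hα0 i)
      field_simp at hi ⊢
      linear_combination -hi
    rw [h5 i (Prod.ext_iff.1 heq).1, h5 j (Prod.ext_iff.1 heq).2]
  rcases lt_or_gt_of_ne htt with hlt | hlt
  · exact key t t' hlt heq
  · exact key t' t hlt heq.symm

end A3

section A4

variable {K : Type*} [Field K] {r : ℕ}

/-- absolute value attached to an embedding into a normed field -/
def nav {F : Type*} [NormedField F] (σ : K →+* F) : AbsoluteValue K ℝ where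
  toFun x := ‖σ x‖
  map_mul' x y := by simp
  nonneg' x := norm_nonneg _
  eq_zero' x := by simp
  add_le' x y := by simpa using norm_add_le _ _

lemma nav_apply {F : Type*} [NormedField F] (σ : K →+* F) (x : K) : nav σ x = ‖σ x‖ := rfl

lemma exists_place [NumberField K] (q : ℕ) (hq : q.Prime) : ∃ v : AbsoluteValue K ℝ, IsNonarchimedean v ∧
    (∀ z : ℤ, v (z : K) = ((padicNorm q z : ℚ) : ℝ)) ∧ ∃ (_ : Fact q.Prime) (τ : K →+* PadicAlgCl q), ∀ x, v x = ‖τ x‖ := by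
  haveI : Fact q.Prime := ⟨hq⟩
  let τ : K →+* PadicAlgCl q := ((IsAlgClosed.lift : K →ₐ[ℚ] PadicAlgCl q) : K →+* PadicAlgCl q)
  refine ⟨nav τ, ?_, ?_, ⟨hq⟩, τ, fun x => rfl⟩
  · intro x y
    rw [nav_apply, nav_apply, nav_apply, map_add]
    exact PadicAlgCl.isNonarchimedean q _ _
  · intro z
    rw [nav_apply, map_intCast]
    have := PadicAlgCl.norm_extends q (z : ℚ_[q])
    rw [map_intCast] at this
    rw [this]
    have h2 := Padic.eq_padicNorm (p := q) (z : ℚ)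
    simpa using h2

lemma prodS (S : Finset ℕ) (hS : ∀ q ∈ S, q.Prime) (z : ℤ) (hz : z ≠ 0) :
    1 ≤ |(z : ℝ)| * ∏ q ∈ S, ((padicNorm q z : ℚ) : ℝ) ∧
    (z.natAbs.primeFactors ⊆ S → |(z : ℝ)| * ∏ q ∈ S, ((padicNorm q z : ℚ) : ℝ) = 1) := by
  have hn : z.natAbs ≠ 0 := by simpa using hz
  have h1 : ∀ T : Finset ℕ, (∀ q ∈ T, q.Prime) → z.natAbs.primeFactors ⊆ T → ∏ q ∈ T, (q : ℝ) ^ (z.natAbs.factorization q) = |(z : ℝ)| := by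
    intro T hT hsub
    have h2 : ∏ q ∈ T, q ^ (z.natAbs.factorization q) = z.natAbs := by
      rw [← prod_subset hsub]
      · exact Nat.prod_factorization_pow_eq_self hn
      · intro q hq hq2
        rw [Finsupp.notMem_support_iff.1 (by simpa using hq2), pow_zero]
    have h3 := congrArg (Nat.cast : ℕ → ℝ) h2
    push_cast at h3
    rw [h3, Nat.cast_natAbs]; simp
  have h4 : ∏ q ∈ S, ((padicNorm q z : ℚ) : ℝ) = (∏ q ∈ S, (q : ℝ) ^ (z.natAbs.factorization q))⁻¹ := by
    rw [← prod_inv_distrib]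
    refine prod_congr rfl fun q hq => ?_
    rw [padicNorm.eq_zpow_of_nonzero (by exact_mod_cast hz), padicValRat.of_int, zpow_neg, zpow_natCast, padicValInt, Nat.factorization_def _ (hS q hq)]
    push_cast; rfl
  have hpos : 0 < ∏ q ∈ S, (q : ℝ) ^ (z.natAbs.factorization q) :=
    prod_pos fun q hq => pow_pos (by exact_mod_cast (hS q hq).pos) _
  rw [h4]
  constructor
  · rw [← div_eq_mul_inv, le_div_iff₀ hpos, one_mul, ← h1 (S ∪ z.natAbs.primeFactors) ?_ subset_union_right]
    · rw [← prod_sdiff (subset_union_left (s₁ := S) (s₂ := z.natAbs.primeFactors))]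
      refine le_mul_of_one_le_left hpos.le (prod_induction _ (fun x : ℝ => 1 ≤ x) (fun _ _ => one_le_mul_of_one_le_of_one_le) le_rfl fun q hq => ?_)
      have : q ≠ 0 := by
        rcases mem_union.1 (Finset.mem_sdiff.1 hq).1 with h | h
        · exact (hS q h).ne_zero
        · exact (Nat.prime_of_mem_primeFactors h).ne_zero
      exact one_le_pow₀ (by exact_mod_cast Nat.one_le_iff_ne_zero.2 this)
    · intro q hq
      rcases mem_union.1 hq with h | h
      · exact hS q h
      · exact Nat.prime_of_mem_primeFactors h
  · intro hsub
    rw [h1 S hS hsub, mul_inv_cancel₀]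
    simpa using hz

lemma realrows_aux (ρ τ : Sq r ℝ)
    (h : (of fun i l => (ρ i l : ℂ) + Complex.I * (τ i l : ℂ)).det ≠ 0) (s : Finset (Fin r)) :
    ∃ b : Fin r → Bool, (of fun i l => if i ∈ s then (if b i then (ρ i l : ℂ) else (τ i l : ℂ)) else (ρ i l : ℂ) + Complex.I * (τ i l : ℂ)).det ≠ 0 := by
  classical
  induction s using Finset.induction_on with
  | empty => exact ⟨fun _ => true, by simpa using h⟩
  | insert j s hj ih =>
    obtain ⟨b, hb⟩ := ih
    obtain ⟨M, hM⟩ : ∃ M : Sq r ℂ, M = (of fun i l => if i ∈ s then (if b i then (ρ i l : ℂ) else (τ i l : ℂ)) else (ρ i l : ℂ) + Complex.I * (τ i l : ℂ)) := ⟨_, rfl⟩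
    rw [← hM] at hb
    have h1 : M = M.updateRow j ((fun l => (ρ j l : ℂ)) + Complex.I • (fun l => (τ j l : ℂ))) := by
      ext i l
      by_cases hij : i = j
      · subst hij; simp [hM, hj]
      · rw [updateRow_ne hij]
    have h2 : M.det = (M.updateRow j (fun l => (ρ j l : ℂ))).det + Complex.I * (M.updateRow j (fun l => (τ j l : ℂ))).det := by
      conv_lhs => rw [h1, Matrix.det_updateRow_add, Matrix.det_updateRow_smul]
    have h3 : ∀ B : Bool, (of fun i l => if i ∈ insert j s then (if update b j B i then (ρ i l : ℂ) else (τ i l : ℂ)) else (ρ i l : ℂ) + Complex.I * (τ i l : ℂ)) =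
        M.updateRow j (if B then (fun l => (ρ j l : ℂ)) else (fun l => (τ j l : ℂ))) := by
      intro B
      ext i l
      by_cases hij : i = j
      · subst hij; cases B <;> simp
      · rw [updateRow_ne hij, hM]; simp [hij]
    by_cases h4 : (M.updateRow j (fun l => (ρ j l : ℂ))).det = 0
    · refine ⟨update b j false, ?_⟩
      rw [h3]
      intro h5
      apply hb
      rw [h2, h4]
      simp at h5
      rw [h5]; simp
    · refine ⟨update b j true, ?_⟩
      rw [h3]
      simpa using h4

lemma realrows (σ : K →+* ℂ) (Re Im : K → K) (hRe : ∀ x, σ (Re x) = ((σ x).re : ℂ)) (hIm : ∀ x, σ (Im x) = ((σ x).im : ℂ))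
    (M : Sq r K) (hM : M.det ≠ 0) :
    ∃ (L0 : Sq r K) (R : Sq r ℝ), L0.det ≠ 0 ∧ R.det ≠ 0 ∧
      (∀ (x : Fin r → ℤ) t, nav σ (L0.mulVec (fun l => (x l : K)) t) = |R.mulVec (fun l => (x l : ℝ)) t|) ∧
      ∀ (x : Fin r → ℤ) t, |R.mulVec (fun l => (x l : ℝ)) t| ≤ nav σ (M.mulVec (fun l => (x l : K)) t) := by
  obtain ⟨b, hb⟩ := realrows_aux (of fun i l => (σ (M i l)).re) (of fun i l => (σ (M i l)).im) (by
    have h1 := map_det_ne σ M hM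
    have h2 : (of fun i l => (((σ (M i l)).re : ℝ) : ℂ) + Complex.I * (((σ (M i l)).im : ℝ) : ℂ)) = M.map σ := by
      ext i l
      rw [of_apply, mul_comm, Complex.re_add_im, map_apply]
    exact h2 ▸ h1) univ
  simp only [mem_univ, if_true, of_apply] at hb
  let R : Sq r ℝ := of fun i l => if b i then (σ (M i l)).re else (σ (M i l)).im
  let L0 : Sq r K := of fun i l => if b i then Re (M i l) else Im (M i l)
  have hRdet : ((R.det : ℝ) : ℂ) ≠ 0 := by
    have h1 := map_det Complex.ofRealHom R
    simp only [Complex.ofRealHom_eq_coe] at h1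
    rw [h1]
    convert hb using 2
    ext i l
    simp [R]
    split_ifs <;> simp
  have hLR : L0.map σ = R.map (fun x => (x : ℂ)) := by
    ext i l
    simp only [map_apply, L0, R, of_apply]
    split_ifs
    · exact hRe _
    · exact hIm _
  have key : ∀ (x : Fin r → ℤ) t, σ (L0.mulVec (fun l => (x l : K)) t) = ((R.mulVec (fun l => (x l : ℝ)) t : ℝ) : ℂ) := by
    intro x t
    simp only [mulVec, dotProduct, map_sum, map_mul, map_intCast]
    push_cast
    refine sum_congr rfl fun l _ => ?_
    have := congrFun (congrFun hLR t) l
    simp only [map_apply] at this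
    rw [this]
  refine ⟨L0, R, ?_, by exact_mod_cast hRdet, ?_, ?_⟩
  · intro h0
    apply hRdet
    have h1 := map_det σ L0
    have h2 := map_det Complex.ofRealHom R
    rw [h0, map_zero, mapMatrix_apply, hLR] at h1
    simp only [Complex.ofRealHom_eq_coe, mapMatrix_apply] at h2
    rw [h2, h1]; rfl
  · intro x t
    rw [nav_apply, key, Complex.norm_real, Real.norm_eq_abs]
  · intro x t
    rw [nav_apply]
    have h1 : R.mulVec (fun l => (x l : ℝ)) t = if b t then (σ (M.mulVec (fun l => (x l : K)) t)).re else (σ (M.mulVec (fun l => (x l : K)) t)).im := by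
      simp only [mulVec, dotProduct, map_sum, map_mul, map_intCast, R, of_apply, Complex.re_sum, Complex.im_sum]
      split_ifs <;> exact sum_congr rfl fun l _ => by simp
    rw [h1]
    split_ifs
    · exact Complex.abs_re_le_norm _
    · exact Complex.abs_im_le_norm _

end A4

lemma genbasis {F : Type*} [Field F] [IsAlgClosed F] {r : ℕ} (M : Sq r F) :
    ∃ (Ψ : Sq r F) (α : Fin r → F) (k : ℕ), Ψ.det ≠ 0 ∧
      ∀ i, vecMul (Ψ i) ((M - α i • (1 : Sq r F)) ^ k) = 0 := by
  classical
  have hspan : ⊤ ≤ span F (⋃ μ : F, ((End.maxGenEigenspace (vecMulLinear M : End F (Fin r → F)) μ : Submodule F (Fin r → F)) : Set (Fin r → F))) := by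
    rw [← Submodule.iSup_eq_span, End.iSup_maxGenEigenspace_eq_top]
  let b := (Basis.ofSpan hspan)
  let b' := b.reindex (b.indexEquiv (Pi.basisFun F (Fin r)))
  have hb : ∀ i, ∃ μ : F, ∃ k : ℕ, vecMul (b' i) ((M - μ • (1 : Sq r F)) ^ k) = 0 := by
    intro i
    have h1 : b' i ∈ ⋃ μ : F, ((End.maxGenEigenspace (vecMulLinear M : End F (Fin r → F)) μ : Submodule F (Fin r → F)) : Set (Fin r → F)) := by
      apply Basis.ofSpan_subset hspan
      simp [b', b]
    obtain ⟨μ, hμ⟩ := Set.mem_iUnion.1 h1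
    obtain ⟨k, hk⟩ := (End.mem_maxGenEigenspace _ _ _).1 hμ
    refine ⟨μ, k, ?_⟩
    have h2 : ∀ (k : ℕ) (y : Fin r → F), (((vecMulLinear M : End F (Fin r → F)) - μ • 1) ^ k) y = vecMul y ((M - μ • (1 : Sq r F)) ^ k) := by
      intro k
      induction k with
      | zero => intro y; simp
      | succ k ih =>
        intro y
        rw [pow_succ, End.mul_apply, ih, pow_succ', ← vecMul_vecMul]
        congr 1
        ext l
        simp [Matrix.vecMul_sub, Matrix.vecMul_smul, LinearMap.sub_apply]
    rw [← h2, hk]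
  choose α k hk using hb
  refine ⟨of fun i => b' i, α, ∑ i, k i, ?_, fun i => ?_⟩
  · have h1 : IsUnit (of fun i => b' i : Sq r F) :=
      Matrix.linearIndependent_rows_iff_isUnit.1 b'.linearIndependent
    exact ((Matrix.isUnit_iff_isUnit_det _).1 h1).ne_zero
  · have h1 : k i ≤ ∑ i, k i := single_le_sum (fun _ _ => Nat.zero_le _) (mem_univ i)
    rw [← Nat.add_sub_cancel' h1, pow_add, ← vecMul_vecMul]
    change vecMul (vecMul (b' i) _) _ = 0
    rw [hk, zero_vecMul]

theorem exists_K {r : ℕ} (A : Sq r ℤ) :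
    ∃ (K : Type) (_ : Field K) (_ : NumberField K) (σ : K →+* ℂ) (Re Im : K → K)
      (_ : ∀ x, σ (Re x) = ((σ x).re : ℂ)) (_ : ∀ x, σ (Im x) = ((σ x).im : ℂ))
      (Ψ : Sq r K) (α : Fin r → K) (k : ℕ), Ψ.det ≠ 0 ∧
      ∀ i, vecMul (Ψ i) ((A.map (Int.cast : ℤ → K) - α i • (1 : Sq r K)) ^ k) = 0 := by
  classical
  obtain ⟨Ψ0, α0, k, hd0, h0⟩ := genbasis (A.map (Int.cast : ℤ → AlgebraicClosure ℚ))
  haveI : Algebra.IsAlgebraic ℚ (AlgebraicClosure ℚ) := by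
    have h1 : (DivisionRing.toRatAlgebra : Algebra ℚ (AlgebraicClosure ℚ)) = AlgebraicClosure.instAlgebra ℚ := Subsingleton.elim _ _
    rw [h1]
    exact AlgebraicClosure.isAlgebraic ℚ
  let σ0 : AlgebraicClosure ℚ →ₐ[ℚ] ℂ := IsAlgClosed.lift
  have hσ0 : ∀ x, IsIntegral ℚ (σ0 x) := fun x => (Algebra.IsIntegral.isIntegral (R := ℚ) x).map σ0
  let conj : ℂ →ₐ[ℚ] ℂ := (Complex.conjAe.toAlgHom).restrictScalars ℚ
  have hconj : ∀ z, conj z = (starRingEnd ℂ) z := fun z => rfl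
  let S : Set ℂ := {Complex.I} ∪ Set.range (fun il : Fin r × Fin r => σ0 (Ψ0 il.1 il.2)) ∪ Set.range (fun i => σ0 (α0 i))
  have hI : IsIntegral ℚ Complex.I := by
    refine ⟨Polynomial.X ^ 2 + 1, ?_, by simp⟩
    exact Polynomial.monic_X_pow_add (by simp)
  have hSint : ∀ z ∈ S, IsIntegral ℚ z := by
    rintro z ((hz | ⟨x, rfl⟩) | ⟨x, rfl⟩)
    · rw [hz]; exact hI
    · exact hσ0 _
    · exact hσ0 _
  have hSfin : S.Finite := ((Set.finite_singleton _).union (Set.finite_range _)).union (Set.finite_range _)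
  let K := IntermediateField.adjoin ℚ (S ∪ conj '' S)
  haveI : Finite ↑(S ∪ conj '' S) := (hSfin.union (hSfin.image _)).to_subtype
  haveI : FiniteDimensional ℚ K := IntermediateField.finiteDimensional_adjoin (by
    rintro z (hz | ⟨w, hw, rfl⟩)
    · exact hSint z hz
    · exact (hSint w hw).map conj)
  haveI : NumberField K := { to_charZero := inferInstance, to_finiteDimensional := inferInstance }
  have hSK : ∀ z ∈ S, z ∈ K := fun z hz => IntermediateField.subset_adjoin _ _ (Or.inl hz)
  have hKc : ∀ z ∈ K, conj z ∈ K := by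
    intro z hz
    have h1 : K.map conj = K := by
      rw [IntermediateField.adjoin_map]
      congr 1
      rw [Set.image_union, Set.union_comm]
      congr 1
      rw [← Set.image_comp]
      have : (conj ∘ conj : ℂ → ℂ) = id := by ext z; simp [hconj]
      rw [this, Set.image_id]
    rw [← h1]
    exact ⟨z, hz, rfl⟩
  have hIK : Complex.I ∈ K := hSK _ (Or.inl (Or.inl rfl))
  have hre : ∀ z : K, (((z : ℂ).re : ℝ) : ℂ) ∈ K := by
    intro z
    rw [Complex.re_eq_add_conj]
    exact K.div_mem (K.add_mem z.2 (hKc _ z.2)) (by exact_mod_cast K.algebraMap_mem 2)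
  have him : ∀ z : K, (((z : ℂ).im : ℝ) : ℂ) ∈ K := by
    intro z
    rw [Complex.im_eq_sub_conj]
    exact K.div_mem (K.sub_mem z.2 (hKc _ z.2)) (K.mul_mem (by exact_mod_cast K.algebraMap_mem 2) hIK)
  let Ψ : Sq r K := of fun i l => ⟨σ0 (Ψ0 i l), hSK _ (Or.inl (Or.inr ⟨(i, l), rfl⟩))⟩
  let α : Fin r → K := fun i => ⟨σ0 (α0 i), hSK _ (Or.inr ⟨i, rfl⟩)⟩
  refine ⟨K, inferInstance, inferInstance, algebraMap K ℂ, fun x => ⟨_, hre x⟩, fun x => ⟨_, him x⟩, fun x => rfl, fun x => rfl, Ψ, α, k, ?_, ?_⟩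
  · intro h
    apply map_det_ne (σ0 : AlgebraicClosure ℚ →+* ℂ) Ψ0 hd0
    have h1 := map_det (algebraMap K ℂ) Ψ
    rw [h, map_zero, mapMatrix_apply] at h1
    exact h1.symm
  · intro i
    refine funext fun l => ?_
    apply (algebraMap K ℂ).injective
    rw [map_data_eq, Pi.zero_apply, map_zero]
    exact congrFun (map_data (σ0 : AlgebraicClosure ℚ →+* ℂ) A (Ψ0 i) (α0 i) k (h0 i)) l

section A6

lemma lattice {r : ℕ} (p : ℕ) (hp : p.Prime) (w x : Fin r → ℤ) (hw : w ≠ 0) (a : ℤ) (m : ℕ) (hwx : w ⬝ᵥ x = a * (p : ℤ) ^ m) :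
    ∃ (D : Sq r ℤ) (z : Fin r → ℤ) (t : ℕ), t ≤ m ∧ |D.det| = (p : ℤ) ^ (m - t) ∧ D.mulVec z = x ∧
      (∀ l, (p : ℤ) ^ m ∣ vecMul w D l) ∧ (∀ l, (p : ℤ) ^ t ∣ w l) ∧ (t = m ∨ ∃ l, ¬ (p : ℤ) ^ (t + 1) ∣ w l) := by
  classical
  haveI : Fact p.Prime := ⟨hp⟩
  cases r with
  | zero => exact absurd (Subsingleton.elim w 0) hw
  | succ r =>
  obtain ⟨U, g, hU, hg⟩ := unimod w hw
  have hg0 : g ≠ 0 := by rintro rfl; exact hw (by ext i; simp [hg])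
  have hwU : w = vecMul (Pi.single 0 g) U.transpose := by
    ext i; rw [Matrix.single_vecMul, hg]; rfl
  have hUT : IsUnit U.transpose.det := by rwa [Matrix.det_transpose]
  obtain ⟨y, hy⟩ : ∃ y, y = U.transpose.mulVec x := ⟨_, rfl⟩
  have hgy : g * y 0 = a * (p : ℤ) ^ m := by
    rw [← hwx, hwU, ← dotProduct_mulVec, ← hy, single_dotProduct]
  obtain ⟨t, ht⟩ : ∃ t, t = min m (padicValInt p g) := ⟨_, rfl⟩
  have htm : t ≤ m := by omega
  have htg : (p : ℤ) ^ t ∣ g := (padicValInt_dvd_iff t g).2 (Or.inr (by omega))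
  have hpt : Prime (p : ℤ) := Nat.prime_iff_prime_int.1 hp
  have hy0 : (p : ℤ) ^ (m - t) ∣ y 0 := by
    by_cases hmt : t = m
    · simp [hmt]
    · obtain ⟨g', hg'⟩ := htg
      have h1 : ¬ (p : ℤ) ∣ g' := by
        intro ⟨c, hc⟩
        have : (p : ℤ) ^ (t + 1) ∣ g := ⟨c, by rw [hg', hc]; ring⟩
        rcases (padicValInt_dvd_iff _ g).1 this with h | h
        · exact hg0 h
        · omega
      have h2 : (p : ℤ) ^ (m - t) ∣ g' * y 0 := by
        refine ⟨a, ?_⟩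
        have h3 : (p : ℤ) ^ m = (p : ℤ) ^ t * (p : ℤ) ^ (m - t) := by rw [← pow_add]; congr 1; omega
        apply mul_left_cancel₀ (pow_ne_zero t hpt.ne_zero)
        rw [← mul_assoc, ← hg', hgy, h3]; ring
      exact hpt.pow_dvd_of_dvd_mul_left _ h1 h2
  obtain ⟨y', hy'⟩ := hy0
  obtain ⟨d, hd⟩ : ∃ d : Fin (r + 1) → ℤ, d = update (fun _ => 1) 0 ((p : ℤ) ^ (m - t)) := ⟨_, rfl⟩
  refine ⟨U.transpose⁻¹ * diagonal d, update y 0 y', t, htm, ?_, ?_, ?_, ?_, ?_⟩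
  · rw [det_mul, Matrix.det_diagonal, Matrix.det_nonsing_inv, abs_mul]
    have h1 : |Ring.inverse U.transpose.det| = 1 := by
      obtain ⟨u, hu⟩ := hUT
      rw [← hu, Ring.inverse_unit]
      exact Int.isUnit_iff_abs_eq.1 u⁻¹.isUnit
    have h2 : ∏ i, d i = (p : ℤ) ^ (m - t) := by
      rw [hd, prod_update_of_mem (mem_univ 0)]; simp
    rw [h1, h2, one_mul, abs_of_nonneg (by positivity)]
  · rw [← mulVec_mulVec]
    have h1 : (diagonal d).mulVec (update y 0 y') = y := by
      ext i
      rw [mulVec_diagonal, hd]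
      by_cases hi : i = 0
      · subst hi; simp [hy']
      · simp [hi]
    rw [h1, hy, mulVec_mulVec, nonsing_inv_mul _ hUT, one_mulVec]
  · intro l
    rw [hwU, vecMul_vecMul, ← mul_assoc, mul_nonsing_inv _ hUT, one_mul, Matrix.vecMul_diagonal]
    by_cases hl : l = 0
    · subst hl
      rw [Pi.single_eq_same, hd, Function.update_self]
      obtain ⟨g', hg'⟩ := htg
      refine ⟨g', ?_⟩
      have h3 : (p : ℤ) ^ m = (p : ℤ) ^ t * (p : ℤ) ^ (m - t) := by rw [← pow_add]; congr 1; omega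
      rw [hg', h3]; ring
    · simp [hl]
  · intro l
    rw [hg]; exact htg.mul_right _
  · by_cases hmt : t = m
    · exact Or.inl hmt
    · right
      by_contra hcon
      push Not at hcon
      have h1 : vecMul w U.transpose⁻¹ 0 = g := by
        rw [hwU, vecMul_vecMul, mul_nonsing_inv _ hUT, vecMul_one, Pi.single_eq_same]
      have h2 : (p : ℤ) ^ (t + 1) ∣ g := by
        rw [← h1]
        show _ ∣ ∑ i, w i * U.transpose⁻¹ i 0
        exact dvd_sum fun i _ => (hcon i).mul_right _
      rcases (padicValInt_dvd_iff _ g).1 h2 with h | h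
      · exact hg0 h
      · omega

variable {K : Type*} [Field K] {r : ℕ}

lemma na_sum_le (v : AbsoluteValue K ℝ) (hv : IsNonarchimedean v) {ι : Type*} (s : Finset ι) (f : ι → K) (B : ℝ) (hB : 0 ≤ B) (h : ∀ i ∈ s, v (f i) ≤ B) :
    v (∑ i ∈ s, f i) ≤ B := by
  classical
  induction s using Finset.induction_on with
  | empty => simpa using hB
  | insert j s hj ih =>
    rw [sum_insert hj]
    exact (hv _ _).trans (max_le (h _ (mem_insert_self _ _)) (ih fun i hi => h i (mem_insert_of_mem hi)))

lemma na_int (v : AbsoluteValue K ℝ) (hv : IsNonarchimedean v) (z : ℤ) : v (z : K) ≤ 1 := by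
  have hn : ∀ n : ℕ, v (n : K) ≤ 1 := by
    intro n
    induction n with
    | zero => simp
    | succ n ih => push_cast; exact (hv _ _).trans (max_le ih (by simp))
  obtain ⟨n, rfl | rfl⟩ := z.eq_nat_or_neg
  · simpa using hn n
  · simpa using hn n

lemma row_est (v : AbsoluteValue K ℝ) (B Ψ : Sq r K) (hΨ : Ψ.det ≠ 0) (α : Fin r → K) (hα : ∀ i, α i ≠ 0) (k : ℕ)
    (h : ∀ i, vecMul (Ψ i) ((B - α i • (1 : Sq r K)) ^ k) = 0) (e : Fin r → K)
    (L : ℝ) (hL : ∀ i, log (v (α i)) ≤ L) (ε : ℝ) (hε : 0 < ε) :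
    ∀ᶠ n : ℕ in atTop, ∀ l, v (vecMul e (B ^ n) l) ≤ exp (n * (L + ε)) := by
  obtain ⟨c, hc⟩ : ∃ c : Fin r → K, c = vecMul e Ψ⁻¹ := ⟨_, rfl⟩
  have hce : e = vecMul c Ψ := by
    rw [hc, vecMul_vecMul, nonsing_inv_mul _ (isUnit_iff_ne_zero.2 hΨ), vecMul_one]
  have h1 : ∀ᶠ n : ℕ in atTop, ∀ i l, v (vecMul (Ψ i) (B ^ n) l) ≤ exp (n * (log (v (α i)) + ε / 2)) := by
    rw [eventually_all]
    intro i
    exact est' v _ _ _ (hα i) k (h i) (ε / 2) (by linarith)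
  filter_upwards [h1, poly_exp (∑ i, v (c i)) 0 (ε / 2) (by linarith)] with n hn hn2 l
  have h2 : vecMul e (B ^ n) l = ∑ i, c i * vecMul (Ψ i) (B ^ n) l := by
    rw [hce, vecMul_vecMul]; rfl
  rw [h2]
  calc _ ≤ ∑ i, v (c i * vecMul (Ψ i) (B ^ n) l) := abv_sum_le _ _ _
    _ ≤ ∑ i, v (c i) * exp (n * (L + ε / 2)) := by
        refine sum_le_sum fun i _ => ?_
        rw [map_mul]
        refine mul_le_mul_of_nonneg_left ((hn i l).trans ?_) (v.nonneg _)
        gcongr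
        exact hL i
    _ ≤ exp (n * (ε / 2)) * exp (n * (L + ε / 2)) := by
        rw [← sum_mul]
        gcongr
        simpa using hn2
    _ = _ := by rw [← exp_add]; congr 1; ring

end A6

section A7

lemma padic_ge (p : ℕ) (hp : p.Prime) (t : ℕ) (z : ℤ) (h : ¬ (p : ℤ) ^ (t + 1) ∣ z) :
    exp (-(t * log p)) ≤ ((padicNorm p z : ℚ) : ℝ) := by
  haveI : Fact p.Prime := ⟨hp⟩
  have hz : z ≠ 0 := by rintro rfl; simp at h
  have h1 : padicValInt p z ≤ t := by
    by_contra h2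
    exact h ((padicValInt_dvd_iff _ _).2 (Or.inr (by omega)))
  have hp1 : (1 : ℝ) ≤ p := by exact_mod_cast hp.one_lt.le
  rw [padicNorm.eq_zpow_of_nonzero (by exact_mod_cast hz), padicValRat.of_int, zpow_neg, zpow_natCast, exp_neg, exp_nat_mul, exp_log (by linarith)]
  push_cast
  gcongr

lemma padic_le (p : ℕ) (hp : p.Prime) (t : ℕ) (z : ℤ) (h : (p : ℤ) ^ t ∣ z) :
    ((padicNorm p z : ℚ) : ℝ) ≤ exp (-(t * log p)) := by
  haveI : Fact p.Prime := ⟨hp⟩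
  have hp1 : (1 : ℝ) ≤ p := by exact_mod_cast hp.one_lt.le
  have h1 := (padicNorm.dvd_iff_norm_le (p := p) (n := t) (z := z)).1 (by exact_mod_cast h)
  have h2 : ((padicNorm p z : ℚ) : ℝ) ≤ (((p : ℚ) ^ (-(t : ℤ)) : ℚ) : ℝ) := by exact_mod_cast h1
  refine h2.trans_eq ?_
  rw [exp_neg, exp_nat_mul, exp_log (by linarith), zpow_neg, zpow_natCast]
  push_cast; rfl

variable {K : Type*} [Field K] [NumberField K] {r : ℕ}

lemma core_seq (A : Sq r ℤ) (hA : A.det ≠ 0) (e x : Fin r → ℤ)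
    (σ : K →+* ℂ) (Re Im : K → K) (hRe : ∀ x, σ (Re x) = ((σ x).re : ℂ)) (hIm : ∀ x, σ (Im x) = ((σ x).im : ℂ))
    (Ψ : Sq r K) (α : Fin r → K) (k : ℕ) (hΨ : Ψ.det ≠ 0)
    (h : ∀ i, vecMul (Ψ i) ((A.map (Int.cast : ℤ → K) - α i • (1 : Sq r K)) ^ k) = 0)
    (hα : ∀ i, α i ≠ 0)
    {V : Type*} [Fintype V] [DecidableEq V] (v : V → AbsoluteValue K ℝ) (hna : ∀ i, IsNonarchimedean (v i))
    (hv : ∀ z : ℤ, z ≠ 0 → 1 ≤ nav σ (z : K) * ∏ i, v i (z : K)) (hprod : nav σ (A.det : K) * ∏ i, v i (A.det : K) = 1)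
    (p : ℕ) (hp : p.Prime) (P : V) (hP : ∀ z : ℤ, v P (z : K) = ((padicNorm p z : ℚ) : ℝ))
    (ip iw : Fin r) (hip : ∀ i, v P (α i) ≤ v P (α ip)) (hiw : ∀ i, nav σ (α i) ≤ nav σ (α iw))
    (hdp : (Ψ.updateRow ip (fun l => (e l : K))).det ≠ 0) (hdw : (Ψ.updateRow iw (fun l => (e l : K))).det ≠ 0)
    (g : Fin r → K) (hg : (A.map (Int.cast : ℤ → K)).mulVec g = α ip • g) (heg : (fun l => (e l : K)) ⬝ᵥ g ≠ 0)
    (hgr : 1 < nav σ (α iw) * v P (α ip)) (a : ℤ) (ha : a ≠ 0) (n m : ℕ → ℕ) (hn0 : ∀ j, 0 < n j) (hn : Tendsto n atTop atTop)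
    (hnm : ∀ j, e ⬝ᵥ (A ^ n j).mulVec x = a * (p : ℤ) ^ m j) (μ : ℝ) (hμ : Tendsto (fun j => (m j : ℝ) / n j) atTop (𝓝 μ)) :
    ∃ ψ : Fin r → ℤ, ψ ≠ 0 ∧ ∃ᶠ j in atTop, ψ ⬝ᵥ (A ^ n j).mulVec x = 0 := by
  classical
  obtain ⟨B, hB⟩ : ∃ B : Sq r K, B = A.map (Int.cast : ℤ → K) := ⟨_, rfl⟩
  obtain ⟨E, hE⟩ : ∃ E : Fin r → K, E = (fun l => (e l : K)) := ⟨_, rfl⟩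
  rw [← hB] at hg
  simp only [← hB] at h
  rw [← hE] at hdp hdw heg
  have hrow : ∀ n l, vecMul E (B ^ n) l = ((vecMul e (A ^ n) l : ℤ) : K) := by
    intro n l; rw [hE, hB]; exact cast_row A e n l
  have hBdet : B.det = (A.det : K) := by
    have := map_det (castRingHom K) A
    rw [hB]; simpa using this.symm
  have hBpow : ∀ n, (A ^ n).map (Int.cast : ℤ → K) = B ^ n := by
    intro n
    have := (map_pow (mapMatrix (castRingHom K) : Sq r ℤ →+* _) A n)
    rw [hB]; simpa using this
  have hp1 : (1 : ℝ) < p := by exact_mod_cast hp.one_lt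
  obtain ⟨lp, hlp⟩ : ∃ lp, lp = log p := ⟨_, rfl⟩
  have hlp0 : 0 < lp := hlp ▸ log_pos hp1
  have hppow : ∀ t : ℕ, (p : ℝ) ^ t = exp (t * lp) := by
    intro t; rw [hlp, exp_nat_mul, exp_log (by linarith)]
  obtain ⟨κ, hκ⟩ : ∃ κ, κ = -log (v P (α ip)) := ⟨_, rfl⟩
  have hw0 : ∀ j, vecMul e (A ^ n j) ≠ 0 := by
    intro j h0
    have h1 := hnm j
    rw [dotProduct_mulVec, h0, zero_dotProduct] at h1
    have : (p : ℤ) ≠ 0 := by exact_mod_cast hp.ne_zero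
    exact mul_ne_zero ha (pow_ne_zero _ this) h1.symm
  have hlat := fun j => lattice p hp (vecMul e (A ^ n j)) x (hw0 j) a (m j) (by rw [← dotProduct_mulVec]; exact hnm j)
  choose D z t htm hDdet hDz hDdvd htdvd htor using hlat
  have hnR : Tendsto (fun j => (n j : ℝ)) atTop atTop := tendsto_natCast_atTop_atTop.comp hn
  -- t / n → κ / log p
  have hvp : ∀ i, 0 < v P (α i) := fun i => (v P).pos (hα i)
  have ht_low : ∀ ε : ℝ, 0 < ε → ∀ᶠ j in atTop, κ - ε < t j * lp / n j := by
    intro ε hε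
    have h1 := row_est (v P) B Ψ hΨ α hα k h E (-κ) (fun i => by
      rw [hκ, neg_neg]; exact log_le_log (hvp i) (hip i)) (ε / 4) (by linarith)
    have hva : 0 < v P (a : K) := (v P).pos (by exact_mod_cast ha)
    have h2 := poly_exp ((v P (a : K))⁻¹) 0 (ε / 4) (by linarith)
    filter_upwards [hn.eventually h1, hn.eventually h2, hn.eventually (poly_exp 1 0 (ε / 4) (by linarith))] with j h1 h2 h3
    have hnj : (0 : ℝ) < n j := by exact_mod_cast hn0 j
    simp only [hrow] at h1
    have key : exp (-(t j * lp)) ≤ exp (n j * (-κ + ε / 4 + ε / 4)) := by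
      rcases htor j with htm' | ⟨l, hl⟩
      · have h4 : v P ((a * (p : ℤ) ^ m j : ℤ) : K) ≤ exp (n j * (-κ + ε / 4)) := by
          rw [← hnm j, dotProduct_mulVec]
          simp only [dotProduct, Int.cast_sum]
          refine na_sum_le _ (hna P) _ _ _ (exp_pos _).le fun l _ => ?_
          push_cast
          rw [map_mul]
          refine (mul_le_of_le_one_right ((v P).nonneg _) (na_int _ (hna P) _)).trans (h1 l)
        have h5 : v P ((p : K) ^ m j) = exp (-(m j * lp)) := by
          have h6 := hP ((p : ℤ))
          rw [map_pow]
          haveI : Fact p.Prime := ⟨hp⟩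
          push_cast at h6
          rw [h6, exp_neg, ← hppow]
          simp
        push_cast at h4
        rw [map_mul, h5, ← htm'] at h4
        calc _ = (v P (a : K))⁻¹ * (v P (a : K) * exp (-(t j * lp))) := by field_simp
          _ ≤ exp (n j * (ε / 4)) * exp (n j * (-κ + ε / 4)) := by
              gcongr
              simpa using h2
          _ = _ := by rw [← exp_add]; congr 1; ring
      · have h4 := (padic_ge p hp (t j) _ hl).trans ((hP _).symm.le.trans (h1 l))
        rw [← hlp] at h4
        refine h4.trans (exp_le_exp.2 ?_)
        nlinarith
    rw [exp_le_exp] at key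
    rw [lt_div_iff₀ hnj]
    nlinarith
  have ht_up : ∀ ε : ℝ, 0 < ε → ∀ᶠ j in atTop, t j * lp / n j < κ + ε := by
    intro ε hε
    have hveg : 0 < v P (E ⬝ᵥ g) := (v P).pos heg
    have h2 := poly_exp ((∑ l, v P (g l)) / v P (E ⬝ᵥ g)) 0 (ε / 2) (by linarith)
    filter_upwards [hn.eventually h2] with j h2
    have hnj : (0 : ℝ) < n j := by exact_mod_cast hn0 j
    have h3 : vecMul E (B ^ n j) ⬝ᵥ g = α ip ^ n j * (E ⬝ᵥ g) := by
      rw [← dotProduct_mulVec, eig_pow _ _ _ hg, dotProduct_smul, smul_eq_mul]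
    have h4 : v P (α ip) ^ n j * v P (E ⬝ᵥ g) ≤ exp (-(t j * lp)) * ∑ l, v P (g l) := by
      rw [← map_pow, ← map_mul, ← h3, mul_sum]
      refine (abv_sum_le _ _ _).trans (sum_le_sum fun l _ => ?_)
      rw [map_mul, hrow, hP, hlp]
      exact mul_le_mul_of_nonneg_right (padic_le p hp _ _ (htdvd j l)) ((v P).nonneg _)
    have h5 : v P (α ip) ^ n j = exp (n j * (-κ)) := by
      rw [hκ, neg_neg, exp_nat_mul, exp_log (hvp ip)]
    rw [h5] at h4
    have h6 : exp (n j * (-κ)) ≤ exp (-(t j * lp)) * exp (n j * (ε / 2)) := by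
      calc _ ≤ exp (-(t j * lp)) * ((∑ l, v P (g l)) / v P (E ⬝ᵥ g)) := by
            rw [mul_div_assoc', le_div_iff₀ hveg]; exact h4
        _ ≤ _ := by
            gcongr
            simpa using h2
    rw [← exp_add, exp_le_exp] at h6
    rw [div_lt_iff₀ hnj]
    nlinarith
  have ht : Tendsto (fun j => t j * lp / (n j : ℝ)) atTop (𝓝 κ) := by
    rw [tendsto_order]
    exact ⟨fun b hb => (ht_low (κ - b) (by linarith)).mono fun j hj => by linarith,
      fun b hb => (ht_up (b - κ) (by linarith)).mono fun j hj => by linarith⟩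
  obtain ⟨Δ, hΔ⟩ : ∃ Δ, Δ = log |(A.det : ℝ)| + (μ * lp - κ) := ⟨_, rfl⟩
  have hAdetR : (A.det : ℝ) ≠ 0 := by exact_mod_cast hA
  have hv0det : nav σ (A.det : K) = |(A.det : ℝ)| := by
    rw [nav_apply, map_intCast, Complex.norm_intCast]
  have hdetv : ∀ i, ∑ t, log (v i (α t)) ≤ log (v i (A.det : K)) := by
    intro i; rw [← hBdet]; exact detineq (v i) B (by rw [hBdet]; exact_mod_cast hA) Ψ hΨ α hα k h
  have hdet0 : ∑ t, log (nav σ (α t)) ≤ log |(A.det : ℝ)| := by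
    rw [← hv0det, ← hBdet]; exact detineq (nav σ) B (by rw [hBdet]; exact_mod_cast hA) Ψ hΨ α hα k h
  have hsum0 : log |(A.det : ℝ)| + ∑ i, log (v i (A.det : K)) = 0 := by
    have hA' : (A.det : K) ≠ 0 := by exact_mod_cast hA
    have h1 := congrArg log hprod
    rw [log_mul ((nav σ).pos hA').ne' (prod_ne_zero_iff.2 fun i _ => ((v i).pos hA').ne'), Real.log_prod (fun i _ => ((v i).pos hA').ne'), Real.log_one, hv0det] at h1
    exact h1
  obtain ⟨L0, R, hL0, hR, hRL, hRM⟩ := realrows σ Re Im hRe hIm (Ψ.updateRow iw E) hdw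
  obtain ⟨W, hW⟩ : ∃ W : V → Fin r → ℝ, W = fun i t => log (v i (α t)) + if i = P then (if t = ip then κ - μ * lp else 0) else 0 := ⟨_, rfl⟩
  obtain ⟨w, hw⟩ : ∃ w : Fin r → ℝ, w = fun t => log (nav σ (α t)) + if t = iw then μ * lp - log (nav σ (α iw)) else 0 := ⟨_, rfl⟩
  have hLdet : ∀ i : V, (if i = P then Ψ.updateRow ip E else Ψ).det ≠ 0 := by
    intro i; split_ifs
    · exact hdp
    · exact hΨ
  have hdotrow : ∀ (M : Sq r K) (s : Fin r) (n : ℕ) (D' : Sq r ℤ) (l : Fin r),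
      (M * (A ^ n * D').map (Int.cast : ℤ → K)) s l = ∑ q, vecMul (M s) (B ^ n) q * (D' q l : K) := by
    intro M s n D' l
    have h1 : (A ^ n * D').map (Int.cast : ℤ → K) = B ^ n * D'.map (Int.cast : ℤ → K) := by
      rw [← hBpow]
      exact Matrix.map_mul (f := castRingHom K)
    rw [h1, ← Matrix.mul_assoc]
    rfl
  have hmain := thmS (nav σ) v hna hv L0 hL0 R hR hRL (fun i => if i = P then Ψ.updateRow ip E else Ψ) hLdet
    (fun j => exp (n j)) (fun j => Real.one_lt_exp_iff.2 (by exact_mod_cast hn0 j)) (Real.tendsto_exp_atTop.comp hnR)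
    (fun j => A ^ n j * D j) (fun j => by
      rw [det_mul, det_pow]
      refine mul_ne_zero (pow_ne_zero _ hA) ?_
      have : (p : ℤ) ≠ 0 := by exact_mod_cast hp.ne_zero
      rw [← abs_ne_zero, hDdet j]
      exact pow_ne_zero _ this) Δ ?_ w W ?_ ?_ z ?_ ?_
  · obtain ⟨ψ, hψ0, hψ⟩ := hmain
    refine ⟨ψ, hψ0, hψ.mono fun j hj => ?_⟩
    rw [← mulVec_mulVec, hDz] at hj
    exact hj
  · have h1 : Tendsto (fun j => log |(A.det : ℝ)| + ((m j : ℝ) / n j * lp - t j * lp / n j)) atTop (𝓝 Δ) := by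
      rw [hΔ]
      exact ((hμ.mul_const lp).sub ht).const_add _
    refine h1.congr fun j => ?_
    have hnj : (0 : ℝ) < n j := by exact_mod_cast hn0 j
    have h2 : |((A ^ n j * D j).det : ℝ)| = |(A.det : ℝ)| ^ n j * exp (((m j - t j : ℕ) : ℝ) * lp) := by
      rw [det_mul, det_pow]
      push_cast
      have h3 := congrArg (Int.cast : ℤ → ℝ) (hDdet j)
      push_cast at h3
      rw [abs_mul, abs_pow, h3, hppow]
    rw [h2, log_exp, log_mul (pow_ne_zero _ (abs_ne_zero.2 hAdetR)) (Real.exp_ne_zero _), log_pow, log_exp, Nat.cast_sub (htm j)]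
    field_simp
  · have h1 : ∑ i, ∑ t, W i t = ∑ i, ∑ t, log (v i (α t)) + (κ - μ * lp) := by
      rw [hW]
      simp only [sum_add_distrib]
      congr 1
      rw [sum_eq_single P (fun b _ hb => by simp [hb]) (by simp)]
      simp
    have h2 := sum_le_sum (s := univ) (fun i _ => hdetv i)
    rw [h1, hΔ]
    linarith
  · have h1 : ∑ t, w t = ∑ t, log (nav σ (α t)) + (μ * lp - log (nav σ (α iw))) := by
      rw [hw]
      simp only [sum_add_distrib]
      congr 1
      simp
    have h2 : κ < log (nav σ (α iw)) := by
      have h3 := log_pos hgr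
      rw [log_mul ((nav σ).pos (hα iw)).ne' (hvp ip).ne'] at h3
      rw [hκ]; linarith
    rw [h1, hΔ]
    linarith
  · intro ε hε
    have h1 : ∀ᶠ n : ℕ in atTop, ∀ i t l, v i (vecMul (Ψ t) (B ^ n) l) ≤ exp (n * (log (v i (α t)) + ε)) := by
      rw [eventually_all]; intro i
      rw [eventually_all]; intro t
      exact est' (v i) _ _ _ (hα t) k (h t) ε hε
    have h2 : ∀ᶠ j in atTop, μ - ε / lp < (m j : ℝ) / n j := hμ.eventually (lt_mem_nhds (by have := div_pos hε hlp0; linarith))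
    filter_upwards [hn.eventually h1, h2] with j h1 h2 i s l
    have hnj : (0 : ℝ) < n j := by exact_mod_cast hn0 j
    rw [hdotrow, exp_rpow]
    have hgen : vecMul (Ψ s) (B ^ n j) = vecMul (Ψ s) (B ^ n j) → v i (∑ q, vecMul (Ψ s) (B ^ n j) q * (D j q l : K)) ≤ exp (n j * (log (v i (α s)) + ε)) := by
      intro _
      refine na_sum_le _ (hna i) _ _ _ (exp_pos _).le fun q _ => ?_
      rw [map_mul]
      exact (mul_le_of_le_one_right ((v i).nonneg _) (na_int _ (hna i) _)).trans (h1 i s q)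
    by_cases hi : i = P
    · by_cases hs : s = ip
      · subst hi hs
        simp only [if_true, updateRow_self, hW]
        have h3 : ∑ q, vecMul E (B ^ n j) q * (D j q l : K) = ((vecMul (vecMul e (A ^ n j)) (D j) l : ℤ) : K) := by
          simp only [hrow]
          show _ = ((∑ q, vecMul e (A ^ n j) q * D j q l : ℤ) : K)
          push_cast; rfl
        rw [h3, hP]
        refine (padic_le p hp _ _ (hDdvd j l)).trans (exp_le_exp.2 ?_)
        rw [← hlp, hκ]
        rw [lt_div_iff₀ hnj] at h2
        have h4 : (μ - ε / lp) * n j * lp = n j * (μ * lp - ε) := by field_simp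
        nlinarith
      · subst hi
        simp only [if_true, updateRow_ne hs, hW, if_neg hs, add_zero]
        exact hgen rfl
    · simp only [hW, if_neg hi, add_zero]
      exact hgen rfl
  · intro ε hε
    have h1 : ∀ᶠ n : ℕ in atTop, ∀ t l, nav σ (vecMul (Ψ t) (B ^ n) l) ≤ exp (n * (log (nav σ (α t)) + ε / 2)) := by
      rw [eventually_all]; intro t
      exact est' (nav σ) _ _ _ (hα t) k (h t) (ε / 2) (by linarith)
    have h2 : ∀ᶠ j in atTop, (m j : ℝ) / n j < μ + ε / 2 / lp := hμ.eventually (gt_mem_nhds (by have := div_pos (half_pos hε) hlp0; linarith))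
    filter_upwards [hn.eventually h1, h2, hn.eventually (poly_exp (∑ l, |(x l : ℝ)|) 0 (ε / 2) (by linarith)),
      hn.eventually (poly_exp (|(a : ℝ)|) 0 (ε / 2) (by linarith))] with j h1 h2 h3 h4 s
    have hnj : (0 : ℝ) < n j := by exact_mod_cast hn0 j
    rw [exp_rpow]
    refine (hRM _ _).trans ?_
    rw [← mulVec_mulVec, hDz]
    have h5 : ∀ M : Sq r K, M.mulVec (fun l => (((A ^ n j).mulVec x l : ℤ) : K)) s = ∑ l, vecMul (M s) (B ^ n j) l * (x l : K) := by
      intro M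
      rw [cast_mulVec, hBpow]
      rfl
    by_cases hs : s = iw
    · subst hs
      rw [h5, updateRow_self]
      have h6 : ∑ l, vecMul E (B ^ n j) l * (x l : K) = ((a * (p : ℤ) ^ m j : ℤ) : K) := by
        rw [← hnm j, dotProduct_mulVec]
        simp only [hrow, dotProduct]
        push_cast; rfl
      rw [h6, nav_apply, map_intCast, Complex.norm_intCast, hw]
      push_cast
      rw [abs_mul, abs_of_nonneg (by positivity : (0 : ℝ) ≤ (p : ℝ) ^ m j), hppow]
      simp only [if_true]
      calc _ ≤ exp (n j * (ε / 2)) * exp (m j * lp) := by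
            gcongr
            simpa using h4
        _ ≤ _ := by
            rw [← exp_add, exp_le_exp]
            rw [div_lt_iff₀ hnj] at h2
            have h7 : (μ + ε / 2 / lp) * n j * lp = n j * (μ * lp + ε / 2) := by field_simp
            nlinarith
    · rw [h5, updateRow_ne hs]
      simp only [hw, if_neg hs, add_zero]
      calc _ ≤ ∑ l, exp (n j * (log (nav σ (α s)) + ε / 2)) * |(x l : ℝ)| := by
            refine (abv_sum_le _ _ _).trans (sum_le_sum fun l _ => ?_)
            rw [map_mul]
            exact mul_le_mul (h1 s l) (abv_int_le _ _) ((nav σ).nonneg _) (exp_pos _).le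
        _ ≤ exp (n j * (log (nav σ (α s)) + ε / 2)) * exp (n j * (ε / 2)) := by
            rw [← mul_sum]
            gcongr
            simpa using h3
        _ = _ := by rw [← exp_add]; congr 1; ring

end A7

section A8
variable {K : Type*} [Field K] [NumberField K] {r : ℕ}

lemma eig_le (v : AbsoluteValue K ℝ) (hv : IsNonarchimedean v) (A : Sq r ℤ) (θ : K) (g : Fin r → K)
    (hg0 : g ≠ 0) (hg : (A.map (Int.cast : ℤ → K)).mulVec g = θ • g) : v θ ≤ 1 := by
  obtain ⟨l0, hl0⟩ := ne_iff.1 hg0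
  haveI : Nonempty (Fin r) := ⟨l0⟩
  obtain ⟨l, hl⟩ := Finite.exists_max fun l => v (g l)
  have h0 : 0 < v (g l) := lt_of_lt_of_le (v.pos hl0) (hl l0)
  have h1 := congrArg v (congrFun hg l)
  rw [Pi.smul_apply, smul_eq_mul, map_mul] at h1
  have h2 : v ((A.map (Int.cast : ℤ → K)).mulVec g l) ≤ v (g l) := by
    refine na_sum_le v hv (univ : Finset (Fin r)) _ _ h0.le fun i _ => ?_
    rw [map_mul]
    change v ((A l i : ℤ) : K) * v (g i) ≤ v (g l)
    calc _ ≤ 1 * v (g i) := by gcongr; exact na_int v hv _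
      _ ≤ _ := by rw [one_mul]; exact hl i
  rw [h1] at h2
  nlinarith

theorem core (A : Sq r ℤ) (hA : A.det ≠ 0) (e x : Fin r → ℤ)
    (hx : ∀ N, 1 ≤ N → ∀ (a : ℕ) (b : Fin r → ℤ), (∀ n, b ⬝ᵥ (A ^ (a + N * n)).mulVec x = 0) → b = 0)
    (he : ∀ N, 1 ≤ N → ∀ (a : ℕ) (y : Fin r → ℤ), (∀ n, e ⬝ᵥ (A ^ (a + N * n)).mulVec y = 0) → y = 0)
    (σ : K →+* ℂ) (Re Im : K → K) (hRe : ∀ x, σ (Re x) = ((σ x).re : ℂ)) (hIm : ∀ x, σ (Im x) = ((σ x).im : ℂ))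
    (Ψ : Sq r K) (α : Fin r → K) (k : ℕ) (hΨ : Ψ.det ≠ 0)
    (h : ∀ i, vecMul (Ψ i) ((A.map (Int.cast : ℤ → K) - α i • (1 : Sq r K)) ^ k) = 0)
    (i1 j1 : Fin r) (hij : α i1 ≠ α j1) (p : ℕ) (hp : p.Prime) (a : ℤ) (ha : a ≠ 0) :
    {n : ℕ | ∃ m : ℕ, e ⬝ᵥ (A ^ n).mulVec x = a * (p : ℤ) ^ m}.Finite := by
  classical
  haveI : Nonempty (Fin r) := ⟨i1⟩
  have hg : ∀ i, ∃ g : Fin r → K, g ≠ 0 ∧ (A.map (Int.cast : ℤ → K)).mulVec g = α i • g := fun i =>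
    exists_eig _ _ (Ψ i) (fun h0 => hΨ (det_eq_zero_of_row_eq_zero i (fun l => congrFun h0 l))) k (h i)
  choose g hg0 hg using hg
  have hBdet : (A.map (Int.cast : ℤ → K)).det = (A.det : K) := by
    simpa using (map_det (castRingHom K) A).symm
  have hα : ∀ i, α i ≠ 0 := by
    intro i h0
    apply hg0 i
    refine Matrix.eq_zero_of_mulVec_eq_zero (M := A.map (Int.cast : ℤ → K)) (by rw [hBdet]; exact_mod_cast hA) ?_
    rw [hg, h0, zero_smul]
  have heg : ∀ i, (fun l => (e l : K)) ⬝ᵥ g i ≠ 0 := by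
    intro i h0
    apply hg0 i
    refine stabK A e 1 0 (he 1 le_rfl 0) (g i) fun n => ?_
    rw [eig_pow _ _ _ (hg i), dotProduct_smul, h0, smul_zero]
  obtain ⟨S, hS⟩ : ∃ S, S = (p * A.det.natAbs).primeFactors := ⟨_, rfl⟩
  have hSp : ∀ q ∈ S, q.Prime := fun q hq => Nat.prime_of_mem_primeFactors (hS ▸ hq)
  have hne : p * A.det.natAbs ≠ 0 := mul_ne_zero hp.ne_zero (by simpa using hA)
  have hpS : p ∈ S := by rw [hS]; exact Nat.mem_primeFactors.2 ⟨hp, dvd_mul_right _ _, hne⟩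
  have hdS : A.det.natAbs.primeFactors ⊆ S := by
    rw [hS]; exact Nat.primeFactors_mono (dvd_mul_left _ _) hne
  choose v hna hvz F τ hτ using fun q : {q // q ∈ S} => exists_place (K := K) q.1 (hSp _ q.2)
  have hpr : ∀ z : ℤ, nav σ (z : K) * ∏ i, v i (z : K) = |(z : ℝ)| * ∏ q ∈ S, ((padicNorm q z : ℚ) : ℝ) := by
    intro z
    rw [nav_apply, map_intCast, ← prod_coe_sort S]
    congr 1
    · simp
    · exact prod_congr rfl fun q _ => hvz q z
  obtain ⟨P, hP⟩ : ∃ P : {q // q ∈ S}, P = ⟨p, hpS⟩ := ⟨_, rfl⟩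
  obtain ⟨ip0, hip0⟩ := Finite.exists_max fun i => v P (α i)
  obtain ⟨iw0, hiw0⟩ := Finite.exists_max fun i => nav σ (α i)
  obtain ⟨ip, hip, hdp⟩ := pick _ Ψ hΨ α k h (g ip0) _ (hg ip0) _ (heg ip0)
  obtain ⟨iw, hiw, hdw⟩ := pick _ Ψ hΨ α k h (g iw0) _ (hg iw0) _ (heg iw0)
  rw [← hip] at hip0
  rw [← hiw] at hiw0
  have hgr : 1 < nav σ (α iw) * v P (α ip) := by
    by_contra hcon
    push Not at hcon
    have h0 : 0 < v P (α ip) := (v P).pos (hα _)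
    have h1 : v P (α ip) ≤ 1 := eig_le _ (hna P) A _ _ (hg0 ip) (hg ip)
    have h2 : nav σ (α iw) ≤ (v P (α ip))⁻¹ := by rw [← one_div, le_div_iff₀ h0]; exact hcon
    haveI := F P
    obtain ⟨N, hN, hN2⟩ := growth P.1 σ (τ P) A Ψ hΨ α k h hα (v P (α ip))⁻¹ ((one_le_inv₀ h0).2 h1)
      (fun i => (hiw0 i).trans h2) (fun i => by rw [inv_inv, ← hτ]; exact hip0 i) i1 j1
    exact pow_ne A e N (he N hN 0) _ _ hij (g i1) (g j1) (hg0 i1) (hg i1) (hg j1) (heg j1) hN2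
  by_contra hinf
  have hinf2 : ({n : ℕ | ∃ m : ℕ, e ⬝ᵥ (A ^ n).mulVec x = a * (p : ℤ) ^ m} \ {0}).Infinite :=
    Set.Infinite.diff hinf (Set.finite_singleton 0)
  obtain ⟨n, hn⟩ : ∃ n : ℕ → ℕ, n = Nat.nth (· ∈ ({n : ℕ | ∃ m : ℕ, e ⬝ᵥ (A ^ n).mulVec x = a * (p : ℤ) ^ m} \ {0})) := ⟨_, rfl⟩
  have hmono : StrictMono n := by rw [hn]; exact Nat.nth_strictMono hinf2
  have hmem : ∀ j, (∃ m : ℕ, e ⬝ᵥ (A ^ n j).mulVec x = a * (p : ℤ) ^ m) ∧ n j ≠ 0 := by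
    intro j
    rw [hn]
    exact Nat.nth_mem_of_infinite hinf2 j
  choose m hm using fun j => (hmem j).1
  have hn0 : ∀ j, 0 < n j := fun j => Nat.pos_of_ne_zero (hmem j).2
  have hp1 : (1 : ℝ) < p := by exact_mod_cast hp.one_lt
  obtain ⟨L, hL⟩ : ∃ L, L = log (nav σ (α iw)) := ⟨_, rfl⟩
  obtain ⟨X, hX⟩ : ∃ X : ℝ, X = 1 + ∑ l, |(x l : ℝ)| := ⟨_, rfl⟩
  have hX1 : 1 ≤ X := by rw [hX]; have := sum_nonneg (s := univ) fun l _ => abs_nonneg (x l : ℝ); linarith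
  have hbd : ∀ᶠ j in atTop, (m j : ℝ) / n j ∈ Metric.closedBall (0 : ℝ) ((L + 1 + log X) / log p) := by
    have h1 := row_est (nav σ) _ Ψ hΨ α hα k h (fun l => (e l : K)) L
      (fun i => hL ▸ log_le_log ((nav σ).pos (hα i)) (hiw0 i)) 1 one_pos
    filter_upwards [hmono.tendsto_atTop.eventually h1] with j hj
    have hnj : (1 : ℝ) ≤ n j := by exact_mod_cast hn0 j
    have h2 : (p : ℝ) ^ m j ≤ exp (n j * (L + 1)) * X := by
      have h3 : |((a * (p : ℤ) ^ m j : ℤ) : ℝ)| ≤ exp (n j * (L + 1)) * ∑ l, |(x l : ℝ)| := by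
        rw [← hm, dotProduct_mulVec, dotProduct]
        push_cast
        refine (abs_sum_le_sum_abs _ _).trans ?_
        rw [mul_sum]
        refine sum_le_sum fun l _ => ?_
        rw [abs_mul]
        gcongr
        have := hj l
        rw [cast_row, nav_apply, map_intCast] at this
        simpa using this
      have h4 : (1 : ℝ) ≤ |(a : ℝ)| := by exact_mod_cast one_le_abs ha
      push_cast at h3
      rw [abs_mul, abs_of_pos (a := (p : ℝ) ^ m j) (by positivity)] at h3
      have h5 : (0:ℝ) < (p : ℝ) ^ m j := by positivity
      have h6 := exp_pos (n j * (L + 1))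
      rw [hX]; nlinarith
    have h3 := log_le_log (by positivity) h2
    rw [log_pow, log_mul (exp_pos _).ne' (by linarith), log_exp] at h3
    have h4 := log_nonneg hX1
    have hlp := log_pos hp1
    rw [mem_closedBall_zero_iff, Real.norm_eq_abs, abs_of_nonneg (by positivity), div_le_div_iff₀ (by linarith) hlp]
    nlinarith
  obtain ⟨μ, -, φ, hφ, hμ⟩ := tendsto_subseq_of_frequently_bounded Metric.isBounded_closedBall hbd.frequently
  obtain ⟨ψ, hψ, hfr⟩ := core_seq A hA e x σ Re Im hRe hIm Ψ α k hΨ h hα v hna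
    (fun z hz => by rw [hpr]; exact (prodS S hSp z hz).1) (by rw [hpr]; exact (prodS S hSp _ hA).2 hdS)
    p hp P (by rw [hP]; exact hvz _) ip iw hip0 hiw0 hdp hdw (g ip) (hg ip) (heg ip) hgr a ha (n ∘ φ) (m ∘ φ)
    (fun j => hn0 _) (hmono.tendsto_atTop.comp hφ.tendsto_atTop) (fun j => hm _) μ hμ
  obtain ⟨N, hN, hsml⟩ := sml A hA
  obtain ⟨c, hc⟩ := freq_pigeon (fun j => (⟨n (φ j) % N, Nat.mod_lt _ hN⟩ : Fin N)) hfr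
  apply hψ
  refine hx N hN c.1 ψ (hsml ψ x c.1 ?_)
  rw [← Nat.frequently_atTop_iff_infinite, frequently_atTop]
  intro b
  have htend : Tendsto (n ∘ φ) atTop atTop := hmono.tendsto_atTop.comp hφ.tendsto_atTop
  obtain ⟨j, ⟨hj1, hj2⟩, hj3⟩ := (hc.and_eventually (htend.eventually_ge_atTop (N * b))).exists
  refine ⟨n (φ j) / N, (Nat.le_div_iff_mul_le hN).2 (by rw [mul_comm]; exact hj3), ?_⟩
  rw [show c.1 + N * (n (φ j) / N) = n (φ j) by rw [← hj2]; exact Nat.mod_add_div _ _]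
  exact hj1

end A8

lemma msprod {K : Type*} (s : Multiset K) (f : K → ℝ) (c : ℝ) (hc : 0 ≤ c) (h : ∀ r ∈ s, c ≤ f r) :
    c ^ s.card ≤ (s.map f).prod := by
  induction s using Multiset.induction_on with
  | empty => simp
  | cons a s ih =>
    rw [Multiset.card_cons, Multiset.map_cons, Multiset.prod_cons, pow_succ']
    exact mul_le_mul (h a (by simp)) (ih fun r hr => h r (by simp [hr])) (by positivity) (hc.trans (h a (by simp)))

lemma tworoots {K : Type*} [Field K] [NumberField K] (w v : AbsoluteValue K ℝ) (hw : ∀ z : ℤ, w (z : K) = |(z : ℝ)|)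
    (hwv : ∀ z : ℤ, z ≠ 0 → 1 ≤ w (z : K) * v (z : K)) (P : Polynomial K) (hs : P.Splits) (ρ1 ρ2 : K)
    (h1 : ρ1 ∈ P.roots) (h2 : ρ2 ∈ P.roots) (h12 : ρ1 ≠ ρ2) (C : ℝ) :
    {n : ℕ | w (P.eval (n : K)) * v (P.eval (n : K)) ≤ C}.Finite := by
  classical
  by_contra hinf
  have hP0 : P ≠ 0 := by rintro rfl; simp at h1
  have hlc : P.leadingCoeff ≠ 0 := by simpa using hP0
  have hmin : ∀ n : ℕ, ∃ ρ : {x // x ∈ P.roots.toFinset}, ∀ r ∈ P.roots, v (n - ρ) ≤ v ((n : K) - r) := by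
    intro n
    obtain ⟨ρ, hρ, hm⟩ := exists_min_image P.roots.toFinset (fun r => v ((n : K) - r)) ⟨ρ1, by simpa using h1⟩
    exact ⟨⟨ρ, hρ⟩, fun r hr => hm r (by simpa using hr)⟩
  choose f hf using hmin
  obtain ⟨⟨ρ, hρ'⟩, hfr⟩ := freq_pigeon f (Nat.frequently_atTop_iff_infinite.2 hinf)
  have hρ : ρ ∈ P.roots := by simpa using hρ'
  obtain ⟨ρ', hr', hne⟩ : ∃ ρ' ∈ P.roots, ρ' ≠ ρ := by
    by_cases h : ρ1 = ρ
    · exact ⟨ρ2, h2, fun h3 => h12 (h.trans h3.symm)⟩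
    · exact ⟨ρ1, h1, h⟩
  obtain ⟨t, ht⟩ := Multiset.exists_cons_of_mem hr'
  obtain ⟨E, hE⟩ : ∃ E, E = t.card := ⟨_, rfl⟩
  have hE1 : (1 : ℝ) ≤ E := by
    have : ρ ∈ t := by rw [ht] at hρ; exact (Multiset.mem_cons.1 hρ).resolve_left hne.symm
    rw [hE]; exact_mod_cast Multiset.card_pos_iff_exists_mem.2 ⟨ρ, this⟩
  have hev : ∀ (u : AbsoluteValue K ℝ) (n : ℕ), u (P.eval (n : K)) = u P.leadingCoeff * (P.roots.map fun r => u (n - r)).prod := by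
    intro u n
    conv_lhs => rw [hs.eq_prod_roots]
    rw [Polynomial.eval_mul, Polynomial.eval_C, map_mul, Polynomial.eval_multiset_prod, map_multiset_prod, Multiset.map_map, Multiset.map_map]
    simp
  obtain ⟨δ, hδ⟩ : ∃ δ, δ = v (ρ' - ρ) / 2 := ⟨_, rfl⟩
  have hδ0 : 0 < δ := by rw [hδ]; have := v.pos (sub_ne_zero.2 hne); positivity
  obtain ⟨κ, hκ⟩ : ∃ κ, κ = w P.leadingCoeff * v P.leadingCoeff * δ / 2 ^ (E + 1) := ⟨_, rfl⟩
  have hκ0 : 0 < κ := by have := v.pos hlc; have := w.pos hlc; rw [hκ]; positivity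
  have hbig : ∀ᶠ n : ℕ in atTop, ∀ r ∈ P.roots.toFinset, w r ≤ n / 2 := by
    rw [eventually_all_finset]
    exact fun r _ => ((tendsto_natCast_atTop_atTop (R := ℝ)).atTop_div_const two_pos).eventually_ge_atTop _
  have hsq : ∀ᶠ n : ℕ in atTop, C / κ ≤ (n : ℝ) ^ (1 / 2 : ℝ) :=
    ((tendsto_rpow_atTop one_half_pos).comp (tendsto_natCast_atTop_atTop (R := ℝ))).eventually_ge_atTop _
  obtain ⟨n, hn, hgood⟩ := extraction_of_frequently_atTop (hfr.and_eventually (hbig.and (hsq.and (eventually_ge_atTop 1))))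
  have key : ∀ j, v ((n j : K) - ρ) ≤ (n j : ℝ) ^ (-(1 + 1 / (2 * E) : ℝ)) := by
    intro j
    obtain ⟨⟨hS, hfj⟩, hb, hq, hn1⟩ := hgood j
    have hn0 : (0 : ℝ) < n j := by exact_mod_cast hn1
    have hmin := hf (n j)
    rw [hfj] at hmin
    simp only at hmin
    have hv0 := v.nonneg ((n j : K) - ρ)
    have hd : δ ≤ v ((n j : K) - ρ') := by
      have h3 := v.sub_le ρ' (n j : K) ρ
      rw [v.map_sub ρ' (n j)] at h3
      have := hmin ρ' hr'
      rw [hδ]; linarith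
    have hvP : v P.leadingCoeff * (δ * v ((n j : K) - ρ) ^ E) ≤ v (P.eval (n j : K)) := by
      rw [hev v, ht, Multiset.map_cons, Multiset.prod_cons]
      have := msprod t (fun r => v ((n j : K) - r)) _ hv0 fun r hr => hmin r (by rw [ht]; simp [hr])
      rw [← hE] at this
      gcongr
    have hwP : w P.leadingCoeff * ((n j : ℝ) / 2) ^ (E + 1) ≤ w (P.eval (n j : K)) := by
      rw [hev w]
      have := msprod P.roots (fun r => w ((n j : K) - r)) (n j / 2) (by positivity) fun r hr => by
        have h3 := w.le_sub (n j : K) r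
        have h4 := hw (n j : ℤ)
        simp only [Int.cast_natCast, Nat.abs_cast] at h4
        have := hb r (by simpa using hr)
        linarith
      rw [ht, Multiset.card_cons, ← hE, ← ht] at this
      gcongr
    have h5 : κ * (n j : ℝ) ^ (E + 1) * v ((n j : K) - ρ) ^ E ≤ C := by
      refine le_trans ?_ hS
      refine le_trans (le_of_eq ?_) (mul_le_mul hwP hvP (by positivity) (w.nonneg _))
      rw [hκ, div_pow]; ring
    rw [← pow_le_pow_iff_left₀ hv0 (by positivity) (n := E) (by rintro rfl; norm_num at hE1), ← Real.rpow_natCast (_ ^ _), ← Real.rpow_mul hn0.le,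
      show -(1 + 1 / (2 * E) : ℝ) * E = 1 / 2 - ((E + 1 : ℕ) : ℝ) by push_cast; field_simp; ring, Real.rpow_sub hn0, Real.rpow_natCast,
      le_div_iff₀ (by positivity)]
    refine le_trans ?_ hq
    rw [le_div_iff₀ hκ0]
    linarith
  have hn0 : ∀ j, (1 : ℝ) ≤ n j := fun j => by exact_mod_cast (hgood j).2.2.2
  obtain ⟨m, hm0, hm⟩ := thmP (n := Fin 2) (V := Bool) (fun i => if i then w else v) (fun z hz => by simpa using hwv z hz) 1
    (fun i => if i then 1 else !![1, 0; -ρ, 1]) (fun i => if i then 1 else !![1, 0; ρ, 1])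
    (by rintro (_ | _) <;> simp [Matrix.one_fin_two])
    (fun i => if i then ![0, 1] else ![0, -(1 + 1 / (2 * E))]) (by simp; exact_mod_cast hE1) 0 (fun j => n j)
    ((tendsto_natCast_atTop_atTop (R := ℝ)).comp hn.tendsto_atTop) (fun j => !![1, 0; (n j : ℤ), 1]) (by simp) (by
      rintro j (_ | _) t l hl
      · obtain rfl : l = 0 := by omega
        fin_cases t
        · simp [Matrix.mul_apply]
        · have := key j
          simpa [Matrix.mul_apply, neg_add_eq_sub] using this
      · obtain rfl : l = 0 := by omega
        have := hw (n j : ℤ)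
        simp at this
        fin_cases t <;> simp [Matrix.mul_apply, Matrix.one_apply, this])
    (by rintro j (_ | _) t <;> fin_cases t <;> simp [Matrix.mul_apply, Matrix.one_apply])
  obtain ⟨φ, hφ, hm⟩ := extraction_of_frequently_atTop hm
  have e1 := hm 0 0 (by decide)
  have e2 := hm 1 0 (by decide)
  have hlt : (n (φ 0) : ℤ) < n (φ 1) := by exact_mod_cast hn (hφ one_pos)
  simp [vecMul, dotProduct] at e1 e2
  have e3 : m 1 = 0 := by
    have : m 1 * ((n (φ 1) : ℤ) - n (φ 0)) = 0 := by linarith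
    rcases mul_eq_zero.1 this with h | h
    · exact h
    · omega
  apply hm0
  ext i
  fin_cases i
  · simpa [e3] using e1
  · exact e3

section B2

/-- finite unions of arithmetic progressions and (fully integral) `p`-arithmetic sequences -/
inductive Val (p : ℕ) : Set ℕ → Prop
  | pa (g : ℕ → ℕ) (c d : ℚ) (k : ℕ) (h : ∀ j, (g j : ℚ) = c * (p : ℚ) ^ (k * j) + d) : Val p (Set.range g)
  | ap (m l : ℕ) : Val p (Set.range fun j => m * j + l)
  | empty : Val p ∅
  | union (S T : Set ℕ) (hS : Val p S) (hT : Val p T) : Val p (S ∪ T)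

variable {p : ℕ}

lemma Val.conv {S : Set ℕ} (h : Val p S) : ∃ (M : ℕ) (f : Fin M → Set ℕ),
    (∀ i, IsAPNat (f i) ∨ IsPArithSeqNat p (f i)) ∧ S = ⋃ i, f i := by
  suffices H : ∃ l : List (Set ℕ), (∀ s ∈ l, IsAPNat s ∨ IsPArithSeqNat p s) ∧ ∀ n, n ∈ S ↔ ∃ s ∈ l, n ∈ s by
    obtain ⟨l, h1, h2⟩ := H
    refine ⟨l.length, l.get, fun i => h1 _ (l.get_mem i), Set.ext fun n => ?_⟩
    rw [h2, Set.mem_iUnion]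
    constructor
    · rintro ⟨s, hs, hn⟩
      obtain ⟨i, rfl⟩ := List.get_of_mem hs
      exact ⟨i, hn⟩
    · rintro ⟨i, hi⟩
      exact ⟨_, l.get_mem i, hi⟩
  induction h with
  | pa g c d k h =>
    refine ⟨[Set.range g], ?_, by simp⟩
    simp only [List.mem_singleton, forall_eq]
    refine Or.inr ⟨c, d, k, Set.ext fun n => exists_congr fun j => ?_⟩
    rw [← h]
    exact ⟨fun h => by rw [h], fun h => by exact_mod_cast h.symm⟩
  | ap m l =>
    refine ⟨[Set.range fun j => m * j + l], ?_, by simp⟩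
    simp only [List.mem_singleton, forall_eq]
    exact Or.inl ⟨m, l, Set.ext fun n => exists_congr fun j => eq_comm⟩
  | empty => exact ⟨[], by simp, by simp⟩
  | union S T _ _ hS hT =>
    obtain ⟨l, h1, h2⟩ := hS
    obtain ⟨l', h1', h2'⟩ := hT
    refine ⟨l ++ l', fun s hs => (List.mem_append.1 hs).elim (h1 s) (h1' s), fun n => ?_⟩
    simp only [Set.mem_union, h2, h2', List.mem_append, or_and_right, exists_or]

lemma Val.bU {ι : Type*} (s : Finset ι) (f : ι → Set ℕ) (h : ∀ i ∈ s, Val p (f i)) : Val p (⋃ i ∈ s, f i) := by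
  classical
  induction s using Finset.induction_on with
  | empty => simpa using Val.empty
  | insert a s ha ih =>
    rw [set_biUnion_insert]
    exact .union _ _ (h a (by simp)) (ih fun i hi => h i (by simp [hi]))

lemma Val.fin {S : Set ℕ} (h : S.Finite) : Val p S := by
  have := Val.bU (p := p) h.toFinset (fun n => Set.range fun j => 0 * j + n) fun i _ => .ap _ _
  convert this
  ext; simp

lemma Val.aff (N a : ℕ) {S : Set ℕ} (h : Val p S) : Val p ((fun n => N * n + a) '' S) := by
  induction h with
  | pa g c d k h =>
    rw [← Set.range_comp]
    exact .pa _ (N * c) (N * d + a) k fun j => by simp [h]; ring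
  | ap m l =>
    rw [← Set.range_comp]
    convert Val.ap (p := p) (N * m) (N * l + a) using 3
    simp; ring
  | empty => simpa using Val.empty
  | union S T _ _ hS hT => rw [Set.image_union]; exact .union _ _ hS hT

lemma Val.sec (N : ℕ) (hN : 1 ≤ N) (a : ℕ) (S : Set ℕ) (h : ∀ c, Val p {n | a + c + N * n ∈ S}) : Val p S := by
  have := Val.union _ _ (Val.fin (p := p) ((Set.finite_lt_nat a).inter_of_right S))
    (Val.bU (range N) _ fun c _ => (h c).aff N (a + c))
  convert this
  ext n
  simp only [Set.mem_union, Set.mem_inter_iff, Set.mem_setOf_eq, Set.mem_iUnion, Set.mem_image, mem_range, exists_prop]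
  constructor
  · intro hn
    rcases lt_or_ge n a with h1 | h1
    · exact Or.inl ⟨hn, h1⟩
    · have h2 := Nat.mod_add_div (n - a) N
      have h3 : a + (n - a) % N + N * ((n - a) / N) = n := by omega
      exact Or.inr ⟨(n - a) % N, Nat.mod_lt _ hN, (n - a) / N, by rwa [h3], by omega⟩
  · rintro (h1 | ⟨c, -, m, h1, rfl⟩)
    · exact h1.1
    · rwa [add_comm]

lemma fwd (S : Set ℕ) (J L : ℕ) (hL : 1 ≤ L) (h : ∀ i ∈ S, J ≤ i → i + L ∈ S) (g : ℕ → ℕ)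
    (hg : ∀ i, (∀ j, i + L * j ∈ S) → Val p (Set.range fun j => g (i + L * j))) : Val p (g '' S) := by
  classical
  have h1 : ∀ ρ, Val p (g '' {i | i ∈ S ∧ J ≤ i ∧ i % L = ρ}) := by
    intro ρ
    by_cases hne : ∃ i, i ∈ S ∧ J ≤ i ∧ i % L = ρ
    · have h2 := Nat.find_spec hne
      have h3 := fun i => Nat.find_min' hne (m := i)
      obtain ⟨i0, hi0⟩ : ∃ i0, i0 = Nat.find hne := ⟨_, rfl⟩
      rw [← hi0] at h2
      simp only [← hi0] at h3
      have hcl : ∀ j, i0 + L * j ∈ S := by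
        intro j
        induction j with
        | zero => exact h2.1
        | succ j ih => have := h _ ih (by have := h2.2.1; nlinarith); rwa [mul_add, mul_one, ← add_assoc]
      convert hg i0 hcl
      ext n
      constructor
      · rintro ⟨i, hi, rfl⟩
        have h4 := h3 i hi
        have h5 : (i - i0) % L = 0 := Nat.sub_mod_eq_zero_of_mod_eq (hi.2.2.trans h2.2.2.symm)
        refine ⟨(i - i0) / L, ?_⟩
        simp only
        rw [Nat.mul_div_cancel' (Nat.dvd_of_mod_eq_zero h5)]
        congr 1; omega
      · rintro ⟨j, rfl⟩
        exact ⟨i0 + L * j, ⟨hcl j, by have := h2.2.1; nlinarith, by simpa using h2.2.2⟩, rfl⟩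
    · convert Val.empty (p := p)
      rw [Set.image_eq_empty]
      exact Set.eq_empty_of_forall_notMem fun i hi => hne ⟨i, hi⟩
  have := Val.union _ _ (Val.fin (p := p) (((Set.finite_lt_nat J).inter_of_right S).image g)) (Val.bU (range L) _ fun ρ _ => h1 ρ)
  convert this
  ext n
  simp only [Set.mem_union, Set.mem_inter_iff, Set.mem_setOf_eq, Set.mem_iUnion, Set.mem_image, mem_range, exists_prop]
  constructor
  · rintro ⟨i, hi, rfl⟩
    rcases lt_or_ge i J with h1 | h1
    · exact Or.inl ⟨i, ⟨hi, h1⟩, rfl⟩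
    · exact Or.inr ⟨i % L, Nat.mod_lt _ hL, i, ⟨hi, h1, rfl⟩, rfl⟩
  · rintro (⟨i, h1, rfl⟩ | ⟨c, -, i, h1, rfl⟩)
    · exact ⟨i, h1.1, rfl⟩
    · exact ⟨i, h1.1, rfl⟩

lemma fwdAP (S : Set ℕ) (J L : ℕ) (hL : 1 ≤ L) (h : ∀ i ∈ S, J ≤ i → i + L ∈ S) : Val p S := by
  have := fwd (p := p) S J L hL h id fun i _ => by simp only [id, add_comm i]; exact .ap _ _
  rwa [Set.image_id] at this

end B2

lemma rat_pow (p : ℕ) (hp : p.Prime) (θ : ℚ) (hθ : 1 ≤ θ) (E A B : ℕ) (hE : E ≠ 0) (h : θ ^ E * (p : ℚ) ^ A = (p : ℚ) ^ B) :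
    ∃ i : ℕ, θ = (p : ℚ) ^ i := by
  have hp1 : (1 : ℚ) < p := by exact_mod_cast hp.one_lt
  have hAB : A ≤ B := (pow_le_pow_iff_right₀ hp1).1 (by rw [← h]; exact le_mul_of_one_le_left (by positivity) (one_le_pow₀ hθ))
  have h1 : θ ^ E = (p : ℚ) ^ (B - A) := by
    rw [← mul_left_inj' (pow_ne_zero A (zero_lt_one.trans hp1).ne'), h, ← pow_add, Nat.sub_add_cancel hAB]
  have h2 : θ.den = 1 := by
    have := congrArg Rat.den h1
    rw [Rat.den_pow, ← Nat.cast_pow, Rat.den_natCast] at this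
    exact (Nat.pow_eq_one.1 this).resolve_right hE
  have h3 : θ = θ.num.natAbs := by
    conv_lhs => rw [← Rat.num_div_den θ, h2]
    have h4 : 0 ≤ θ.num := Rat.num_nonneg.2 (by linarith)
    simp [abs_of_nonneg h4]
  rw [h3] at h1
  obtain ⟨i, -, hi⟩ := (Nat.dvd_prime_pow hp).1 (show θ.num.natAbs ∣ p ^ (B - A) by
    rw [← (by exact_mod_cast h1 : θ.num.natAbs ^ E = p ^ (B - A))]; exact dvd_pow_self _ hE)
  exact ⟨i, by rw [h3, hi]; push_cast; rfl⟩

lemma oneroot (p : ℕ) (hp : p.Prime) (k s e : ℕ) (hk : 1 ≤ k) (he : e ≠ 0) (z a : ℤ) (ha : a ≠ 0) (hz : z ^ 2 = (p : ℤ) ^ (2 * s)) (c d : ℚ) :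
    Val p {n : ℕ | ∃ m : ℕ, (z : ℚ) ^ n * (c * (n - d) ^ e) = a * (p : ℚ) ^ (k * m)} := by
  classical
  obtain ⟨T, hT⟩ : ∃ T, T = {n : ℕ | ∃ m : ℕ, (z : ℚ) ^ n * (c * (n - d) ^ e) = a * (p : ℚ) ^ (k * m)} := ⟨_, rfl⟩
  rw [← hT]
  have hp0 : (p : ℚ) ≠ 0 := by exact_mod_cast hp.ne_zero
  have ha0 : (a : ℚ) ≠ 0 := by exact_mod_cast ha
  have hzq : (z : ℚ) ^ 2 = (p : ℚ) ^ (2 * s) := by exact_mod_cast hz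
  have hfin : (T ∩ {n : ℕ | (n : ℚ) ≤ d}).Finite := (Set.finite_le_nat ⌊d⌋₊).subset fun n hn => Nat.le_floor hn.2
  by_cases hne : ∃ n, n ∈ T ∧ d < (n : ℚ)
  swap
  · refine Val.fin (hfin.subset fun n hn => ⟨hn, ?_⟩)
    by_contra h
    exact hne ⟨n, hn, not_le.1 h⟩
  have hn0 := Nat.find_spec hne
  have hmin := fun n => Nat.find_min' hne (m := n)
  obtain ⟨n0, hn0'⟩ : ∃ n0, n0 = Nat.find hne := ⟨_, rfl⟩
  rw [← hn0'] at hn0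
  simp only [← hn0'] at hmin
  obtain ⟨hn0T, hd⟩ := hn0
  obtain ⟨y, hy⟩ : ∃ y : ℚ, y = n0 - d := ⟨_, rfl⟩
  have hy0 : 0 < y := by rw [hy]; linarith
  obtain ⟨M, hM⟩ : ∃ M, M = 2 * k * y.den := ⟨_, rfl⟩
  haveI : NeZero M := ⟨by rw [hM]; have := y.den_pos; positivity⟩
  obtain ⟨i0, j0, hij, hpow⟩ : ∃ i0 j0 : ℕ, i0 < j0 ∧ (p : ZMod M) ^ (k * i0) = (p : ZMod M) ^ (k * j0) := by
    obtain ⟨i, j, h1, h2⟩ := Finite.exists_ne_map_eq_of_infinite fun i : ℕ => (p : ZMod M) ^ (k * i)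
    rcases lt_or_gt_of_ne h1 with h | h
    · exact ⟨i, j, h, h2⟩
    · exact ⟨j, i, h, h2.symm⟩
  obtain ⟨l, rfl⟩ := Nat.exists_eq_add_of_lt hij
  obtain ⟨L, hL⟩ : ∃ L, L = k * (l + 1) := ⟨_, rfl⟩
  obtain ⟨I, hI⟩ : ∃ I : Set ℕ, I = {i | ∃ n ∈ T, (n : ℚ) = y * (p : ℚ) ^ i + d} := ⟨_, rfl⟩
  have hg : ∀ i ∈ I, (⌊y * (p : ℚ) ^ i + d⌋₊ : ℚ) = y * (p : ℚ) ^ i + d ∧ ⌊y * (p : ℚ) ^ i + d⌋₊ ∈ T := by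
    intro i hi
    rw [hI] at hi
    obtain ⟨n, hn, h⟩ := hi
    rw [← h, Nat.floor_natCast]
    exact ⟨rfl, hn⟩
  have h1 : Val p ((fun i => ⌊y * (p : ℚ) ^ i + d⌋₊) '' I) := by
    refine fwd I (k * i0) L (by rw [hL]; exact Nat.mul_pos hk (by omega)) (fun i hi hi0 => ?_) _ fun i hi => ?_
    · rw [hI] at hi ⊢
      obtain ⟨n, hn, h⟩ := hi
      obtain ⟨t, ht⟩ : ∃ t, p ^ (i + L) = p ^ i + M * t := by
        have h2 : p ^ i ≤ p ^ (i + L) := Nat.pow_le_pow_right hp.pos (by omega)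
        have h3 : (p ^ i) ≡ p ^ (i + L) [MOD M] := by
          rw [← ZMod.natCast_eq_natCast_iff]
          push_cast
          obtain ⟨f, rfl⟩ := Nat.exists_eq_add_of_le hi0
          rw [pow_add, hpow, hL, show k * i0 + f + k * (l + 1) = k * (i0 + l + 1) + f by ring, pow_add]
        obtain ⟨t, ht⟩ := (Nat.modEq_iff_dvd' h2).1 h3
        exact ⟨t, by omega⟩
      have hyd : y * y.den = y.num.natAbs := by
        rw [Rat.mul_den_eq_num]
        have h4 : 0 < y.num := Rat.num_pos.2 hy0
        simp [abs_of_pos h4]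
      have htq : (p : ℚ) ^ (i + L) = (p : ℚ) ^ i + 2 * k * y.den * t := by rw [hM] at ht; exact_mod_cast ht
      have heq : ((n + 2 * k * (y.num.natAbs * t) : ℕ) : ℚ) = y * (p : ℚ) ^ (i + L) + d := by
        push_cast at hyd ⊢
        rw [htq, h, ← hyd]; ring
      refine ⟨n + 2 * k * (y.num.natAbs * t), ?_, heq⟩
      rw [hT] at hn ⊢
      obtain ⟨m, hm⟩ := hn
      refine ⟨m + 2 * s * (y.num.natAbs * t) + (l + 1) * e, ?_⟩
      have h5 : (n : ℚ) - d = y * (p : ℚ) ^ i := by rw [h]; ring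
      rw [heq, pow_add, show 2 * k * (y.num.natAbs * t) = 2 * (k * (y.num.natAbs * t)) by ring, pow_mul _ 2, hzq, add_sub_cancel_right, pow_add _ i,
        ← mul_assoc y, ← h5, mul_pow, ← pow_mul, ← pow_mul]
      calc _ = (z : ℚ) ^ n * (c * (n - d) ^ e) * ((p : ℚ) ^ (2 * s * (k * (y.num.natAbs * t))) * (p : ℚ) ^ (L * e)) := by ring
        _ = _ := by rw [hm, mul_assoc, ← pow_add, ← pow_add, hL]; ring_nf
    · exact .pa _ (y * (p : ℚ) ^ i) d L fun j => by rw [(hg _ (hi j)).1, pow_add]; ring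
  convert Val.union _ _ (Val.fin (p := p) hfin) h1
  ext n
  constructor
  · intro hn
    rcases le_or_gt (n : ℚ) d with h | h
    · exact Or.inl ⟨hn, h⟩
    · refine Or.inr ?_
      have hle := hmin n ⟨hn, h⟩
      obtain ⟨f, rfl⟩ := Nat.exists_eq_add_of_le hle
      have hn' := hn
      rw [hT] at hn' hn0T
      obtain ⟨m, hm⟩ := hn'
      obtain ⟨m0, hm0⟩ := hn0T
      obtain ⟨i, hi⟩ := rat_pow p hp (((n0 + f : ℕ) - d) / y) (by rw [le_div_iff₀ hy0, hy]; push_cast; linarith [(Nat.cast_nonneg f : (0 : ℚ) ≤ f)])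
        (e * 2) (2 * s * f + k * m0 * 2) (k * m * 2) (by omega) (by
          have h2 : (((n0 + f : ℕ) - d) / y) ^ e * ((z : ℚ) ^ f * (p : ℚ) ^ (k * m0)) = (p : ℚ) ^ (k * m) := by
            rw [← div_mul_cancel₀ (((n0 + f : ℕ) : ℚ) - d) hy0.ne', mul_pow, pow_add] at hm
            rw [← hy] at hm0
            apply mul_left_cancel₀ ha0
            linear_combination hm - hm0 * ((((n0 + f : ℕ) - d) / y) ^ e * (z : ℚ) ^ f)
          rw [pow_mul, pow_add, pow_mul _ (2 * s), ← hzq, pow_mul _ (k * m0), pow_mul _ (k * m), ← h2]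
          ring)
      rw [div_eq_iff hy0.ne'] at hi
      have hq : ((n0 + f : ℕ) : ℚ) = y * (p : ℚ) ^ i + d := by linarith
      exact ⟨i, by rw [hI]; exact ⟨_, hn, hq⟩, by simp only [← hq, Nat.floor_natCast]⟩
  · rintro (h | ⟨i, hi, rfl⟩)
    · exact h.1
    · exact (hg i hi).2

lemma polycase (p : ℕ) (hp : p.Prime) (k : ℕ) (hk : 1 ≤ k) (z a D : ℤ) (hz : z ≠ 0) (ha : a ≠ 0) (hD : D ≠ 0) (P : Polynomial ℚ)
    (hP : ∀ n : ℕ, ∃ y : ℤ, (y : ℚ) = D * P.eval (n : ℚ)) :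
    Val p {n : ℕ | ∃ m : ℕ, (z : ℚ) ^ n * P.eval (n : ℚ) = a * (p : ℚ) ^ (k * m)} := by
  classical
  by_cases hq : ∃ q : ℕ, q.Prime ∧ q ∣ z.natAbs ∧ q ≠ p
  · obtain ⟨q, hq, hqz, hqp⟩ := hq
    refine Val.fin ((Set.finite_lt_nat (D * a).natAbs).subset ?_)
    rintro n ⟨m, hm⟩
    obtain ⟨y, hy⟩ := hP n
    have h1 : z ^ n * y = D * a * (p : ℤ) ^ (k * m) := by
      have : (z : ℚ) ^ n * y = D * a * (p : ℚ) ^ (k * m) := by rw [hy, mul_left_comm, hm, mul_assoc]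
      exact_mod_cast this
    have h2 : q ^ n ∣ (D * a).natAbs * p ^ (k * m) := by
      have := congrArg Int.natAbs h1
      rw [Int.natAbs_mul, Int.natAbs_mul (D * a), Int.natAbs_pow, Int.natAbs_pow, Int.natAbs_natCast] at this
      rw [← this]
      exact (pow_dvd_pow_of_dvd hqz n).mul_right _
    have h3 : q ^ n ∣ (D * a).natAbs :=
      (Nat.Coprime.pow _ _ ((Nat.coprime_primes hq hp).2 hqp)).dvd_of_dvd_mul_right h2
    exact (Nat.lt_pow_self hq.one_lt).trans_le (Nat.le_of_dvd (by simpa using ⟨hD, ha⟩) h3)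
  push Not at hq
  obtain ⟨s, hs⟩ : ∃ s, z.natAbs = p ^ s := ⟨_, Nat.eq_prime_pow_of_unique_prime_dvd (by simpa using hz) fun {d} h1 h2 => hq d h1 h2⟩
  have hz2 : z ^ 2 = (p : ℤ) ^ (2 * s) := by
    rw [← Int.natAbs_sq, hs]; push_cast; ring
  by_cases hdeg : P.natDegree = 0
  · obtain ⟨c, rfl⟩ : ∃ c, P = Polynomial.C c := ⟨_, Polynomial.eq_C_of_natDegree_eq_zero hdeg⟩
    refine fwdAP _ 0 (2 * k) (by omega) ?_
    rintro n ⟨m, hm⟩ -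
    refine ⟨m + 2 * s, ?_⟩
    have : (z : ℚ) ^ 2 = (p : ℚ) ^ (2 * s) := by exact_mod_cast hz2
    rw [Polynomial.eval_C] at hm ⊢
    rw [pow_add, pow_mul _ 2, this, ← pow_mul, mul_right_comm, hm]
    ring
  have hKf : FiniteDimensional ℚ P.SplittingField := inferInstance
  have : NumberField P.SplittingField := { to_finiteDimensional := by convert hKf <;> rfl }
  obtain ⟨K, hK, hKn, hs2⟩ : ∃ (K : Type) (_ : Field K) (_ : NumberField K), (P.map (algebraMap ℚ K)).Splits :=
    ⟨P.SplittingField, inferInstance, this, (Subsingleton.elim _ _ : _ = algebraMap ℚ P.SplittingField) ▸ Polynomial.SplittingField.splits P⟩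
  obtain ⟨v, -, hvz, -⟩ := exists_place (K := K) p hp
  obtain ⟨σ⟩ : Nonempty (K →+* ℂ) := inferInstance
  have hw : ∀ y : ℤ, nav σ (y : K) = |(y : ℝ)| := fun y => by rw [nav_apply, map_intCast]; simp
  have hwv : ∀ y : ℤ, y ≠ 0 → 1 ≤ nav σ (y : K) * v (y : K) ∧ (y.natAbs.primeFactors ⊆ {p} → nav σ (y : K) * v (y : K) = 1) := by
    intro y hy
    have := prodS {p} (by simpa using hp) y hy
    simpa [hw, hvz] using this
  obtain ⟨Q, hQ⟩ : ∃ Q, Q = P.map (algebraMap ℚ K) := ⟨_, rfl⟩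
  rw [← hQ] at hs2
  have hev : ∀ n : ℕ, Q.eval (n : K) = ((P.eval (n : ℚ) : ℚ) : K) := by
    intro n
    have := Polynomial.eval_map_apply (f := algebraMap ℚ K) (p := P) (n : ℚ)
    rw [hQ]; simpa using this
  by_cases h2 : ∃ ρ1 ∈ Q.roots, ∃ ρ2 ∈ Q.roots, ρ1 ≠ ρ2
  · obtain ⟨ρ1, h1, ρ2, h2, h12⟩ := h2
    refine Val.fin ((tworoots (nav σ) v hw (fun y hy => (hwv y hy).1) Q hs2 ρ1 ρ2 h1 h2 h12 (nav σ (a : K) * v (a : K))).subset ?_)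
    rintro n ⟨m, hm⟩
    have hm' : (z : K) ^ n * Q.eval (n : K) = a * ((p : ℤ) : K) ^ (k * m) := by rw [hev]; exact_mod_cast congrArg (Rat.cast : ℚ → K) hm
    have e1 := (hwv z hz).2 fun q h => mem_singleton.2 (hq q (Nat.prime_of_mem_primeFactors h) (Nat.dvd_of_mem_primeFactors h))
    have e2 := (hwv (p : ℤ) (by exact_mod_cast hp.ne_zero)).2 (by simp [hp.primeFactors])
    have e3 := congrArg₂ (· * ·) (congrArg (nav σ) hm') (congrArg v hm')
    simp only [map_mul, map_pow] at e3
    rw [mul_mul_mul_comm, ← mul_pow, e1, mul_mul_mul_comm, ← mul_pow, e2, one_pow, one_pow, one_mul, mul_one] at e3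
    exact e3.le
  push Not at h2
  have hcard := hs2.natDegree_eq_card_roots
  obtain ⟨e, he⟩ : ∃ e, e = P.natDegree := ⟨_, rfl⟩
  rw [hQ, Polynomial.natDegree_map, ← hQ, ← he] at hcard
  obtain ⟨ρ, hρ⟩ := Multiset.card_pos_iff_exists_mem.1 (show 0 < Q.roots.card by omega)
  have hroots : Q.roots = Multiset.replicate e ρ := Multiset.eq_replicate.2 ⟨hcard.symm, fun r hr => h2 r hr ρ hρ⟩
  have hQe : Q = Polynomial.C (P.leadingCoeff : K) * (Polynomial.X - Polynomial.C ρ) ^ e := by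
    conv_lhs => rw [hs2.eq_prod_roots, hroots]
    rw [hQ, Polynomial.leadingCoeff_map]; simp
  have hlc : P.leadingCoeff ≠ 0 := by rw [Polynomial.leadingCoeff_ne_zero]; rintro rfl; simp at hdeg
  obtain ⟨d, hd⟩ : ∃ d : ℚ, ρ = d := by
    have h3 := congrArg (fun R => Polynomial.coeff R (e - 1)) hQe
    simp only [Polynomial.coeff_C_mul, sub_eq_add_neg, ← Polynomial.C_neg, Polynomial.coeff_X_add_C_pow, hQ, Polynomial.coeff_map] at h3
    rw [show e - (e - 1) = 1 by omega, Nat.choose_symm_of_eq_add (show e = (e - 1) + 1 by omega), Nat.choose_one_right, pow_one] at h3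
    refine ⟨-P.coeff (e - 1) / (P.leadingCoeff * e), ?_⟩
    have h4 : (P.leadingCoeff : K) ≠ 0 := by exact_mod_cast hlc
    have h5 : (e : K) ≠ 0 := by rw [he]; exact_mod_cast hdeg
    push_cast
    rw [eq_div_iff (mul_ne_zero h4 h5), ← eq_ratCast (algebraMap ℚ K) (P.coeff (e - 1)), h3]; ring
  convert oneroot p hp k s e hk (by omega) z a ha hz2 P.leadingCoeff d using 7 with n m
  have := hev n
  rw [hQe, hd] at this
  simp only [Polynomial.eval_mul, Polynomial.eval_C, Polynomial.eval_pow, Polynomial.eval_sub, Polynomial.eval_X] at this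
  exact_mod_cast this.symm

section B5
variable {r : ℕ}

lemma nilcase (p : ℕ) (hp : p.Prime) (k : ℕ) (hk : 1 ≤ k) (z a : ℤ) (hz : z ≠ 0) (ha : a ≠ 0) (A : Sq r ℤ)
    (e x : Fin r → ℤ) (s : ℕ) (h : (A - z • (1 : Sq r ℤ)) ^ s = 0) :
    Val p {n | ∃ m, e ⬝ᵥ (A ^ n).mulVec x = a * (p : ℤ) ^ (k * m)} := by
  obtain ⟨N, hN⟩ : ∃ N, A = N + z • (1 : Sq r ℤ) := ⟨_, (sub_add_cancel A _).symm⟩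
  rw [hN, add_sub_cancel_right] at h
  have hq : (z : ℚ) ≠ 0 := by exact_mod_cast hz
  obtain ⟨w, hw⟩ : ∃ w : ℕ → ℤ, w = fun i => e ⬝ᵥ (N ^ i).mulVec x := ⟨_, rfl⟩
  have h0 : ∀ i, s ≤ i → w i = 0 := fun i hi => by rw [hw]; simp [pow_eq_zero_of_le hi h]
  have h1 : ∀ n, e ⬝ᵥ (A ^ n).mulVec x = ∑ i ∈ range (n + 1), (n.choose i : ℤ) * z ^ (n - i) * w i := by
    intro n
    have h2 : A ^ n = ∑ i ∈ range (n + 1), ((n.choose i : ℤ) * z ^ (n - i)) • N ^ i := by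
      rw [hN, ((Commute.one_right N).smul_right z).add_pow]
      refine sum_congr rfl fun i _ => ?_
      rw [smul_pow, one_pow, show ((n.choose i : ℕ) : Sq r ℤ) = (n.choose i : ℤ) • 1 by simp]
      simp only [mul_smul_comm, mul_one, smul_smul]
    rw [h2, Matrix.sum_mulVec, dotProduct_sum, hw]
    refine sum_congr rfl fun i _ => ?_
    rw [smul_mulVec, dotProduct_smul, smul_eq_mul]
  obtain ⟨P, hP⟩ : ∃ P : Polynomial ℚ, P = ∑ i ∈ range s, Polynomial.C (w i / (z ^ i * i.factorial) : ℚ) * descPochhammer ℚ i := ⟨_, rfl⟩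
  have h2 : ∀ n : ℕ, P.eval (n : ℚ) = ∑ i ∈ range s, (n.choose i : ℚ) * w i / z ^ i := by
    intro n
    rw [hP, Polynomial.eval_finset_sum]
    refine sum_congr rfl fun i _ => ?_
    rw [Polynomial.eval_mul, Polynomial.eval_C, Nat.cast_choose_eq_descPochhammer_div]
    field_simp
  have h3 : ∀ n : ℕ, (z : ℚ) ^ n * P.eval (n : ℚ) = ((e ⬝ᵥ (A ^ n).mulVec x : ℤ) : ℚ) := by
    intro n
    rw [h1, h2, mul_sum]
    push_cast
    rw [sum_subset (range_mono (le_max_left s (n + 1))), sum_subset (range_mono (le_max_right s (n + 1)))]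
    · refine sum_congr rfl fun i _ => ?_
      rcases le_or_gt i n with hi | hi
      · rw [← Nat.sub_add_cancel hi, Nat.add_sub_cancel, pow_add]; field_simp
      · simp [Nat.choose_eq_zero_of_lt hi]
    · intro i _ hi
      rw [Nat.choose_eq_zero_of_lt (by simpa using hi)]; simp
    · intro i _ hi
      rw [h0 i (by simpa using hi)]; simp
  convert polycase p hp k hk z a (z ^ s) hz ha (pow_ne_zero _ hz) P fun n => ⟨∑ i ∈ range s, (n.choose i : ℤ) * w i * z ^ (s - i), ?_⟩ using 5 with n m
  · rw [h3]; exact_mod_cast Iff.rfl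
  · rw [h2, mul_sum]
    push_cast
    refine sum_congr rfl fun i hi => ?_
    rw [← Nat.sub_add_cancel (mem_range.1 hi).le, Nat.add_sub_cancel, pow_add]; field_simp

end B5

section B6
variable {r : ℕ}

def Stb (A : Sq r ℤ) (e x : Fin r → ℤ) : Prop :=
  (∀ N, 1 ≤ N → ∀ (a : ℕ) (b : Fin r → ℤ), (∀ n, b ⬝ᵥ (A ^ (a + N * n)).mulVec x = 0) → b = 0) ∧
  (∀ N, 1 ≤ N → ∀ (a : ℕ) (y : Fin r → ℤ), (∀ n, e ⬝ᵥ (A ^ (a + N * n)).mulVec y = 0) → y = 0)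

lemma Stb.det {A : Sq r ℤ} {e x : Fin r → ℤ} (h : Stb A e x) : A.det ≠ 0 := by
  intro h0
  obtain ⟨b, hb, hb2⟩ := Matrix.exists_vecMul_eq_zero_iff.2 h0
  exact hb (h.1 1 le_rfl 1 b fun n => by
    rw [pow_add, pow_one, ← mulVec_mulVec, dotProduct_mulVec, hb2, zero_dotProduct])

lemma stab1 (p : ℕ) (A : Sq r ℤ) (e x : Fin r → ℤ) (h : Stb A e x) :
    Val p {n | e ⬝ᵥ (A ^ n).mulVec x ∈ ({0} : Set ℤ)} := by
  obtain ⟨N, hN, h1⟩ := sml A h.det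
  refine Val.sec N hN 0 _ fun c => ?_
  simp only [zero_add, Set.mem_setOf_eq, Set.mem_singleton_iff]
  by_cases hf : {n | e ⬝ᵥ (A ^ (c + N * n)).mulVec x = 0}.Finite
  · exact Val.fin hf
  · convert Val.ap (p := p) 1 0
    ext n; simpa using h1 e x c hf n

lemma stab2 (p : ℕ) (hp : p.Prime) (k : ℕ) (hk : 1 ≤ k) (a : ℤ) (ha : a ≠ 0) (A : Sq r ℤ) (e x : Fin r → ℤ)
    (hs : Stb A e x) : Val p {n | e ⬝ᵥ (A ^ n).mulVec x ∈ {y | ∃ m, y = a * (p : ℤ) ^ (k * m)}} := by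
  obtain ⟨K, _, _, σ, Re, Im, hRe, hIm, Ψ, α, s, hΨ, h⟩ := exists_K A
  by_cases hij : ∃ i j, α i ≠ α j
  · obtain ⟨i, j, hij⟩ := hij
    exact Val.fin ((core A hs.det e x hs.1 hs.2 σ Re Im hRe hIm Ψ α s hΨ h i j hij p hp a ha).subset fun n ⟨m, hm⟩ => ⟨k * m, hm⟩)
  push Not at hij
  rcases isEmpty_or_nonempty (Fin r) with _ | hne
  · convert Val.empty (p := p)
    refine Set.eq_empty_of_forall_notMem fun n ⟨m, hm⟩ => ?_
    simp only [dotProduct, univ_eq_empty, sum_empty] at hm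
    exact mul_ne_zero ha (pow_ne_zero _ (by exact_mod_cast hp.ne_zero)) hm.symm
  obtain ⟨i0⟩ := id hne
  obtain ⟨B, hB⟩ : ∃ B, B = A.map (Int.cast : ℤ → K) - α i0 • (1 : Sq r K) := ⟨_, rfl⟩
  have hB0 : B ^ s = 0 := by
    have h1 : Ψ * B ^ s = 0 := by
      ext i l
      have := congrFun (h i) l
      rw [hij i i0, ← hB] at this
      simpa [Matrix.mul_apply_eq_vecMul] using this
    have hu := (Matrix.isUnit_iff_isUnit_det Ψ).2 (isUnit_iff_ne_zero.2 hΨ)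
    exact hu.mul_right_eq_zero.1 h1
  obtain ⟨z, hz⟩ : ∃ z : ℤ, α i0 = z := by
    have hr : (r : K) ≠ 0 := by exact_mod_cast (Fin.pos i0).ne'
    have h1 := (Matrix.isNilpotent_trace_of_isNilpotent ⟨s, hB0⟩).eq_zero
    have h2 : (A.map (Int.cast : ℤ → K)).trace = (A.trace : K) := by simp [Matrix.trace]
    rw [hB, Matrix.trace_sub, Matrix.trace_smul, Matrix.trace_one, Fintype.card_fin, h2, sub_eq_zero, smul_eq_mul, eq_comm, ← eq_div_iff hr] at h1
    have h3 : IsIntegral ℤ (α i0) := by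
      refine ⟨A.charpoly, A.charpoly_monic, ?_⟩
      rw [Polynomial.eval₂_eq_eval_map, ← charpoly_map, eval_charpoly]
      have h4 : B.det ^ s = 0 := by
        rw [← det_pow, hB0, Matrix.det_zero]
      have h5 := (eq_zero_or_neZero (B.det)).resolve_right fun h => pow_ne_zero s h.1 h4
      rw [show Matrix.scalar (Fin r) (α i0) - A.map (algebraMap ℤ K) = -B by ext i l; simp [hB, Matrix.one_apply, Matrix.diagonal_apply], Matrix.det_neg, h5, mul_zero]
    have h4 : α i0 = algebraMap ℚ K (A.trace / r : ℚ) := by rw [h1]; simp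
    rw [h4, isIntegral_algebraMap_iff (algebraMap ℚ K).injective] at h3
    obtain ⟨z, hz⟩ := IsIntegrallyClosed.isIntegral_iff.1 h3
    exact ⟨z, by rw [h4, ← hz]; simp⟩
  have hA : (A - z • (1 : Sq r ℤ)) ^ s = 0 := by
    have h1 : (A - z • (1 : Sq r ℤ)).map (castRingHom K) = B := by
      ext i l
      rw [hB, hz]; by_cases hil : i = l <;> simp [Matrix.one_apply, Matrix.intCast_apply, hil]
    refine Matrix.map_injective (f := castRingHom K) Int.cast_injective ?_
    simp only [Matrix.map_pow, h1, hB0]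
    simp
  refine nilcase p hp k hk z a ?_ ha A e x s hA
  rintro rfl
  rw [zero_smul, sub_zero] at hA
  have := congrArg det hA
  rw [det_pow, Matrix.det_zero] at this
  exact pow_ne_zero _ hs.det this

end B6

lemma torep {M : Type*} [AddCommGroup M] [Module ℤ M] [Module.Free ℤ M] [Module.Finite ℤ M] (T : M →ₗ[ℤ] M) (f : M →ₗ[ℤ] ℤ) (x : M) :
    ∃ (A : Matrix (Fin (finrank ℤ M)) (Fin (finrank ℤ M)) ℤ) (e x' : Fin (finrank ℤ M) → ℤ),
      ∀ n, f ((T ^ n) x) = e ⬝ᵥ (A ^ n).mulVec x' := by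
  have b := Module.finBasis ℤ M
  refine ⟨LinearMap.toMatrix b b T, fun i => f (b i), b.repr x, fun n => ?_⟩
  rw [LinearMap.toMatrix_pow, LinearMap.toMatrix_mulVec_repr]
  conv_lhs => rw [← b.sum_repr ((T ^ n) x), map_sum]
  exact sum_congr rfl fun i _ => by rw [f.map_smul, smul_eq_mul, mul_comm]

lemma cut {r : ℕ} (A : Sq r ℤ) (e x b : Fin r → ℤ) (hb : b ≠ 0) (N a : ℕ)
    (h : ∀ n, b ⬝ᵥ (A ^ (a + N * n)).mulVec x = 0) (c : ℕ) :
    ∃ s < r, ∃ (A' : Sq s ℤ) (e' x' : Fin s → ℤ), ∀ n, e ⬝ᵥ (A ^ (a + c + N * n)).mulVec x = e' ⬝ᵥ (A' ^ n).mulVec x' := by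
  obtain ⟨V, hV⟩ : ∃ V, V = span ℤ (Set.range fun n => (A ^ (a + N * n)).mulVec x) := ⟨_, rfl⟩
  have hT : ∀ v ∈ V, (A ^ N).mulVecLin v ∈ V := by
    intro v hv
    refine (show V ≤ V.comap (A ^ N).mulVecLin from ?_) hv
    conv_lhs => rw [hV]
    rw [span_le]
    rintro _ ⟨n, rfl⟩
    rw [hV]
    refine subset_span ⟨n + 1, ?_⟩
    simp only [Matrix.mulVecLin_apply, mulVec_mulVec, ← pow_add]
    congr 2; ring
  have hx : ∀ n, (A ^ (a + N * n)).mulVec x ∈ V := fun n => hV ▸ subset_span ⟨n, rfl⟩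
  have hr : finrank ℤ V < r := by
    obtain ⟨φ, hφ⟩ : ∃ φ : (Fin r → ℤ) →ₗ[ℤ] ℤ, φ = dotProductBilin ℤ ℤ b := ⟨_, rfl⟩
    have h1 : V ≤ φ.ker := by
      rw [hV, span_le]
      rintro _ ⟨n, rfl⟩
      simpa [hφ] using h n
    have h2 := φ.ker.finrank_quotient_add_finrank
    rw [φ.quotKerEquivRange.finrank_eq] at h2
    have h3 : 1 ≤ finrank ℤ φ.range := by
      rw [Submodule.one_le_finrank_iff, Ne, LinearMap.range_eq_bot]
      rintro h0
      apply hb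
      funext i
      have := LinearMap.congr_fun h0 (Pi.single i 1)
      simpa [hφ] using this
    have h4 := Submodule.finrank_mono h1
    simp at h2
    omega
  obtain ⟨A', e', x', h'⟩ := torep ((A ^ N).mulVecLin.restrict hT) ((dotProductBilin ℤ ℤ e ∘ₗ (A ^ c).mulVecLin) ∘ₗ V.subtype) ⟨_, hx 0⟩
  refine ⟨_, hr, A', e', x', fun n => ?_⟩
  rw [← h', End.pow_restrict]
  simp only [comp_apply, Submodule.subtype_apply, LinearMap.restrict_coe_apply, Matrix.mulVecLin_apply]
  have h5 : ∀ n v, (((A ^ N).mulVecLin) ^ n) v = (A ^ (N * n)).mulVec v := by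
    intro n v
    rw [pow_mul]
    induction n with
    | zero => simp
    | succ n ih => rw [pow_succ', End.mul_apply, ih, Matrix.mulVecLin_apply, mulVec_mulVec, ← pow_succ']
  rw [h5, mulVec_mulVec, mulVec_mulVec, ← pow_add, ← pow_add]
  simp only [dotProductBilin_apply_apply]
  congr 3; ring

lemma reduce (p : ℕ) (Y : Set ℤ) (hst : ∀ (r : ℕ) (A : Sq r ℤ) e x, Stb A e x → Val p {n | e ⬝ᵥ (A ^ n).mulVec x ∈ Y}) :
    ∀ (r : ℕ) (A : Sq r ℤ) e x, Val p {n | e ⬝ᵥ (A ^ n).mulVec x ∈ Y} := by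
  intro r
  induction r using Nat.strong_induction_on with
  | _ r ih =>
  intro A e x
  by_cases hs : Stb A e x
  · exact hst r A e x hs
  rw [Stb, not_and_or] at hs
  push Not at hs
  rcases hs with ⟨N, hN, a, b, h, hb⟩ | ⟨N, hN, a, b, h, hb⟩
  · refine Val.sec N hN a _ fun c => ?_
    obtain ⟨s, hsr, A', e', x', h'⟩ := cut A e x b hb N a h c
    simp only [Set.mem_setOf_eq, h']
    exact ih s hsr A' e' x'
  · have hT : ∀ n (u v : Fin r → ℤ), u ⬝ᵥ (A ^ n).mulVec v = v ⬝ᵥ (A.transpose ^ n).mulVec u := fun n u v => by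
      rw [← Matrix.transpose_pow, Matrix.mulVec_transpose, dotProduct_mulVec, dotProduct_comm]
    refine Val.sec N hN a _ fun c => ?_
    obtain ⟨s, hsr, A', e', x', h'⟩ := cut A.transpose x e b hb N a (fun n => by rw [← hT, h]) c
    simp only [Set.mem_setOf_eq, hT, h']
    exact ih s hsr A' e' x'

lemma rep (u : ℕ → ℤ) (hu : IsLinRecSeq u) (D E : ℤ) :
    ∃ (r : ℕ) (A : Sq r ℤ) (e x : Fin r → ℤ), ∀ n, D * u n + E = e ⬝ᵥ (A ^ n).mulVec x := by
  obtain ⟨m, hm, c, h⟩ := hu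
  obtain ⟨V, hV⟩ : ∃ V, V = span ℤ (insert (1 : ℕ → ℤ) (Set.range fun (i : Fin m) (n : ℕ) => u (n + i))) := ⟨_, rfl⟩
  have h1 : (1 : ℕ → ℤ) ∈ V := hV ▸ subset_span (Set.mem_insert _ _)
  have h2 : ∀ i < m, (fun n => u (n + i)) ∈ V := fun i hi => hV ▸ subset_span (Set.mem_insert_of_mem _ ⟨⟨i, hi⟩, rfl⟩)
  have hT : ∀ v ∈ V, funLeft ℤ ℤ Nat.succ v ∈ V := by
    intro v hv
    refine (show V ≤ V.comap (funLeft ℤ ℤ Nat.succ) from ?_) hv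
    conv_lhs => rw [hV]
    rw [span_le]
    rintro _ (rfl | ⟨i, rfl⟩)
    · exact h1
    rw [SetLike.mem_coe, Submodule.mem_comap]
    rcases Nat.lt_or_ge (i + 1) m with hi | hi
    · convert h2 _ hi using 1
      funext n; simp only [funLeft_apply]; congr 1; omega
    · convert V.neg_mem (V.sum_mem fun i (hi : i ∈ range m) => V.smul_mem (c i) (h2 i (mem_range.1 hi))) using 1
      funext n
      have := h n
      simp only [funLeft_apply, Pi.neg_apply, Finset.sum_apply, Pi.smul_apply, smul_eq_mul]
      rw [show n.succ + i = n + m by omega]; linarith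
  haveI : Module.Finite ℤ V := hV ▸ Module.Finite.span_of_finite ℤ ((Set.finite_range _).insert _)
  obtain ⟨A, e, x, h'⟩ := torep ((funLeft ℤ ℤ Nat.succ).restrict hT) ((proj 0) ∘ₗ V.subtype)
    ⟨_, V.add_mem (V.smul_mem D (h2 0 hm)) (V.smul_mem E h1)⟩
  refine ⟨_, A, e, x, fun n => ?_⟩
  have h5 : ∀ n v j, ((funLeft ℤ ℤ Nat.succ ^ n) v : ℕ → ℤ) j = v (j + n) := by
    intro n
    induction n with
    | zero => simp
    | succ n ih => intro v j; rw [pow_succ, End.mul_apply, ih, funLeft_apply, Nat.succ_eq_add_one, add_assoc]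
  rw [← h', End.pow_restrict]
  simp [h5]

end
end Sub

/-- For an integer linear recurrence sequence `{u_n}`, a prime `p`,
`k ∈ ℕ₀` and `a, b ∈ ℚ`, the set `T = {n : u_n = b + a·p^{km} for some m}` is a
finite union of arithmetic progressions together with a finite union of
`p`-arithmetic sequences. -/
theorem stmt7 (u : ℕ → ℤ) (hu : IsLinRecSeq u) (p : ℕ) (hp : p.Prime) (k : ℕ) (a b : ℚ) :
    ∃ (M : ℕ) (f : Fin M → Set ℕ), (∀ i, IsAPNat (f i) ∨ IsPArithSeqNat p (f i)) ∧
      {n : ℕ | ∃ m : ℕ, (u n : ℚ) = b + a * (p : ℚ) ^ (k * m)} = ⋃ i, f i := by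
  refine Sub.Val.conv ?_
  have key : ∀ (a b : ℚ) (k : ℕ), a = 0 ∨ 1 ≤ k → Sub.Val p {n : ℕ | ∃ m : ℕ, (u n : ℚ) = b + a * (p : ℚ) ^ (k * m)} := by
    intro a b k hak
    obtain ⟨D, hD, z, hz⟩ := Sub.int_clear ![a, b]
    have ha := hz 0
    have hb := hz 1
    simp only [Matrix.cons_val_zero, Matrix.cons_val_one] at ha hb
    have hD' : (D : ℚ) ≠ 0 := by exact_mod_cast hD
    obtain ⟨r, A, e, x, h⟩ := Sub.rep u hu D (-z 1)
    have h1 : ∀ n (y : ℚ), (u n : ℚ) = b + a * y ↔ ((e ⬝ᵥ (A ^ n).mulVec x : ℤ) : ℚ) = z 0 * y := by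
      intro n y
      rw [← h]; push_cast; rw [ha, hb, ← mul_right_inj' hD', ← sub_eq_zero, eq_comm, ← sub_eq_zero (b := _ * y)]
      constructor <;> intro h <;> linarith
    simp only [h1]
    by_cases h0 : a = 0
    · have h2 : z 0 = 0 := by exact_mod_cast (show (z 0 : ℚ) = 0 by rw [ha, h0, mul_zero])
      convert Sub.reduce p {0} (fun r A e x => Sub.stab1 p A e x) r A e x using 3 with n
      simp [h2]
    · have h2 : z 0 ≠ 0 := by
        have : (z 0 : ℚ) ≠ 0 := by rw [ha]; exact mul_ne_zero hD' h0
        exact_mod_cast this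
      convert Sub.reduce p _ (fun r A e x => Sub.stab2 p hp k (hak.resolve_left h0) (z 0) h2 A e x) r A e x using 3 with n
      exact exists_congr fun m => by exact_mod_cast Iff.rfl
  rcases Nat.eq_zero_or_pos k with rfl | hk
  · simpa using key 0 (b + a) 0 (Or.inl rfl)
  · exact key a b k (Or.inr hk)
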